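/- There exists a universal constant c₀ > 0 such that for every dimension n ≥ 1, every isotropic log-concave random vector X in ℝⁿ, every ε with 0 < ε < c₀, and every point y ∈ ℝⁿ, one has ℙ(‖X − y‖₂² ≤ ε·n) ≤ ε^{c₀·n}. -/

import Mathlib

open MeasureTheory ProbabilityTheory

noncomputable section

/-- A nonnegative function is log-concave if it satisfies
`f(t x + (1-t) y) ≥ f(x)^t f(y)^(1-t)`; this is equivalent to `f = e^{-V}`
for some convex function `V : ℝⁿ → ℝ ∪ {+∞}`. -/
def IsLogConcaveFun {E : Type*} [AddCommGroup E] [Module ℝ E] (f : E → ℝ) : Prop :=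
  (∀ x, 0 ≤ f x) ∧
  ∀ x y : E, ∀ t : ℝ, 0 ≤ t → t ≤ 1 →
    f x ^ t * f y ^ (1 - t) ≤ f (t • x + (1 - t) • y)

/-- A measure on `ℝⁿ` is log-concave (with density) if it has a log-concave
density with respect to the Lebesgue measure. -/
def IsLogConcaveMeasure {n : ℕ} (μ : Measure (EuclideanSpace ℝ (Fin n))) : Prop :=
  ∃ f : EuclideanSpace ℝ (Fin n) → ℝ, IsLogConcaveFun f ∧
    μ = volume.withDensity fun x => ENNReal.ofReal (f x)

/-- A measure on `ℝⁿ` is isotropic if it has mean `0` and covariance matrix `Iₙ`. -/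
def IsIsotropicMeasure {n : ℕ} (μ : Measure (EuclideanSpace ℝ (Fin n))) : Prop :=
  (∀ i, ∫ x, x i ∂μ = 0) ∧
  (∀ i j, ∫ x, x i * x j ∂μ = if i = j then 1 else 0)

section

open Set Filter Topology
open scoped ContDiff

local notation "ℰ" => EuclideanSpace ℝ

open Real (exp log exp_pos norm_eq_abs exp_add exp_le_exp exp_log exp_mul abs_exp)
open Finset (sum_congr mul_sum sum_mul sum_le_sum sum_add_distrib sum_comm sum_nonneg sum_sub_distrib)
open ENNReal (ofReal)

section

open scoped ENNReal NNReal Pointwise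

/-- One-dimensional Brunn-Minkowski inequality for compact sets. -/
theorem volume_add_le_of_compact {K L M : Set ℝ} (hK : IsCompact K) (hL : IsCompact L)
    (hK0 : K.Nonempty) (hL0 : L.Nonempty) (hM : ∀ x ∈ K, ∀ y ∈ L, x + y ∈ M) :
    volume K + volume L ≤ volume M := by
  obtain ⟨a, ha, hamax⟩ := hK.exists_isGreatest hK0
  obtain ⟨b, hb, hbmin⟩ := hL.exists_isLeast hL0
  have h1 : (fun x => x + b) '' K ∪ (fun y => a + y) '' L ⊆ M := by
    rintro z (⟨x, hx, rfl⟩ | ⟨y, hy, rfl⟩)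
    · exact hM _ hx _ hb
    · exact hM _ ha _ hy
  have hK' : IsCompact ((fun x => x + b) '' K) := hK.image (by fun_prop)
  have hL' : IsCompact ((fun y => a + y) '' L) := hL.image (by fun_prop)
  have h2 : AEDisjoint volume ((fun x => x + b) '' K) ((fun y => a + y) '' L) := by
    refine measure_mono_null (t := {a + b}) ?_ (by simp)
    rintro z ⟨⟨x, hx, rfl⟩, ⟨y, hy, hxy⟩⟩
    have := hamax hx
    have := hbmin hy
    simp only [mem_singleton_iff] at *
    linarith
  calc volume K + volume L
      = volume ((fun x => x + b) '' K) + volume ((fun y => a + y) '' L) := by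
        rw [image_add_right, image_add_left, measure_preimage_add_right, measure_preimage_add]
    _ = volume ((fun x => x + b) '' K ∪ (fun y => a + y) '' L) :=
        (measure_union₀ hL'.measurableSet.nullMeasurableSet h2).symm
    _ ≤ volume M := measure_mono h1

theorem volume_add_le {K L M : Set ℝ} (hK : MeasurableSet K) (hL : MeasurableSet L)
    (hK0 : K.Nonempty) (hL0 : L.Nonempty) (hM : ∀ x ∈ K, ∀ y ∈ L, x + y ∈ M) :
    volume K + volume L ≤ volume M := by
  obtain ⟨k, hk⟩ := hK0
  obtain ⟨l, hl⟩ := hL0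
  rw [hK.measure_eq_iSup_isCompact, hL.measure_eq_iSup_isCompact]
  simp only [iSup_and', iSup_subtype']
  have : ∀ A : Set ℝ, Nonempty {i // i ⊆ A ∧ IsCompact i} := fun A =>
    ⟨⟨∅, empty_subset _, isCompact_empty⟩⟩
  refine ENNReal.iSup_add_iSup_le ?_
  intro K' L'
  calc volume (K' : Set ℝ) + volume (L' : Set ℝ)
      ≤ volume ((K' : Set ℝ) ∪ {k}) + volume ((L' : Set ℝ) ∪ {l}) := by
        gcongr <;> exact subset_union_left
    _ ≤ volume M := by
        refine volume_add_le_of_compact ((K'.2.2).union isCompact_singleton)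
          ((L'.2.2).union isCompact_singleton) ⟨k, by simp⟩ ⟨l, by simp⟩ ?_
        intro x hx y hy
        refine hM x ?_ y ?_
        · rcases hx with hx | hx
          · exact K'.2.1 hx
          · rw [hx]; exact hk
        · rcases hy with hx | hx
          · exact L'.2.1 hx
          · rw [hx]; exact hl

theorem volume_smul_add_le {K L M : Set ℝ} {s : ℝ} (hs0 : 0 < s) (hs1 : s < 1)
    (hK : MeasurableSet K) (hL : MeasurableSet L)
    (hK0 : K.Nonempty) (hL0 : L.Nonempty)
    (hM : ∀ x ∈ K, ∀ y ∈ L, s * x + (1 - s) * y ∈ M) :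
    ofReal s * volume K + ofReal (1 - s) * volume L ≤ volume M := by
  have h1 := volume_add_le (K := s • K) (L := (1 - s) • L) (M := M)
    (hK.const_smul₀ s) (hL.const_smul₀ _) hK0.smul_set hL0.smul_set (by
      rintro _ ⟨x, hx, rfl⟩ _ ⟨y, hy, rfl⟩
      exact hM x hx y hy)
  have h2 : 0 < 1 - s := by linarith
  simpa [Measure.addHaar_smul, abs_of_pos hs0, abs_of_pos h2] using h1

/-- The Prékopa-Leindler property of a measure on a real vector space. -/
def PrekopaLeindler {E : Type*} [AddCommGroup E] [Module ℝ E] [MeasurableSpace E]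
    (μ : Measure E) : Prop :=
  ∀ s : ℝ, 0 < s → s < 1 → ∀ f g h : E → ℝ≥0∞, Measurable f → Measurable g → Measurable h →
    (∀ x y, f x ^ s * g y ^ (1 - s) ≤ h (s • x + (1 - s) • y)) →
    (∫⁻ x, f x ∂μ) ^ s * (∫⁻ x, g x ∂μ) ^ (1 - s) ≤ ∫⁻ x, h x ∂μ

theorem ennreal_geom_le_arith {s : ℝ} (hs0 : 0 < s) (hs1 : s < 1) (a b : ℝ≥0∞) :
    a ^ s * b ^ (1 - s) ≤ ofReal s * a + ofReal (1 - s) * b := by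
  have h2 : 0 < 1 - s := by linarith
  by_cases ha : a = ⊤
  · simp [ha, ENNReal.mul_top, hs0]
  by_cases hb : b = ⊤
  · simp [hb, ENNReal.mul_top, h2, hs1]
  lift a to ℝ≥0 using ha
  lift b to ℝ≥0 using hb
  lift s to ℝ≥0 using hs0.le
  have h3 : (1 - (s : ℝ)) = ((1 - s : ℝ≥0) : ℝ) := by
    rw [NNReal.coe_sub]; rfl
    exact_mod_cast hs1.le
  rw [h3, ENNReal.ofReal_coe_nnreal, ENNReal.ofReal_coe_nnreal,
    ← ENNReal.coe_rpow_of_nonneg _ (by positivity), ← ENNReal.coe_rpow_of_nonneg _ (by positivity)]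
  norm_cast
  refine NNReal.geom_mean_le_arith_mean2_weighted s (1 - s) a b ?_
  exact add_tsub_cancel_of_le (by exact_mod_cast hs1.le)

theorem lintegral_eq_lintegral_lt_of_le_one {f : ℝ → ℝ≥0∞} (hf : Measurable f) (h1 : ∀ x, f x ≤ 1) :
    ∫⁻ x, f x = ∫⁻ r in Ioo (0 : ℝ) 1, volume {x | ofReal r < f x} := by
  have h2 : ∫⁻ x, f x = ∫⁻ x, ofReal ((f x).toReal) := by
    refine lintegral_congr fun x => ?_
    rw [ENNReal.ofReal_toReal]
    exact ((h1 x).trans_lt (by simp)).ne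
  rw [h2, lintegral_eq_lintegral_meas_lt _ (ae_of_all _ fun x => by positivity)
    hf.ennreal_toReal.aemeasurable, ← Ioo_union_Ici_eq_Ioi (zero_lt_one' ℝ),
    lintegral_union measurableSet_Ici (Set.disjoint_left.2 fun x hx hx' => by
      simp only [mem_Ioo, mem_Ici] at *; linarith)]
  have h3 : ∫⁻ r in Ici (1 : ℝ), volume {a | r < (f a).toReal} = 0 := by
    rw [setLIntegral_congr_fun (g := fun _ => 0) measurableSet_Ici]
    · simp
    · intro r hr
      simp only [mem_Ici] at hr
      have : {a | r < (f a).toReal} = ∅ := by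
        ext a
        simp only [mem_ofPred_eq, mem_empty_iff_false, iff_false, not_lt]
        refine le_trans ?_ hr
        exact ENNReal.toReal_mono (by simp) (h1 a)
      simp [this]
  rw [h3, add_zero]
  refine setLIntegral_congr_fun measurableSet_Ioo fun r hr => ?_
  congr 1
  ext a
  simp only [mem_ofPred_eq]
  rw [ENNReal.ofReal_lt_iff_lt_toReal hr.1.le]
  exact ((h1 a).trans_lt (by simp)).ne

theorem prekopaLeindler_real_of_sup_one {s : ℝ} (hs0 : 0 < s) (hs1 : s < 1) {f g h : ℝ → ℝ≥0∞}
    (hf : Measurable f) (hg : Measurable g) (hh : Measurable h)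
    (hf1 : ⨆ x, f x = 1) (hg1 : ⨆ x, g x = 1)
    (H : ∀ x y, f x ^ s * g y ^ (1 - s) ≤ h (s • x + (1 - s) • y)) :
    (∫⁻ x, f x) ^ s * (∫⁻ x, g x) ^ (1 - s) ≤ ∫⁻ x, h x := by
  have h2 : 0 < 1 - s := by linarith
  refine (ennreal_geom_le_arith hs0 hs1 _ _).trans ?_
  calc _ ≤ ∫⁻ x, min (h x) 1 := ?_
    _ ≤ _ := lintegral_mono fun x => min_le_left _ _
  rw [lintegral_eq_lintegral_lt_of_le_one hf fun x => hf1 ▸ le_iSup f x,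
    lintegral_eq_lintegral_lt_of_le_one hg fun x => hg1 ▸ le_iSup g x,
    lintegral_eq_lintegral_lt_of_le_one (hh.min measurable_const) fun x => min_le_right _ _]
  rw [← lintegral_const_mul' _ _ (by simp), ← lintegral_const_mul' _ _ (by simp)]
  refine (le_lintegral_add _ _).trans ?_
  refine setLIntegral_mono' measurableSet_Ioo fun r hr => ?_
  have hr1 : ofReal r < 1 := by
    rw [← ENNReal.ofReal_one]
    exact (ENNReal.ofReal_lt_ofReal_iff (by simp)).2 hr.2
  refine volume_smul_add_le hs0 hs1 (measurableSet_lt measurable_const hf)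
    (measurableSet_lt measurable_const hg) ?_ ?_ ?_
  · rw [← hf1] at hr1
    exact lt_iSup_iff.1 hr1
  · rw [← hg1] at hr1
    exact lt_iSup_iff.1 hr1
  · intro x hx y hy
    refine lt_min ?_ hr1
    refine lt_of_lt_of_le ?_ (H x y)
    have h3 : ofReal r = ofReal r ^ s * ofReal r ^ (1 - s) := by
      rw [← ENNReal.rpow_add _ _ (by simpa using hr.1) (by simp)]
      simp
    rw [h3]
    exact ENNReal.mul_lt_mul (ENNReal.rpow_lt_rpow hx hs0) (ENNReal.rpow_lt_rpow hy h2)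

theorem prekopaLeindler_real_of_bdd {s : ℝ} (hs0 : 0 < s) (hs1 : s < 1) {f g h : ℝ → ℝ≥0∞}
    (hf : Measurable f) (hg : Measurable g) (hh : Measurable h)
    (hf1 : ⨆ x, f x ≠ ⊤) (hg1 : ⨆ x, g x ≠ ⊤)
    (H : ∀ x y, f x ^ s * g y ^ (1 - s) ≤ h (s • x + (1 - s) • y)) :
    (∫⁻ x, f x) ^ s * (∫⁻ x, g x) ^ (1 - s) ≤ ∫⁻ x, h x := by
  have h2 : 0 < 1 - s := by linarith
  set a := ⨆ x, f x with ha
  set b := ⨆ x, g x with hb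
  by_cases ha0 : a = 0
  · have : ∀ x, f x = 0 := fun x => by simpa [← ha, ha0] using le_iSup f x
    simp [this, hs0]
  by_cases hb0 : b = 0
  · have : ∀ x, g x = 0 := fun x => by simpa [← hb, hb0] using le_iSup g x
    simp [this, h2]
  have key := prekopaLeindler_real_of_sup_one hs0 hs1 (f := fun x => a⁻¹ * f x)
    (g := fun x => b⁻¹ * g x) (h := fun x => ((a⁻¹) ^ s * (b⁻¹) ^ (1 - s)) * h x)
    (hf.const_mul _) (hg.const_mul _) (hh.const_mul _)
    (by rw [← ENNReal.mul_iSup, ENNReal.inv_mul_cancel ha0 hf1])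
    (by rw [← ENNReal.mul_iSup, ENNReal.inv_mul_cancel hb0 hg1]) (by
      intro x y
      rw [ENNReal.mul_rpow_of_nonneg _ _ hs0.le, ENNReal.mul_rpow_of_nonneg _ _ h2.le,
        mul_mul_mul_comm]
      gcongr
      exact H x y)
  have hc0 : (a⁻¹) ^ s * (b⁻¹) ^ (1 - s) ≠ 0 := by
    simp [ENNReal.rpow_eq_zero_iff, hf1, hg1, ha0, hb0]
  have hc1 : (a⁻¹) ^ s * (b⁻¹) ^ (1 - s) ≠ ⊤ := by
    refine ENNReal.mul_ne_top ?_ ?_ <;>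
    simp [ENNReal.rpow_eq_top_iff, ha0, hb0, hf1, hg1]
  rw [lintegral_const_mul _ hf, lintegral_const_mul _ hg, lintegral_const_mul _ hh,
    ENNReal.mul_rpow_of_nonneg _ _ hs0.le, ENNReal.mul_rpow_of_nonneg _ _ h2.le,
    mul_mul_mul_comm] at key
  exact (ENNReal.mul_le_mul_iff_right hc0 hc1).1 key

theorem prekopaLeindler_real : PrekopaLeindler (volume : Measure ℝ) := by
  intro s hs0 hs1 f g h hf hg hh H
  have h2 : 0 < 1 - s := by linarith
  have hlim : ∀ u : ℝ → ℝ≥0∞, Measurable u →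
      Tendsto (fun N : ℕ => ∫⁻ x, min (u x) N) atTop (𝓝 (∫⁻ x, u x)) := by
    intro u hu
    refine lintegral_tendsto_of_tendsto_of_monotone
      (fun N => (hu.min measurable_const).aemeasurable)
      (ae_of_all _ fun x m n hmn => ?_) (ae_of_all _ fun x => ?_)
    · exact min_le_min_left _ (by exact_mod_cast hmn)
    · have := (tendsto_const_nhds (x := u x)).min ENNReal.tendsto_nat_nhds_top
      simpa using this
  by_cases hf0 : ∫⁻ x, f x = 0
  · simp [hf0, hs0]
  by_cases hg0 : ∫⁻ x, g x = 0
  · simp [hg0, h2]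
  refine le_of_tendsto (ENNReal.Tendsto.mul ((hlim f hf).ennrpow_const s) (Or.inl ?_)
    ((hlim g hg).ennrpow_const (1 - s)) (Or.inl ?_)) (Eventually.of_forall fun N => ?_)
  · simp [ENNReal.rpow_eq_zero_iff, hf0, hs0.le]
  · simp [ENNReal.rpow_eq_zero_iff, hg0, hs1.le]
  · have hb : ∀ u : ℝ → ℝ≥0∞, ⨆ x, min (u x) N ≠ ⊤ := fun u =>
      ((iSup_le fun x => min_le_right _ _).trans_lt (ENNReal.natCast_lt_top N)).ne
    refine prekopaLeindler_real_of_bdd hs0 hs1 (hf.min measurable_const)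
      (hg.min measurable_const) hh (hb f) (hb g) fun x y => (le_trans ?_ (H x y))
    gcongr
    · exact min_le_left _ _
    · exact min_le_left _ _

theorem PrekopaLeindler.prod {E F : Type*} [AddCommGroup E] [Module ℝ E] [MeasurableSpace E]
    [AddCommGroup F] [Module ℝ F] [MeasurableSpace F] {μ : Measure E} {ν : Measure F}
    [SFinite μ] [SFinite ν] (hμ : PrekopaLeindler μ) (hν : PrekopaLeindler ν) :
    PrekopaLeindler (μ.prod ν) := by
  intro s hs0 hs1 f g h hf hg hh H
  rw [lintegral_prod _ hf.aemeasurable, lintegral_prod _ hg.aemeasurable,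
    lintegral_prod _ hh.aemeasurable]
  refine hμ s hs0 hs1 _ _ _ hf.lintegral_prod_right' hg.lintegral_prod_right'
    hh.lintegral_prod_right' fun x y => ?_
  refine hν s hs0 hs1 _ _ _ (hf.comp measurable_prodMk_left) (hg.comp measurable_prodMk_left)
    (hh.comp measurable_prodMk_left) fun x' y' => ?_
  exact H (x, x') (y, y')

theorem PrekopaLeindler.of_measurePreserving {E F : Type*} [AddCommGroup E] [Module ℝ E]
    [MeasurableSpace E] [AddCommGroup F] [Module ℝ F] [MeasurableSpace F] {μ : Measure E}
    {ν : Measure F} (hμ : PrekopaLeindler μ) (e : E →ₗ[ℝ] F) (he : MeasurePreserving e μ ν) :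
    PrekopaLeindler ν := by
  intro s hs0 hs1 f g h hf hg hh H
  rw [← he.lintegral_comp hf, ← he.lintegral_comp hg, ← he.lintegral_comp hh]
  refine hμ s hs0 hs1 _ _ _ (hf.comp he.measurable) (hg.comp he.measurable)
    (hh.comp he.measurable) fun x y => ?_
  simpa using H (e x) (e y)

theorem prekopaLeindler_fin (n : ℕ) : PrekopaLeindler (volume : Measure (Fin n → ℝ)) := by
  induction n with
  | zero =>
    intro s hs0 hs1 f g h hf hg hh H
    have : (volume : Measure (Fin 0 → ℝ)) = Measure.dirac 0 := by
      rw [volume_pi, Measure.pi_of_empty]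
      congr 1
      exact Subsingleton.elim _ _
    rw [this, lintegral_dirac, lintegral_dirac, lintegral_dirac]
    simpa using H 0 0
  | succ n ih =>
    refine (prekopaLeindler_real.prod ih).of_measurePreserving
      (e := { toFun := fun p => (MeasurableEquiv.piFinSuccAbove (fun _ => ℝ) 0).symm p
              map_add' := ?_, map_smul' := ?_ })
      ((volume_preserving_piFinSuccAbove (fun _ : Fin (n + 1) => ℝ) 0).symm _)
    · intro x y
      ext i
      refine Fin.cases ?_ (fun j => ?_) i <;> simp [MeasurableEquiv.piFinSuccAbove]
    · intro c x
      ext i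
      refine Fin.cases ?_ (fun j => ?_) i <;> simp [MeasurableEquiv.piFinSuccAbove]

/-- The Prékopa-Leindler inequality. -/
theorem prekopaLeindler_euclidean (ι : Type*) [Fintype ι] :
    PrekopaLeindler (volume : Measure (ℰ ι)) := by
  let e := Fintype.equivFin ι
  have h1 := (prekopaLeindler_fin (Fintype.card ι)).of_measurePreserving
    (e := (WithLp.linearEquiv 2 ℝ (Fin (Fintype.card ι) → ℝ)).symm.toLinearMap)
    (PiLp.volume_preserving_toLp _)
  exact h1.of_measurePreserving
    (e := (LinearIsometryEquiv.piLpCongrLeft 2 ℝ ℝ e.symm).toLinearEquiv.toLinearMap)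
    (LinearIsometryEquiv.measurePreserving _)

end

section

variable {E : Type*} [NormedAddCommGroup E] [NormedSpace ℝ E]

/-- Directional derivative. -/
def dd (v : E) (f : E → ℝ) (x : E) : ℝ := fderiv ℝ f x v

theorem ContDiff.dd {f : E → ℝ} (hf : ContDiff ℝ ∞ f) (v : E) : ContDiff ℝ ∞ (dd v f) := by
  unfold _root_.dd
  exact (hf.fderiv_right (m := ∞) (by simp)).clm_apply contDiff_const

theorem ContDiff.differentiable_infty {f : E → ℝ} (hf : ContDiff ℝ ∞ f) : Differentiable ℝ f :=
  hf.differentiable (by simp)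

theorem HasCompactSupport.dd {f : E → ℝ} (hf : HasCompactSupport f) (v : E) :
    HasCompactSupport (dd v f) := hf.fderiv_apply ℝ v

theorem dd_comm {f : E → ℝ} (hf : ContDiff ℝ ∞ f) (v w : E) : dd v (dd w f) = dd w (dd v f) := by
  ext x
  have h1 : DifferentiableAt ℝ (fderiv ℝ f) x :=
    (hf.fderiv_right (m := ∞) (by simp)).differentiable (by simp) x
  have h2 : ∀ a b : E, _root_.dd a (_root_.dd b f) x = fderiv ℝ (fderiv ℝ f) x a b := by
    intro a b
    unfold _root_.dd
    rw [fderiv_clm_apply h1 (by fun_prop)]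
    simp
  rw [h2, h2]
  exact (hf.contDiffAt.isSymmSndFDerivAt (by simpa using WithTop.coe_le_coe.2 (le_top : (2 : ℕ∞) ≤ ⊤))) v w

theorem dd_mul {f g : E → ℝ} (hf : ContDiff ℝ ∞ f) (hg : ContDiff ℝ ∞ g) (v : E) :
    dd v (fun x => f x * g x) = fun x => dd v f x * g x + f x * dd v g x := by
  ext x
  unfold dd
  rw [fderiv_fun_mul (hf.differentiable_infty x) (hg.differentiable_infty x)]
  simp [mul_comm, add_comm]

theorem dd_add {f g : E → ℝ} (hf : ContDiff ℝ ∞ f) (hg : ContDiff ℝ ∞ g) (v : E) :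
    dd v (fun x => f x + g x) = fun x => dd v f x + dd v g x := by
  ext x
  unfold dd
  rw [fderiv_fun_add (hf.differentiable_infty x) (hg.differentiable_infty x)]
  simp

theorem dd_sub {f g : E → ℝ} (hf : ContDiff ℝ ∞ f) (hg : ContDiff ℝ ∞ g) (v : E) :
    dd v (fun x => f x - g x) = fun x => dd v f x - dd v g x := by
  ext x
  unfold dd
  rw [fderiv_fun_sub (hf.differentiable_infty x) (hg.differentiable_infty x)]
  simp

theorem dd_sum {ι : Type*} {f : ι → E → ℝ} {s : Finset ι} (hf : ∀ i ∈ s, ContDiff ℝ ∞ (f i)) (v : E) :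
    dd v (fun x => ∑ i ∈ s, f i x) = fun x => ∑ i ∈ s, dd v (f i) x := by
  ext x
  unfold dd
  rw [fderiv_fun_sum fun i hi => (hf i hi).differentiable_infty x]
  simp

theorem dd_const (c : ℝ) (v : E) : dd v (fun _ : E => c) = fun _ => 0 := by
  ext x; simp [dd]

theorem dd_const_mul {f : E → ℝ} (hf : ContDiff ℝ ∞ f) (c : ℝ) (v : E) :
    dd v (fun x => c * f x) = fun x => c * dd v f x := by
  rw [dd_mul contDiff_const hf, dd_const]; simp

theorem dd_neg (f : E → ℝ) (v : E) : dd v (fun x => - f x) = fun x => - dd v f x := by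
  ext x; simp [dd, fderiv_fun_neg]

theorem dd_exp_neg {V : E → ℝ} (hV : ContDiff ℝ ∞ V) (v : E) :
    dd v (fun x => exp (-V x)) = fun x => - dd v V x * exp (-V x) := by
  ext x
  unfold dd
  rw [fderiv_exp (f := fun x => -V x) (hV.neg.differentiable_infty x)]
  simp [fderiv_fun_neg]
  ring

theorem dd_sum_dir {ι : Type*} (s : Finset ι) (c : ι → ℝ) (v : ι → E) (f : E → ℝ) (x : E) :
    dd (∑ i ∈ s, c i • v i) f x = ∑ i ∈ s, c i * dd (v i) f x := by
  simp [dd]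

variable [FiniteDimensional ℝ E] [MeasurableSpace E] [BorelSpace E] {μ : Measure E}
  [μ.IsAddHaarMeasure]

theorem integral_mul_dd {f g : E → ℝ} (hf : ContDiff ℝ ∞ f) (hg : ContDiff ℝ ∞ g)
    (hc : HasCompactSupport f ∨ HasCompactSupport g) (v : E) :
    ∫ x, f x * dd v g x ∂μ = - ∫ x, dd v f x * g x ∂μ := by
  unfold dd
  have hi : ∀ u w : E → ℝ, ContDiff ℝ ∞ u → ContDiff ℝ ∞ w →
      (HasCompactSupport u ∨ HasCompactSupport w) → Integrable (fun x => u x * w x) μ := by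
    intro u w hu hw huw
    refine (hu.continuous.mul hw.continuous).integrable_of_hasCompactSupport ?_
    rcases huw with h | h
    · exact h.mul_right
    · exact h.mul_left
  refine integral_mul_fderiv_eq_neg_fderiv_mul_of_integrable ?_ ?_ ?_ ?_ ?_
  · exact hi (dd v f) g (hf.dd v) hg (hc.imp (fun h => h.dd v) id)
  · exact hi f (dd v g) hf (hg.dd v) (hc.imp id (fun h => h.dd v))
  · exact hi _ _ hf hg hc
  · exact fun x _ => hf.differentiable_infty x
  · exact fun x _ => hg.differentiable_infty x

end

section

variable {ι : Type*} [Fintype ι]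

/-- Standard basis vector. -/
def ee (i : ι) : ℰ ι := EuclideanSpace.basisFun ι ℝ i

/-- Smooth uniformly convex potentials with Lipschitz gradient, normalized to a probability. -/
structure LangevinPotential (V : ℰ ι → ℝ) (t B : ℝ) : Prop where
  smooth : ContDiff ℝ ∞ V
  conv : ∀ x, ∀ c : ι → ℝ,
    t * ∑ i, c i ^ 2 ≤ ∑ i, ∑ j, c i * c j * dd (ee i) (dd (ee j) V) x
  lip : ∀ i x y, |dd (ee i) V x - dd (ee i) V y| ≤ B * ‖x - y‖
  prob : ∫ x, exp (-V x) = 1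

/-- Expectation with respect to `exp (-V)`. -/
def ev (V f : ℰ ι → ℝ) : ℝ := ∫ x, f x * exp (-V x)

/-- Test functions. -/
def TestFun (f : ℰ ι → ℝ) : Prop := ContDiff ℝ ∞ f ∧ HasCompactSupport f

/-- The (positive) generator `-L`. -/
def genOp (V u : ℰ ι → ℝ) (x : ℰ ι) : ℝ :=
  ∑ i, (dd (ee i) V x * dd (ee i) u x - dd (ee i) (dd (ee i) u) x)

theorem TestFun.dd {f : ℰ ι → ℝ} (hf : TestFun f) (v : ℰ ι) :
    TestFun (dd v f) := ⟨hf.1.dd v, hf.2.dd v⟩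

theorem TestFun.mul {f g : ℰ ι → ℝ} (hf : TestFun f) (hg : ContDiff ℝ ∞ g) :
    TestFun (fun x => f x * g x) := ⟨hf.1.mul hg, hf.2.mul_right⟩

theorem TestFun.mul' {f g : ℰ ι → ℝ} (hf : ContDiff ℝ ∞ f) (hg : TestFun g) :
    TestFun (fun x => f x * g x) := ⟨hf.mul hg.1, hg.2.mul_left⟩

theorem TestFun.add {f g : ℰ ι → ℝ} (hf : TestFun f) (hg : TestFun g) :
    TestFun (fun x => f x + g x) := ⟨hf.1.add hg.1, hf.2.add hg.2⟩

theorem TestFun.neg {f : ℰ ι → ℝ} (hf : TestFun f) :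
    TestFun (fun x => -f x) := ⟨hf.1.neg, hf.2.neg⟩

theorem TestFun.sub {f g : ℰ ι → ℝ} (hf : TestFun f) (hg : TestFun g) :
    TestFun (fun x => f x - g x) := by
  simpa [sub_eq_add_neg] using hf.add hg.neg

theorem TestFun.zero : TestFun (fun _ : ℰ ι => (0 : ℝ)) :=
  ⟨contDiff_const, HasCompactSupport.zero⟩

theorem TestFun.sum {κ : Type*} {f : κ → ℰ ι → ℝ} {s : Finset κ}
    (hf : ∀ i, TestFun (f i)) : TestFun (fun x => ∑ i ∈ s, f i x) := by
  classical
  induction s using Finset.induction_on with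
  | empty => simpa using TestFun.zero
  | insert a s ha ih => simpa [Finset.sum_insert ha] using (hf a).add ih

theorem TestFun.integrable {f : ℰ ι → ℝ} (hf : TestFun f) : Integrable f :=
  hf.1.continuous.integrable_of_hasCompactSupport hf.2

theorem TestFun.genOp {V u : ℰ ι → ℝ} (hV : ContDiff ℝ ∞ V) (hu : TestFun u) :
    TestFun (genOp V u) :=
  TestFun.sum (s := Finset.univ) (f := fun i x =>
      _root_.dd (ee i) V x * _root_.dd (ee i) u x - _root_.dd (ee i) (_root_.dd (ee i) u) x)
    fun i => (TestFun.mul' (hV.dd _) (hu.dd _)).sub ((hu.dd _).dd _)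

variable {V : ℰ ι → ℝ}

theorem TestFun.integrable_exp {f : ℰ ι → ℝ} (hV : ContDiff ℝ ∞ V)
    (hf : TestFun f) : Integrable (fun x => f x * exp (-V x)) :=
  (hf.mul hV.neg.exp).integrable

theorem ev_add {f g : ℰ ι → ℝ} (hV : ContDiff ℝ ∞ V) (hf : TestFun f)
    (hg : TestFun g) : ev V (fun x => f x + g x) = ev V f + ev V g := by
  unfold ev
  rw [← integral_add (hf.integrable_exp hV) (hg.integrable_exp hV)]
  simp [add_mul]

theorem ev_sum {κ : Type*} {f : κ → ℰ ι → ℝ} {s : Finset κ}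
    (hV : ContDiff ℝ ∞ V) (hf : ∀ i, TestFun (f i)) :
    ev V (fun x => ∑ i ∈ s, f i x) = ∑ i ∈ s, ev V (f i) := by
  unfold ev
  rw [← integral_finsetSum _ fun i _ => (hf i).integrable_exp hV]
  simp [sum_mul]

theorem ev_dd_mul {f g : ℰ ι → ℝ} (hV : ContDiff ℝ ∞ V) (hf : ContDiff ℝ ∞ f)
    (hg : TestFun g) (v : ℰ ι) :
    ev V (fun x => dd v f x * g x) = ev V (fun x => f x * (dd v V x * g x - dd v g x)) := by
  unfold ev
  have h1 := integral_mul_dd (μ := volume) hf (hg.mul (hV.neg.exp)).1 (Or.inr (hg.mul hV.neg.exp).2) v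
  rw [dd_mul hg.1 hV.neg.exp, dd_exp_neg hV] at h1
  simp only [mul_assoc] at h1 ⊢
  rw [eq_neg_iff_add_eq_zero, ← neg_eq_iff_add_eq_zero] at h1
  rw [← h1, ← integral_neg]
  congr 1
  ext x
  ring

theorem ev_mul_genOp {f u : ℰ ι → ℝ} (hV : ContDiff ℝ ∞ V) (hf : ContDiff ℝ ∞ f)
    (hu : TestFun u) :
    ev V (fun x => f x * genOp V u x) = ∑ i, ev V (fun x => dd (ee i) f x * dd (ee i) u x) := by
  simp only [ev_dd_mul hV hf (hu.dd _)]
  rw [← ev_sum hV fun i => TestFun.mul' hf ((TestFun.mul' (hV.dd _) (hu.dd _)).sub ((hu.dd _).dd _))]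
  simp only [genOp, mul_sum]

/-- Bochner's identity. -/
theorem bochner {u : ℰ ι → ℝ} (hV : ContDiff ℝ ∞ V) (hu : TestFun u) :
    ev V (fun x => genOp V u x ^ 2) =
      ∑ i, ∑ j, ev V (fun x => dd (ee i) (dd (ee j) u) x ^ 2) +
      ev V (fun x => ∑ i, ∑ j, dd (ee i) u x * dd (ee j) u x * dd (ee i) (dd (ee j) V) x) := by
  have hG := hu.genOp hV
  have h1 : ∀ i, ev V (fun x => dd (ee i) (genOp V u) x * dd (ee i) u x) =
      ∑ j, ev V (fun x => dd (ee i) (dd (ee j) u) x ^ 2) +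
      ev V (fun x => ∑ j, dd (ee i) u x * dd (ee j) u x * dd (ee i) (dd (ee j) V) x) := by
    intro i
    have hd : ∀ x, dd (ee i) (genOp V u) x = genOp V (dd (ee i) u) x +
        ∑ j, dd (ee j) u x * dd (ee i) (dd (ee j) V) x := by
      intro x
      have : genOp V u = fun x => ∑ j, (dd (ee j) V x * dd (ee j) u x -
        dd (ee j) (dd (ee j) u) x) := rfl
      rw [this, dd_sum fun j _ => ((hV.dd _).mul (hu.1.dd _)).sub ((hu.1.dd _).dd _)]
      simp only [genOp]
      rw [← sum_add_distrib]
      refine sum_congr rfl fun j _ => ?_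
      rw [dd_sub ((hV.dd _).mul (hu.1.dd _)) ((hu.1.dd _).dd _), dd_mul (hV.dd _) (hu.1.dd _),
        dd_comm (hu.1.dd (ee j)) (ee i) (ee j), dd_comm hu.1 (ee i) (ee j)]
      ring
    have h2 := ev_mul_genOp (u := dd (ee i) u) hV (hu.1.dd (ee i)) (hu.dd _)
    have h3 : ∀ j, ev V (fun x => dd (ee i) (dd (ee j) u) x ^ 2) =
        ev V (fun x => dd (ee j) (dd (ee i) u) x * dd (ee j) (dd (ee i) u) x) := by
      intro j
      rw [dd_comm hu.1 (ee i) (ee j)]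
      simp only [sq]
    simp only [h3]
    rw [← h2, ← ev_add hV]
    · congr 1
      ext x
      rw [hd, add_mul, sum_mul]
      congr 1
      · ring
      · exact sum_congr rfl fun j _ => by ring
    · exact TestFun.mul (hu.dd _) ((hu.dd _).genOp hV).1
    · exact TestFun.sum fun j => ((hu.dd _).mul (hu.1.dd _)).mul ((hV.dd _).dd _)
  calc _ = ev V (fun x => genOp V u x * genOp V u x) := by simp only [sq]
    _ = _ := by
      rw [ev_mul_genOp hV hG.1 hu]
      simp only [h1]
      rw [sum_add_distrib, ev_sum hV]
      exact fun i => TestFun.sum fun j => ((hu.dd _).mul (hu.1.dd _)).mul ((hV.dd _).dd _)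

end

section

theorem sq_integral_mul_le {α : Type*} [MeasurableSpace α] {μ : Measure α} {f g : α → ℝ}
    (hf : Integrable (fun x => f x ^ 2) μ) (hg : Integrable (fun x => g x ^ 2) μ)
    (hfg : Integrable (fun x => f x * g x) μ) :
    (∫ x, f x * g x ∂μ) ^ 2 ≤ (∫ x, f x ^ 2 ∂μ) * ∫ x, g x ^ 2 ∂μ := by
  have h : ∀ s : ℝ, 0 ≤ (∫ x, g x ^ 2 ∂μ) * (s * s) + (2 * ∫ x, f x * g x ∂μ) * s +
      ∫ x, f x ^ 2 ∂μ := by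
    intro s
    have : ∫ x, (f x + s * g x) ^ 2 ∂μ = (∫ x, g x ^ 2 ∂μ) * (s * s) +
        (2 * ∫ x, f x * g x ∂μ) * s + ∫ x, f x ^ 2 ∂μ := by
      have h1 : ∀ x, (f x + s * g x) ^ 2 = (s * s) * g x ^ 2 + (2 * s) * (f x * g x) + f x ^ 2 := by
        intro x; ring
      simp only [h1]
      have h12 : Integrable (fun x => s * s * g x ^ 2 + 2 * s * (f x * g x)) μ :=
        (hg.const_mul _).add (hfg.const_mul _)
      rw [integral_add h12 hf,
        integral_add (hg.const_mul _) (hfg.const_mul _), integral_const_mul, integral_const_mul]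
      ring
    rw [← this]
    exact integral_nonneg fun x => sq_nonneg _
  have := discrim_le_zero h
  unfold discrim at this
  nlinarith

variable {ι : Type*} [Fintype ι] {V : ℰ ι → ℝ} {t B : ℝ}

theorem ev_mul_sq_le {f g : ℰ ι → ℝ}
    (hf : Integrable (fun x => f x ^ 2 * exp (-V x)))
    (hg : Integrable (fun x => g x ^ 2 * exp (-V x)))
    (hfg : Integrable (fun x => f x * g x * exp (-V x))) :
    (ev V fun x => f x * g x) ^ 2 ≤ (ev V fun x => f x ^ 2) * ev V fun x => g x ^ 2 := by
  unfold ev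
  have hs : ∀ x, exp (-V x / 2) * exp (-V x / 2) = exp (-V x) := by
    intro x; rw [← exp_add]; ring_nf
  have h1 : ∀ u : ℰ ι → ℝ, ∀ x, (u x * exp (-V x / 2)) ^ 2 =
      u x ^ 2 * exp (-V x) := by
    intro u x; rw [mul_pow, sq (exp _), hs]
  have h2 : ∀ x, (f x * exp (-V x / 2)) * (g x * exp (-V x / 2)) =
      f x * g x * exp (-V x) := by
    intro x; rw [← hs]; ring
  have := sq_integral_mul_le (μ := volume) (f := fun x => f x * exp (-V x / 2))
    (g := fun x => g x * exp (-V x / 2)) (by simpa only [h1] using hf)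
    (by simpa only [h1] using hg) (by simpa only [h2] using hfg)
  simpa only [h1, h2] using this

theorem ev_nonneg {f : ℰ ι → ℝ} (hf : ∀ x, 0 ≤ f x) : 0 ≤ ev V f :=
  integral_nonneg fun x => mul_nonneg (hf x) (exp_pos _).le

theorem TestFun.sq {f : ℰ ι → ℝ} (hf : TestFun f) : TestFun (fun x => f x ^ 2) := by
  simpa only [_root_.sq] using hf.mul hf.1

/-- `C` is a valid Poincaré constant for `exp (-V)` on test functions. -/
def PoincareConst (V : ℰ ι → ℝ) (C : ℝ) : Prop :=
  ∀ g, TestFun g → (ev V fun x => g x ^ 2) - ev V g ^ 2 ≤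
    C * ∑ i, ev V fun x => dd (ee i) g x ^ 2

theorem genOp_bochner_ge {u : ℰ ι → ℝ} (hV : LangevinPotential V t B) (hu : TestFun u) :
    ∑ i, ∑ j, ev V (fun x => dd (ee i) (dd (ee j) u) x ^ 2) +
      t * ∑ i, ev V (fun x => dd (ee i) u x ^ 2) ≤ ev V (fun x => genOp V u x ^ 2) := by
  rw [bochner hV.smooth hu]
  gcongr
  rw [← ev_sum hV.smooth fun i => (hu.dd _).sq]
  unfold ev
  rw [← integral_const_mul]
  refine integral_mono ?_ ?_ fun x => ?_
  · exact (TestFun.sum fun i => (hu.dd _).sq).integrable_exp hV.smooth |>.const_mul _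
  · exact TestFun.integrable_exp hV.smooth (TestFun.sum fun i => TestFun.sum fun j =>
      ((hu.dd _).mul (hu.1.dd _)).mul ((hV.smooth.dd _).dd _))
  · simp only []
    rw [← mul_assoc]
    gcongr
    exact hV.conv x _

theorem genOp_grad_le {u : ℰ ι → ℝ} (hV : LangevinPotential V t B) (hu : TestFun u) :
    t * ∑ i, ev V (fun x => dd (ee i) u x ^ 2) ≤ ev V (fun x => genOp V u x ^ 2) := by
  refine le_trans ?_ (genOp_bochner_ge hV hu)
  have : 0 ≤ ∑ i, ∑ j, ev V (fun x => dd (ee i) (dd (ee j) u) x ^ 2) :=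
    sum_nonneg fun i _ => sum_nonneg fun j _ => ev_nonneg fun x => sq_nonneg _
  linarith

/-- Directional variances of `exp (-V)` are at most `a`. -/
def VarBound (V : ℰ ι → ℝ) (a : ℝ) : Prop :=
  ∀ c : ι → ℝ, ∃ m : ℝ, Integrable (fun x => ((∑ i, c i * x i) - m) ^ 2 * exp (-V x)) ∧
    (ev V fun x => ((∑ i, c i * x i) - m) ^ 2) ≤ a * ∑ i, c i ^ 2

theorem contDiff_lin (c : ι → ℝ) (m : ℝ) :
    ContDiff ℝ ∞ (fun x : ℰ ι => (∑ i, c i * x i) - m) := by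
  fun_prop

theorem dd_lin (c : ι → ℝ) (m : ℝ) (i : ι) (x : ℰ ι) :
    dd (ee i) (fun x : ℰ ι => (∑ i, c i * x i) - m) x = c i := by
  classical
  have h : HasFDerivAt (fun x : ℰ ι => (∑ i, c i * x i) - m)
      (∑ i, c i • (EuclideanSpace.proj i : ℰ ι →L[ℝ] ℝ)) x := by
    refine HasFDerivAt.sub_const m ?_
    have := (∑ i, c i • (EuclideanSpace.proj i : ℰ ι →L[ℝ] ℝ)).hasFDerivAt (x := x)
    refine this.congr_of_eventuallyEq (Eventually.of_forall fun y => ?_)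
    simp
  unfold dd
  rw [h.fderiv]
  simp [ee]

theorem sum_sq_ev_dd_le {u : ℰ ι → ℝ} {a : ℝ} (hV : LangevinPotential V t B)
    (ha : VarBound V a) (hu : TestFun u) :
    ∑ i, ev V (dd (ee i) u) ^ 2 ≤ a * ev V (fun x => genOp V u x ^ 2) := by
  set b : ι → ℝ := fun i => ev V (dd (ee i) u) with hb
  obtain ⟨m, hm, hma⟩ := ha b
  have h1 := ev_mul_genOp hV.smooth (contDiff_lin b m) hu
  have h2 : ∑ i, ev V (fun x => dd (ee i) (fun x => (∑ i, b i * x i) - m) x * dd (ee i) u x) =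
      ∑ i, b i ^ 2 := by
    refine sum_congr rfl fun i _ => ?_
    simp only [dd_lin]
    unfold ev
    simp only [mul_assoc]
    rw [integral_const_mul, sq]
    rfl
  rw [h2] at h1
  have h3 := ev_mul_sq_le (V := V) hm ((hu.genOp hV.smooth).sq.integrable_exp hV.smooth)
    ((TestFun.mul' (contDiff_lin b m) (hu.genOp hV.smooth)).integrable_exp hV.smooth)
  rw [h1] at h3
  have hN : 0 ≤ ev V (fun x => genOp V u x ^ 2) := ev_nonneg fun x => sq_nonneg _
  have h4 : (∑ i, b i ^ 2) ^ 2 ≤ (∑ i, b i ^ 2) * (a * ev V (fun x => genOp V u x ^ 2)) := by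
    refine h3.trans ((mul_le_mul_of_nonneg_right hma hN).trans (le_of_eq (by ring)))
  have h5 : 0 ≤ ∑ i, b i ^ 2 := sum_nonneg fun i _ => sq_nonneg _
  rcases h5.eq_or_lt with h6 | h6
  · rw [← h6]
    have : 0 ≤ a ∨ IsEmpty ι := by
      rcases isEmpty_or_nonempty ι with h | ⟨⟨i⟩⟩
      · exact Or.inr h
      · left
        classical
        obtain ⟨m, -, hm2⟩ := ha (Pi.single i 1)
        have h7 : (0 : ℝ) ≤ a * ∑ j, (Pi.single i 1 : ι → ℝ) j ^ 2 :=
          le_trans (ev_nonneg fun x => sq_nonneg _) hm2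
        simpa [Pi.single_apply] using h7
    rcases this with h | h
    · positivity
    · have : ev V (fun x => genOp V u x ^ 2) = 0 := by simp [genOp, ev]
      simp [this]
  · rw [sq] at h4
    exact le_of_mul_le_mul_left h4 h6

theorem genOp_grad_le_of_poincare {u : ℰ ι → ℝ} {a C : ℝ} (hC0 : 0 ≤ C)
    (hV : LangevinPotential V t B) (ha : VarBound V a) (hC : PoincareConst V C) (hu : TestFun u) :
    (1 + C * t) * ∑ i, ev V (fun x => dd (ee i) u x ^ 2) ≤
      (C + a) * ev V (fun x => genOp V u x ^ 2) := by
  have h1 := sum_sq_ev_dd_le hV ha hu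
  have h2 := mul_le_mul_of_nonneg_left (genOp_bochner_ge hV hu) hC0
  have h3 : ∑ i, ((ev V fun x => dd (ee i) u x ^ 2) - ev V (dd (ee i) u) ^ 2) ≤
      ∑ i, C * ∑ j, ev V (fun x => dd (ee i) (dd (ee j) u) x ^ 2) := by
    refine sum_le_sum fun i _ => ?_
    refine (hC _ (hu.dd (ee i))).trans (le_of_eq ?_)
    congr 1
    exact sum_congr rfl fun j _ => by rw [dd_comm hu.1]
  rw [sum_sub_distrib, ← mul_sum] at h3
  linarith

/-- The range of the generator is dense among centred functions. -/
def GenDense (V : ℰ ι → ℝ) : Prop :=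
  ∀ g, TestFun g → ∀ η > 0, ∃ u, TestFun u ∧
    (ev V fun x => (genOp V u x - (g x - ev V g)) ^ 2) ≤ η ^ 2

theorem LangevinPotential.integrable_exp (hV : LangevinPotential V t B) :
    Integrable (fun x => exp (-V x)) := by
  by_contra h
  have := hV.prob
  rw [integral_undef h] at this
  exact zero_ne_one this

theorem ev_genOp {u : ℰ ι → ℝ} (hV : ContDiff ℝ ∞ V) (hu : TestFun u) :
    ev V (genOp V u) = 0 := by
  have := ev_mul_genOp (f := fun _ => (1 : ℝ)) hV contDiff_const hu
  simpa [dd_const, ev] using this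

theorem poincare_of_grad_le {C : ℝ} (hV : LangevinPotential V t B) (hd : GenDense V) (hC0 : 0 ≤ C)
    (hC : ∀ u, TestFun u → ∑ i, ev V (fun x => dd (ee i) u x ^ 2) ≤
      C * ev V (fun x => genOp V u x ^ 2)) : PoincareConst V C := by
  intro g hg
  have hI := hV.integrable_exp
  set m := ev V g with hm
  set G := (ev V fun x => (g x - m) ^ 2) with hG
  set Dg := ∑ i, ev V fun x => dd (ee i) g x ^ 2 with hDg
  have hgI := hg.integrable_exp hV.smooth
  have hg2I := hg.sq.integrable_exp hV.smooth
  have hcI : Integrable fun x => (g x - m) ^ 2 * exp (-V x) := by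
    have : (fun x => (g x - m) ^ 2 * exp (-V x)) = fun x =>
      g x ^ 2 * exp (-V x) - (2 * m) * (g x * exp (-V x)) + m ^ 2 * exp (-V x) := by
      ext x; ring
    rw [this]
    exact (hg2I.sub (hgI.const_mul _)).add (hI.const_mul _)
  have hGe : (ev V fun x => g x ^ 2) - m ^ 2 = G := by
    rw [hG]
    unfold ev
    have : (fun x => (g x - m) ^ 2 * exp (-V x)) = fun x =>
      g x ^ 2 * exp (-V x) - (2 * m) * (g x * exp (-V x)) + m ^ 2 * exp (-V x) := by
      ext x; ring
    have h12 : Integrable (fun x => g x ^ 2 * exp (-V x) - (2 * m) * (g x * exp (-V x))) :=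
      hg2I.sub (hgI.const_mul _)
    rw [this, integral_add h12 (hI.const_mul _),
      integral_sub hg2I (hgI.const_mul _), integral_const_mul, integral_const_mul, hV.prob]
    have : ∫ x, g x * exp (-V x) = m := rfl
    rw [this]
    ring
  rw [hGe]
  have hG0 : 0 ≤ G := ev_nonneg fun x => sq_nonneg _
  have hDg0 : 0 ≤ Dg := sum_nonneg fun i _ => ev_nonneg fun x => sq_nonneg _
  have key : ∀ η : ℝ, 0 < η → 0 ≤ G - η / 2 * (G + 1) →
      (G - η / 2 * (G + 1)) ^ 2 ≤ C * ((1 + η) * G + η ^ 2 + η) * Dg := by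
    intro η hη hpos
    obtain ⟨u, hu, hur⟩ := hd g hg η hη
    have hL := hu.genOp hV.smooth
    have hLI := hL.sq.integrable_exp hV.smooth
    have hrI : Integrable fun x => (genOp V u x - (g x - m)) ^ 2 * exp (-V x) := by
      have : (fun x => (genOp V u x - (g x - m)) ^ 2 * exp (-V x)) = fun x =>
        (genOp V u x - g x) ^ 2 * exp (-V x) +
        (2 * m) * ((genOp V u x - g x) * exp (-V x)) + m ^ 2 * exp (-V x) := by
        ext x; ring
      rw [this]
      exact (((hL.sub hg).sq.integrable_exp hV.smooth).add
        (((hL.sub hg).integrable_exp hV.smooth).const_mul _)).add (hI.const_mul _)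
    have hN : ev V (fun x => genOp V u x ^ 2) ≤ (1 + η) * G + η ^ 2 + η := by
      have h1 : ev V (fun x => genOp V u x ^ 2) ≤ (1 + η) * G + (1 + 1 / η) *
          (ev V fun x => (genOp V u x - (g x - m)) ^ 2) := by
        rw [hG]
        unfold ev
        rw [← integral_const_mul, ← integral_const_mul,
          ← integral_add (hcI.const_mul _) (hrI.const_mul _)]
        refine integral_mono hLI ((hcI.const_mul _).add (hrI.const_mul _)) fun x => ?_
        simp only []
        rw [← mul_assoc, ← mul_assoc, ← add_mul]
        refine mul_le_mul_of_nonneg_right ?_ (exp_pos _).le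
        set p := g x - m
        set q := genOp V u x - p with hq
        have : genOp V u x = p + q := by rw [hq]; ring
        rw [this]
        have h2 : 0 ≤ (η * p - q) ^ 2 / η := by positivity
        have h3 : (1 + η) * p ^ 2 + (1 + 1 / η) * q ^ 2 - (p + q) ^ 2 = (η * p - q) ^ 2 / η := by
          field_simp; ring
        linarith
      have h4 : (1 + 1 / η) * (ev V fun x => (genOp V u x - (g x - m)) ^ 2) ≤ (1 + 1 / η) * η ^ 2 := by
        gcongr
      have h5 : (1 + 1 / η) * η ^ 2 = η ^ 2 + η := by field_simp
      linarith
    have hx1 : ev V (fun x => g x * genOp V u x) = ∑ i, ev V (fun x => dd (ee i) g x * dd (ee i) u x) :=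
      ev_mul_genOp hV.smooth hg.1 hu
    have hx2 : G - η / 2 * (G + 1) ≤ ev V (fun x => g x * genOp V u x) := by
      have h0 : ev V (fun x => g x * genOp V u x) = ev V (fun x => (g x - m) * genOp V u x) := by
        have h00 := ev_genOp hV.smooth hu
        unfold ev at h00 ⊢
        have : (fun x => (g x - m) * genOp V u x * exp (-V x)) = fun x =>
          g x * genOp V u x * exp (-V x) - m * (genOp V u x * exp (-V x)) := by
          ext x; ring
        rw [this, integral_sub ((hg.mul hL.1).integrable_exp hV.smooth)
          ((hL.integrable_exp hV.smooth).const_mul _), integral_const_mul, h00]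
        ring
      have h1 : G - η / 2 * G - 1 / (2 * η) * (ev V fun x => (genOp V u x - (g x - m)) ^ 2) ≤
          ev V (fun x => (g x - m) * genOp V u x) := by
        have h10 : G - η / 2 * G - 1 / (2 * η) * (ev V fun x => (genOp V u x - (g x - m)) ^ 2) =
          (1 - η / 2) * G - 1 / (2 * η) * (ev V fun x => (genOp V u x - (g x - m)) ^ 2) := by ring
        rw [h10, hG]
        unfold ev
        rw [← integral_const_mul, ← integral_const_mul,
          ← integral_sub (hcI.const_mul _) (hrI.const_mul _)]
        refine integral_mono ((hcI.const_mul _).sub (hrI.const_mul _)) ?_ fun x => ?_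
        · have : (fun x => (g x - m) * genOp V u x * exp (-V x)) = fun x =>
            g x * genOp V u x * exp (-V x) - m * (genOp V u x * exp (-V x)) := by
            ext x; ring
          rw [this]
          exact ((hg.mul hL.1).integrable_exp hV.smooth).sub
            ((hL.integrable_exp hV.smooth).const_mul _)
        simp only []
        rw [← mul_assoc, ← mul_assoc, ← sub_mul]
        refine mul_le_mul_of_nonneg_right ?_ (exp_pos _).le
        set p := g x - m
        set q := genOp V u x - p with hq
        have : genOp V u x = p + q := by rw [hq]; ring
        rw [this]
        have h2 : 0 ≤ (η * p + q) ^ 2 / (2 * η) := by positivity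
        have h3 : p * (p + q) - ((1 - η / 2) * p ^ 2 - 1 / (2 * η) * q ^ 2) =
          (η * p + q) ^ 2 / (2 * η) := by
          field_simp; ring
        linarith
      have h4 : 1 / (2 * η) * (ev V fun x => (genOp V u x - (g x - m)) ^ 2) ≤ 1 / (2 * η) * η ^ 2 := by
        gcongr
      have h5 : 1 / (2 * η) * η ^ 2 = η / 2 := by field_simp
      rw [h0]
      linarith
    have hx3 : (∑ i, ev V (fun x => dd (ee i) g x * dd (ee i) u x)) ^ 2 ≤
        Dg * ∑ i, ev V (fun x => dd (ee i) u x ^ 2) := by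
      refine Finset.sum_sq_le_sum_mul_sum_of_sq_le_mul _ (fun i _ => ev_nonneg fun x => sq_nonneg _)
        (fun i _ => ev_nonneg fun x => sq_nonneg _) fun i _ => ?_
      exact ev_mul_sq_le ((hg.dd _).sq.integrable_exp hV.smooth)
        ((hu.dd _).sq.integrable_exp hV.smooth) (((hg.dd _).mul (hu.1.dd _)).integrable_exp hV.smooth)
    rw [← hx1] at hx3
    calc (G - η / 2 * (G + 1)) ^ 2 ≤ (ev V (fun x => g x * genOp V u x)) ^ 2 := by gcongr
      _ ≤ Dg * ∑ i, ev V (fun x => dd (ee i) u x ^ 2) := hx3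
      _ ≤ Dg * (C * ((1 + η) * G + η ^ 2 + η)) := by
        gcongr
        exact (hC u hu).trans (by gcongr)
      _ = _ := by ring
  rcases hG0.eq_or_lt with h0 | h0
  · rw [← h0]; positivity
  have hlim1 : Tendsto (fun η : ℝ => (G - η / 2 * (G + 1)) ^ 2) (𝓝[>] 0) (𝓝 ((G - 0 / 2 * (G + 1)) ^ 2)) :=
    (Continuous.tendsto (by fun_prop) _).mono_left nhdsWithin_le_nhds
  have hlim2 : Tendsto (fun η : ℝ => C * ((1 + η) * G + η ^ 2 + η) * Dg) (𝓝[>] 0)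
      (𝓝 (C * ((1 + 0) * G + 0 ^ 2 + 0) * Dg)) :=
    (Continuous.tendsto (by fun_prop) _).mono_left nhdsWithin_le_nhds
  have hev : ∀ᶠ η : ℝ in 𝓝[>] 0, 0 ≤ G - η / 2 * (G + 1) := by
    have : Tendsto (fun η : ℝ => G - η / 2 * (G + 1)) (𝓝[>] 0) (𝓝 (G - 0 / 2 * (G + 1))) :=
      (Continuous.tendsto (by fun_prop) _).mono_left nhdsWithin_le_nhds
    exact (this.eventually_const_lt (u := 0) (by simpa using h0)).mono fun _ h => h.le
  have := le_of_tendsto_of_tendsto hlim1 hlim2 (by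
    filter_upwards [hev, self_mem_nhdsWithin] with η h1 h2 using key η h2 h1)
  simp only [zero_div, zero_mul, sub_zero, add_zero, one_mul] at this
  have h6 : G * G ≤ G * (C * Dg) := by nlinarith
  exact le_of_mul_le_mul_left h6 h0

/-- The improved Lichnerowicz inequality for smooth potentials. -/
theorem improved_lichnerowicz_of_dense {a : ℝ} (ht : 0 < t) (ha0 : 0 ≤ a)
    (hV : LangevinPotential V t B) (hd : GenDense V) (ha : VarBound V a) :
    PoincareConst V (Real.sqrt (a / t)) := by
  set S : Set ℝ := {C | 0 ≤ C ∧ PoincareConst V C} with hS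
  have h1 : (1 / t) ∈ S := by
    refine ⟨by positivity, poincare_of_grad_le hV hd (by positivity) fun u hu => ?_⟩
    have := genOp_grad_le hV hu
    rw [one_div, inv_mul_eq_div, le_div_iff₀ ht]
    linarith
  have hb : BddBelow S := ⟨0, fun C hC => hC.1⟩
  set c := sInf S with hc
  have hc0 : 0 ≤ c := le_csInf ⟨_, h1⟩ fun C hC => hC.1
  have hcP : PoincareConst V c := by
    intro g hg
    have hD : 0 ≤ ∑ i, ev V fun x => dd (ee i) g x ^ 2 :=
      sum_nonneg fun i _ => ev_nonneg fun x => sq_nonneg _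
    refine le_of_forall_pos_le_add fun ε hε => ?_
    set D := ∑ i, ev V fun x => dd (ee i) g x ^ 2
    obtain ⟨C, hC, hCc⟩ := exists_lt_of_csInf_lt ⟨_, h1⟩
      (show c < c + ε / (D + 1) by have : 0 < ε / (D + 1) := by positivity
                                   linarith)
    have h2 := hC.2 g hg
    have h3 : C * D ≤ (c + ε / (D + 1)) * D := by gcongr
    have h4 : ε / (D + 1) * D ≤ ε := by
      rw [div_mul_eq_mul_div, div_le_iff₀ (by positivity)]
      nlinarith
    linarith
  have h2 : (c + a) / (1 + c * t) ∈ S := by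
    refine ⟨by positivity, poincare_of_grad_le hV hd (by positivity) fun u hu => ?_⟩
    have := genOp_grad_le_of_poincare hc0 hV ha hcP hu
    rw [div_mul_eq_mul_div, le_div_iff₀ (by positivity)]
    linarith
  have h3 : c ≤ (c + a) / (1 + c * t) := csInf_le hb h2
  rw [le_div_iff₀ (by positivity)] at h3
  have h4 : c ≤ Real.sqrt (a / t) := by
    refine Real.le_sqrt_of_sq_le ?_
    rw [le_div_iff₀ ht]
    nlinarith
  intro g hg
  refine (hcP g hg).trans ?_
  gcongr
  exact sum_nonneg fun i _ => ev_nonneg fun x => sq_nonneg _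

end

section

variable {ι : Type*} [Fintype ι]

/-- Convolution of `w` with the kernel `ρ`. -/
def moll (ρ w : ℰ ι → ℝ) (y : ℰ ι) : ℝ := ∫ x, w x * ρ (y - x)

theorem moll_eq_convolution (ρ w : ℰ ι → ℝ) :
    moll ρ w = convolution w ρ (ContinuousLinearMap.mul ℝ ℝ) volume := rfl

theorem moll_contDiff {ρ w : ℰ ι → ℝ} (hρ : TestFun ρ) (hw : LocallyIntegrable w) :
    ContDiff ℝ ∞ (moll ρ w) := by
  rw [moll_eq_convolution]
  exact HasCompactSupport.contDiff_convolution_right (n := ⊤) _ hρ.2 hw hρ.1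

theorem dd_moll {ρ w : ℰ ι → ℝ} (hρ : TestFun ρ) (hw : LocallyIntegrable w)
    (v : ℰ ι) : dd v (moll ρ w) = moll (dd v ρ) w := by
  ext y
  unfold dd
  rw [moll_eq_convolution, (HasCompactSupport.hasFDerivAt_convolution_right
    (ContinuousLinearMap.mul ℝ ℝ) hρ.2 hw (hρ.1.of_le (by simp)) y).fderiv,
    convolution_precompR_apply _ hw (hρ.2.fderiv ℝ) (hρ.1.continuous_fderiv (by simp))]
  rfl

theorem TestFun.comp_sub_left {ρ : ℰ ι → ℝ} (hρ : TestFun ρ)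
    (y : ℰ ι) : TestFun (fun x => ρ (y - x)) := by
  refine ⟨hρ.1.comp (contDiff_const.sub contDiff_id), ?_⟩
  exact hρ.2.comp_homeomorph (Homeomorph.subLeft y)

theorem dd_comp_sub_left {ρ : ℰ ι → ℝ} (hρ : ContDiff ℝ ∞ ρ)
    (v y : ℰ ι) : dd v (fun x => ρ (y - x)) = fun x => - dd v ρ (y - x) := by
  ext x
  unfold dd
  have h1 : HasFDerivAt (fun x : ℰ ι => y - x) (-ContinuousLinearMap.id ℝ _) x :=
    (hasFDerivAt_id x).const_sub y
  have h2 := (hρ.differentiable_infty (y - x)).hasFDerivAt.comp x h1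
  have h3 : HasFDerivAt (fun x => ρ (y - x)) _ x := h2
  rw [h3.fderiv]
  simp

theorem integrable_mul_comp_sub {ρ w : ℰ ι → ℝ} (hρ : TestFun ρ)
    (hw : LocallyIntegrable w) (y : ℰ ι) : Integrable fun x => w x * ρ (y - x) := by
  have := hρ.2.convolutionExists_right (ContinuousLinearMap.mul ℝ ℝ) (μ := volume) hw
    hρ.1.continuous y
  exact this

theorem integral_moll {ρ w : ℰ ι → ℝ} (hρ : TestFun ρ) (h1 : ∫ x, ρ x = 1)
    (hw : Integrable w) : ∫ y, moll ρ w y = ∫ x, w x := by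
  rw [moll_eq_convolution, integral_convolution _ hw hρ.integrable, h1]
  simp

theorem integrable_moll {ρ w : ℰ ι → ℝ} (hρ : TestFun ρ)
    (hw : Integrable w) : Integrable (moll ρ w) := by
  rw [moll_eq_convolution]
  exact hw.integrable_convolution _ hρ.integrable

theorem integral_moll_mul {ρ w ψ : ℰ ι → ℝ} (hρ : TestFun ρ)
    (hs : ∀ x, ρ (-x) = ρ x) (hw : Integrable w) (hψ : Continuous ψ) (hψc : HasCompactSupport ψ) :
    ∫ y, moll ρ w y * ψ y = ∫ x, w x * moll ρ ψ x := by
  unfold moll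
  have h1 : Integrable (fun p : ℰ ι × ℰ ι =>
      w p.2 * ρ (p.1 - p.2)) (volume.prod volume) :=
    hw.convolution_integrand (ContinuousLinearMap.mul ℝ ℝ) hρ.integrable
  obtain ⟨C, hC⟩ := hψc.exists_bound_of_continuous hψ
  have h2 : Integrable (fun p : ℰ ι × ℰ ι =>
      ψ p.1 * (w p.2 * ρ (p.1 - p.2))) (volume.prod volume) :=
    h1.bdd_mul (c := C) (hψ.comp continuous_fst).aestronglyMeasurable (Eventually.of_forall fun p => hC _)
  calc _ = ∫ y, ∫ x, ψ y * (w x * ρ (y - x)) := by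
        congr 1; ext y; rw [integral_const_mul, mul_comm]
    _ = ∫ x, ∫ y, ψ y * (w x * ρ (y - x)) := integral_integral_swap h2
    _ = _ := by
        congr 1; ext x; rw [← integral_const_mul]
        congr 1; ext y
        rw [← hs, neg_sub]; ring

/-- The normalized bump at scale `ε`. -/
def bumpAt (ε : ℝ) (hε : 0 < ε) : ContDiffBump (0 : ℰ ι) :=
  ⟨ε / 2, ε, by positivity, by linarith⟩

theorem bumpAt_test (ε : ℝ) (hε : 0 < ε) :
    TestFun ((bumpAt (ι := ι) ε hε).normed volume) :=
  ⟨(bumpAt ε hε).contDiff_normed, (bumpAt ε hε).hasCompactSupport_normed⟩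

theorem bumpAt_ne_zero {ε : ℝ} {hε : 0 < ε} {x : ℰ ι}
    (h : (bumpAt (ι := ι) ε hε).normed volume x ≠ 0) : ‖x‖ < ε := by
  have : x ∈ Function.support ((bumpAt (ι := ι) ε hε).normed volume) := h
  rw [ContDiffBump.support_normed_eq] at this
  simpa [bumpAt] using this

/-- A locally integrable function with vanishing weak gradient is constant. -/
theorem ae_const_of_weak_grad_zero {h : ℰ ι → ℝ} (hh : LocallyIntegrable h)
    (hz : ∀ ψ, TestFun ψ → ∀ i, ∫ x, h x * dd (ee i) ψ x = 0) : ∃ c, ∀ᵐ x, h x = c := by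
  set φ : ℕ → ContDiffBump (0 : ℰ ι) := fun k =>
    bumpAt (1 / ((k : ℝ) + 1)) (by positivity) with hφ
  have h1 : ∀ k, ∃ c, ∀ x, moll ((φ k).normed volume) h x = c := by
    intro k
    have ht : TestFun ((φ k).normed volume) := bumpAt_test _ _
    refine ⟨moll ((φ k).normed volume) h 0, fun x => ?_⟩
    have hd := (moll_contDiff ht hh).differentiable_infty
    refine is_const_of_fderiv_eq_zero hd (fun y => ?_) x 0
    have h2 : ∀ i, dd (ee i) (moll ((φ k).normed volume) h) y = 0 := by
      intro i
      rw [dd_moll ht hh]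
      have := hz _ (ht.comp_sub_left y) i
      rw [dd_comp_sub_left ht.1] at this
      simpa [moll, integral_neg] using this
    refine ContinuousLinearMap.coe_injective
      ((EuclideanSpace.basisFun ι ℝ).toBasis.ext fun i => ?_)
    simpa [dd, ee] using h2 i
  choose c hc using h1
  have h3 : ∀ᵐ x, Tendsto (fun k => moll ((φ k).normed volume) h x) atTop (𝓝 (h x)) := by
    have := ContDiffBump.ae_convolution_tendsto_right_of_locallyIntegrable (μ := volume)
      (φ := φ) (l := atTop) (g := h) (K := 2)
      (by simpa [hφ, bumpAt] using tendsto_one_div_add_atTop_nhds_zero_nat (𝕜 := ℝ))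
      (Eventually.of_forall fun k => by simp [hφ, bumpAt]; linarith) hh
    filter_upwards [this] with x hx
    refine hx.congr fun k => ?_
    rw [convolution_lsmul_swap]
    simp [moll, mul_comm]
  simp only [hc] at h3
  have hne : ∃ x, Tendsto c atTop (𝓝 (h x)) := h3.exists
  obtain ⟨x0, hx0⟩ := hne
  exact ⟨h x0, h3.mono fun x hx => tendsto_nhds_unique hx hx0⟩

end

section

variable {ι : Type*} [Fintype ι] {V : ℰ ι → ℝ} {t B : ℝ}

theorem integrable_mul_exp_of_sq {h : ℰ ι → ℝ} (hV : LangevinPotential V t B)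
    (hm : AEStronglyMeasurable h) (h2 : Integrable fun x => h x ^ 2 * exp (-V x)) :
    Integrable fun x => h x * exp (-V x) := by
  refine (h2.add hV.integrable_exp).mono'
    (hm.mul hV.smooth.continuous.neg.rexp.aestronglyMeasurable) (Eventually.of_forall fun x => ?_)
  simp only [Pi.add_apply, norm_eq_abs, abs_mul, abs_exp]
  have : |h x| ≤ h x ^ 2 + 1 := by
    rw [← sq_abs]; nlinarith [sq_nonneg (|h x| - 1)]
  nlinarith [exp_pos (-V x)]

theorem moll_generator {w ρ : ℰ ι → ℝ} (hV : ContDiff ℝ ∞ V)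
    (hw : LocallyIntegrable w) (horth : ∀ u, TestFun u → ∫ x, w x * genOp V u x = 0)
    (hρ : TestFun ρ) (y : ℰ ι) :
    ∑ i, (dd (ee i) (moll ρ fun x => w x * dd (ee i) V x) y +
      dd (ee i) (dd (ee i) (moll ρ w)) y) = 0 := by
  have hwV : ∀ i, LocallyIntegrable fun x => w x * dd (ee i) V x := fun i =>
    hw.mul_continuous (hV.dd (ee i)).continuous
  have h := horth _ (hρ.comp_sub_left y)
  have h2 : ∀ x, w x * genOp V (fun x => ρ (y - x)) x =
      - ∑ i, ((w x * dd (ee i) V x) * dd (ee i) ρ (y - x) +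
        w x * dd (ee i) (dd (ee i) ρ) (y - x)) := by
    intro x
    simp only [genOp, mul_sum, ← Finset.sum_neg_distrib]
    refine sum_congr rfl fun i _ => ?_
    rw [dd_comp_sub_left hρ.1, dd_neg, dd_comp_sub_left (hρ.1.dd _)]
    ring
  simp only [h2] at h
  have h3 : ∀ i ∈ Finset.univ, Integrable fun x => (w x * dd (ee i) V x) * dd (ee i) ρ (y - x) +
        w x * dd (ee i) (dd (ee i) ρ) (y - x) := fun i _ =>
    (integrable_mul_comp_sub (hρ.dd _) (hwV i) y).add
      (integrable_mul_comp_sub ((hρ.dd _).dd _) hw y)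
  rw [integral_neg, neg_eq_zero, integral_finsetSum _ h3] at h
  rw [← h]
  refine sum_congr rfl fun i _ => ?_
  rw [integral_add (integrable_mul_comp_sub (hρ.dd _) (hwV i) y)
      (integrable_mul_comp_sub ((hρ.dd _).dd _) hw y),
    dd_moll hρ (hwV i), dd_moll hρ hw, dd_moll (hρ.dd _) hw]
  rfl

theorem moll_weak {w ρ φ : ℰ ι → ℝ} (hV : ContDiff ℝ ∞ V)
    (hw : LocallyIntegrable w) (horth : ∀ u, TestFun u → ∫ x, w x * genOp V u x = 0)
    (hρ : TestFun ρ) (hφ : TestFun φ) :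
    ∑ i, ∫ y, (moll ρ (fun x => w x * dd (ee i) V x) y + dd (ee i) (moll ρ w) y) *
      dd (ee i) φ y = 0 := by
  have hwV : ∀ i, LocallyIntegrable fun x => w x * dd (ee i) V x := fun i =>
    hw.mul_continuous (hV.dd (ee i)).continuous
  have hs : ∀ i, ContDiff ℝ ∞ fun y => moll ρ (fun x => w x * dd (ee i) V x) y +
      dd (ee i) (moll ρ w) y := fun i =>
    (moll_contDiff hρ (hwV i)).add ((moll_contDiff hρ hw).dd _)
  have h1 : ∀ i, ∫ y, (moll ρ (fun x => w x * dd (ee i) V x) y + dd (ee i) (moll ρ w) y) *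
      dd (ee i) φ y = - ∫ y, (dd (ee i) (moll ρ fun x => w x * dd (ee i) V x) y +
      dd (ee i) (dd (ee i) (moll ρ w)) y) * φ y := by
    intro i
    rw [integral_mul_dd (hs i) hφ.1 (Or.inr hφ.2),
      dd_add (moll_contDiff hρ (hwV i)) ((moll_contDiff hρ hw).dd _)]
  simp only [h1]
  rw [Finset.sum_neg_distrib, ← integral_finsetSum]
  · simp only [← sum_mul, moll_generator hV hw horth hρ]
    simp
  · intro i _
    exact (TestFun.mul' (((moll_contDiff hρ (hwV i)).dd _).add
      (((moll_contDiff hρ hw).dd _).dd _)) hφ).integrable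

theorem caccioppoli {g χ : ℰ ι → ℝ} {R : ι → ℰ ι → ℝ}
    (hV : ContDiff ℝ ∞ V) (hg : ContDiff ℝ ∞ g) (hχ : TestFun χ) (hR : ∀ i, Continuous (R i))
    (hweak : ∑ i, ∫ y, (exp (-V y) * dd (ee i) g y + R i y) *
      dd (ee i) (fun x => χ x * χ x * g x) y = 0) :
    ∑ i, ∫ y, χ y ^ 2 * dd (ee i) g y ^ 2 * exp (-V y) ≤
      ∑ i, ∫ y, (10 * (g y ^ 2 * exp (-V y)) * dd (ee i) χ y ^ 2 +
        4 * (χ y ^ 2) * (R i y ^ 2 * exp (V y))) := by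
  have hcχ := hχ.1.continuous
  have hcg := hg.continuous
  have hcV := hV.continuous
  have hcd := fun i => (hg.dd (ee i)).continuous
  have hcχd := fun i => (hχ.1.dd (ee i)).continuous
  have hd : ∀ i y, dd (ee i) (fun x => χ x * χ x * g x) y =
      χ y ^ 2 * dd (ee i) g y + 2 * χ y * dd (ee i) χ y * g y := by
    intro i y
    rw [dd_mul (hχ.1.mul hχ.1) hg, dd_mul hχ.1 hχ.1]
    ring
  simp only [hd] at hweak
  have hi1 : ∀ i, Integrable fun y => (exp (-V y) * dd (ee i) g y + R i y) *
      (χ y ^ 2 * dd (ee i) g y + 2 * χ y * dd (ee i) χ y * g y) := by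
    intro i
    refine Continuous.integrable_of_hasCompactSupport (by have := hR i; have := hcd i; have := hcχd i; fun_prop) ?_
    refine hχ.2.mono fun x hx => ?_
    contrapose! hx
    simp only [Function.mem_support, not_not] at hx ⊢
    simp [hx]
  have hi2 : ∀ i, Integrable fun y => χ y ^ 2 * dd (ee i) g y ^ 2 * exp (-V y) := by
    intro i
    refine Continuous.integrable_of_hasCompactSupport (by have := hR i; have := hcd i; have := hcχd i; fun_prop) ?_
    refine hχ.2.mono fun x hx => ?_
    contrapose! hx
    simp only [Function.mem_support, not_not] at hx ⊢
    simp [hx]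
  have hi3 : ∀ i, Integrable fun y => 10 * (g y ^ 2 * exp (-V y)) * dd (ee i) χ y ^ 2 +
        4 * (χ y ^ 2) * (R i y ^ 2 * exp (V y)) := by
    intro i
    have h1 := hR i
    have h2 := hcd i
    have h3 := hcχd i
    refine Integrable.add ?_ ?_
    · refine Continuous.integrable_of_hasCompactSupport (by fun_prop) ?_
      refine (hχ.dd (ee i)).2.mono fun x hx => ?_
      contrapose! hx
      simp only [Function.mem_support, not_not] at hx ⊢
      simp [hx]
    · refine Continuous.integrable_of_hasCompactSupport (by fun_prop) ?_
      refine hχ.2.mono fun x hx => ?_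
      contrapose! hx
      simp only [Function.mem_support, not_not] at hx ⊢
      simp [hx]
  rw [← integral_finsetSum _ fun i _ => hi2 i, ← integral_finsetSum _ fun i _ => hi3 i]
  rw [← integral_finsetSum _ fun i _ => hi1 i] at hweak
  have hpt : ∀ y, ∑ i, χ y ^ 2 * dd (ee i) g y ^ 2 * exp (-V y) ≤
      2 * (∑ i, (exp (-V y) * dd (ee i) g y + R i y) *
      (χ y ^ 2 * dd (ee i) g y + 2 * χ y * dd (ee i) χ y * g y)) +
      ∑ i, (10 * (g y ^ 2 * exp (-V y)) * dd (ee i) χ y ^ 2 +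
        4 * (χ y ^ 2) * (R i y ^ 2 * exp (V y))) := by
    intro y
    rw [mul_sum, ← sum_add_distrib]
    refine sum_le_sum fun i _ => ?_
    have hE := exp_pos (V y)
    rw [Real.exp_neg]
    set E := exp (V y)
    set d := dd (ee i) g y
    set r := R i y
    set c := χ y
    set c' := dd (ee i) χ y
    have : 2 * ((E⁻¹ * d + r) * (c ^ 2 * d + 2 * c * c' * g y)) +
      (10 * (g y ^ 2 * E⁻¹) * c' ^ 2 + 4 * c ^ 2 * (r ^ 2 * E)) - c ^ 2 * d ^ 2 * E⁻¹ =
      ((c * d + 2 * c' * g y + c * r * E) ^ 2 + 6 * (c' * g y) ^ 2 + 3 * (c * r * E) ^ 2) * E⁻¹ := by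
      field_simp
      ring
    have h2 : 0 ≤ ((c * d + 2 * c' * g y + c * r * E) ^ 2 + 6 * (c' * g y) ^ 2 + 3 * (c * r * E) ^ 2) * E⁻¹ := by
      positivity
    linarith
  have hs1 := integrable_finsetSum Finset.univ fun i _ => hi1 i
  have hs3 := integrable_finsetSum Finset.univ fun i _ => hi3 i
  calc _ ≤ ∫ y, (2 * (∑ i, (exp (-V y) * dd (ee i) g y + R i y) *
      (χ y ^ 2 * dd (ee i) g y + 2 * χ y * dd (ee i) χ y * g y)) +
      ∑ i, (10 * (g y ^ 2 * exp (-V y)) * dd (ee i) χ y ^ 2 +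
        4 * (χ y ^ 2) * (R i y ^ 2 * exp (V y)))) :=
        integral_mono (integrable_finsetSum Finset.univ fun i _ => hi2 i)
          ((hs1.const_mul 2).add hs3) hpt
    _ = _ := by
      rw [integral_add (hs1.const_mul 2) hs3, integral_const_mul, hweak]
      ring

/-- Pointwise control of mollified densities at small scales. -/
theorem exists_scale_bound {h : ℰ ι → ℝ} (hV : LangevinPotential V t B)
    (hm : AEStronglyMeasurable h) (h2 : Integrable fun x => h x ^ 2 * exp (-V x)) (r : ℝ) :
    ∃ ε₀ > 0, ∀ ε, ∀ hε : 0 < ε, ε < ε₀ → ∀ y : ℰ ι, ‖y‖ ≤ r →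
      exp (V y) * (moll ((bumpAt ε hε).normed volume) (fun x => |h x| * exp (-V x)) y) ^ 2 ≤
      2 * moll ((bumpAt ε hε).normed volume) (fun x => h x ^ 2 * exp (-V x)) y := by
  have hu : UniformContinuousOn V (Metric.closedBall 0 (r + 1)) :=
    (isCompact_closedBall _ _).uniformContinuousOn_of_continuous hV.smooth.continuous.continuousOn
  rw [Metric.uniformContinuousOn_iff] at hu
  obtain ⟨δ, hδ, hu⟩ := hu (log 2) (Real.log_pos (by norm_num))
  refine ⟨min δ 1, by positivity, fun ε hε hε' y hy => ?_⟩
  have hεδ : ε < δ := hε'.trans_le (min_le_left _ _)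
  have hε1 : ε < 1 := hε'.trans_le (min_le_right _ _)
  set ρ := (bumpAt (ι := ι) ε hε).normed volume with hρ
  have hρt : TestFun ρ := bumpAt_test _ _
  have hρ0 : ∀ x, 0 ≤ ρ x := fun x => ContDiffBump.nonneg_normed _ _
  have h1 := integrable_mul_exp_of_sq hV hm h2
  have habs : Integrable fun x => |h x| * exp (-V x) := by
    have := h1.norm
    simpa [abs_mul] using this
  have hE := hV.integrable_exp
  have i1 := integrable_mul_comp_sub hρt h2.locallyIntegrable y
  have i2 := integrable_mul_comp_sub hρt hE.locallyIntegrable y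
  have i3 := integrable_mul_comp_sub hρt habs.locallyIntegrable y
  have hs : ∀ x, Real.sqrt (exp (-V x) * ρ (y - x)) ^ 2 = exp (-V x) * ρ (y - x) :=
    fun x => Real.sq_sqrt (mul_nonneg (exp_pos _).le (hρ0 _))
  have e1 : ∀ x, (|h x| * Real.sqrt (exp (-V x) * ρ (y - x))) ^ 2 =
      h x ^ 2 * exp (-V x) * ρ (y - x) := by
    intro x; rw [mul_pow, hs, sq_abs]; ring
  have e3 : ∀ x, (|h x| * Real.sqrt (exp (-V x) * ρ (y - x))) *
      Real.sqrt (exp (-V x) * ρ (y - x)) = |h x| * exp (-V x) * ρ (y - x) := by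
    intro x; rw [mul_assoc, ← sq, hs]; ring
  have cs := sq_integral_mul_le (μ := volume)
    (f := fun x => |h x| * Real.sqrt (exp (-V x) * ρ (y - x)))
    (g := fun x => Real.sqrt (exp (-V x) * ρ (y - x)))
    (by simpa only [e1] using i1) (by simpa only [hs] using i2) (by simpa only [e3] using i3)
  simp only [e1, e3, hs] at cs
  have hb : ∫ x, exp (-V x) * ρ (y - x) ≤ 2 * exp (-V y) := by
    have h3 : ∫ x, ρ (y - x) = 1 := by
      rw [integral_sub_left_eq_self ρ volume y]; exact ContDiffBump.integral_normed _
    calc _ ≤ ∫ x, 2 * exp (-V y) * ρ (y - x) := by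
          refine integral_mono i2 ((hρt.comp_sub_left y).integrable.const_mul _) fun x => ?_
          simp only []
          by_cases h0 : ρ (y - x) = 0
          · simp [h0]
          refine mul_le_mul_of_nonneg_right ?_ (hρ0 _)
          have hyx : ‖y - x‖ < ε := bumpAt_ne_zero h0
          have hx : ‖x‖ ≤ r + 1 := by
            have : x = y - (y - x) := by abel
            calc ‖x‖ = ‖y - (y - x)‖ := by rw [← this]
              _ ≤ ‖y‖ + ‖y - x‖ := norm_sub_le _ _
              _ ≤ r + 1 := by linarith
          have h4 := hu y (by simp; linarith) x (by simpa using hx) (by rw [dist_eq_norm]; linarith)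
          rw [Real.dist_eq, abs_lt] at h4
          calc exp (-V x) ≤ exp (log 2 + -V y) := Real.exp_le_exp.2 (by linarith)
            _ = _ := by rw [exp_add, exp_log (by norm_num)]
      _ = _ := by rw [integral_const_mul, h3, mul_one]
  have hn : 0 ≤ ∫ x, h x ^ 2 * exp (-V x) * ρ (y - x) := integral_nonneg fun x =>
    mul_nonneg (mul_nonneg (sq_nonneg _) (exp_pos _).le) (hρ0 _)
  calc _ ≤ exp (V y) * ((∫ x, h x ^ 2 * exp (-V x) * ρ (y - x)) *
        (2 * exp (-V y))) := by
        refine mul_le_mul_of_nonneg_left (cs.trans ?_) (exp_pos _).le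
        gcongr
    _ = 2 * moll ρ (fun x => h x ^ 2 * exp (-V x)) y * (exp (V y) * exp (-V y)) := by
        unfold moll; ring
    _ = _ := by rw [← exp_add]; simp

theorem exists_cutoff (ι : Type*) [Fintype ι] : ∃ C : ℝ, 0 ≤ C ∧ ∀ r : ℝ, 0 < r →
    ∃ χ : ℰ ι → ℝ, TestFun χ ∧ (∀ x, ‖x‖ ≤ r → χ x = 1) ∧
      (∀ x, 0 ≤ χ x ∧ χ x ≤ 1) ∧ (∀ x, χ x ≠ 0 → ‖x‖ ≤ 2 * r) ∧
      (∀ i x, |dd (ee i) χ x| ≤ C / r) ∧ ∀ i x, dd (ee i) χ x ≠ 0 → ‖x‖ ≤ 2 * r := by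
  set b : ContDiffBump (0 : ℰ ι) := ⟨1, 2, by norm_num, by norm_num⟩ with hb
  have hbt : TestFun (b : ℰ ι → ℝ) := ⟨b.contDiff, b.hasCompactSupport⟩
  have h1 : ∀ i, ∃ C, ∀ x, ‖dd (ee i) b x‖ ≤ C := fun i =>
    (hbt.dd (ee i)).2.exists_bound_of_continuous (hbt.dd (ee i)).1.continuous
  choose C hC using h1
  have hC0 : ∀ i, 0 ≤ C i := fun i => (norm_nonneg _).trans (hC i 0)
  have hsup : ∀ x, x ∈ tsupport (b : ℰ ι → ℝ) → ‖x‖ ≤ 2 := by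
    intro x hx
    rw [b.tsupport_eq] at hx
    simpa [hb] using hx
  refine ⟨∑ i, C i, sum_nonneg fun i _ => hC0 i, fun r hr => ?_⟩
  have hsc : ∀ x : ℰ ι, ‖r⁻¹ • x‖ = ‖x‖ / r := fun x => by
    rw [norm_smul, norm_inv, Real.norm_of_nonneg hr.le, inv_mul_eq_div]
  have hdd : ∀ i x, dd (ee i) (fun x => b (r⁻¹ • x)) x = r⁻¹ * dd (ee i) b (r⁻¹ • x) := by
    intro i x
    unfold dd
    have h1 : HasFDerivAt (fun x : ℰ ι => r⁻¹ • x)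
      (r⁻¹ • ContinuousLinearMap.id ℝ _) x :=
      (r⁻¹ • ContinuousLinearMap.id ℝ (ℰ ι)).hasFDerivAt
    have h3 : HasFDerivAt (fun x => b (r⁻¹ • x)) _ x :=
      (hbt.1.differentiable_infty (r⁻¹ • x)).hasFDerivAt.comp x h1
    rw [h3.fderiv]
    simp
  refine ⟨fun x => b (r⁻¹ • x), ⟨hbt.1.comp (contDiff_id.const_smul _),
    hbt.2.comp_homeomorph (Homeomorph.smulOfNeZero r⁻¹ (inv_ne_zero hr.ne'))⟩, ?_, ?_, ?_, ?_, ?_⟩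
  · intro x hx
    refine b.one_of_mem_closedBall ?_
    simp only [hb, mem_closedBall_zero_iff, hsc]
    rw [div_le_one hr]
    exact hx
  · exact fun x => ⟨b.nonneg, b.le_one⟩
  · intro x hx
    have := hsup _ (subset_tsupport _ hx)
    rwa [hsc, div_le_iff₀ hr] at this
  · intro i x
    rw [hdd, abs_mul, abs_inv, abs_of_pos hr, inv_mul_eq_div]
    gcongr
    exact (hC i _).trans (Finset.single_le_sum (fun j _ => hC0 j) (Finset.mem_univ i))
  · intro i x hx
    rw [hdd] at hx
    have h2 : dd (ee i) b (r⁻¹ • x) ≠ 0 := right_ne_zero_of_mul hx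
    have h3 : r⁻¹ • x ∈ tsupport (b : ℰ ι → ℝ) := by
      refine tsupport_fderiv_subset ℝ (subset_tsupport _ ?_)
      intro h0
      apply h2
      simp [dd, h0]
    have := hsup _ h3
    rwa [hsc, div_le_iff₀ hr] at this

theorem dd_mul_exp {g : ℰ ι → ℝ} (hV : ContDiff ℝ ∞ V) (hg : ContDiff ℝ ∞ g)
    (v x : ℰ ι) : dd v (fun x => g x * exp (V x)) x =
      (dd v g x + g x * dd v V x) * exp (V x) := by
  have h := dd_exp_neg (V := fun x => -V x) hV.neg v
  simp only [neg_neg, dd_neg] at h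
  rw [dd_mul hg hV.exp, h]
  ring

set_option maxHeartbeats 1000000 in
theorem weak_grad_small {h : ℰ ι → ℝ} (hV : LangevinPotential V t B)
    (hm : AEStronglyMeasurable h) (h2 : Integrable fun x => h x ^ 2 * exp (-V x))
    (horth : ∀ u, TestFun u → ∫ x, h x * exp (-V x) * genOp V u x = 0)
    {ψ : ℰ ι → ℝ} (hψ : TestFun ψ) (i : ι) {η : ℝ} (hη : 0 < η) :
    ∃ ε₀ > 0, ∀ ε, ∀ hε : 0 < ε, ε < ε₀ →
      (∫ y, moll ((bumpAt ε hε).normed volume) (fun x => h x * exp (-V x)) y *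
        (exp (V y) * dd (ee i) ψ y)) ^ 2 ≤ η := by
  obtain ⟨C, hC0, hC⟩ := exists_cutoff ι
  set N := ∫ x, h x ^ 2 * exp (-V x) with hN
  set M := ∫ x, ψ x ^ 2 * exp (V x) with hM
  set n := (Fintype.card ι : ℝ) with hn
  have hN0 : 0 ≤ N := integral_nonneg fun x => mul_nonneg (sq_nonneg _) (exp_pos _).le
  have hM0 : 0 ≤ M := integral_nonneg fun x => mul_nonneg (sq_nonneg _) (exp_pos _).le
  set K := n * N * M * (20 * C ^ 2 + 8 * B ^ 2) + 1 with hK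
  have hn0 : 0 ≤ n := Nat.cast_nonneg _
  have hKpos : 0 < K := by positivity
  set δ := η / K with hδ
  have hδ0 : 0 < δ := by positivity
  obtain ⟨r0, hr0⟩ : ∃ r0, ∀ x, ψ x ≠ 0 → ‖x‖ ≤ r0 := by
    obtain ⟨r0, hr0⟩ := hψ.2.isBounded.exists_norm_le
    exact ⟨r0, fun x hx => hr0 x (subset_tsupport _ hx)⟩
  set r := max r0 (max 1 (1 / δ)) with hr
  have hr1 : 1 ≤ r := (le_max_left _ _).trans (le_max_right _ _)
  have hrδ : 1 / δ ≤ r := (le_max_right _ _).trans (le_max_right _ _)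
  obtain ⟨χ, hχ, hχ1, hχ01, hχs, hχd, hχds⟩ := hC r (by linarith)
  obtain ⟨ε₀, hε₀, hsc⟩ := exists_scale_bound hV hm h2 (2 * r)
  refine ⟨min ε₀ (min 1 δ), by positivity, fun ε hε hlt => ?_⟩
  have hlt0 : ε < ε₀ := hlt.trans_le (min_le_left _ _)
  have hlt1 : ε < 1 := hlt.trans_le ((min_le_right _ _).trans (min_le_left _ _))
  have hltδ : ε < δ := hlt.trans_le ((min_le_right _ _).trans (min_le_right _ _))
  have hsc := hsc ε hε hlt0
  set ρ := (bumpAt (ι := ι) ε hε).normed volume with hρ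
  have hρt : TestFun ρ := bumpAt_test _ _
  have hρ0 : ∀ x, 0 ≤ ρ x := fun x => ContDiffBump.nonneg_normed _ _
  set w : ℰ ι → ℝ := fun x => h x * exp (-V x) with hw
  have hwI : Integrable w := integrable_mul_exp_of_sq hV hm h2
  have hwL := hwI.locallyIntegrable
  have habs : Integrable fun x => |h x| * exp (-V x) := by
    have := hwI.norm
    simpa [hw, abs_mul] using this
  have hwV : ∀ i, LocallyIntegrable fun x => w x * dd (ee i) V x := fun i =>
    hwL.mul_continuous (hV.smooth.dd (ee i)).continuous
  have hws := moll_contDiff hρt hwL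
  set g : ℰ ι → ℝ := fun x => moll ρ w x * exp (V x) with hg
  have hgs : ContDiff ℝ ∞ g := hws.mul hV.smooth.exp
  set R : ι → ℰ ι → ℝ := fun i y =>
    moll ρ (fun x => w x * dd (ee i) V x) y - moll ρ w y * dd (ee i) V y with hR
  set m := moll ρ (fun x => |h x| * exp (-V x)) with hmm
  set q := moll ρ (fun x => h x ^ 2 * exp (-V x)) with hq
  have hqI : Integrable q := integrable_moll hρt h2
  have hqN : ∫ y, q y = N := integral_moll hρt (ContDiffBump.integral_normed _) h2
  have hq0 : ∀ y, 0 ≤ q y := fun y => integral_nonneg fun x =>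
    mul_nonneg (mul_nonneg (sq_nonneg _) (exp_pos _).le) (hρ0 _)
  have hm0 : ∀ y, 0 ≤ m y := fun y => integral_nonneg fun x =>
    mul_nonneg (mul_nonneg (abs_nonneg _) (exp_pos _).le) (hρ0 _)
  have hmb : ∀ y, |moll ρ w y| ≤ m y := by
    intro y
    refine abs_integral_le_integral_abs.trans (le_of_eq ?_)
    simp only [hw, abs_mul, abs_exp, abs_of_nonneg (hρ0 _)]
    rfl
  have hRb : ∀ i y, |R i y| ≤ |B| * ε * m y := by
    intro i y
    have e1 : R i y = ∫ x, w x * (dd (ee i) V x - dd (ee i) V y) * ρ (y - x) := by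
      simp only [hR, moll]
      rw [← integral_mul_const, ← integral_sub (integrable_mul_comp_sub hρt (hwV i) y)
        ((integrable_mul_comp_sub hρt hwL y).mul_const _)]
      congr 1; ext x; ring
    rw [e1]
    refine abs_integral_le_integral_abs.trans ?_
    simp only [hmm, moll]
    rw [← integral_const_mul]
    refine integral_mono_of_nonneg (Eventually.of_forall fun x => abs_nonneg _)
      ((integrable_mul_comp_sub hρt habs.locallyIntegrable y).const_mul _)
      (Eventually.of_forall fun x => ?_)
    simp only [hw, abs_mul, abs_exp, abs_of_nonneg (hρ0 _)]
    by_cases h0 : ρ (y - x) = 0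
    · simp [h0]
    have hyx : ‖y - x‖ < ε := bumpAt_ne_zero h0
    have hl : |dd (ee i) V x - dd (ee i) V y| ≤ |B| * ε := by
      refine (hV.lip i x y).trans ?_
      rw [norm_sub_rev]
      exact mul_le_mul (le_abs_self B) hyx.le (norm_nonneg _) (abs_nonneg _)
    calc |h x| * exp (-V x) * |dd (ee i) V x - dd (ee i) V y| * ρ (y - x)
        ≤ |h x| * exp (-V x) * (|B| * ε) * ρ (y - x) := by
          have := hρ0 (y - x)
          gcongr
      _ = _ := by ring
  have hdg : ∀ i y, dd (ee i) g y =
      (dd (ee i) (moll ρ w) y + moll ρ w y * dd (ee i) V y) * exp (V y) :=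
    fun i y => dd_mul_exp hV.smooth hws _ _
  have hweak := moll_weak hV.smooth hwL horth hρt (TestFun.mul (hχ.mul hχ.1) hgs)
  have hweak2 : ∑ i, ∫ y, (exp (-V y) * dd (ee i) g y + R i y) *
      dd (ee i) (fun x => χ x * χ x * g x) y = 0 := by
    rw [← hweak]
    refine sum_congr rfl fun i _ => ?_
    congr 1; ext y
    rw [hdg]
    congr 1
    have : exp (-V y) * exp (V y) = 1 := by rw [← exp_add]; simp
    simp only [hR]
    linear_combination (dd (ee i) (moll ρ w) y + moll ρ w y * dd (ee i) V y) * this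
  have hcac := caccioppoli hV.smooth hgs hχ (fun i =>
    ((moll_contDiff hρt (hwV i)).continuous.sub (hws.continuous.mul
      (hV.smooth.dd (ee i)).continuous))) hweak2
  have hgE : ∀ y, g y ^ 2 * exp (-V y) = exp (V y) * moll ρ w y ^ 2 := by
    intro y
    have : exp (-V y) * exp (V y) = 1 := by rw [← exp_add]; simp
    simp only [hg]
    linear_combination moll ρ w y ^ 2 * exp (V y) * this
  have hrhs : ∑ i, ∫ y, (10 * (g y ^ 2 * exp (-V y)) * dd (ee i) χ y ^ 2 +
        4 * (χ y ^ 2) * (R i y ^ 2 * exp (V y))) ≤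
      n * ((20 * (C / r) ^ 2 + 8 * (B ^ 2 * ε ^ 2)) * N) := by
    have : ∀ i ∈ Finset.univ, ∫ y, (10 * (g y ^ 2 * exp (-V y)) * dd (ee i) χ y ^ 2 +
        4 * (χ y ^ 2) * (R i y ^ 2 * exp (V y))) ≤
        (20 * (C / r) ^ 2 + 8 * (B ^ 2 * ε ^ 2)) * N := by
      intro i _
      rw [← hqN, ← integral_const_mul]
      refine integral_mono_of_nonneg (Eventually.of_forall fun y => by positivity)
        (hqI.const_mul _) (Eventually.of_forall fun y => ?_)
      simp only []
      rw [hgE]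
      by_cases hy : ‖y‖ ≤ 2 * r
      · have hs := hsc y hy
        have a1 : moll ρ w y ^ 2 ≤ m y ^ 2 := by
          rw [← sq_abs]; gcongr; exact hmb y
        have a2 : R i y ^ 2 ≤ B ^ 2 * ε ^ 2 * m y ^ 2 := by
          rw [← sq_abs]
          calc |R i y| ^ 2 ≤ (|B| * ε * m y) ^ 2 := by gcongr; exact hRb i y
            _ = _ := by rw [mul_pow, mul_pow, sq_abs]
        have a3 : dd (ee i) χ y ^ 2 ≤ (C / r) ^ 2 := by
          rw [← sq_abs]; gcongr; exact hχd i y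
        have a4 : χ y ^ 2 ≤ 1 := pow_le_one₀ (hχ01 y).1 (hχ01 y).2
        have hE := exp_pos (V y)
        calc 10 * (exp (V y) * moll ρ w y ^ 2) * dd (ee i) χ y ^ 2 +
            4 * χ y ^ 2 * (R i y ^ 2 * exp (V y))
            ≤ 10 * (exp (V y) * m y ^ 2) * (C / r) ^ 2 +
            4 * 1 * (B ^ 2 * ε ^ 2 * m y ^ 2 * exp (V y)) := by gcongr
          _ = (10 * (C / r) ^ 2 + 4 * (B ^ 2 * ε ^ 2)) * (exp (V y) * m y ^ 2) := by ring
          _ ≤ (10 * (C / r) ^ 2 + 4 * (B ^ 2 * ε ^ 2)) * (2 * q y) := by gcongr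
          _ = _ := by ring
      · have b1 : χ y = 0 := by by_contra h0; exact hy (hχs y h0)
        have b2 : dd (ee i) χ y = 0 := by by_contra h0; exact hy (hχds i y h0)
        rw [b1, b2]
        have := hq0 y
        have : 0 ≤ (20 * (C / r) ^ 2 + 8 * (B ^ 2 * ε ^ 2)) * q y := by positivity
        simpa using this
    refine (sum_le_sum this).trans (le_of_eq ?_)
    simp [hn]
  have hone : ∫ y, χ y ^ 2 * dd (ee i) g y ^ 2 * exp (-V y) ≤
      n * ((20 * (C / r) ^ 2 + 8 * (B ^ 2 * ε ^ 2)) * N) := by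
    refine le_trans (Finset.single_le_sum (f := fun i => ∫ y, χ y ^ 2 * dd (ee i) g y ^ 2 *
      exp (-V y)) (fun j _ => integral_nonneg fun y => by positivity) (Finset.mem_univ i))
      (hcac.trans hrhs)
  have hibp : ∫ y, moll ρ w y * (exp (V y) * dd (ee i) ψ y) =
      - ∫ y, (χ y * dd (ee i) g y * exp (-V y / 2)) * (ψ y * exp (V y / 2)) := by
    have := integral_mul_dd (μ := volume) hgs hψ.1 (Or.inr hψ.2) (ee i)
    have e1 : ∀ y, (χ y * dd (ee i) g y * exp (-V y / 2)) * (ψ y * exp (V y / 2)) =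
        dd (ee i) g y * ψ y := by
      intro y
      by_cases h0 : ψ y = 0
      · simp [h0]
      have : exp (-V y / 2) * exp (V y / 2) = 1 := by
        rw [← exp_add, ← Real.exp_zero]; ring_nf
      rw [hχ1 y ((hr0 y h0).trans (le_max_left _ _))]
      linear_combination dd (ee i) g y * ψ y * this
    simp only [e1]
    rw [← this]
    simp only [hg, mul_assoc]
  have c1 := hχ.1.continuous
  have c2 := (hgs.dd (ee i)).continuous
  have c3 := hV.smooth.continuous
  have c4 := hψ.1.continuous
  have e1 : ∀ y, (χ y * dd (ee i) g y * exp (-V y / 2)) ^ 2 =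
      χ y ^ 2 * dd (ee i) g y ^ 2 * exp (-V y) := by
    intro y
    have : exp (-V y / 2) ^ 2 = exp (-V y) := by
      rw [sq, ← exp_add]; ring_nf
    rw [← this]; ring
  have e2 : ∀ y, (ψ y * exp (V y / 2)) ^ 2 = ψ y ^ 2 * exp (V y) := by
    intro y
    have : exp (V y / 2) ^ 2 = exp (V y) := by
      rw [sq, ← exp_add]; ring_nf
    rw [← this]; ring
  have hcs := sq_integral_mul_le (μ := volume)
    (f := fun y => χ y * dd (ee i) g y * exp (-V y / 2))
    (g := fun y => ψ y * exp (V y / 2))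
    (Continuous.integrable_of_hasCompactSupport (by fun_prop) (hχ.2.mono fun x hx => by
      contrapose! hx
      simp only [Function.mem_support, not_not] at hx ⊢
      simp [hx]))
    (Continuous.integrable_of_hasCompactSupport (by fun_prop) (hψ.2.mono fun x hx => by
      contrapose! hx
      simp only [Function.mem_support, not_not] at hx ⊢
      simp [hx]))
    (Continuous.integrable_of_hasCompactSupport (by fun_prop) (hψ.2.mono fun x hx => by
      contrapose! hx
      simp only [Function.mem_support, not_not] at hx ⊢
      simp [hx]))
  simp only [e1, e2] at hcs
  rw [hibp, neg_sq]
  refine hcs.trans ?_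
  have f1 : (C / r) ^ 2 ≤ C ^ 2 * δ := by
    rw [div_pow, div_eq_mul_one_div]
    gcongr
    rw [div_le_iff₀ (by positivity)]
    have : 1 ≤ δ * r := by
      rw [div_le_iff₀ hδ0] at hrδ; linarith
    nlinarith
  have f2 : ε ^ 2 ≤ δ := by nlinarith
  calc _ ≤ n * ((20 * (C / r) ^ 2 + 8 * (B ^ 2 * ε ^ 2)) * N) * M := by gcongr
    _ ≤ n * ((20 * (C ^ 2 * δ) + 8 * (B ^ 2 * δ)) * N) * M := by gcongr
    _ = (K - 1) * δ := by rw [hK]; ring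
    _ ≤ K * δ := by gcongr; linarith
    _ = η := by rw [hδ]; field_simp

theorem ae_const_of_orth {h : ℰ ι → ℝ} (hV : LangevinPotential V t B)
    (hm : AEStronglyMeasurable h) (h2 : Integrable fun x => h x ^ 2 * exp (-V x))
    (horth : ∀ u, TestFun u → ∫ x, h x * exp (-V x) * genOp V u x = 0) :
    ∃ c, ∀ᵐ x, h x = c := by
  have hwI := integrable_mul_exp_of_sq hV hm h2
  have hloc : LocallyIntegrable h := by
    have := hwI.locallyIntegrable.mul_continuous (g := fun x => exp (V x))
      hV.smooth.continuous.rexp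
    refine this.congr (Eventually.of_forall fun x => ?_)
    simp only [mul_assoc, ← exp_add]
    simp
  refine ae_const_of_weak_grad_zero hloc fun ψ hψ i => ?_
  set w : ℰ ι → ℝ := fun x => h x * exp (-V x) with hw
  set Ψ : ℰ ι → ℝ := fun y => exp (V y) * dd (ee i) ψ y with hΨ
  have hΨt : TestFun Ψ := TestFun.mul' hV.smooth.exp (hψ.dd _)
  have hI : ∫ x, h x * dd (ee i) ψ x = ∫ x, w x * Ψ x := by
    congr 1; ext x
    have : exp (-V x) * exp (V x) = 1 := by rw [← exp_add]; simp
    simp only [hw, hΨ]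
    linear_combination (- h x * dd (ee i) ψ x) * this
  rw [hI]
  set I := ∫ x, w x * Ψ x with hIdef
  set L := ∫ x, ‖w x‖ with hL
  have hL0 : 0 ≤ L := integral_nonneg fun x => norm_nonneg _
  have key : ∀ η : ℝ, 0 < η → |I| ≤ η + η * L := by
    intro η hη
    obtain ⟨ε₀, hε₀, hs⟩ := weak_grad_small hV hm h2 horth hψ i (η := η ^ 2) (by positivity)
    have hu := hΨt.2.uniformContinuous_of_continuous hΨt.1.continuous
    rw [Metric.uniformContinuous_iff] at hu
    obtain ⟨δ, hδ, hu⟩ := hu η hη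
    set ε := min (ε₀ / 2) δ with hεd
    have hε : 0 < ε := by positivity
    have h1 := hs ε hε (by have := min_le_left (ε₀ / 2) δ; linarith)
    set φ := bumpAt (ι := ι) ε hε with hφ
    have ht : TestFun (φ.normed volume) := bumpAt_test _ _
    rw [integral_moll_mul ht φ.normed_neg hwI hΨt.1.continuous hΨt.2] at h1
    have h3 : ∀ x, |moll (φ.normed volume) Ψ x - Ψ x| ≤ η := by
      intro x
      have := φ.dist_normed_convolution_le (μ := volume) (g := Ψ) (x₀ := x) (ε := η)
        hΨt.1.continuous.aestronglyMeasurable (fun z hz => (hu (lt_of_lt_of_le hz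
          (min_le_right _ _))).le)
      rw [convolution_lsmul_swap, Real.dist_eq] at this
      convert this using 3
      simp [moll, mul_comm]
    have hi1 : Integrable fun x => w x * moll (φ.normed volume) Ψ x := by
      have hb := (moll_contDiff ht hΨt.integrable.locallyIntegrable).continuous
      obtain ⟨K, hK⟩ := hΨt.2.exists_bound_of_continuous hΨt.1.continuous
      refine hwI.mul_bdd (c := K + η) hb.aestronglyMeasurable (Eventually.of_forall fun x => ?_)
      have e1 := h3 x
      have e2 := hK x
      rw [norm_eq_abs] at e2 ⊢
      calc |moll (φ.normed volume) Ψ x| = |Ψ x + (moll (φ.normed volume) Ψ x - Ψ x)| := by ring_nf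
        _ ≤ _ := (abs_add_le _ _).trans (by linarith)
    have hi2 : Integrable fun x => w x * Ψ x := by
      obtain ⟨K, hK⟩ := hΨt.2.exists_bound_of_continuous hΨt.1.continuous
      exact hwI.mul_bdd (c := K) hΨt.1.continuous.aestronglyMeasurable (Eventually.of_forall hK)
    have h4 : |(∫ x, w x * moll (φ.normed volume) Ψ x) - I| ≤ η * L := by
      rw [hIdef, ← integral_sub hi1 hi2, hL, ← integral_const_mul]
      refine abs_integral_le_integral_abs.trans ?_
      refine integral_mono_of_nonneg (Eventually.of_forall fun x => abs_nonneg _)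
        (hwI.norm.const_mul _) (Eventually.of_forall fun x => ?_)
      simp only [← mul_sub, abs_mul, norm_eq_abs]
      rw [mul_comm]
      exact mul_le_mul_of_nonneg_right (h3 x) (abs_nonneg _)
    have h5 : |∫ x, w x * moll (φ.normed volume) Ψ x| ≤ η := abs_le_of_sq_le_sq h1 hη.le
    calc |I| = |(∫ x, w x * moll (φ.normed volume) Ψ x) -
          ((∫ x, w x * moll (φ.normed volume) Ψ x) - I)| := by ring_nf
      _ ≤ _ := (abs_sub _ _).trans (by linarith)
  by_contra hne
  have hpos : 0 < |I| := abs_pos.2 hne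
  have := key (|I| / (2 * (1 + L))) (by positivity)
  have h7 : |I| / (2 * (1 + L)) + |I| / (2 * (1 + L)) * L = |I| / 2 := by field_simp
  linarith

/-- The probability measure with density `exp (-V)`. -/
def gibbsMeasure (V : ℰ ι → ℝ) : Measure (ℰ ι) :=
  volume.withDensity fun x => ofReal (exp (-V x))

theorem gibbsMeasure_meas (hV : ContDiff ℝ ∞ V) :
    Measurable fun x => ofReal (exp (-V x)) :=
  hV.continuous.neg.rexp.measurable.ennreal_ofReal

theorem integral_gibbsMeasure (hV : ContDiff ℝ ∞ V) (f : ℰ ι → ℝ) :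
    ∫ x, f x ∂(gibbsMeasure V) = ev V f := by
  unfold gibbsMeasure ev
  rw [integral_withDensity_eq_integral_toReal_smul (gibbsMeasure_meas hV)
    (Eventually.of_forall fun x => ENNReal.ofReal_lt_top)]
  congr 1; ext x
  rw [ENNReal.toReal_ofReal (exp_pos _).le, smul_eq_mul, mul_comm]

theorem integrable_gibbsMeasure (hV : ContDiff ℝ ∞ V) (f : ℰ ι → ℝ) :
    Integrable f (gibbsMeasure V) ↔ Integrable fun x => f x * exp (-V x) := by
  unfold gibbsMeasure
  rw [integrable_withDensity_iff_integrable_smul' (gibbsMeasure_meas hV)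
    (Eventually.of_forall fun x => ENNReal.ofReal_lt_top)]
  simp only [ENNReal.toReal_ofReal (exp_pos _).le, smul_eq_mul, mul_comm]

theorem volume_ac_gibbsMeasure (hV : ContDiff ℝ ∞ V) : volume ≪ gibbsMeasure V :=
  withDensity_absolutelyContinuous' (gibbsMeasure_meas hV).aemeasurable
    (Eventually.of_forall fun x => by simp [exp_pos])

theorem memLp_gibbsMeasure (hV : ContDiff ℝ ∞ V) {f : ℰ ι → ℝ} (hf : Continuous f)
    (h : Integrable fun x => f x ^ 2 * exp (-V x)) : MemLp f 2 (gibbsMeasure V) := by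
  rw [memLp_two_iff_integrable_sq hf.aestronglyMeasurable, integrable_gibbsMeasure hV]
  exact h

theorem TestFun.memLp (hV : ContDiff ℝ ∞ V) {f : ℰ ι → ℝ} (hf : TestFun f) :
    MemLp f 2 (gibbsMeasure V) :=
  memLp_gibbsMeasure hV hf.1.continuous (hf.sq.integrable_exp hV)

theorem genOp_add {u v : ℰ ι → ℝ} (hu : TestFun u) (hv : TestFun v) :
    genOp V (fun x => u x + v x) = fun x => genOp V u x + genOp V v x := by
  ext x
  simp only [genOp, ← sum_add_distrib]
  refine sum_congr rfl fun i _ => ?_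
  rw [dd_add hu.1 hv.1, dd_add (hu.1.dd _) (hv.1.dd _)]
  ring

theorem genOp_smul (c : ℝ) {u : ℰ ι → ℝ} (hu : TestFun u) :
    genOp V (fun x => c * u x) = fun x => c * genOp V u x := by
  ext x
  simp only [genOp, mul_sum]
  refine sum_congr rfl fun i _ => ?_
  rw [dd_const_mul hu.1, dd_const_mul (hu.1.dd _)]
  ring

theorem genDense (hV : LangevinPotential V t B) : GenDense V := by
  have hs := hV.smooth
  let K : Submodule ℝ (Lp ℝ 2 (gibbsMeasure V)) :=
    { carrier := {f | ∃ u, TestFun u ∧ f =ᵐ[gibbsMeasure V] genOp V u}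
      zero_mem' := ⟨fun _ => 0, TestFun.zero, by
        have : genOp V (fun _ : ℰ ι => (0 : ℝ)) = 0 := by
          ext x; simp [genOp, dd_const]
        rw [this]; exact Lp.coeFn_zero _ _ _⟩
      add_mem' := by
        rintro f g ⟨u, hu, hfu⟩ ⟨v, hv, hgv⟩
        refine ⟨_, hu.add hv, ?_⟩
        rw [genOp_add hu hv]
        filter_upwards [Lp.coeFn_add f g, hfu, hgv] with x h1 h2 h3
        rw [h1, Pi.add_apply, h2, h3]
      smul_mem' := by
        rintro c f ⟨u, hu, hfu⟩
        refine ⟨fun x => c * u x, TestFun.mul' contDiff_const hu, ?_⟩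
        rw [genOp_smul c hu]
        filter_upwards [Lp.coeFn_smul c f, hfu] with x h1 h2
        rw [h1, Pi.smul_apply, h2, smul_eq_mul] }
  have hprob : IsProbabilityMeasure (gibbsMeasure V) := by
    constructor
    unfold gibbsMeasure
    rw [withDensity_apply _ MeasurableSet.univ, Measure.restrict_univ,
      ← ofReal_integral_eq_lintegral_ofReal hV.integrable_exp
      (Eventually.of_forall fun x => (exp_pos _).le), hV.prob, ENNReal.ofReal_one]
  intro g hg η hη
  have hgm : MemLp (fun x => g x - ev V g) 2 (gibbsMeasure V) :=
    (hg.memLp hs).sub (memLp_const _)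
  have hmem : hgm.toLp ∈ K.topologicalClosure := by
    rw [← Submodule.orthogonal_orthogonal_eq_closure, Submodule.mem_orthogonal]
    intro h hh
    rw [Submodule.mem_orthogonal] at hh
    have hc : ∃ c, ∀ᵐ x, h x = c := by
      refine ae_const_of_orth hV ((Lp.aestronglyMeasurable h).mono_ac (volume_ac_gibbsMeasure hs)) ?_ ?_
      · rw [← integrable_gibbsMeasure hs]
        exact (memLp_two_iff_integrable_sq (Lp.aestronglyMeasurable h)).1 (Lp.memLp h)
      · intro u hu
        have h1 := hh ((hu.genOp hs).memLp hs).toLp ⟨u, hu, MemLp.coeFn_toLp _⟩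
        rw [L2.inner_def] at h1
        have h2 : ∫ x, h x * genOp V u x ∂(gibbsMeasure V) = 0 := by
          rw [← h1]
          refine integral_congr_ae ?_
          filter_upwards [MemLp.coeFn_toLp ((hu.genOp hs).memLp hs)] with x hx
          rw [hx]; simp
        rw [integral_gibbsMeasure hs] at h2
        rw [← h2]
        unfold ev
        congr 1; ext x; ring
    obtain ⟨c, hc⟩ := hc
    have hc' : ∀ᵐ x ∂(gibbsMeasure V), h x = c :=
      (withDensity_absolutelyContinuous _ _).ae_le hc
    rw [L2.inner_def]
    have h3 : ∫ x, inner ℝ (h x) ((hgm.toLp _ : Lp ℝ 2 (gibbsMeasure V)) x) ∂(gibbsMeasure V) =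
        ∫ x, c * (g x - ev V g) ∂(gibbsMeasure V) := by
      refine integral_congr_ae ?_
      filter_upwards [hc', MemLp.coeFn_toLp hgm] with x h1 h2
      rw [h1, h2]; simp [mul_comm]
    rw [h3, integral_const_mul, integral_sub ((hg.memLp hs).integrable (by norm_num))
      (integrable_const _), integral_gibbsMeasure hs]
    simp
  have hmem2 : hgm.toLp ∈ closure (K : Set (Lp ℝ 2 (gibbsMeasure V))) := hmem
  rw [Metric.mem_closure_iff] at hmem2
  obtain ⟨f, ⟨u, hu, hfu⟩, hd⟩ := hmem2 η hη
  refine ⟨u, hu, ?_⟩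
  rw [dist_comm, dist_eq_norm] at hd
  have h5 : ‖f - hgm.toLp‖ ^ 2 ≤ η ^ 2 := by gcongr
  rw [← real_inner_self_eq_norm_sq, L2.inner_def] at h5
  refine le_trans (le_of_eq ?_) h5
  rw [← integral_gibbsMeasure hs]
  refine integral_congr_ae ?_
  filter_upwards [Lp.coeFn_sub f hgm.toLp, hfu, MemLp.coeFn_toLp hgm] with x h1 h2 h3
  rw [h1, Pi.sub_apply, h2, h3]
  simp [sq]

/-- The improved Lichnerowicz inequality for smooth potentials. -/
theorem improved_lichnerowicz {a : ℝ} (ht : 0 < t) (ha0 : 0 ≤ a)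
    (hV : LangevinPotential V t B) (ha : VarBound V a) :
    PoincareConst V (Real.sqrt (a / t)) :=
  improved_lichnerowicz_of_dense ht ha0 hV (genDense hV) ha

end

section

variable {X : Type*} [MeasurableSpace X] {μ : Measure X} [IsFiniteMeasure μ]
  {F : Type*} [NormedAddCommGroup F] [NormedSpace ℝ F] [FiniteDimensional ℝ F]

/-- Essentially bounded, a.e. strongly measurable functions. -/
def EssBdd {G : Type*} [NormedAddCommGroup G] (μ : Measure X) (ψ : X → G) : Prop :=
  AEStronglyMeasurable ψ μ ∧ ∃ C, ∀ᵐ x ∂μ, ‖ψ x‖ ≤ C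

/-- The weighted Laplace transform along the linear exponents `b`. -/
def lap (μ : Measure X) (b : X → F →L[ℝ] ℝ) (ψ : X → ℝ) (ξ : F) : ℝ :=
  ∫ x, ψ x * exp (b x ξ) ∂μ

theorem EssBdd.mul {ψ φ : X → ℝ} (h1 : EssBdd μ ψ) (h2 : EssBdd μ φ) :
    EssBdd μ (fun x => ψ x * φ x) := by
  obtain ⟨m1, C1, h1⟩ := h1
  obtain ⟨m2, C2, h2⟩ := h2
  refine ⟨m1.mul m2, C1 * C2, ?_⟩
  filter_upwards [h1, h2] with x hx1 hx2
  rw [norm_mul]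
  exact mul_le_mul hx1 hx2 (norm_nonneg _) ((norm_nonneg _).trans hx1)

theorem EssBdd.integrable {ψ : X → ℝ} (h1 : EssBdd μ ψ) : Integrable ψ μ := by
  obtain ⟨m1, C1, h1⟩ := h1
  exact Integrable.of_bound m1 C1 h1

theorem EssBdd.const (c : ℝ) : EssBdd μ (fun _ : X => c) :=
  ⟨aestronglyMeasurable_const, ‖c‖, by simp⟩

theorem EssBdd.apply {b : X → F →L[ℝ] ℝ} (hb : EssBdd μ b) (v : F) :
    EssBdd μ (fun x => b x v) := by
  obtain ⟨m1, C1, h1⟩ := hb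
  refine ⟨(ContinuousLinearMap.apply ℝ ℝ v).continuous.comp_aestronglyMeasurable m1,
    C1 * ‖v‖, ?_⟩
  filter_upwards [h1] with x hx
  exact ((b x).le_opNorm v).trans (by gcongr)

theorem EssBdd.exp {ψ : X → ℝ} (h : EssBdd μ ψ) : EssBdd μ (fun x => Real.exp (ψ x)) := by
  obtain ⟨m1, C1, h1⟩ := h
  refine ⟨Real.continuous_exp.comp_aestronglyMeasurable m1, Real.exp C1, ?_⟩
  filter_upwards [h1] with x hx
  rw [Real.norm_eq_abs, Real.abs_exp]
  exact Real.exp_le_exp.2 ((le_abs_self _).trans hx)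

theorem lap_hasFDerivAt {b : X → F →L[ℝ] ℝ} {ψ : X → ℝ} (hb : EssBdd μ b) (hψ : EssBdd μ ψ)
    (ξ : F) : HasFDerivAt (lap μ b ψ) (∫ x, (ψ x * exp (b x ξ)) • b x ∂μ) ξ := by
  obtain ⟨mψ, C, hC⟩ := id hψ
  obtain ⟨mb, B, hB⟩ := id hb
  refine hasFDerivAt_integral_of_dominated_of_fderiv_le (s := Metric.ball ξ 1)
    (bound := fun _ => C * exp (B * (‖ξ‖ + 1)) * B)
    (F' := fun η x => (ψ x * exp (b x η)) • b x)
    (Metric.ball_mem_nhds _ one_pos) ?_ ?_ ?_ ?_ (integrable_const _) ?_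
  · exact Eventually.of_forall fun η => (hψ.mul (hb.apply η).exp).1
  · exact (hψ.mul (hb.apply ξ).exp).integrable
  · exact (hψ.mul (hb.apply ξ).exp).1.smul mb
  · filter_upwards [hC, hB] with x hx1 hx2 η hη
    have hη' : ‖η‖ ≤ ‖ξ‖ + 1 := by
      have := norm_sub_norm_le η ξ
      rw [mem_ball_iff_norm] at hη
      linarith
    have hB0 : 0 ≤ B := (norm_nonneg _).trans hx2
    have hC0 : 0 ≤ C := (norm_nonneg _).trans hx1
    rw [norm_smul, norm_mul, norm_eq_abs (exp _), abs_exp]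
    have h3 : b x η ≤ B * (‖ξ‖ + 1) :=
      (le_abs_self _).trans (((b x).le_opNorm η).trans (by gcongr))
    gcongr
  · refine Eventually.of_forall fun x η _ => ?_
    have := ((b x).hasFDerivAt (x := η)).exp.const_mul (ψ x)
    rw [smul_smul] at this
    exact this

theorem dd_lap {b : X → F →L[ℝ] ℝ} {ψ : X → ℝ} (hb : EssBdd μ b) (hψ : EssBdd μ ψ) (v : F) :
    dd v (lap μ b ψ) = lap μ b (fun x => ψ x * b x v) := by
  ext ξ
  unfold dd
  rw [(lap_hasFDerivAt hb hψ ξ).fderiv, ContinuousLinearMap.integral_apply]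
  · unfold lap
    congr 1; ext x; simp; ring
  · obtain ⟨mψ, C, hC⟩ := hψ.mul (hb.apply ξ).exp
    obtain ⟨mb, B, hB⟩ := hb
    refine Integrable.of_bound (mψ.smul mb) (C * B) ?_
    filter_upwards [hC, hB] with x hx1 hx2
    simp only [norm_smul]
    exact mul_le_mul hx1 hx2 (norm_nonneg _) ((norm_nonneg _).trans hx1)

theorem contDiff_of_dd {G : Type*} [NormedAddCommGroup G] [NormedSpace ℝ G]
    [FiniteDimensional ℝ G] (S : Set (G → ℝ)) (hd : ∀ f ∈ S, Differentiable ℝ f)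
    (hS : ∀ f ∈ S, ∀ v, dd v f ∈ S) {f : G → ℝ} (hf : f ∈ S) : ContDiff ℝ ∞ f := by
  rw [contDiff_infty]
  intro n
  induction n generalizing f with
  | zero => exact contDiff_zero.2 (hd f hf).continuous
  | succ n ih =>
    push_cast
    rw [contDiff_succ_iff_fderiv]
    refine ⟨hd f hf, by simp, ?_⟩
    rw [contDiff_clm_apply_iff]
    intro v
    exact ih (hS f hf v)

theorem contDiff_lap {b : X → F →L[ℝ] ℝ} {ψ : X → ℝ} (hb : EssBdd μ b) (hψ : EssBdd μ ψ) :
    ContDiff ℝ ∞ (lap μ b ψ) := by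
  refine contDiff_of_dd {f | ∃ ψ, EssBdd μ ψ ∧ f = lap μ b ψ} ?_ ?_ ⟨ψ, hψ, rfl⟩
  · rintro f ⟨ψ, hψ, rfl⟩ ξ
    exact (lap_hasFDerivAt hb hψ ξ).differentiableAt
  · rintro f ⟨ψ, hψ, rfl⟩ v
    exact ⟨_, hψ.mul (hb.apply v), dd_lap hb hψ v⟩

theorem lap_add {b : X → F →L[ℝ] ℝ} {ψ φ : X → ℝ} (hb : EssBdd μ b) (hψ : EssBdd μ ψ)
    (hφ : EssBdd μ φ) (ξ : F) :
    lap μ b (fun x => ψ x + φ x) ξ = lap μ b ψ ξ + lap μ b φ ξ := by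
  unfold lap
  rw [← integral_add (hψ.mul (hb.apply ξ).exp).integrable (hφ.mul (hb.apply ξ).exp).integrable]
  congr 1; ext x; ring

theorem lap_const_mul (b : X → F →L[ℝ] ℝ) (ψ : X → ℝ) (c : ℝ) (ξ : F) :
    lap μ b (fun x => c * ψ x) ξ = c * lap μ b ψ ξ := by
  unfold lap
  rw [← integral_const_mul]
  congr 1; ext x; ring

end

section

variable {κ : Type*} [Fintype κ]

/-- The standard Gaussian density. -/
def gd (z : ℰ κ) : ℝ :=
  ((2 * Real.pi) ^ ((Fintype.card κ : ℝ) / 2))⁻¹ * exp (-(1 / 2) * ‖z‖ ^ 2)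

theorem gd_pos (z : ℰ κ) : 0 < gd z := by unfold gd; positivity

theorem contDiff_gd : ContDiff ℝ ∞ (gd : ℰ κ → ℝ) := by
  unfold gd
  exact contDiff_const.mul ((contDiff_const.mul (contDiff_norm_sq ℝ)).exp)

theorem integral_gd : ∫ z : ℰ κ, gd z = 1 := by
  unfold gd
  rw [integral_const_mul, GaussianFourier.integral_rexp_neg_mul_sq_norm (by norm_num)]
  simp only [finrank_euclideanSpace]
  rw [show Real.pi / (1 / 2) = 2 * Real.pi by ring]
  exact inv_mul_cancel₀ (by positivity)

theorem integrable_exp_neg_mul_sq_norm {b : ℝ} (hb : 0 < b) :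
    Integrable fun z : ℰ κ => exp (-b * ‖z‖ ^ 2) := by
  by_contra h
  have h1 := GaussianFourier.integral_rexp_neg_mul_sq_norm (V := ℰ κ) hb
  rw [integral_undef h] at h1
  have : 0 < (Real.pi / b) ^ ((Module.finrank ℝ (ℰ κ) : ℝ) / 2) := by positivity
  linarith

theorem integrable_exp_mul_gd (k : ℝ) :
    Integrable fun z : ℰ κ => exp (k * ‖z‖) * gd z := by
  refine ((integrable_exp_neg_mul_sq_norm (κ := κ) (b := 1 / 4) (by norm_num)).const_mul
    (((2 * Real.pi) ^ ((Fintype.card κ : ℝ) / 2))⁻¹ * exp (k ^ 2))).mono' ?_ ?_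
  · exact ((Real.continuous_exp.comp (continuous_const.mul continuous_norm)).mul
      contDiff_gd.continuous).aestronglyMeasurable
  · refine Eventually.of_forall fun z => ?_
    rw [norm_eq_abs, abs_of_pos (mul_pos (exp_pos _) (gd_pos z))]
    unfold gd
    rw [mul_left_comm, mul_assoc, ← exp_add, ← exp_add]
    refine mul_le_mul_of_nonneg_left (Real.exp_le_exp.2 ?_) (by positivity)
    nlinarith [sq_nonneg (k - ‖z‖ / 2)]

theorem integrable_mul_gd {G : ℰ κ → ℝ} (hG : AEStronglyMeasurable G)
    {C k : ℝ} (h : ∀ z, |G z| ≤ C * exp (k * ‖z‖)) : Integrable fun z => G z * gd z := by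
  refine ((integrable_exp_mul_gd (κ := κ) k).const_mul C).mono'
    (hG.mul contDiff_gd.continuous.aestronglyMeasurable) (Eventually.of_forall fun z => ?_)
  rw [norm_mul, norm_eq_abs, norm_eq_abs, abs_of_pos (gd_pos z), ← mul_assoc]
  exact mul_le_mul_of_nonneg_right (h z) (gd_pos z).le

theorem integrable_gd : Integrable (gd : ℰ κ → ℝ) := by
  have := integrable_exp_mul_gd (κ := κ) 0
  simpa using this

theorem dd_gd (v z : ℰ κ) : dd v gd z = -(inner ℝ z v * gd z) := by
  unfold dd gd
  have h1 : HasFDerivAt (fun z : ℰ κ => ‖z‖ ^ 2) (2 • innerSL ℝ z) z :=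
    (hasStrictFDerivAt_norm_sq z).hasFDerivAt
  rw [((h1.const_mul (-(1 / 2) : ℝ)).exp.const_mul _).fderiv]
  simp
  ring

theorem gauss_ibp {G : ℰ κ → ℝ} (hG : ContDiff ℝ ∞ G)
    {C k : ℝ} (h : ∀ z, |G z| ≤ C * exp (k * ‖z‖)) (v : ℰ κ)
    (h' : ∀ z, |dd v G z| ≤ C * exp (k * ‖z‖)) :
    ∫ z, inner ℝ z v * G z * gd z = ∫ z, dd v G z * gd z := by
  have hC : 0 ≤ C := by
    have := (abs_nonneg _).trans (h 0)
    simpa using this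
  have i1 : Integrable fun z => (inner ℝ z v * G z) * gd z := by
    refine integrable_mul_gd (C := ‖v‖ * C) (k := k + 1) ?_ ?_
    · exact ((continuous_id.inner continuous_const).mul hG.continuous).aestronglyMeasurable
    · intro z
      rw [abs_mul]
      have e1 : |inner ℝ z v| ≤ exp ‖z‖ * ‖v‖ := by
        refine (abs_real_inner_le_norm z v).trans ?_
        gcongr
        linarith [Real.add_one_le_exp ‖z‖]
      calc |inner ℝ z v| * |G z| ≤ (exp ‖z‖ * ‖v‖) * (C * exp (k * ‖z‖)) := by
            gcongr
            exact h z
        _ = ‖v‖ * C * exp ((k + 1) * ‖z‖) := by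
            rw [add_mul, exp_add]; ring_nf
  have h3 := integral_mul_fderiv_eq_neg_fderiv_mul_of_integrable (𝕜 := ℝ) (f := G) (g := gd)
    (v := v) (μ := volume) (integrable_mul_gd (hG.dd v).continuous.aestronglyMeasurable h')
    ?_ (integrable_mul_gd hG.continuous.aestronglyMeasurable h) (fun x _ => hG.differentiable_infty x)
    (fun x _ => contDiff_gd.differentiable_infty x)
  · change ∫ z, G z * dd v gd z = - ∫ z, dd v G z * gd z at h3
    have h4 : (fun z => G z * dd v gd z) = fun z => - (inner ℝ z v * G z * gd z) := by
      ext z; rw [dd_gd]; ring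
    rw [h4, integral_neg] at h3
    linarith
  · change Integrable fun z => G z * dd v gd z
    have h4 : (fun z => G z * dd v gd z) = fun z => - (inner ℝ z v * G z * gd z) := by
      ext z; rw [dd_gd]; ring
    rw [h4]
    exact i1.neg

theorem integral_gauss_subst {r : ℝ} (hr : 0 < r) (G : ℰ κ → ℝ)
    (p : ℰ κ) :
    ∫ u, G u * ((r ^ Fintype.card κ)⁻¹ * gd (r⁻¹ • (u - p))) = ∫ z, G (p + r • z) * gd z := by
  have h1 := Measure.integral_comp_smul (volume : Measure (ℰ κ))
    (fun w => G (p + w) * gd (r⁻¹ • w)) r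
  rw [← integral_sub_right_eq_self (μ := volume) (fun w => G (p + w) * gd (r⁻¹ • w)) p] at h1
  simp only [smul_smul, inv_mul_cancel₀ hr.ne', one_smul, add_sub_cancel,
    finrank_euclideanSpace] at h1
  rw [h1, abs_of_pos (by positivity), smul_eq_mul, ← integral_const_mul]
  congr 1; ext u; ring

theorem integrable_gauss_subst {r : ℝ} (hr : 0 < r) (G : ℰ κ → ℝ)
    (p : ℰ κ) (h : Integrable fun z => G (p + r • z) * gd z) :
    Integrable fun u => G u * ((r ^ Fintype.card κ)⁻¹ * gd (r⁻¹ • (u - p))) := by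
  have h1 : Integrable fun w => G (p + w) * gd (r⁻¹ • w) := by
    rw [← integrable_comp_smul_iff volume _ hr.ne']
    simpa only [smul_smul, inv_mul_cancel₀ hr.ne', one_smul] using h
  have h2 := (h1.comp_sub_right p).const_mul (r ^ Fintype.card κ)⁻¹
  simp only [add_sub_cancel] at h2
  refine h2.congr (Eventually.of_forall fun u => ?_)
  simp only; ring

end

section

open scoped ENNReal

variable {ι κ : Type*} [Fintype ι] [Fintype κ]

/-- Nonnegative functions that are log-concave with modulus `t`. -/
def StrongLC {E : Type*} [NormedAddCommGroup E] [NormedSpace ℝ E] (t : ℝ) (f : E → ℝ) : Prop :=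
  (∀ x, 0 ≤ f x) ∧ ∀ x y s, 0 < s → s < 1 →
    f x ^ s * f y ^ (1 - s) ≤
      f (s • x + (1 - s) • y) * exp (-(t * s * (1 - s) / 2) * ‖x - y‖ ^ 2)

/-- The density of `P X + r G`, with `X` of law `ν` and `G` standard Gaussian. -/
def convDensity (ν : Measure (ℰ ι))
    (P : ℰ ι →L[ℝ] ℰ κ) (r : ℝ) (u : ℰ κ) : ℝ :=
  ∫ x, (r ^ Fintype.card κ)⁻¹ * gd (r⁻¹ • (u - P x)) ∂ν

/-- Minus the logarithm of `convDensity`. -/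
def convPot (ν : Measure (ℰ ι))
    (P : ℰ ι →L[ℝ] ℰ κ) (r : ℝ) (u : ℰ κ) : ℝ :=
  - log (convDensity ν P r u)

variable {ν : Measure (ℰ ι)} [IsProbabilityMeasure ν]
  {P : ℰ ι →L[ℝ] ℰ κ} {r R : ℝ}

theorem lap_pos {X F : Type*} [MeasurableSpace X] {μ : Measure X} [IsFiniteMeasure μ] [NeZero μ]
    [NormedAddCommGroup F] [NormedSpace ℝ F] [FiniteDimensional ℝ F] {b : X → F →L[ℝ] ℝ} {ψ : X → ℝ}
    (hb : EssBdd μ b) (hψ : EssBdd μ ψ) (h : ∀ x, 0 < ψ x) (ξ : F) : 0 < lap μ b ψ ξ := by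
  unfold lap
  rw [integral_pos_iff_support_of_nonneg (fun x => (mul_pos (h x) (exp_pos _)).le)
    (hψ.mul (hb.apply ξ).exp).integrable]
  have : Function.support (fun x => ψ x * exp (b x ξ)) = univ := by
    ext x; simpa using (h x).ne'
  rw [this]
  exact (NeZero.pos (μ univ))

/-- Exponent of the Laplace transform in `convDensity`. -/
def convExp (P : ℰ ι →L[ℝ] ℰ κ) (r : ℝ)
    (x : ℰ ι) : ℰ κ →L[ℝ] ℝ := (r ^ 2)⁻¹ • innerSL ℝ (P x)

/-- Weight of the Laplace transform in `convDensity`. -/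
def convWt (P : ℰ ι →L[ℝ] ℰ κ) (r : ℝ)
    (x : ℰ ι) : ℝ := exp (-(1 / 2) * ‖r⁻¹ • P x‖ ^ 2)

theorem essBdd_convExp (hP : ∀ x, ‖P x‖ ≤ ‖x‖) (hR : ∀ᵐ x ∂ν, ‖x‖ ≤ R) :
    EssBdd ν (convExp P r) := by
  refine ⟨?_, (r ^ 2)⁻¹ * R, ?_⟩
  · have : Continuous (convExp P r) :=
      (((innerSL ℝ).continuous.comp P.continuous).const_smul ((r ^ 2)⁻¹ : ℝ))
    exact this.aestronglyMeasurable
  · filter_upwards [hR] with x hx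
    unfold convExp
    rw [norm_smul, innerSL_apply_norm, norm_eq_abs, abs_of_nonneg (by positivity)]
    exact mul_le_mul_of_nonneg_left ((hP x).trans hx) (by positivity)

theorem essBdd_convWt : EssBdd ν (convWt P r) := by
  refine ⟨?_, 1, Eventually.of_forall fun x => ?_⟩
  · unfold convWt
    exact (Real.continuous_exp.comp (continuous_const.mul
      ((P.continuous.const_smul r⁻¹).norm.pow 2))).aestronglyMeasurable
  · unfold convWt
    rw [norm_eq_abs, abs_exp, Real.exp_le_one_iff]
    nlinarith [sq_nonneg ‖r⁻¹ • P x‖]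

theorem convDensity_eq (hr : 0 < r) (u : ℰ κ) :
    convDensity ν P r u = ((r ^ Fintype.card κ)⁻¹ * ((2 * Real.pi) ^ ((Fintype.card κ : ℝ) / 2))⁻¹) *
      exp (-(2 * r ^ 2)⁻¹ * ‖u‖ ^ 2) * lap ν (convExp P r) (convWt P r) u := by
  unfold convDensity lap
  rw [← integral_const_mul]
  congr 1; ext x
  unfold gd convWt convExp
  simp only [mul_assoc]
  congr 2
  rw [← exp_add, ← exp_add]
  congr 1
  rw [norm_smul, norm_smul, mul_pow, mul_pow, norm_sub_sq_real]
  simp [real_inner_comm]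
  field_simp
  ring

theorem lap_conv_pos (hP : ∀ x, ‖P x‖ ≤ ‖x‖) (hR : ∀ᵐ x ∂ν, ‖x‖ ≤ R) (u : ℰ κ) :
    0 < lap ν (convExp P r) (convWt P r) u :=
  lap_pos (essBdd_convExp hP hR) essBdd_convWt (fun _ => exp_pos _) u

theorem convPot_eq (hr : 0 < r) (hP : ∀ x, ‖P x‖ ≤ ‖x‖) (hR : ∀ᵐ x ∂ν, ‖x‖ ≤ R) :
    ∃ c : ℝ, convPot ν P r = fun u => (c + (2 * r ^ 2)⁻¹ * ‖u‖ ^ 2) -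
      log (lap ν (convExp P r) (convWt P r) u) := by
  refine ⟨-log ((r ^ Fintype.card κ)⁻¹ * ((2 * Real.pi) ^ ((Fintype.card κ : ℝ) / 2))⁻¹), ?_⟩
  ext u
  unfold convPot
  have h := lap_conv_pos (r := r) hP hR u
  rw [convDensity_eq hr, Real.log_mul (by positivity) h.ne', Real.log_mul (by positivity)
    (exp_pos _).ne', Real.log_exp]
  ring

theorem convDensity_pos (hr : 0 < r) (hP : ∀ x, ‖P x‖ ≤ ‖x‖) (hR : ∀ᵐ x ∂ν, ‖x‖ ≤ R)
    (u : ℰ κ) : 0 < convDensity ν P r u := by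
  rw [convDensity_eq hr]
  have h := lap_conv_pos (r := r) hP hR u
  positivity

theorem contDiff_convPot (hr : 0 < r) (hP : ∀ x, ‖P x‖ ≤ ‖x‖) (hR : ∀ᵐ x ∂ν, ‖x‖ ≤ R) :
    ContDiff ℝ ∞ (convPot ν P r) := by
  obtain ⟨c, hc⟩ := convPot_eq hr hP hR
  rw [hc]
  have h1 := contDiff_lap (essBdd_convExp (r := r) hP hR) (essBdd_convWt (ν := ν) (P := P) (r := r))
  exact (contDiff_const.add (contDiff_const.mul (contDiff_norm_sq ℝ))).sub
    (h1.log fun u => (lap_conv_pos hP hR u).ne')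

theorem dd_norm_sq {E : Type*} [NormedAddCommGroup E] [InnerProductSpace ℝ E] (v x : E) :
    dd v (fun x : E => ‖x‖ ^ 2) x = 2 * inner ℝ x v := by
  unfold dd
  rw [(hasStrictFDerivAt_norm_sq x).hasFDerivAt.fderiv]
  simp

theorem dd_log {E : Type*} [NormedAddCommGroup E] [NormedSpace ℝ E] {L : E → ℝ}
    (hL : ContDiff ℝ ∞ L) (h : ∀ x, 0 < L x) (v : E) :
    dd v (fun x => log (L x)) = fun x => dd v L x * (L x)⁻¹ := by
  ext x
  unfold dd
  rw [((hL.differentiable_infty x).hasFDerivAt.log (h x).ne').fderiv]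
  simp [mul_comm]

theorem dd_inv {E : Type*} [NormedAddCommGroup E] [NormedSpace ℝ E] {L : E → ℝ}
    (hL : ContDiff ℝ ∞ L) (h : ∀ x, 0 < L x) (v : E) :
    dd v (fun x => (L x)⁻¹) = fun x => - dd v L x * ((L x)⁻¹) ^ 2 := by
  ext x
  unfold dd
  have := (hasDerivAt_inv (h x).ne').comp_hasFDerivAt x (hL.differentiable_infty x).hasFDerivAt
  rw [show (fun x => (L x)⁻¹) = Inv.inv ∘ L from rfl, this.fderiv]
  simp [mul_comm]

theorem lap_abs_le {X F : Type*} [MeasurableSpace X] {μ : Measure X} [IsFiniteMeasure μ]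
    [NormedAddCommGroup F] [NormedSpace ℝ F] [FiniteDimensional ℝ F] {b : X → F →L[ℝ] ℝ} {ψ φ : X → ℝ}
    (hb : EssBdd μ b) (hψ : EssBdd μ ψ) (hφ : EssBdd μ φ) {C : ℝ}
    (h : ∀ᵐ x ∂μ, |φ x| ≤ C * ψ x) (ξ : F) : |lap μ b φ ξ| ≤ C * lap μ b ψ ξ := by
  unfold lap
  rw [← integral_const_mul]
  refine abs_integral_le_integral_abs.trans (integral_mono_ae
    (hφ.mul (hb.apply ξ).exp).integrable.abs
    ((hψ.mul (hb.apply ξ).exp).integrable.const_mul C) ?_)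
  filter_upwards [h] with x hx
  simp only [abs_mul, abs_exp]
  rw [← mul_assoc]
  exact mul_le_mul_of_nonneg_right hx (exp_pos _).le

theorem dd_dd_convPot_le (hr : 0 < r) (hP : ∀ x, ‖P x‖ ≤ ‖x‖) (hR : ∀ᵐ x ∂ν, ‖x‖ ≤ R)
    (v w u : ℰ κ) :
    |dd w (dd v (convPot ν P r)) u| ≤ ((r ^ 2)⁻¹ + 2 * ((r ^ 2)⁻¹ * R) ^ 2) * ‖v‖ * ‖w‖ := by
  obtain ⟨c, hc⟩ := convPot_eq hr hP hR
  have hb := essBdd_convExp (r := r) hP hR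
  have hψ : EssBdd ν (convWt P r) := essBdd_convWt
  set L := lap ν (convExp P r) (convWt P r) with hL
  have hLs : ContDiff ℝ ∞ L := contDiff_lap hb hψ
  have hLp : ∀ u, 0 < L u := fun u => lap_conv_pos hP hR u
  have hLi : ContDiff ℝ ∞ (fun u => (L u)⁻¹) := hLs.inv fun u => (hLp u).ne'
  have hsq : ContDiff ℝ ∞ (fun u : ℰ κ => ‖u‖ ^ 2) := contDiff_norm_sq ℝ
  have hin : ContDiff ℝ ∞ (fun u : ℰ κ => inner ℝ u v) :=
    contDiff_id.inner ℝ contDiff_const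
  have e1 : dd v (convPot ν P r) = fun u => (r ^ 2)⁻¹ * inner ℝ u v - dd v L u * (L u)⁻¹ := by
    rw [hc, dd_sub (contDiff_const.add (contDiff_const.mul hsq))
      (hLs.log fun u => (hLp u).ne'), dd_add contDiff_const (contDiff_const.mul hsq), dd_const,
      dd_const_mul hsq, dd_log hLs hLp]
    ext u
    beta_reduce
    rw [dd_norm_sq]
    field_simp
    ring
  have e3 : ∀ u, dd w (fun u : ℰ κ => inner ℝ u v) u = inner ℝ w v := by
    intro u
    have : (fun u : ℰ κ => inner ℝ u v) = innerSL ℝ v := by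
      ext u; simp [real_inner_comm]
    unfold dd
    rw [this, ContinuousLinearMap.fderiv]
    simp [real_inner_comm]
  have e2 : dd w (dd v (convPot ν P r)) u = (r ^ 2)⁻¹ * inner ℝ w v -
      (dd w (dd v L) u * (L u)⁻¹ + dd v L u * (- dd w L u * ((L u)⁻¹) ^ 2)) := by
    rw [e1, dd_sub (contDiff_const.mul hin) ((hLs.dd v).mul hLi), dd_const_mul hin,
      dd_mul (hLs.dd v) hLi, dd_inv hLs hLp]
    beta_reduce
    rw [e3]
  set k := (r ^ 2)⁻¹ * R with hk
  have hR0 : 0 ≤ R := by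
    obtain ⟨x, hx⟩ := hR.exists
    exact (norm_nonneg x).trans hx
  have hk0 : 0 ≤ k := by positivity
  have hbv : ∀ v, ∀ᵐ x ∂ν, |convExp P r x v| ≤ k * ‖v‖ := by
    intro v
    filter_upwards [hR] with x hx
    unfold convExp
    simp only [_root_.smul_apply, innerSL_apply_apply, smul_eq_mul, abs_mul]
    rw [abs_of_nonneg (by positivity : (0:ℝ) ≤ (r ^ 2)⁻¹), hk, mul_assoc]
    refine mul_le_mul_of_nonneg_left ((abs_real_inner_le_norm _ _).trans ?_) (by positivity)
    exact mul_le_mul_of_nonneg_right ((hP x).trans hx) (norm_nonneg _)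
  have b1 : ∀ v, |dd v L u| ≤ k * ‖v‖ * L u := by
    intro v
    rw [hL, dd_lap hb hψ]
    refine lap_abs_le hb hψ (hψ.mul (hb.apply v)) ?_ u
    filter_upwards [hbv v] with x hx
    have hw : 0 < convWt P r x := exp_pos _
    rw [abs_mul, abs_of_pos hw, mul_comm]
    exact mul_le_mul_of_nonneg_right hx hw.le
  have b2 : |dd w (dd v L) u| ≤ (k * ‖v‖) * (k * ‖w‖) * L u := by
    rw [hL, dd_lap hb hψ, dd_lap hb (hψ.mul (hb.apply v))]
    refine lap_abs_le hb hψ ((hψ.mul (hb.apply v)).mul (hb.apply w)) ?_ u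
    filter_upwards [hbv v, hbv w] with x hx hx'
    have hw : 0 < convWt P r x := exp_pos _
    rw [abs_mul, abs_mul, abs_of_pos hw]
    calc convWt P r x * |convExp P r x v| * |convExp P r x w| ≤
        convWt P r x * (k * ‖v‖) * (k * ‖w‖) := by gcongr
      _ = _ := by ring
  have hLu := hLp u
  have c1 : |dd w (dd v L) u * (L u)⁻¹| ≤ k * ‖v‖ * (k * ‖w‖) := by
    rw [abs_mul, abs_of_pos (inv_pos.2 hLu), ← div_eq_mul_inv, div_le_iff₀ hLu]
    exact b2
  have c2 : |dd v L u * (- dd w L u * ((L u)⁻¹) ^ 2)| ≤ k * ‖v‖ * (k * ‖w‖) := by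
    have h1 : |dd v L u * (L u)⁻¹| ≤ k * ‖v‖ := by
      rw [abs_mul, abs_of_pos (inv_pos.2 hLu), ← div_eq_mul_inv, div_le_iff₀ hLu]
      exact b1 v
    have h2 : |dd w L u * (L u)⁻¹| ≤ k * ‖w‖ := by
      rw [abs_mul, abs_of_pos (inv_pos.2 hLu), ← div_eq_mul_inv, div_le_iff₀ hLu]
      exact b1 w
    have : dd v L u * (- dd w L u * ((L u)⁻¹) ^ 2) =
      -((dd v L u * (L u)⁻¹) * (dd w L u * (L u)⁻¹)) := by ring
    rw [this, abs_neg, abs_mul]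
    exact mul_le_mul h1 h2 (abs_nonneg _) (by positivity)
  have c3 : |(r ^ 2)⁻¹ * inner ℝ w v| ≤ (r ^ 2)⁻¹ * (‖w‖ * ‖v‖) := by
    rw [abs_mul, abs_of_nonneg (by positivity : (0:ℝ) ≤ (r ^ 2)⁻¹)]
    exact mul_le_mul_of_nonneg_left (abs_real_inner_le_norm _ _) (by positivity)
  rw [e2]
  refine (abs_sub _ _).trans ((add_le_add c3 ((abs_add_le _ _).trans (add_le_add c1 c2))).trans
    (le_of_eq ?_))
  ring

theorem convPot_lip (hr : 0 < r) (hP : ∀ x, ‖P x‖ ≤ ‖x‖) (hR : ∀ᵐ x ∂ν, ‖x‖ ≤ R) (i : κ)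
    (x y : ℰ κ) :
    |dd (ee i) (convPot ν P r) x - dd (ee i) (convPot ν P r) y| ≤
      ((r ^ 2)⁻¹ + 2 * ((r ^ 2)⁻¹ * R) ^ 2) * ‖x - y‖ := by
  have hs := (contDiff_convPot hr hP hR).dd (ee i)
  refine Convex.norm_image_sub_le_of_norm_fderiv_le (𝕜 := ℝ) (s := univ)
    (fun x _ => hs.differentiable_infty x) (fun x _ => ?_) convex_univ (mem_univ y) (mem_univ x)
  refine ContinuousLinearMap.opNorm_le_bound _ (by positivity) fun w => ?_
  have := dd_dd_convPot_le hr hP hR (ee i) w x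
  have h1 : ‖(ee i : ℰ κ)‖ = 1 := by simp [ee]
  rw [h1, mul_one] at this
  exact this

end

section

open scoped ENNReal

variable {ι κ : Type*} [Fintype ι] [Fintype κ]

theorem norm_sq_convex_comb {E : Type*} [NormedAddCommGroup E] [InnerProductSpace ℝ E] (a b : E)
    (s : ℝ) : s * ‖a‖ ^ 2 + (1 - s) * ‖b‖ ^ 2 =
      ‖s • a + (1 - s) • b‖ ^ 2 + s * (1 - s) * ‖a - b‖ ^ 2 := by
  rw [norm_add_sq_real, norm_sub_sq_real, norm_smul, norm_smul, mul_pow, mul_pow,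
    inner_smul_left, inner_smul_right, norm_eq_abs, norm_eq_abs, sq_abs, sq_abs]
  simp
  ring

theorem gd_rpow_mul (a b : ℰ κ) (s : ℝ) :
    gd a ^ s * gd b ^ (1 - s) =
      gd (s • a + (1 - s) • b) * exp (-(s * (1 - s) / 2) * ‖a - b‖ ^ 2) := by
  unfold gd
  set c := ((2 * Real.pi) ^ ((Fintype.card κ : ℝ) / 2))⁻¹ with hc
  have hc0 : 0 < c := by positivity
  rw [Real.mul_rpow hc0.le (exp_pos _).le, Real.mul_rpow hc0.le (exp_pos _).le,
    ← exp_mul, ← exp_mul, mul_mul_mul_comm, ← Real.rpow_add hc0, ← exp_add,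
    mul_assoc c, ← exp_add]
  have := norm_sq_convex_comb a b s
  rw [show s + (1 - s) = 1 by ring, Real.rpow_one]
  congr 2
  linarith

theorem StrongLC.mul_gd {t r : ℝ} (ht : 0 < t) (hr : 0 < r) {f : ℰ ι → ℝ}
    (hf : StrongLC t f) {P : ℰ ι →L[ℝ] ℰ κ}
    (hP : ∀ x, ‖P x‖ ≤ ‖x‖) (u v : ℰ κ) (x y : ℰ ι) {s : ℝ}
    (hs0 : 0 < s) (hs1 : s < 1) :
    (f x * gd (r⁻¹ • (u - P x))) ^ s * (f y * gd (r⁻¹ • (v - P y))) ^ (1 - s) ≤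
      f (s • x + (1 - s) • y) * gd (r⁻¹ • ((s • u + (1 - s) • v) - P (s • x + (1 - s) • y))) *
        exp (-(t / (1 + r ^ 2 * t) * s * (1 - s) / 2) * ‖u - v‖ ^ 2) := by
  rw [Real.mul_rpow (hf.1 x) (gd_pos _).le, Real.mul_rpow (hf.1 y) (gd_pos _).le, mul_mul_mul_comm,
    gd_rpow_mul]
  set a := r⁻¹ • (u - P x) with ha
  set b := r⁻¹ • (v - P y) with hb
  have e1 : s • a + (1 - s) • b =
      r⁻¹ • ((s • u + (1 - s) • v) - P (s • x + (1 - s) • y)) := by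
    rw [ha, hb, map_add, map_smul, map_smul]
    module
  rw [← e1]
  have hs2 : 0 < 1 - s := by linarith
  have key : t / (1 + r ^ 2 * t) * ‖u - v‖ ^ 2 ≤ t * ‖x - y‖ ^ 2 + ‖a - b‖ ^ 2 := by
    have e2 : u - v = r • (a - b) + P (x - y) := by
      rw [ha, hb, map_sub, ← smul_sub, smul_smul, mul_inv_cancel₀ hr.ne', one_smul]
      abel
    have e3 : ‖u - v‖ ≤ r * ‖a - b‖ + ‖x - y‖ := by
      rw [e2]
      refine (norm_add_le _ _).trans (add_le_add ?_ (hP _))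
      rw [norm_smul, norm_eq_abs, abs_of_pos hr]
    have e4 : ‖u - v‖ ^ 2 ≤ (r * ‖a - b‖ + ‖x - y‖) ^ 2 := by gcongr
    rw [div_mul_eq_mul_div, div_le_iff₀ (by positivity)]
    refine (mul_le_mul_of_nonneg_left e4 ht.le).trans ?_
    nlinarith [sq_nonneg (‖a - b‖ - t * r * ‖x - y‖)]
  calc f x ^ s * f y ^ (1 - s) *
        (gd (s • a + (1 - s) • b) * exp (-(s * (1 - s) / 2) * ‖a - b‖ ^ 2))
      ≤ (f (s • x + (1 - s) • y) * exp (-(t * s * (1 - s) / 2) * ‖x - y‖ ^ 2)) *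
        (gd (s • a + (1 - s) • b) * exp (-(s * (1 - s) / 2) * ‖a - b‖ ^ 2)) := by
        refine mul_le_mul_of_nonneg_right (hf.2 x y s hs0 hs1) ?_
        exact mul_nonneg (gd_pos _).le (exp_pos _).le
    _ = f (s • x + (1 - s) • y) * gd (s • a + (1 - s) • b) *
        exp (-(t * s * (1 - s) / 2) * ‖x - y‖ ^ 2 + -(s * (1 - s) / 2) * ‖a - b‖ ^ 2) := by
        rw [exp_add]; ring
    _ ≤ _ := by
        refine mul_le_mul_of_nonneg_left (Real.exp_le_exp.2 ?_)
          (mul_nonneg (hf.1 _) (gd_pos _).le)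
        have := mul_le_mul_of_nonneg_left key (by positivity : 0 ≤ s * (1 - s) / 2)
        nlinarith

variable {ν : Measure (ℰ ι)} [IsProbabilityMeasure ν]
  {P : ℰ ι →L[ℝ] ℰ κ} {r R t : ℝ} {f : ℰ ι → ℝ}

theorem ofReal_convDensity (hr : 0 < r) (hfm : Measurable f) (hf : ∀ x, 0 ≤ f x)
    (hν : ν = volume.withDensity fun x => ofReal (f x)) (u : ℰ κ) :
    ofReal (convDensity ν P r u) = ofReal (r ^ Fintype.card κ)⁻¹ *
      ∫⁻ x, ofReal (f x * gd (r⁻¹ • (u - P x))) := by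
  unfold convDensity
  have hc : Continuous fun x => gd (r⁻¹ • (u - P x)) :=
    contDiff_gd.continuous.comp (by fun_prop)
  have hi : Integrable (fun x => gd (r⁻¹ • (u - P x))) ν := by
    refine Integrable.of_bound hc.aestronglyMeasurable
      (((2 * Real.pi) ^ ((Fintype.card κ : ℝ) / 2))⁻¹) (Eventually.of_forall fun x => ?_)
    rw [norm_eq_abs, abs_of_pos (gd_pos _)]
    unfold gd
    refine mul_le_of_le_one_right (by positivity) (Real.exp_le_one_iff.2 ?_)
    nlinarith [sq_nonneg ‖r⁻¹ • (u - P x)‖]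
  rw [integral_const_mul, ENNReal.ofReal_mul (by positivity),
    ofReal_integral_eq_lintegral_ofReal hi (Eventually.of_forall fun x => (gd_pos _).le), hν,
    lintegral_withDensity_eq_lintegral_mul _ hfm.ennreal_ofReal hc.measurable.ennreal_ofReal]
  congr 2
  ext x
  simp only [Pi.mul_apply]
  rw [ENNReal.ofReal_mul (hf x)]

theorem convDensity_strongLC (ht : 0 < t) (hr : 0 < r) (hfm : Measurable f) (hf : StrongLC t f)
    (hν : ν = volume.withDensity fun x => ofReal (f x)) (hP : ∀ x, ‖P x‖ ≤ ‖x‖) :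
    StrongLC (t / (1 + r ^ 2 * t)) (convDensity ν P r) := by
  have h0 : ∀ u, 0 ≤ convDensity ν P r u := fun u =>
    integral_nonneg fun x => mul_nonneg (by positivity) (gd_pos _).le
  refine ⟨h0, fun u v s hs0 hs1 => ?_⟩
  have hs2 : 0 < 1 - s := by linarith
  set q := exp (-(t / (1 + r ^ 2 * t) * s * (1 - s) / 2) * ‖u - v‖ ^ 2) with hq
  have hc : ∀ u, Measurable fun x => ofReal (f x * gd (r⁻¹ • (u - P x))) := fun u =>
    (hfm.mul (contDiff_gd.continuous.comp
      (by fun_prop : Continuous fun x => r⁻¹ • (u - P x))).measurable).ennreal_ofReal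
  have key := prekopaLeindler_euclidean ι s hs0 hs1
    (fun x => ofReal (f x * gd (r⁻¹ • (u - P x))))
    (fun x => ofReal (f x * gd (r⁻¹ • (v - P x))))
    (fun x => ofReal (f x * gd (r⁻¹ • ((s • u + (1 - s) • v) - P x))) * ofReal q)
    (hc _) (hc _) ((hc _).mul_const _) ?_
  · rw [lintegral_mul_const _ (hc _)] at key
    have hk0 : 0 < (r ^ Fintype.card κ)⁻¹ := by positivity
    set k := ofReal (r ^ Fintype.card κ)⁻¹ with hk
    have hkt : k ≠ ⊤ := ENNReal.ofReal_ne_top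
    have hkz : k ≠ 0 := by rw [hk]; simpa using pow_pos hr _
    rw [← ENNReal.ofReal_le_ofReal_iff (mul_nonneg (h0 _) (exp_pos _).le),
      ENNReal.ofReal_mul (Real.rpow_nonneg (h0 _) _), ENNReal.ofReal_mul (h0 _),
      ← ENNReal.ofReal_rpow_of_nonneg (h0 _) hs0.le, ← ENNReal.ofReal_rpow_of_nonneg (h0 _) hs2.le,
      ofReal_convDensity hr hfm hf.1 hν, ofReal_convDensity hr hfm hf.1 hν,
      ofReal_convDensity hr hfm hf.1 hν,
      ENNReal.mul_rpow_of_nonneg _ _ hs0.le, ENNReal.mul_rpow_of_nonneg _ _ hs2.le,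
      mul_mul_mul_comm, ← ENNReal.rpow_add _ _ hkz hkt,
      show s + (1 - s) = 1 by ring, ENNReal.rpow_one, mul_assoc]
    gcongr
  · intro x y
    have hn : ∀ u x, 0 ≤ f x * gd (r⁻¹ • (u - P x)) := fun u x => mul_nonneg (hf.1 x) (gd_pos _).le
    rw [ENNReal.ofReal_rpow_of_nonneg (hn _ _) hs0.le, ENNReal.ofReal_rpow_of_nonneg (hn _ _) hs2.le,
      ← ENNReal.ofReal_mul (Real.rpow_nonneg (hn _ _) _), ← ENNReal.ofReal_mul (hn _ _)]
    exact ENNReal.ofReal_le_ofReal (hf.mul_gd ht hr hP u v x y hs0 hs1)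

theorem hasDerivAt_line {E : Type*} [NormedAddCommGroup E] [NormedSpace ℝ E] {V : E → ℝ}
    (hV : ContDiff ℝ ∞ V) (x c : E) (τ : ℝ) :
    HasDerivAt (fun τ : ℝ => V (x + τ • c)) (dd c V (x + τ • c)) τ := by
  have h1 : HasDerivAt (fun τ : ℝ => x + τ • c) c τ := by
    simpa using ((hasDerivAt_id τ).smul_const c).const_add x
  exact (hV.differentiable_infty _).hasFDerivAt.comp_hasDerivAt τ h1

theorem le_dd_dd_of_strongLC {E : Type*} [NormedAddCommGroup E] [NormedSpace ℝ E] {V : E → ℝ}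
    (hV : ContDiff ℝ ∞ V) (h : StrongLC t fun x => exp (-V x)) (x c : E) :
    t * ‖c‖ ^ 2 ≤ dd c (dd c V) x := by
  set φ : ℝ → ℝ := fun τ => V (x + τ • c) - t / 2 * ‖c‖ ^ 2 * τ ^ 2 with hφ
  have hd : ∀ τ, HasDerivAt φ (dd c V (x + τ • c) - t * ‖c‖ ^ 2 * τ) τ := by
    intro τ
    have := (hasDerivAt_line hV x c τ).sub (((hasDerivAt_id τ).pow 2).const_mul (t / 2 * ‖c‖ ^ 2))
    have e : dd c V (x + τ • c) - t * ‖c‖ ^ 2 * τ = dd c V (x + τ • c) -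
        t / 2 * ‖c‖ ^ 2 * (((2 : ℕ) : ℝ) * id τ ^ (2 - 1) * 1) := by
      simp; ring
    rw [e]
    exact this
  have hconv : ConvexOn ℝ univ φ := by
    refine LinearOrder.convexOn_of_lt convex_univ ?_
    intro α _ β _ _ a b ha hb hab
    obtain rfl : b = 1 - a := by linarith
    have h1 := h.2 (x + α • c) (x + β • c) a ha (by linarith)
    rw [← exp_mul, ← exp_mul, ← exp_add, ← exp_add, exp_le_exp] at h1
    have e1 : a • (x + α • c) + (1 - a) • (x + β • c) = x + (a • α + (1 - a) • β) • c := by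
      module
    have e2 : ‖(x + α • c) - (x + β • c)‖ ^ 2 = (α - β) ^ 2 * ‖c‖ ^ 2 := by
      rw [add_sub_add_left_eq_sub, ← sub_smul, norm_smul, mul_pow, norm_eq_abs, sq_abs]
    rw [e1, e2] at h1
    change _ ≤ -V (x + (a * α + (1 - a) * β) • c) + _ at h1
    change V (x + (a * α + (1 - a) * β) • c) - t / 2 * ‖c‖ ^ 2 * (a * α + (1 - a) * β) ^ 2 ≤
      a * (V (x + α • c) - t / 2 * ‖c‖ ^ 2 * α ^ 2) +
        (1 - a) * (V (x + β • c) - t / 2 * ‖c‖ ^ 2 * β ^ 2)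
    nlinarith
  have hmono := hconv.monotoneOn_deriv fun τ _ => (hd τ).differentiableAt
  have hderiv : deriv φ = fun τ => dd c V (x + τ • c) - t * ‖c‖ ^ 2 * τ := by
    ext τ; exact (hd τ).deriv
  have h2 : HasDerivAt (deriv φ) (dd c (dd c V) x - t * ‖c‖ ^ 2) 0 := by
    rw [hderiv]
    have := (hasDerivAt_line (hV.dd c) x c 0).sub ((hasDerivAt_id (0:ℝ)).const_mul (t * ‖c‖ ^ 2))
    rw [mul_one, zero_smul, add_zero] at this
    exact this
  have h3 : 0 ≤ deriv (deriv φ) 0 := Monotone.deriv_nonneg (monotoneOn_univ.1 hmono)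
  rw [h2.deriv] at h3
  linarith

theorem sum_dd_dd_eq {V : ℰ κ → ℝ} (hV : ContDiff ℝ ∞ V) (c : κ → ℝ)
    (x : ℰ κ) :
    ∑ i, ∑ j, c i * c j * dd (ee i) (dd (ee j) V) x =
      dd (∑ i, c i • ee i) (dd (∑ i, c i • ee i) V) x := by
  have e1 : dd (∑ i, c i • (ee i : ℰ κ)) V =
      fun x => ∑ j, c j * dd (ee j) V x := by
    ext x; exact dd_sum_dir _ _ _ _ _
  rw [e1, dd_sum_dir]
  refine sum_congr rfl fun i _ => ?_
  rw [dd_sum fun j _ => contDiff_const.mul (hV.dd _), mul_sum]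
  refine sum_congr rfl fun j _ => ?_
  rw [dd_const_mul (hV.dd _)]
  ring

theorem norm_sum_smul_ee (c : κ → ℝ) : ‖∑ i, c i • (ee i : ℰ κ)‖ ^ 2 =
    ∑ i, c i ^ 2 := by
  have h : ∑ i, c i • (ee i : ℰ κ) = WithLp.toLp 2 c := by
    have := (EuclideanSpace.basisFun κ ℝ).sum_repr (WithLp.toLp 2 c)
    simpa [ee] using this
  rw [h, EuclideanSpace.norm_sq_eq]
  simp

theorem ev_convPot_aux (hr : 0 < r) (hP : ∀ x, ‖P x‖ ≤ ‖x‖) (hR : ∀ᵐ x ∂ν, ‖x‖ ≤ R)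
    {G : ℰ κ → ℝ} (hG : Continuous G) {C k : ℝ} (hk : 0 ≤ k)
    (hb : ∀ u, |G u| ≤ C * exp (k * ‖u‖)) :
    Integrable (fun u => G u * exp (-convPot ν P r u)) ∧
      ev (convPot ν P r) G = ∫ x, (∫ z : ℰ κ, G (P x + r • z) * gd z) ∂ν := by
  have hC : 0 ≤ C := by
    have := (abs_nonneg _).trans (hb 0)
    simpa using this
  have hexp : ∀ u, exp (-convPot ν P r u) = convDensity ν P r u := by
    intro u
    unfold convPot
    rw [neg_neg, exp_log (convDensity_pos hr hP hR u)]
  have hcont : Continuous (Function.uncurry fun (u : ℰ κ) (x : ℰ ι) =>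
      G u * ((r ^ Fintype.card κ)⁻¹ * gd (r⁻¹ • (u - P x)))) := by
    refine (hG.comp continuous_fst).mul (continuous_const.mul (contDiff_gd.continuous.comp ?_))
    fun_prop
  have hbd : ∀ x, ‖x‖ ≤ R → ∀ z, |G (P x + r • z)| ≤
      C * exp (k * R) * exp (k * r * ‖z‖) := by
    intro x hx z
    refine (hb _).trans ?_
    rw [mul_assoc, ← exp_add]
    refine mul_le_mul_of_nonneg_left (Real.exp_le_exp.2 ?_) hC
    have h1 : ‖P x + r • z‖ ≤ R + r * ‖z‖ := by
      refine (norm_add_le _ _).trans (add_le_add ((hP x).trans hx) ?_)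
      rw [norm_smul, norm_eq_abs, abs_of_pos hr]
    nlinarith
  have hGc : ∀ x, Continuous fun z => G (P x + r • z) := fun x =>
    hG.comp (continuous_const.add (continuous_id.const_smul r))
  have hzint : ∀ x, ‖x‖ ≤ R → Integrable fun z => G (P x + r • z) * gd z := fun x hx =>
    integrable_mul_gd (hGc x).aestronglyMeasurable (hbd x hx)
  have hitg : Integrable (Function.uncurry fun (u : ℰ κ) (x : ℰ ι) =>
      G u * ((r ^ Fintype.card κ)⁻¹ * gd (r⁻¹ • (u - P x)))) (volume.prod ν) := by
    rw [integrable_prod_iff' hcont.aestronglyMeasurable]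
    constructor
    · filter_upwards [hR] with x hx
      exact integrable_gauss_subst hr G (P x) (hzint x hx)
    · have hm := (hcont.norm.aestronglyMeasurable (μ := volume.prod ν)).prod_swap.integral_prod_right'
      refine Integrable.of_bound (C := ∫ z : ℰ κ,
        C * exp (k * R) * (exp (k * r * ‖z‖) * gd z)) hm ?_
      filter_upwards [hR] with x hx
      have e1 : ∀ u, ‖(Function.uncurry fun (u : ℰ κ) (x : ℰ ι) =>
          G u * ((r ^ Fintype.card κ)⁻¹ * gd (r⁻¹ • (u - P x)))) (u, x)‖ =
          |G u| * ((r ^ Fintype.card κ)⁻¹ * gd (r⁻¹ • (u - P x))) := by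
        intro u
        simp only [Function.uncurry_apply_pair, norm_mul, norm_eq_abs, abs_of_pos (gd_pos _)]
        rw [abs_of_pos (by positivity : 0 < (r ^ Fintype.card κ)⁻¹)]
      simp only [e1]
      rw [integral_gauss_subst hr (fun u => |G u|) (P x), norm_eq_abs,
        abs_of_nonneg (integral_nonneg fun z => mul_nonneg (abs_nonneg _) (gd_pos _).le)]
      refine integral_mono ?_ ((integrable_exp_mul_gd (k * r)).const_mul _) fun z => ?_
      · have := (hzint x hx).abs
        refine this.congr (Eventually.of_forall fun z => ?_)
        simp only [abs_mul, abs_of_pos (gd_pos _)]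
      · beta_reduce
        rw [← mul_assoc]
        exact mul_le_mul_of_nonneg_right (hbd x hx z) (gd_pos z).le
  have e2 : ∀ u, G u * exp (-convPot ν P r u) =
      ∫ x, G u * ((r ^ Fintype.card κ)⁻¹ * gd (r⁻¹ • (u - P x))) ∂ν := by
    intro u
    rw [hexp, integral_const_mul]
    rfl
  constructor
  · simp only [e2]
    exact hitg.integral_prod_left
  · unfold ev
    simp only [e2]
    rw [integral_integral_swap hitg]
    refine integral_congr_ae ?_
    filter_upwards [hR] with x hx
    exact integral_gauss_subst hr G (P x)

end

section

variable {ι κ : Type*} [Fintype ι] [Fintype κ]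
variable {ν : Measure (ℰ ι)} [IsProbabilityMeasure ν]
  {P : ℰ ι →L[ℝ] ℰ κ} {r R t : ℝ} {f : ℰ ι → ℝ}

theorem exp_neg_convPot (hr : 0 < r) (hP : ∀ x, ‖P x‖ ≤ ‖x‖) (hR : ∀ᵐ x ∂ν, ‖x‖ ≤ R)
    (u : ℰ κ) : exp (-convPot ν P r u) = convDensity ν P r u := by
  unfold convPot
  rw [neg_neg, exp_log (convDensity_pos hr hP hR u)]

theorem langevinPotential_convPot (ht : 0 < t) (hr : 0 < r) (hfm : Measurable f)
    (hf : StrongLC t f) (hν : ν = volume.withDensity fun x => ofReal (f x))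
    (hP : ∀ x, ‖P x‖ ≤ ‖x‖) (hR : ∀ᵐ x ∂ν, ‖x‖ ≤ R) :
    LangevinPotential (convPot ν P r) (t / (1 + r ^ 2 * t))
      ((r ^ 2)⁻¹ + 2 * ((r ^ 2)⁻¹ * R) ^ 2) := by
  refine ⟨contDiff_convPot hr hP hR, fun x c => ?_, fun i x y => convPot_lip hr hP hR i x y, ?_⟩
  · rw [sum_dd_dd_eq (contDiff_convPot hr hP hR), ← norm_sum_smul_ee]
    refine le_dd_dd_of_strongLC (contDiff_convPot hr hP hR) ?_ _ _
    have : (fun x => exp (-convPot ν P r x)) = convDensity ν P r := by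
      ext u; exact exp_neg_convPot hr hP hR u
    rw [this]
    exact convDensity_strongLC ht hr hfm hf hν hP
  · have h := (ev_convPot_aux (C := 1) (k := 0) hr hP hR (G := fun _ => (1 : ℝ)) continuous_const
      le_rfl (by simp)).2
    unfold ev at h
    simpa [integral_gd] using h

theorem abs_sum_mul_le (c : κ → ℝ) (z : ℰ κ) :
    |∑ i, c i * z i| ≤ ‖WithLp.toLp 2 c‖ * ‖z‖ := by
  have := abs_real_inner_le_norm (WithLp.toLp 2 c : ℰ κ) z
  rw [PiLp.inner_apply] at this
  simpa [mul_comm (z _)] using this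

theorem le_exp_norm {E : Type*} [NormedAddCommGroup E] (z : E) : ‖z‖ ≤ exp ‖z‖ := by
  linarith [Real.add_one_le_exp ‖z‖]

theorem integrable_norm_sq_mul_gd : Integrable fun z : ℰ κ => ‖z‖ ^ 2 * gd z := by
  refine integrable_mul_gd (C := 1) (k := 2) (by fun_prop) fun z => ?_
  rw [abs_of_nonneg (by positivity), one_mul, two_mul, exp_add, sq]
  exact mul_le_mul (le_exp_norm z) (le_exp_norm z) (norm_nonneg _) (exp_pos _).le

theorem varBound_convPot (hr : 0 < r) (hP : ∀ x, ‖P x‖ ≤ ‖x‖) (hR : ∀ᵐ x ∂ν, ‖x‖ ≤ R) {a : ℝ}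
    (ha : ∀ c : κ → ℝ, ∃ m : ℝ, ∫ x, ((∑ i, c i * P x i) - m) ^ 2 ∂ν ≤ a * ∑ i, c i ^ 2) :
    VarBound (convPot ν P r)
      ((1 + r) * a + (r ^ 2 + r) * ∫ z : ℰ κ, ‖z‖ ^ 2 * gd z) := by
  intro c
  obtain ⟨m, hm⟩ := ha c
  refine ⟨m, ?_⟩
  set G : ℰ κ → ℝ := fun u => ((∑ i, c i * u i) - m) ^ 2 with hG
  have hGc : Continuous G := by fun_prop
  set K := ‖(WithLp.toLp 2 c : ℰ κ)‖ with hK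
  have hK2 : K ^ 2 = ∑ i, c i ^ 2 := by
    rw [hK, EuclideanSpace.norm_sq_eq]; simp
  have hb : ∀ u, |G u| ≤ (K + |m|) ^ 2 * exp (2 * ‖u‖) := by
    intro u
    rw [hG, abs_of_nonneg (sq_nonneg _), two_mul, exp_add, ← sq, ← mul_pow]
    refine sq_le_sq.2 ?_
    rw [abs_of_nonneg (by positivity : 0 ≤ (K + |m|) * exp ‖u‖)]
    refine (abs_sub _ _).trans ?_
    rw [add_mul]
    refine add_le_add ((abs_sum_mul_le c u).trans ?_) ?_
    · exact mul_le_mul_of_nonneg_left (le_exp_norm u) (norm_nonneg _)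
    · exact le_mul_of_one_le_right (abs_nonneg _) (Real.one_le_exp (norm_nonneg _))
  obtain ⟨h1, h2⟩ := ev_convPot_aux hr hP hR hGc (by norm_num) hb
  refine ⟨h1, ?_⟩
  rw [h2]
  set Cm := ∫ z : ℰ κ, ‖z‖ ^ 2 * gd z with hCm
  have hin : ∀ x, ∫ z : ℰ κ, G (P x + r • z) * gd z ≤
      (1 + r) * ((∑ i, c i * P x i) - m) ^ 2 + (r ^ 2 + r) * Cm * ∑ i, c i ^ 2 := by
    intro x
    have hi1 : Integrable fun z : ℰ κ =>
        (1 + r) * ((∑ i, c i * P x i) - m) ^ 2 * gd z +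
          (r ^ 2 + r) * (∑ i, c i ^ 2) * (‖z‖ ^ 2 * gd z) :=
      (integrable_gd.const_mul _).add (integrable_norm_sq_mul_gd.const_mul _)
    refine (integral_mono_of_nonneg (Eventually.of_forall fun z =>
      mul_nonneg (sq_nonneg _) (gd_pos z).le) hi1 (Eventually.of_forall fun z => ?_)).trans ?_
    · beta_reduce
      rw [← mul_assoc, ← add_mul]
      refine mul_le_mul_of_nonneg_right ?_ (gd_pos z).le
      have e : (∑ i, c i * (P x + r • z) i) - m =
          ((∑ i, c i * P x i) - m) + r * ∑ i, c i * z i := by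
        simp only [PiLp.add_apply, PiLp.smul_apply, smul_eq_mul, mul_add, sum_add_distrib,
          mul_sum]
        rw [add_sub_right_comm]
        congr 1
        exact sum_congr rfl fun i _ => by ring
      rw [e]
      have hz : (∑ i, c i * z i) ^ 2 ≤ (∑ i, c i ^ 2) * ‖z‖ ^ 2 := by
        rw [← hK2, ← mul_pow, sq_le_sq, abs_of_nonneg (by positivity : 0 ≤ K * ‖z‖)]
        exact abs_sum_mul_le c z
      set A := (∑ i, c i * P x i) - m
      set L := ∑ i, c i * z i
      have : (A + r * L) ^ 2 ≤ (1 + r) * A ^ 2 + (r ^ 2 + r) * L ^ 2 := by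
        nlinarith [mul_nonneg hr.le (sq_nonneg (A - L))]
      nlinarith [mul_le_mul_of_nonneg_left hz (by positivity : 0 ≤ r ^ 2 + r)]
    · rw [integral_add (integrable_gd.const_mul _) (integrable_norm_sq_mul_gd.const_mul _),
        integral_const_mul, integral_const_mul, integral_gd, ← hCm]
      exact le_of_eq (by ring)
  have hbi : Integrable (fun x => ((∑ i, c i * P x i) - m) ^ 2) ν := by
    refine Integrable.of_bound (C := (K + |m|) ^ 2 * exp (2 * R))
      (by fun_prop) ?_
    filter_upwards [hR] with x hx
    refine (hb (P x)).trans (mul_le_mul_of_nonneg_left (Real.exp_le_exp.2 ?_) (sq_nonneg _))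
    linarith [(hP x).trans hx]
  refine (integral_mono_of_nonneg (Eventually.of_forall fun x => integral_nonneg fun z =>
      mul_nonneg (sq_nonneg _) (gd_pos z).le) (show Integrable (fun x => (1 + r) *
        ((∑ i, c i * P x i) - m) ^ 2 + (r ^ 2 + r) * Cm * ∑ i, c i ^ 2) ν from
        (hbi.const_mul _).add (integrable_const _))
      (Eventually.of_forall hin)).trans ?_
  rw [integral_add (hbi.const_mul _) (integrable_const _), integral_const_mul]
  simp only [integral_const, probReal_univ, smul_eq_mul, one_mul]
  nlinarith

theorem tendsto_integral_gauss_subst {G : ℰ κ → ℝ} (hG : Continuous G) {C : ℝ}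
    (hC : ∀ u, |G u| ≤ C) :
    Tendsto (fun r : ℝ => ∫ x, (∫ z : ℰ κ, G (P x + r • z) * gd z) ∂ν)
      (𝓝[>] 0) (𝓝 (∫ x, G (P x) ∂ν)) := by
  have h1 : Continuous fun p : ℝ × ℰ ι =>
      ∫ z : ℰ κ, G (P p.2 + p.1 • z) * gd z := by
    refine continuous_of_dominated (bound := fun z => C * gd z) (fun p => ?_) (fun p => ?_)
      (integrable_gd.const_mul C) ?_
    · have : Continuous fun z => G (P p.2 + p.1 • z) := hG.comp (by fun_prop)
      exact (this.mul contDiff_gd.continuous).aestronglyMeasurable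
    · refine Eventually.of_forall fun z => ?_
      rw [norm_mul, norm_eq_abs, norm_eq_abs, abs_of_pos (gd_pos z)]
      exact mul_le_mul_of_nonneg_right (hC _) (gd_pos z).le
    · refine Eventually.of_forall fun z => ?_
      exact (hG.comp (by fun_prop : Continuous fun p : ℝ × ℰ ι =>
        P p.2 + p.1 • z)).mul continuous_const
  have hb : ∀ p : ℝ × ℰ ι,
      ‖∫ z : ℰ κ, G (P p.2 + p.1 • z) * gd z‖ ≤ C := by
    intro p
    refine (norm_integral_le_of_norm_le (integrable_gd.const_mul C)
      (Eventually.of_forall fun z => ?_)).trans ?_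
    · rw [norm_mul, norm_eq_abs, norm_eq_abs, abs_of_pos (gd_pos z)]
      exact mul_le_mul_of_nonneg_right (hC _) (gd_pos z).le
    · rw [integral_const_mul, integral_gd, mul_one]
  have h2 : Continuous fun r : ℝ =>
      ∫ x, (∫ z : ℰ κ, G (P x + r • z) * gd z) ∂ν := by
    refine continuous_of_dominated (bound := fun _ => C) (fun r => ?_) (fun r => ?_)
      (integrable_const C) ?_
    · exact (h1.comp (by fun_prop : Continuous fun x : ℰ ι =>
        (r, x))).aestronglyMeasurable
    · exact Eventually.of_forall fun x => hb (r, x)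
    · exact Eventually.of_forall fun x => h1.comp (by fun_prop : Continuous fun r : ℝ => (r, x))
  have h3 := (h2.tendsto 0).mono_left (nhdsWithin_le_nhds (s := Ioi 0))
  simpa [integral_const_mul, integral_gd] using h3

theorem TestFun.exists_bound {g : ℰ κ → ℝ} (hg : TestFun g) :
    ∃ C, ∀ u, |g u| ≤ C := by
  obtain ⟨C, hC⟩ := hg.2.exists_bound_of_continuous hg.1.continuous
  exact ⟨C, hC⟩

theorem tendsto_ev_convPot (hP : ∀ x, ‖P x‖ ≤ ‖x‖) (hR : ∀ᵐ x ∂ν, ‖x‖ ≤ R)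
    {g : ℰ κ → ℝ} (hg : Continuous g) {C : ℝ} (hC : ∀ u, |g u| ≤ C) :
    Tendsto (fun r : ℝ => ev (convPot ν P r) g) (𝓝[>] 0) (𝓝 (∫ x, g (P x) ∂ν)) := by
  refine (tendsto_integral_gauss_subst hg hC).congr' ?_
  filter_upwards [self_mem_nhdsWithin] with r hr
  exact (ev_convPot_aux hr hP hR hg (le_refl 0) (by simpa using hC)).2.symm

theorem lichnerowicz_marginal_test (ht : 0 < t) (hfm : Measurable f)
    (hf : StrongLC t f) (hν : ν = volume.withDensity fun x => ofReal (f x))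
    (hP : ∀ x, ‖P x‖ ≤ ‖x‖) (hR : ∀ᵐ x ∂ν, ‖x‖ ≤ R) {a : ℝ} (ha0 : 0 ≤ a)
    (ha : ∀ c : κ → ℝ, ∃ m : ℝ, ∫ x, ((∑ i, c i * P x i) - m) ^ 2 ∂ν ≤ a * ∑ i, c i ^ 2)
    {g : ℰ κ → ℝ} (hg : TestFun g) :
    ∫ x, g (P x) ^ 2 ∂ν - (∫ x, g (P x) ∂ν) ^ 2 ≤
      Real.sqrt (a / t) * ∑ i, ∫ x, dd (ee i) g (P x) ^ 2 ∂ν := by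
  have hsq : ∀ {h : ℰ κ → ℝ}, TestFun h →
      Tendsto (fun r : ℝ => ev (convPot ν P r) fun x => h x ^ 2) (𝓝[>] 0)
        (𝓝 (∫ x, h (P x) ^ 2 ∂ν)) := by
    intro h hh
    obtain ⟨C, hC⟩ := hh.exists_bound
    refine tendsto_ev_convPot (g := fun x => h x ^ 2) hP hR (hh.1.continuous.pow 2)
      (C := C ^ 2) fun u => ?_
    rw [abs_pow]
    exact pow_le_pow_left₀ (abs_nonneg _) (hC u) 2
  obtain ⟨C, hC⟩ := hg.exists_bound
  have h1 := (hsq hg).sub ((tendsto_ev_convPot hP hR hg.1.continuous hC).pow 2)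
  set Cm := ∫ z : ℰ κ, ‖z‖ ^ 2 * gd z with hCm
  have hCm0 : 0 ≤ Cm := integral_nonneg fun z => mul_nonneg (sq_nonneg _) (gd_pos z).le
  have h2 : Tendsto (fun r : ℝ => Real.sqrt (((1 + r) * a + (r ^ 2 + r) * Cm) /
      (t / (1 + r ^ 2 * t)))) (𝓝[>] 0) (𝓝 (Real.sqrt (a / t))) := by
    have hc : ContinuousAt (fun r : ℝ => Real.sqrt (((1 + r) * a + (r ^ 2 + r) * Cm) /
      (t / (1 + r ^ 2 * t)))) 0 := by
      refine (ContinuousAt.div (by fun_prop) (ContinuousAt.div (by fun_prop) (by fun_prop)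
        (by positivity)) (by simp [ht.ne'])).sqrt
    have := hc.tendsto.mono_left (nhdsWithin_le_nhds (s := Ioi 0))
    simpa using this
  have h3 : Tendsto (fun r : ℝ => ∑ i, ev (convPot ν P r) fun x => dd (ee i) g x ^ 2) (𝓝[>] 0)
      (𝓝 (∑ i, ∫ x, dd (ee i) g (P x) ^ 2 ∂ν)) :=
    tendsto_finsetSum _ fun i _ => hsq ⟨hg.1.dd _, hg.2.dd _⟩
  refine le_of_tendsto_of_tendsto h1 (h2.mul h3) ?_
  filter_upwards [self_mem_nhdsWithin] with r hr
  have hr' : 0 < r := hr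
  exact improved_lichnerowicz (by positivity) (by positivity)
    (langevinPotential_convPot ht hr hfm hf hν hP hR) (varBound_convPot hr hP hR ha) g hg

/-- The improved Lichnerowicz inequality for linear images of compactly supported measures which
are more log-concave than a Gaussian. -/
theorem lichnerowicz_marginal (ht : 0 < t) (hfm : Measurable f)
    (hf : StrongLC t f) (hν : ν = volume.withDensity fun x => ofReal (f x))
    (hP : ∀ x, ‖P x‖ ≤ ‖x‖) (hR : ∀ᵐ x ∂ν, ‖x‖ ≤ R) {a : ℝ} (ha0 : 0 ≤ a)
    (ha : ∀ c : κ → ℝ, ∃ m : ℝ, ∫ x, ((∑ i, c i * P x i) - m) ^ 2 ∂ν ≤ a * ∑ i, c i ^ 2)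
    {q : ℰ κ → ℝ} (hq : ContDiff ℝ ∞ q) :
    ∫ x, q (P x) ^ 2 ∂ν - (∫ x, q (P x) ∂ν) ^ 2 ≤
      Real.sqrt (a / t) * ∑ i, ∫ x, dd (ee i) q (P x) ^ 2 ∂ν := by
  obtain ⟨_, _, hcut⟩ := exists_cutoff κ
  obtain ⟨χ, hχ, hχ1, -⟩ := hcut (|R| + 1) (by positivity)
  have hg : TestFun fun u => χ u * q u := ⟨hχ.1.mul hq, hχ.2.mul_right⟩
  have hev : ∀ᵐ x ∂ν, (fun u => χ u * q u) =ᶠ[𝓝 (P x)] q := by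
    filter_upwards [hR] with x hx
    have : Metric.ball (0 : ℰ κ) (|R| + 1) ∈ 𝓝 (P x) := by
      refine Metric.isOpen_ball.mem_nhds ?_
      rw [mem_ball_zero_iff]
      linarith [(hP x).trans hx, le_abs_self R]
    filter_upwards [this] with u hu
    rw [hχ1 u (mem_ball_zero_iff.1 hu).le, one_mul]
  have key := lichnerowicz_marginal_test ht hfm hf hν hP hR ha0 ha hg
  have e1 : ∫ x, (χ (P x) * q (P x)) ^ 2 ∂ν = ∫ x, q (P x) ^ 2 ∂ν := by
    refine integral_congr_ae (hev.mono fun x hx => ?_)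
    have := hx.eq_of_nhds
    beta_reduce at this ⊢
    rw [this]
  have e2 : ∫ x, χ (P x) * q (P x) ∂ν = ∫ x, q (P x) ∂ν :=
    integral_congr_ae (hev.mono fun x hx => hx.eq_of_nhds)
  have e3 : ∀ i, ∫ x, dd (ee i) (fun u => χ u * q u) (P x) ^ 2 ∂ν =
      ∫ x, dd (ee i) q (P x) ^ 2 ∂ν := by
    intro i
    refine integral_congr_ae (hev.mono fun x hx => ?_)
    beta_reduce
    unfold dd
    rw [hx.fderiv_eq]
  beta_reduce at key
  rw [e1, e2] at key
  simpa only [e3] using key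

end

section

section General
variable {X : Type*} [MeasurableSpace X] {μ : Measure X}
  {F : Type*} [NormedAddCommGroup F] [NormedSpace ℝ F] {b : X → F →L[ℝ] ℝ}

/-- The mean of `ψ` under the tilt of `μ` by `exp (b · ξ)`. -/
def tm (μ : Measure X) (b : X → F →L[ℝ] ℝ) (ψ : X → ℝ) (ξ : F) : ℝ :=
  lap μ b ψ ξ / lap μ b (fun _ => 1) ξ

/-- The algebra generated by tilted means. -/
def tmAlg (μ : Measure X) (b : X → F →L[ℝ] ℝ) : Subalgebra ℝ (F → ℝ) :=
  Algebra.adjoin ℝ {h | ∃ ψ, EssBdd μ ψ ∧ h = tm μ b ψ}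

theorem tm_mem {ψ : X → ℝ} (hψ : EssBdd μ ψ) : tm μ b ψ ∈ tmAlg μ b :=
  Algebra.subset_adjoin ⟨ψ, hψ, rfl⟩

variable [IsProbabilityMeasure μ] [FiniteDimensional ℝ F]

theorem tm_const_mul (ψ : X → ℝ) (c : ℝ) (ξ : F) :
    tm μ b (fun x => c * ψ x) ξ = c * tm μ b ψ ξ := by
  unfold tm; rw [lap_const_mul]; ring

theorem lap_one_pos (hb : EssBdd μ b) (ξ : F) : 0 < lap μ b (fun _ => 1) ξ :=
  lap_pos hb (EssBdd.const 1) (fun _ => one_pos) ξ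

theorem tm_one (hb : EssBdd μ b) (ξ : F) : tm μ b (fun _ => 1) ξ = 1 :=
  div_self (lap_one_pos hb ξ).ne'

theorem tm_const (hb : EssBdd μ b) (c : ℝ) (ξ : F) : tm μ b (fun _ => c) ξ = c := by
  have := tm_const_mul (μ := μ) (b := b) (fun _ => 1) c ξ
  simpa [tm_one hb] using this

theorem tm_add (hb : EssBdd μ b) {ψ φ : X → ℝ} (hψ : EssBdd μ ψ) (hφ : EssBdd μ φ) (ξ : F) :
    tm μ b (fun x => ψ x + φ x) ξ = tm μ b ψ ξ + tm μ b φ ξ := by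
  unfold tm; rw [lap_add hb hψ hφ, add_div]

theorem contDiff_tm (hb : EssBdd μ b) {ψ : X → ℝ} (hψ : EssBdd μ ψ) : ContDiff ℝ ∞ (tm μ b ψ) :=
  (contDiff_lap hb hψ).div (contDiff_lap hb (EssBdd.const 1)) fun ξ => (lap_one_pos hb ξ).ne'

theorem dd_lap_one (hb : EssBdd μ b) (v ξ : F) :
    dd v (lap μ b fun _ => 1) ξ = tm μ b (fun x => b x v) ξ * lap μ b (fun _ => 1) ξ := by
  rw [dd_lap hb (EssBdd.const 1)]
  unfold tm
  rw [div_mul_cancel₀ _ (lap_one_pos hb ξ).ne']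
  simp only [one_mul]

theorem dd_tm (hb : EssBdd μ b) {ψ : X → ℝ} (hψ : EssBdd μ ψ) (v : F) :
    dd v (tm μ b ψ) = fun ξ => tm μ b (fun x => ψ x * b x v) ξ -
      tm μ b ψ ξ * tm μ b (fun x => b x v) ξ := by
  ext ξ
  have h := congrFun (dd_mul (contDiff_tm hb hψ) (contDiff_lap hb (EssBdd.const (μ := μ) 1)) v) ξ
  have h1 : (fun x => tm μ b ψ x * lap μ b (fun _ => 1) x) = lap μ b ψ := by
    ext η; exact div_mul_cancel₀ _ (lap_one_pos hb η).ne'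
  have hp := lap_one_pos hb ξ
  rw [h1, dd_lap hb hψ, dd_lap_one hb] at h
  have h2 : lap μ b (fun x => ψ x * b x v) ξ =
      tm μ b (fun x => ψ x * b x v) ξ * lap μ b (fun _ => 1) ξ :=
    (div_mul_cancel₀ _ hp.ne').symm
  rw [h2] at h
  have : (dd v (tm μ b ψ) ξ) * lap μ b (fun _ => 1) ξ = (tm μ b (fun x => ψ x * b x v) ξ -
      tm μ b ψ ξ * tm μ b (fun x => b x v) ξ) * lap μ b (fun _ => 1) ξ := by linarith
  exact mul_right_cancel₀ hp.ne' this

theorem tm_abs_le (hb : EssBdd μ b) {ψ : X → ℝ} (hψ : EssBdd μ ψ) {C : ℝ}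
    (h : ∀ᵐ x ∂μ, |ψ x| ≤ C) (ξ : F) : |tm μ b ψ ξ| ≤ C := by
  unfold tm
  have hp := lap_one_pos hb ξ
  rw [abs_div, abs_of_pos hp, div_le_iff₀ hp]
  exact lap_abs_le hb (EssBdd.const 1) hψ (by simpa using h) ξ

theorem tmAlg_bdd (hb : EssBdd μ b) {f : F → ℝ} (hf : f ∈ tmAlg μ b) : ∃ C, ∀ ξ, |f ξ| ≤ C := by
  induction hf using Algebra.adjoin_induction with
  | mem f hf =>
    obtain ⟨ψ, hψ, rfl⟩ := hf
    obtain ⟨C, hC⟩ := hψ.2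
    exact ⟨C, tm_abs_le hb hψ hC⟩
  | algebraMap r => exact ⟨|r|, fun ξ => by simp⟩
  | add f g _ _ hf hg =>
    obtain ⟨C, hC⟩ := hf
    obtain ⟨D, hD⟩ := hg
    exact ⟨C + D, fun ξ => (abs_add_le _ _).trans (add_le_add (hC ξ) (hD ξ))⟩
  | mul f g _ _ hf hg =>
    obtain ⟨C, hC⟩ := hf
    obtain ⟨D, hD⟩ := hg
    refine ⟨C * D, fun ξ => ?_⟩
    rw [Pi.mul_apply, abs_mul]
    exact mul_le_mul (hC ξ) (hD ξ) (abs_nonneg _) ((abs_nonneg _).trans (hC ξ))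

theorem tmAlg_contDiff (hb : EssBdd μ b) {f : F → ℝ} (hf : f ∈ tmAlg μ b) : ContDiff ℝ ∞ f := by
  induction hf using Algebra.adjoin_induction with
  | mem f hf =>
    obtain ⟨ψ, hψ, rfl⟩ := hf
    exact contDiff_tm hb hψ
  | algebraMap r => exact contDiff_const
  | add f g _ _ hf hg => exact hf.add hg
  | mul f g _ _ hf hg => exact hf.mul hg

theorem tmAlg_dd (hb : EssBdd μ b) {f : F → ℝ} (hf : f ∈ tmAlg μ b) (v : F) :
    dd v f ∈ tmAlg μ b := by
  induction hf using Algebra.adjoin_induction with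
  | mem f hf =>
    obtain ⟨ψ, hψ, rfl⟩ := hf
    rw [dd_tm hb hψ]
    exact sub_mem (tm_mem (hψ.mul (hb.apply v)))
      (mul_mem (tm_mem hψ) (tm_mem (hb.apply v)))
  | algebraMap r =>
    have : dd v ((algebraMap ℝ (F → ℝ)) r) = 0 := dd_const r v
    rw [this]; exact zero_mem _
  | add f g hf' hg' hf hg =>
    have := dd_add (tmAlg_contDiff hb hf') (tmAlg_contDiff hb hg') v
    change dd v (fun x => f x + g x) ∈ _
    rw [this]
    exact add_mem hf hg
  | mul f g hf' hg' hf hg =>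
    have := dd_mul (tmAlg_contDiff hb hf') (tmAlg_contDiff hb hg') v
    change dd v (fun x => f x * g x) ∈ _
    rw [this]
    exact add_mem (mul_mem hf hg') (mul_mem hf' hg)

end General

section MatrixCalculus
variable {F : Type*} [NormedAddCommGroup F] [NormedSpace ℝ F] {ι : Type*} [Fintype ι] [DecidableEq ι]

/-- Smooth matrix-valued functions. -/
def MSmooth (M : F → Matrix ι ι ℝ) : Prop := ∀ i j, ContDiff ℝ ∞ fun ξ => M ξ i j

/-- Entrywise directional derivative. -/
def mdd (v : F) (M : F → Matrix ι ι ℝ) (ξ : F) : Matrix ι ι ℝ :=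
  Matrix.of fun i j => dd v (fun ξ => M ξ i j) ξ

theorem MSmooth.mul {M N : F → Matrix ι ι ℝ} (hM : MSmooth M) (hN : MSmooth N) :
    MSmooth fun ξ => M ξ * N ξ := fun i j => by
  simp only [Matrix.mul_apply]
  exact ContDiff.sum fun k _ => (hM i k).mul (hN k j)

theorem MSmooth.pow {M : F → Matrix ι ι ℝ} (hM : MSmooth M) (m : ℕ) :
    MSmooth fun ξ => M ξ ^ m := by
  induction m with
  | zero => intro i j; simp only [pow_zero]; exact contDiff_const
  | succ m ih => simp only [pow_succ]; exact ih.mul hM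

theorem MSmooth.mdd {M : F → Matrix ι ι ℝ} (hM : MSmooth M) (v : F) : MSmooth (mdd v M) :=
  fun i j => (hM i j).dd v

theorem mdd_mul {M N : F → Matrix ι ι ℝ} (hM : MSmooth M) (hN : MSmooth N) (v ξ : F) :
    mdd v (fun ξ => M ξ * N ξ) ξ = mdd v M ξ * N ξ + M ξ * mdd v N ξ := by
  ext i j
  simp only [mdd, Matrix.of_apply, Matrix.mul_apply, Matrix.add_apply]
  rw [dd_sum fun k _ => (hM i k).mul (hN k j), ← sum_add_distrib]
  refine sum_congr rfl fun k _ => ?_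
  rw [dd_mul (hM i k) (hN k j)]

theorem mdd_pow {M : F → Matrix ι ι ℝ} (hM : MSmooth M) (v : F) (m : ℕ) (ξ : F) :
    mdd v (fun ξ => M ξ ^ m) ξ =
      ∑ p ∈ Finset.range m, M ξ ^ p * mdd v M ξ * M ξ ^ (m - 1 - p) := by
  induction m with
  | zero =>
    ext i j
    simp [mdd, dd_const]
  | succ m ih =>
    simp only [pow_succ]
    rw [mdd_mul (hM.pow m) hM, ih, Finset.sum_range_succ, sum_mul]
    congr 1
    · refine sum_congr rfl fun p hp => ?_
      have := Finset.mem_range.1 hp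
      rw [mul_assoc, ← pow_succ]
      congr 2
      omega
    · simp

theorem dd_trace {M : F → Matrix ι ι ℝ} (hM : MSmooth M) (v ξ : F) :
    dd v (fun ξ => (M ξ).trace) ξ = (mdd v M ξ).trace := by
  simp only [Matrix.trace, Matrix.diag, mdd, Matrix.of_apply]
  rw [dd_sum fun i _ => hM i i]

theorem MSmooth.trace {M : F → Matrix ι ι ℝ} (hM : MSmooth M) :
    ContDiff ℝ ∞ fun ξ => (M ξ).trace := by
  simp only [Matrix.trace, Matrix.diag]
  exact ContDiff.sum fun i _ => hM i i

theorem dd_trace_pow {M : F → Matrix ι ι ℝ} (hM : MSmooth M) (v : F) (m : ℕ) :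
    dd v (fun ξ => (M ξ ^ m).trace) = fun ξ => m * (M ξ ^ (m - 1) * mdd v M ξ).trace := by
  ext ξ
  rw [dd_trace (hM.pow m), mdd_pow hM, Matrix.trace_sum]
  have : ∀ p ∈ Finset.range m, (M ξ ^ p * mdd v M ξ * M ξ ^ (m - 1 - p)).trace =
      (M ξ ^ (m - 1) * mdd v M ξ).trace := by
    intro p hp
    have := Finset.mem_range.1 hp
    rw [Matrix.trace_mul_comm, ← mul_assoc, ← pow_add]
    congr 3
    omega
  rw [sum_congr rfl this]
  simp

theorem dd_dd_trace_pow {M : F → Matrix ι ι ℝ} (hM : MSmooth M) (v : F) (m : ℕ) (ξ : F) :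
    dd v (dd v (fun ξ => (M ξ ^ m).trace)) ξ = m * (M ξ ^ (m - 1) * mdd v (mdd v M) ξ).trace +
      m * ∑ p ∈ Finset.range (m - 1),
        (M ξ ^ p * mdd v M ξ * M ξ ^ (m - 2 - p) * mdd v M ξ).trace := by
  rw [dd_trace_pow hM, dd_const_mul ((hM.pow _).mul (hM.mdd v)).trace]
  beta_reduce
  rw [dd_trace ((hM.pow _).mul (hM.mdd v)), mdd_mul (hM.pow _) (hM.mdd v), mdd_pow hM,
    Matrix.trace_add, sum_mul, Matrix.trace_sum, add_comm, mul_add]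
  congr 2

end MatrixCalculus

end

section

variable {ι : Type*} [Fintype ι]

/-- The exponent `⟪x, θ⟫ - s ‖x‖² / 2` as a linear form in `(s, θ)`. -/
def sx (x : ℰ ι) : ℝ × ℰ ι →L[ℝ] ℝ :=
  (innerSL ℝ x).comp (ContinuousLinearMap.snd ℝ ℝ _) -
    (‖x‖ ^ 2 / 2) • ContinuousLinearMap.fst ℝ ℝ _

theorem sx_apply (x : ℰ ι) (ξ : ℝ × ℰ ι) :
    sx x ξ = inner ℝ x ξ.2 - ‖x‖ ^ 2 / 2 * ξ.1 := by
  simp [sx]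

/-- Time direction. -/
def vt : ℝ × ℰ ι := (1, 0)

/-- Space directions. -/
def ve (i : ι) : ℝ × ℰ ι := (0, ee i)

theorem inner_ee (x : ℰ ι) (i : ι) : inner ℝ x (ee i) = x i := by
  classical
  unfold ee
  rw [EuclideanSpace.basisFun_apply, EuclideanSpace.inner_single_right]
  simp

theorem sx_ve (x : ℰ ι) (i : ι) : sx x (ve i) = x i := by
  rw [sx_apply]; simp [ve, inner_ee]

theorem sx_vt (x : ℰ ι) : sx x vt = -(‖x‖ ^ 2 / 2) := by
  rw [sx_apply]; simp [vt]

theorem continuous_sx : Continuous (sx : ℰ ι → _) := by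
  unfold sx
  have h1 : Continuous fun x : ℰ ι => (innerSL ℝ x).comp
      (ContinuousLinearMap.snd ℝ ℝ (ℰ ι)) :=
    (innerSL ℝ).continuous.clm_comp continuous_const
  have h2 : Continuous fun x : ℰ ι => (‖x‖ ^ 2 / 2) •
      ContinuousLinearMap.fst ℝ ℝ (ℰ ι) :=
    (by fun_prop : Continuous fun x : ℰ ι => ‖x‖ ^ 2 / 2).smul continuous_const
  exact h1.sub h2

variable {μ : Measure (ℰ ι)} [IsProbabilityMeasure μ] {R : ℝ}

theorem EssBdd.of_continuous {G : Type*} [NormedAddCommGroup G]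
    (hR : ∀ᵐ x ∂μ, ‖x‖ ≤ R) {ψ : ℰ ι → G} (hψ : Continuous ψ) : EssBdd μ ψ := by
  obtain ⟨C, hC⟩ := (isCompact_closedBall (0 : ℰ ι) R).exists_bound_of_continuousOn
    hψ.continuousOn
  exact ⟨hψ.aestronglyMeasurable, C, hR.mono fun x hx => hC x (by simpa using hx)⟩

theorem essBdd_sx (hR : ∀ᵐ x ∂μ, ‖x‖ ≤ R) : EssBdd μ (sx : ℰ ι → _) :=
  EssBdd.of_continuous hR continuous_sx

/-- The heat operator. -/
def heat (Ψ : ℝ × ℰ ι → ℝ) (ξ : ℝ × ℰ ι) : ℝ :=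
  dd vt Ψ ξ + 1 / 2 * ∑ i, dd (ve i) (dd (ve i) Ψ) ξ

/-- The generator of stochastic localization. -/
def genL (μ : Measure (ℰ ι)) (Φ : ℝ × ℰ ι → ℝ)
    (ξ : ℝ × ℰ ι) : ℝ :=
  heat Φ ξ + ∑ i, tm μ sx (fun x => x i) ξ * dd (ve i) Φ ξ

/-- The partition function. -/
def zf (μ : Measure (ℰ ι)) : ℝ × ℰ ι → ℝ := lap μ sx fun _ => 1

theorem heat_lap (hR : ∀ᵐ x ∂μ, ‖x‖ ≤ R) {ψ : ℰ ι → ℝ} (hψ : EssBdd μ ψ)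
    (ξ : ℝ × ℰ ι) : heat (lap μ sx ψ) ξ = 0 := by
  have hb := essBdd_sx hR
  unfold heat
  have h1 : ∀ i : ι, dd (ve i) (dd (ve i) (lap μ sx ψ)) ξ =
      ∫ x, ψ x * sx x (ve i) * sx x (ve i) * exp (sx x ξ) ∂μ := by
    intro i
    rw [dd_lap hb hψ, dd_lap hb (hψ.mul (hb.apply _))]
    rfl
  simp only [h1]
  rw [dd_lap hb hψ, ← integral_finsetSum]
  · unfold lap
    rw [← integral_const_mul, ← integral_add]
    · rw [← integral_zero (ℰ ι) ℝ (μ := μ)]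
      congr 1
      ext x
      rw [← sum_mul]
      simp only [sx_ve, sx_vt, mul_assoc, ← mul_sum]
      rw [EuclideanSpace.norm_sq_eq]
      simp only [norm_eq_abs, sq_abs, ← sq]
      ring
    · exact ((hψ.mul (hb.apply _)).mul (hb.apply ξ).exp).integrable
    · exact (integrable_finsetSum _ fun i _ =>
        (((hψ.mul (hb.apply _)).mul (hb.apply _)).mul (hb.apply ξ).exp).integrable).const_mul _
  · intro i _
    exact (((hψ.mul (hb.apply _)).mul (hb.apply _)).mul (hb.apply ξ).exp).integrable

theorem heat_mul {f g : ℝ × ℰ ι → ℝ} (hf : ContDiff ℝ ∞ f) (hg : ContDiff ℝ ∞ g)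
    (ξ : ℝ × ℰ ι) :
    heat (fun ξ => f ξ * g ξ) ξ = heat f ξ * g ξ + f ξ * heat g ξ +
      ∑ i, dd (ve i) f ξ * dd (ve i) g ξ := by
  unfold heat
  have h1 : ∀ i : ι, dd (ve i) (dd (ve i) fun ξ => f ξ * g ξ) ξ =
      dd (ve i) (dd (ve i) f) ξ * g ξ + f ξ * dd (ve i) (dd (ve i) g) ξ +
        2 * (dd (ve i) f ξ * dd (ve i) g ξ) := by
    intro i
    rw [dd_mul hf hg, dd_add ((hf.dd _).mul hg) (hf.mul (hg.dd _)), dd_mul (hf.dd _) hg,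
      dd_mul hf (hg.dd _)]
    ring
  simp only [h1, sum_add_distrib, ← mul_sum, ← sum_mul]
  rw [dd_mul hf hg]
  ring

theorem contDiff_zf (hR : ∀ᵐ x ∂μ, ‖x‖ ≤ R) : ContDiff ℝ ∞ (zf μ) :=
  contDiff_lap (essBdd_sx hR) (EssBdd.const 1)

theorem zf_pos (hR : ∀ᵐ x ∂μ, ‖x‖ ≤ R) (ξ : ℝ × ℰ ι) : 0 < zf μ ξ :=
  lap_one_pos (essBdd_sx hR) ξ

theorem dd_ve_zf (hR : ∀ᵐ x ∂μ, ‖x‖ ≤ R) (i : ι) (ξ : ℝ × ℰ ι) :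
    dd (ve i) (zf μ) ξ = tm μ sx (fun x => x i) ξ * zf μ ξ := by
  unfold zf
  rw [dd_lap_one (essBdd_sx hR)]
  simp only [sx_ve]

theorem heat_mul_zf (hR : ∀ᵐ x ∂μ, ‖x‖ ≤ R) {f : ℝ × ℰ ι → ℝ}
    (hf : ContDiff ℝ ∞ f) (ξ : ℝ × ℰ ι) :
    heat (fun ξ => f ξ * zf μ ξ) ξ = genL μ f ξ * zf μ ξ := by
  rw [heat_mul hf (contDiff_zf hR), show heat (zf μ) ξ = 0 from heat_lap hR (EssBdd.const 1) ξ]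
  unfold genL
  simp only [dd_ve_zf hR]
  rw [add_mul, sum_mul, mul_zero, add_zero]
  congr 1
  exact sum_congr rfl fun i _ => by ring

theorem genL_tm (hR : ∀ᵐ x ∂μ, ‖x‖ ≤ R) {ψ : ℰ ι → ℝ} (hψ : EssBdd μ ψ)
    (ξ : ℝ × ℰ ι) : genL μ (tm μ sx ψ) ξ = 0 := by
  have h := heat_mul_zf hR (contDiff_tm (essBdd_sx hR) hψ) ξ
  have h1 : (fun ξ => tm μ sx ψ ξ * zf μ ξ) = lap μ sx ψ := by
    ext η; exact div_mul_cancel₀ _ (zf_pos hR η).ne'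
  rw [h1, heat_lap hR hψ] at h
  exact (mul_eq_zero.1 h.symm).resolve_right (zf_pos hR ξ).ne'

theorem genL_mul {f g : ℝ × ℰ ι → ℝ} (hf : ContDiff ℝ ∞ f) (hg : ContDiff ℝ ∞ g)
    (ξ : ℝ × ℰ ι) :
    genL μ (fun ξ => f ξ * g ξ) ξ = genL μ f ξ * g ξ + f ξ * genL μ g ξ +
      ∑ i, dd (ve i) f ξ * dd (ve i) g ξ := by
  unfold genL
  rw [heat_mul hf hg]
  have : ∑ i, tm μ sx (fun x => x i) ξ * (dd (ve i) f ξ * g ξ + f ξ * dd (ve i) g ξ) =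
      (∑ i, tm μ sx (fun x => x i) ξ * dd (ve i) f ξ) * g ξ +
      f ξ * ∑ i, tm μ sx (fun x => x i) ξ * dd (ve i) g ξ := by
    rw [sum_mul, mul_sum, ← sum_add_distrib]
    exact sum_congr rfl fun i _ => by ring
  have h2 : ∀ i, dd (ve i) (fun ξ => f ξ * g ξ) ξ = dd (ve i) f ξ * g ξ + f ξ * dd (ve i) g ξ :=
    fun i => by rw [dd_mul hf hg]
  simp only [h2, this]
  ring

theorem genL_sub {f g : ℝ × ℰ ι → ℝ} (hf : ContDiff ℝ ∞ f) (hg : ContDiff ℝ ∞ g)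
    (ξ : ℝ × ℰ ι) :
    genL μ (fun ξ => f ξ - g ξ) ξ = genL μ f ξ - genL μ g ξ := by
  unfold genL heat
  have h1 : ∀ i : ι, dd (ve i) (dd (ve i) fun ξ => f ξ - g ξ) ξ =
      dd (ve i) (dd (ve i) f) ξ - dd (ve i) (dd (ve i) g) ξ := by
    intro i
    rw [dd_sub hf hg, dd_sub (hf.dd _) (hg.dd _)]
  have h2 : ∀ v, dd v (fun ξ => f ξ - g ξ) ξ = dd v f ξ - dd v g ξ := fun v => by
    rw [dd_sub hf hg]
  simp only [h1, h2, mul_sub, sum_sub_distrib]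
  ring

theorem zf_le (hR : ∀ᵐ x ∂μ, ‖x‖ ≤ R) {ξ : ℝ × ℰ ι} (hξ : 0 ≤ ξ.1) :
    zf μ ξ ≤ exp (R * ‖ξ.2‖) := by
  have h : ∀ᵐ x ∂μ, ‖(1 : ℝ) * exp (sx x ξ)‖ ≤ exp (R * ‖ξ.2‖) := by
    filter_upwards [hR] with x hx
    rw [one_mul, norm_eq_abs, abs_exp, exp_le_exp, sx_apply]
    have h1 := real_inner_le_norm x ξ.2
    have h2 : ‖x‖ * ‖ξ.2‖ ≤ R * ‖ξ.2‖ := mul_le_mul_of_nonneg_right hx (norm_nonneg _)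
    have h3 : 0 ≤ ‖x‖ ^ 2 / 2 * ξ.1 := by positivity
    linarith
  have h2 := norm_integral_le_of_norm_le_const h
  rw [probReal_univ, mul_one] at h2
  exact (le_abs_self _).trans h2

/-- Expectation of `Φ` along stochastic localization at time `t`. -/
def EE (μ : Measure (ℰ ι)) (Φ : ℝ × ℰ ι → ℝ) (t : ℝ) : ℝ :=
  ∫ g : ℰ ι, Φ (t, √t • g) * zf μ (t, √t • g) * gd g

theorem abs_mul_zf_le (hR : ∀ᵐ x ∂μ, ‖x‖ ≤ R) {Φ : ℝ × ℰ ι → ℝ} {C : ℝ}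
    (hC : ∀ ξ, |Φ ξ| ≤ C) {t : ℝ} (ht : 0 ≤ t) (g : ℰ ι) :
    |Φ (t, √t • g) * zf μ (t, √t • g)| ≤ C * exp (R * √t * ‖g‖) := by
  rw [abs_mul, abs_of_pos (zf_pos hR _)]
  have h := zf_le hR (ξ := (t, √t • g)) ht
  simp only [norm_smul, norm_eq_abs, abs_of_nonneg (Real.sqrt_nonneg t), ← mul_assoc] at h
  exact mul_le_mul (hC _) h (zf_pos hR _).le ((abs_nonneg _).trans (hC (t, √t • g)))

theorem integrable_EE (hR : ∀ᵐ x ∂μ, ‖x‖ ≤ R) {Φ : ℝ × ℰ ι → ℝ}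
    (hΦ : Continuous Φ) {C : ℝ} (hC : ∀ ξ, |Φ ξ| ≤ C) {t : ℝ} (ht : 0 ≤ t) :
    Integrable fun g : ℰ ι => Φ (t, √t • g) * zf μ (t, √t • g) * gd g := by
  have hc : Continuous fun g : ℰ ι => (t, √t • g) := by fun_prop
  refine integrable_mul_gd ?_ (abs_mul_zf_le hR hC ht)
  exact ((hΦ.comp hc).mul ((contDiff_zf hR).continuous.comp hc)).aestronglyMeasurable

end

section

variable {ι : Type*} [Fintype ι] {μ : Measure (ℰ ι)} [IsProbabilityMeasure μ] {R : ℝ}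

theorem dd_mul_zf (hR : ∀ᵐ x ∂μ, ‖x‖ ≤ R) {Φ : ℝ × ℰ ι → ℝ}
    (hΦ : Φ ∈ tmAlg μ sx) (v : ℝ × ℰ ι) :
    ∃ W ∈ tmAlg μ sx, dd v (fun ξ => Φ ξ * zf μ ξ) = fun ξ => W ξ * zf μ ξ := by
  have hb := essBdd_sx hR
  refine ⟨dd v Φ + Φ * tm μ sx (fun x => sx x v),
    add_mem (tmAlg_dd hb hΦ v) (mul_mem hΦ (tm_mem (hb.apply v))), ?_⟩
  rw [dd_mul (tmAlg_contDiff hb hΦ) (contDiff_zf hR)]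
  ext ξ
  rw [show dd v (zf μ) ξ = _ from dd_lap_one hb v ξ]
  simp only [Pi.add_apply, Pi.mul_apply, zf]
  ring

theorem tmAlg_finsetSum {α : Type*} (s : Finset α) {f : α → ℝ × ℰ ι → ℝ}
    (h : ∀ i ∈ s, f i ∈ tmAlg μ sx) : (fun ξ => ∑ i ∈ s, f i ξ) ∈ tmAlg μ sx := by
  have : (fun ξ => ∑ i ∈ s, f i ξ) = ∑ i ∈ s, f i := by ext; simp
  rw [this]; exact sum_mem h

theorem genL_mem (hR : ∀ᵐ x ∂μ, ‖x‖ ≤ R) {Φ : ℝ × ℰ ι → ℝ}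
    (hΦ : Φ ∈ tmAlg μ sx) : genL μ Φ ∈ tmAlg μ sx := by
  have hb := essBdd_sx hR
  have hc : (fun _ => 1 / 2 : ℝ × ℰ ι → ℝ) ∈ tmAlg μ sx :=
    (tmAlg μ sx).algebraMap_mem (1 / 2 : ℝ)
  exact add_mem (add_mem (tmAlg_dd hb hΦ _) (mul_mem hc
    (tmAlg_finsetSum _ fun i _ => tmAlg_dd hb (tmAlg_dd hb hΦ _) _)))
    (tmAlg_finsetSum _ fun i _ => mul_mem
      (tm_mem (EssBdd.of_continuous hR (by fun_prop))) (tmAlg_dd hb hΦ _))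

theorem hasDerivAt_curve {Ψ : ℝ × ℰ ι → ℝ} (hΨ : ContDiff ℝ ∞ Ψ)
    (g : ℰ ι) {s : ℝ} (hs : 0 < s) :
    HasDerivAt (fun s => Ψ (s, √s • g))
      (dd vt Ψ (s, √s • g) + ∑ i, 1 / (2 * √s) * (g i * dd (ve i) Ψ (s, √s • g))) s := by
  have h1 : HasDerivAt (fun s : ℝ => (s, √s • g)) ((1 : ℝ), (1 / (2 * √s)) • g) s :=
    (hasDerivAt_id s).prodMk ((Real.hasDerivAt_sqrt hs.ne').smul_const g)
  have h2 := (hΨ.differentiable_infty (s, √s • g)).hasFDerivAt.comp_hasDerivAt s h1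
  have e : (fderiv ℝ Ψ (s, √s • g)) ((1 : ℝ), (1 / (2 * √s)) • g) =
      dd vt Ψ (s, √s • g) + ∑ i, 1 / (2 * √s) * (g i * dd (ve i) Ψ (s, √s • g)) := by
    have hg : ((1 : ℝ), (1 / (2 * √s)) • g) =
        vt + (1 / (2 * √s)) • ∑ i, g i • (ve i : ℝ × ℰ ι) := by
      have h3 : ∑ i, g i • (ve i : ℝ × ℰ ι) = (0, g) := by
        have h4 := (EuclideanSpace.basisFun ι ℝ).sum_repr g
        ext1
        · simp [ve, Prod.fst_sum]
        · simp only [ve, Prod.snd_sum, Prod.smul_mk, ee]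
          simpa using h4
      rw [h3]; simp [vt]
    rw [hg, map_add, map_smul, map_sum, smul_eq_mul, mul_sum]
    simp only [map_smul, smul_eq_mul]
    rfl
  rw [← e]
  exact h2

theorem abs_mul_zf_le_of_le (hR : ∀ᵐ x ∂μ, ‖x‖ ≤ R) {W : ℝ × ℰ ι → ℝ} {C : ℝ}
    (hC : ∀ ξ, |W ξ| ≤ C) {s T : ℝ} (hs : 0 ≤ s) (hsT : s ≤ T) (g : ℰ ι) :
    |W (s, √s • g) * zf μ (s, √s • g)| ≤ C * exp (|R| * √T * ‖g‖) := by
  have hC0 : 0 ≤ C := (abs_nonneg _).trans (hC 0)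
  refine (abs_mul_zf_le hR hC hs g).trans (mul_le_mul_of_nonneg_left (Real.exp_le_exp.2 ?_) hC0)
  gcongr
  exact le_abs_self R

theorem hasDerivAt_EE (hR : ∀ᵐ x ∂μ, ‖x‖ ≤ R) {Φ : ℝ × ℰ ι → ℝ}
    (hΦ : Φ ∈ tmAlg μ sx) {t : ℝ} (ht : 0 < t) :
    HasDerivAt (EE μ Φ) (EE μ (genL μ Φ) t) t := by
  have hb := essBdd_sx hR
  set Ψ : ℝ × ℰ ι → ℝ := fun ξ => Φ ξ * zf μ ξ with hΨdef
  have hΨ : ContDiff ℝ ∞ Ψ := (tmAlg_contDiff hb hΦ).mul (contDiff_zf hR)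
  obtain ⟨W0, hW0, hd0⟩ := dd_mul_zf hR hΦ vt
  have hW := fun i => dd_mul_zf hR hΦ (ve i)
  choose W hWm hdW using hW
  have hW2 := fun i => dd_mul_zf hR (hWm i) (ve i)
  choose V hVm hdV using hW2
  obtain ⟨C0, hC0⟩ := tmAlg_bdd hb hW0
  have hCW := fun i => tmAlg_bdd hb (hWm i)
  choose CW hCW using hCW
  have hCV := fun i => tmAlg_bdd hb (hVm i)
  choose CV hCV using hCV
  obtain ⟨C, hC⟩ := tmAlg_bdd hb hΦ
  have hcont : ∀ s : ℝ, Continuous fun g : ℰ ι => (s, √s • g) :=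
    fun s => by fun_prop
  set k := |R| * √(2 * t) with hk
  have hk0 : 0 ≤ k := by positivity
  have key := hasDerivAt_integral_of_dominated_loc_of_deriv_le (μ := volume) (x₀ := t)
    (s := Ioo (t / 2) (2 * t))
    (F := fun s (g : ℰ ι) => Ψ (s, √s • g) * gd g)
    (F' := fun s g => (dd vt Ψ (s, √s • g) +
      ∑ i, 1 / (2 * √s) * (g i * dd (ve i) Ψ (s, √s • g))) * gd g)
    (bound := fun g => (C0 + ∑ i, 1 / (2 * √(t / 2)) * CW i) * (exp ((k + 1) * ‖g‖) * gd g))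
    (Ioo_mem_nhds (by linarith) (by linarith))
    (Eventually.of_forall fun s => ((hΨ.continuous.comp (hcont s)).mul
      contDiff_gd.continuous).aestronglyMeasurable)
    (integrable_EE hR (tmAlg_contDiff hb hΦ).continuous hC ht.le)
    (by
      refine Continuous.aestronglyMeasurable ?_
      have h0 := (hΨ.dd vt).continuous.comp (hcont t)
      have hi := fun i => (hΨ.dd (ve i)).continuous.comp (hcont t)
      refine (h0.add (continuous_finsetSum _ fun i _ => continuous_const.mul
        (Continuous.mul (by fun_prop) (hi i)))).mul contDiff_gd.continuous)
    (Eventually.of_forall fun g s hs => by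
      have hs0 : 0 < s := by linarith [hs.1]
      rw [norm_mul, norm_eq_abs, norm_eq_abs, abs_of_pos (gd_pos g), ← mul_assoc]
      refine mul_le_mul_of_nonneg_right ?_ (gd_pos g).le
      have hb0 := abs_mul_zf_le_of_le hR hC0 hs0.le hs.2.le g
      have hbi := fun i => abs_mul_zf_le_of_le hR (hCW i) hs0.le hs.2.le g
      have h1 : exp (k * ‖g‖) ≤ exp ((k + 1) * ‖g‖) :=
        Real.exp_le_exp.2 (by nlinarith [norm_nonneg g])
      rw [add_mul, sum_mul]
      refine (abs_add_le _ _).trans (add_le_add ?_ ((Finset.abs_sum_le_sum_abs _ _).trans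
        (sum_le_sum fun i _ => ?_)))
      · rw [hd0]
        exact hb0.trans (mul_le_mul_of_nonneg_left h1 ((abs_nonneg _).trans (hC0 0)))
      · rw [hdW, abs_mul, abs_mul, abs_of_pos (by positivity : 0 < 1 / (2 * √s)), mul_assoc]
        have hg : |g i| ≤ exp ‖g‖ :=
          (by simpa using PiLp.norm_apply_le g i : |g i| ≤ ‖g‖).trans (le_exp_norm g)
        have h2 : 1 / (2 * √s) ≤ 1 / (2 * √(t / 2)) := by
          have : √(t / 2) ≤ √s := Real.sqrt_le_sqrt hs.1.le
          have : 0 < √(t / 2) := Real.sqrt_pos.2 (by linarith)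
          gcongr
        refine mul_le_mul h2 ?_ (by positivity) (by positivity)
        rw [add_mul, one_mul, exp_add]
        calc _ ≤ exp ‖g‖ * (CW i * exp (k * ‖g‖)) :=
              mul_le_mul hg (hbi i) (abs_nonneg _) (exp_pos _).le
          _ = _ := by ring)
    ((integrable_exp_mul_gd _).const_mul _)
    (Eventually.of_forall fun g s hs =>
      (hasDerivAt_curve hΨ g (by linarith [hs.1])).mul_const _)
  have e : ∫ g : ℰ ι, (dd vt Ψ (t, √t • g) +
      ∑ i, 1 / (2 * √t) * (g i * dd (ve i) Ψ (t, √t • g))) * gd g = EE μ (genL μ Φ) t := by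
    have hst : 0 < √t := Real.sqrt_pos.2 ht
    have hib : ∀ i : ι, ∫ g : ℰ ι, g i * dd (ve i) Ψ (t, √t • g) * gd g =
        √t * ∫ g : ℰ ι, dd (ve i) (dd (ve i) Ψ) (t, √t • g) * gd g := by
      intro i
      set G : ℰ ι → ℝ := fun g => dd (ve i) Ψ (t, √t • g) with hG
      have hGs : ContDiff ℝ ∞ G := (hΨ.dd (ve i)).comp
        (by fun_prop : ContDiff ℝ ∞ fun g : ℰ ι => (t, √t • g))
      have hdG : ∀ z, dd (ee i) G z = √t * dd (ve i) (dd (ve i) Ψ) (t, √t • z) := by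
        intro z
        have h1 : HasFDerivAt (fun g : ℰ ι => (t, √t • g))
            ((0 : ℰ ι →L[ℝ] ℝ).prod (√t • ContinuousLinearMap.id ℝ _)) z :=
          (hasFDerivAt_const t z).prodMk ((hasFDerivAt_id z).const_smul √t)
        have h2 := ((hΨ.dd (ve i)).differentiable_infty (t, √t • z)).hasFDerivAt.comp z h1
        unfold dd at *
        rw [show G = (fun x => fderiv ℝ Ψ x (ve i)) ∘ (fun g => (t, √t • g)) from rfl, h2.fderiv]
        rw [← smul_eq_mul, ← map_smul]
        simp [ve]
      have hbd : ∀ z, |G z| ≤ max (CW i) (√t * CV i) * exp (k * ‖z‖) := by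
        intro z
        rw [hG, hdW]
        refine (abs_mul_zf_le_of_le hR (hCW i) ht.le (by linarith : t ≤ 2 * t) z).trans ?_
        exact mul_le_mul_of_nonneg_right (le_max_left _ _) (exp_pos _).le
      have hbd' : ∀ z, |dd (ee i) G z| ≤ max (CW i) (√t * CV i) * exp (k * ‖z‖) := by
        intro z
        rw [hdG, hdW, hdV, abs_mul, abs_of_pos hst]
        refine (mul_le_mul_of_nonneg_left (abs_mul_zf_le_of_le hR (hCV i) ht.le
          (by linarith : t ≤ 2 * t) z) hst.le).trans ?_
        rw [← mul_assoc]
        exact mul_le_mul_of_nonneg_right (le_max_right _ _) (exp_pos _).le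
      have := gauss_ibp hGs hbd (ee i) hbd'
      simp only [hdG, inner_ee, mul_assoc] at this
      rw [integral_const_mul] at this
      simp only [mul_assoc]
      exact this
    have hint0 : Integrable fun g : ℰ ι => dd vt Ψ (t, √t • g) * gd g := by
      rw [hd0]; exact integrable_EE hR (tmAlg_contDiff hb hW0).continuous hC0 ht.le
    have hinti : ∀ i : ι, Integrable fun g : ℰ ι =>
        dd (ve i) (dd (ve i) Ψ) (t, √t • g) * gd g := by
      intro i
      rw [hdW, hdV]; exact integrable_EE hR (tmAlg_contDiff hb (hVm i)).continuous (hCV i) ht.le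
    have hintg : ∀ i : ι, Integrable fun g : ℰ ι =>
        g i * dd (ve i) Ψ (t, √t • g) * gd g := by
      intro i
      refine integrable_mul_gd (C := CW i) (k := k + 1) ?_ fun g => ?_
      · have hi := (hΨ.dd (ve i)).continuous.comp (hcont t)
        exact (Continuous.mul (by fun_prop) hi).aestronglyMeasurable
      · rw [hdW, abs_mul]
        have hg : |g i| ≤ exp ‖g‖ :=
          (by simpa using PiLp.norm_apply_le g i : |g i| ≤ ‖g‖).trans (le_exp_norm g)
        rw [add_mul, one_mul, exp_add]
        calc _ ≤ exp ‖g‖ * (CW i * exp (k * ‖g‖)) :=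
              mul_le_mul hg (abs_mul_zf_le_of_le hR (hCW i) ht.le (by linarith : t ≤ 2 * t) g)
                (abs_nonneg _) (exp_pos _).le
          _ = _ := by ring
    have h1 : ∀ g : ℰ ι, (dd vt Ψ (t, √t • g) +
        ∑ i, 1 / (2 * √t) * (g i * dd (ve i) Ψ (t, √t • g))) * gd g =
        dd vt Ψ (t, √t • g) * gd g +
        ∑ i, 1 / (2 * √t) * (g i * dd (ve i) Ψ (t, √t • g) * gd g) := by
      intro g
      rw [add_mul, sum_mul]
      simp only [mul_assoc]
    have h2 : ∀ g : ℰ ι, genL μ Φ (t, √t • g) * zf μ (t, √t • g) * gd g =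
        dd vt Ψ (t, √t • g) * gd g +
        ∑ i, 1 / 2 * (dd (ve i) (dd (ve i) Ψ) (t, √t • g) * gd g) := by
      intro g
      rw [← heat_mul_zf hR (tmAlg_contDiff hb hΦ)]
      change heat Ψ _ * _ = _
      unfold heat
      rw [add_mul, mul_assoc, sum_mul, mul_sum]
    unfold EE
    simp only [h1, h2]
    rw [integral_add hint0 (integrable_finsetSum _ fun i _ => (hintg i).const_mul _),
      integral_add hint0 (integrable_finsetSum _ fun i _ => (hinti i).const_mul _),
      integral_finsetSum _ fun i _ => (hintg i).const_mul _,
      integral_finsetSum _ fun i _ => (hinti i).const_mul _]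
    congr 1
    refine sum_congr rfl fun i _ => ?_
    rw [integral_const_mul, integral_const_mul, hib, ← mul_assoc]
    congr 1
    field_simp
  rw [← e]
  exact key.2

end

section

variable {ι : Type*} [Fintype ι] {μ : Measure (ℰ ι)}
  {R : ℝ}

/-- Tilted barycenter coordinates. -/
def ba (μ : Measure (ℰ ι)) (i : ι) : ℝ × ℰ ι → ℝ :=
  tm μ sx fun x => x i

/-- Tilted covariance matrix. -/
def cA (μ : Measure (ℰ ι)) (ξ : ℝ × ℰ ι) : Matrix ι ι ℝ :=
  Matrix.of fun i j => tm μ sx (fun x => x i * x j) ξ - ba μ i ξ * ba μ j ξ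

theorem cA_symm (i j : ι) (ξ : ℝ × ℰ ι) : cA μ ξ i j = cA μ ξ j i := by
  simp only [cA, Matrix.of_apply, mul_comm]

variable [IsProbabilityMeasure μ]

theorem dd_ba (hR : ∀ᵐ x ∂μ, ‖x‖ ≤ R) (i k : ι) (ξ : ℝ × ℰ ι) :
    dd (ve k) (ba μ i) ξ = cA μ ξ i k := by
  unfold ba
  rw [dd_tm (essBdd_sx hR) (EssBdd.of_continuous hR (by fun_prop))]
  simp only [sx_ve]
  rfl

theorem ba_mem (hR : ∀ᵐ x ∂μ, ‖x‖ ≤ R) (i : ι) : ba μ i ∈ tmAlg μ sx :=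
  tm_mem (EssBdd.of_continuous hR (by fun_prop))

theorem cA_mem (hR : ∀ᵐ x ∂μ, ‖x‖ ≤ R) (i j : ι) : (fun ξ => cA μ ξ i j) ∈ tmAlg μ sx :=
  sub_mem (tm_mem (EssBdd.of_continuous hR (by fun_prop)))
    (mul_mem (ba_mem hR i) (ba_mem hR j))

theorem contDiff_ba (hR : ∀ᵐ x ∂μ, ‖x‖ ≤ R) (i : ι) : ContDiff ℝ ∞ (ba μ i) :=
  tmAlg_contDiff (essBdd_sx hR) (ba_mem hR i)

theorem cA_smooth (hR : ∀ᵐ x ∂μ, ‖x‖ ≤ R) : MSmooth (cA μ) :=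
  fun i j => tmAlg_contDiff (essBdd_sx hR) (cA_mem hR i j)

theorem genL_cA (hR : ∀ᵐ x ∂μ, ‖x‖ ≤ R) (i j : ι) (ξ : ℝ × ℰ ι) :
    genL μ (fun ξ => cA μ ξ i j) ξ = -∑ k, cA μ ξ i k * cA μ ξ j k := by
  have hb := essBdd_sx hR
  change genL μ (fun ξ => tm μ sx (fun x => x i * x j) ξ - ba μ i ξ * ba μ j ξ) ξ = _
  have h0 : EssBdd μ fun x : ℰ ι => x i * x j :=
    EssBdd.of_continuous hR (by fun_prop)
  rw [genL_sub (contDiff_tm hb h0) ((contDiff_ba hR i).mul (contDiff_ba hR j)),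
    genL_tm hR h0, genL_mul (contDiff_ba hR i) (contDiff_ba hR j)]
  have h1 : ∀ i, genL μ (ba μ i) ξ = 0 := fun i =>
    genL_tm hR (EssBdd.of_continuous hR (by fun_prop)) ξ
  simp only [h1, dd_ba hR]
  ring

variable [DecidableEq ι]

/-- Tilted third central moments. -/
def cT (μ : Measure (ℰ ι)) (k : ι) (ξ : ℝ × ℰ ι) : Matrix ι ι ℝ :=
  mdd (ve k) (cA μ) ξ

theorem cT_eq (hR : ∀ᵐ x ∂μ, ‖x‖ ≤ R) (i j k : ι) (ξ : ℝ × ℰ ι) :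
    cT μ k ξ i j =
      tm μ sx (fun x => (x i - ba μ i ξ) * (x j - ba μ j ξ) * (x k - ba μ k ξ)) ξ := by
  have hb := essBdd_sx hR
  have h0 : EssBdd μ fun x : ℰ ι => x i * x j :=
    EssBdd.of_continuous hR (by fun_prop)
  have hl : cT μ k ξ i j = tm μ sx (fun x => x i * x j * x k) ξ -
      tm μ sx (fun x => x i * x j) ξ * ba μ k ξ -
      (cA μ ξ i k * ba μ j ξ + ba μ i ξ * cA μ ξ j k) := by
    change dd (ve k) (fun ξ => tm μ sx (fun x => x i * x j) ξ - ba μ i ξ * ba μ j ξ) ξ = _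
    rw [dd_sub (contDiff_tm hb h0) ((contDiff_ba hR i).mul (contDiff_ba hR j)),
      dd_mul (contDiff_ba hR i) (contDiff_ba hR j), dd_tm hb h0]
    simp only [sx_ve, dd_ba hR]
    rfl
  have hr : ∀ a b c : ℝ, tm μ sx (fun x : ℰ ι => (x i - a) * (x j - b) * (x k - c)) ξ
      = tm μ sx (fun x => x i * x j * x k) ξ + (-a * tm μ sx (fun x => x j * x k) ξ +
        (-b * tm μ sx (fun x => x i * x k) ξ + (-c * tm μ sx (fun x => x i * x j) ξ +
        (a * b * tm μ sx (fun x => x k) ξ + (a * c * tm μ sx (fun x => x j) ξ +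
        (b * c * tm μ sx (fun x => x i) ξ + -(a * b * c))))))) := by
    intro a b c
    have e : (fun x : ℰ ι => (x i - a) * (x j - b) * (x k - c)) = fun x =>
        x i * x j * x k + (-a * (x j * x k) + (-b * (x i * x k) + (-c * (x i * x j) +
        (a * b * x k + (a * c * x j + (b * c * x i + -(a * b * c))))))) := by
      ext x; ring
    rw [e]
    repeat rw [tm_add hb (EssBdd.of_continuous hR (by fun_prop))
      (EssBdd.of_continuous hR (by fun_prop))]
    simp only [tm_const_mul, tm_const hb]
  rw [hl, hr]
  simp only [cA, ba, Matrix.of_apply]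
  ring

theorem genL_trace_pow (hR : ∀ᵐ x ∂μ, ‖x‖ ≤ R) (m : ℕ) (ξ : ℝ × ℰ ι) :
    genL μ (fun ξ => (cA μ ξ ^ m).trace) ξ = -(m * (cA μ ξ ^ (m + 1)).trace) +
      m / 2 * ∑ k, ∑ p ∈ Finset.range (m - 1),
        (cA μ ξ ^ p * cT μ k ξ * cA μ ξ ^ (m - 2 - p) * cT μ k ξ).trace := by
  have hM := cA_smooth hR
  have hG : mdd vt (cA μ) ξ + (1 / 2 : ℝ) • ∑ k, mdd (ve k) (mdd (ve k) (cA μ)) ξ +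
      ∑ k, ba μ k ξ • mdd (ve k) (cA μ) ξ = -(cA μ ξ * cA μ ξ) := by
    ext i j
    have := genL_cA hR i j ξ
    unfold genL heat at this
    simp only [Matrix.add_apply, Matrix.smul_apply, Matrix.sum_apply, Matrix.neg_apply,
      Matrix.mul_apply, smul_eq_mul, mdd, Matrix.of_apply]
    have hs : ∀ k, cA μ ξ k j = cA μ ξ j k := fun k => cA_symm k j ξ
    simp only [hs]
    exact this
  unfold genL heat
  simp only [dd_dd_trace_pow hM]
  simp only [dd_trace_pow hM, cT]
  have h2 : (m : ℝ) * (cA μ ξ ^ (m - 1) * mdd vt (cA μ) ξ).trace +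
      1 / 2 * (m * ∑ k, (cA μ ξ ^ (m - 1) * mdd (ve k) (mdd (ve k) (cA μ)) ξ).trace) +
      ∑ k, ba μ k ξ * (m * (cA μ ξ ^ (m - 1) * mdd (ve k) (cA μ) ξ).trace) =
      -(m * (cA μ ξ ^ (m + 1)).trace) := by
    have h3 := congrArg (fun N => (m : ℝ) * (cA μ ξ ^ (m - 1) * N).trace) hG
    beta_reduce at h3
    rw [mul_add, mul_add, Matrix.mul_smul, mul_sum, mul_sum] at h3
    simp only [Matrix.trace_add, Matrix.trace_smul, Matrix.trace_sum, Matrix.mul_smul, mul_neg,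
      Matrix.trace_neg, smul_eq_mul] at h3
    rcases Nat.eq_zero_or_pos m with rfl | hm
    · simp
    have e : cA μ ξ ^ (m - 1) * (cA μ ξ * cA μ ξ) = cA μ ξ ^ (m + 1) := by
      rw [← pow_two, ← pow_add]; congr 1; omega
    rw [e] at h3
    have e2 : ∑ k, ba μ k ξ * (m * (cA μ ξ ^ (m - 1) * mdd (ve k) (cA μ) ξ).trace) =
        m * ∑ k, ba μ k ξ * (cA μ ξ ^ (m - 1) * mdd (ve k) (cA μ) ξ).trace := by
      rw [mul_sum]
      exact sum_congr rfl fun k _ => by ring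
    rw [← h3, e2]
    ring
  rw [← h2]
  simp only [sum_add_distrib, ← mul_sum, ba]
  ring

end

section

variable {ι : Type*} [Fintype ι] [DecidableEq ι]

/-- The coordinates in the basis `e` with indices satisfying `S`, the others being replaced
by zero. -/
def coordProj (e : OrthonormalBasis ι ℝ (ℰ ι)) (S : ι → Prop) [DecidablePred S] :
    ℰ ι →L[ℝ] ℰ ι :=
  (EuclideanSpace.equiv ι ℝ).symm.toContinuousLinearMap.comp
    (ContinuousLinearMap.pi fun j => if S j then innerSL ℝ (e j) else 0)

theorem coordProj_apply (e : OrthonormalBasis ι ℝ (ℰ ι)) (S : ι → Prop)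
    [DecidablePred S] (x : ℰ ι) (j : ι) :
    coordProj e S x j = if S j then inner ℝ (e j) x else 0 := by
  change (if S j then innerSL ℝ (e j) else 0) x = _
  split_ifs <;> simp

theorem norm_coordProj_le (e : OrthonormalBasis ι ℝ (ℰ ι)) (S : ι → Prop)
    [DecidablePred S] (x : ℰ ι) : ‖coordProj e S x‖ ≤ ‖x‖ := by
  refine le_of_sq_le_sq ?_ (norm_nonneg x)
  rw [EuclideanSpace.norm_sq_eq, ← e.sum_sq_norm_inner_right x]
  refine sum_le_sum fun j _ => ?_
  rw [coordProj_apply]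
  split_ifs
  · exact le_rfl
  · simp [sq_nonneg]

variable {ν : Measure (ℰ ι)} [IsProbabilityMeasure ν] {R t : ℝ}
  {f : ℰ ι → ℝ} {e : OrthonormalBasis ι ℝ (ℰ ι)} {α lam : ι → ℝ}

theorem integral_lin_sq (hR : ∀ᵐ x ∂ν, ‖x‖ ≤ R)
    (h2 : ∀ i j, ∫ x, (inner ℝ (e i) x - α i) * (inner ℝ (e j) x - α j) ∂ν =
      if i = j then lam i else 0) (c : ι → ℝ) :
    ∫ x, (∑ i, c i * (inner ℝ (e i) x - α i)) ^ 2 ∂ν = ∑ i, c i ^ 2 * lam i := by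
  have h : ∀ x, (∑ i, c i * (inner ℝ (e i) x - α i)) ^ 2 = ∑ i, ∑ j, c i * c j *
      ((inner ℝ (e i) x - α i) * (inner ℝ (e j) x - α j)) := by
    intro x
    rw [sq, Finset.sum_mul_sum]
    exact sum_congr rfl fun i _ => sum_congr rfl fun j _ => by ring
  simp only [h]
  rw [integral_finsetSum _ fun i _ => (EssBdd.of_continuous hR (by fun_prop)).integrable]
  refine sum_congr rfl fun i _ => ?_
  rw [integral_finsetSum _ fun j _ => (EssBdd.of_continuous hR (by fun_prop)).integrable]
  simp only [integral_const_mul, h2]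
  simp only [mul_ite, mul_zero, Finset.sum_ite_eq, Finset.mem_univ, if_true]
  ring

theorem varBound_coordProj (hR : ∀ᵐ x ∂ν, ‖x‖ ≤ R)
    (h2 : ∀ i j, ∫ x, (inner ℝ (e i) x - α i) * (inner ℝ (e j) x - α j) ∂ν =
      if i = j then lam i else 0) (i : ι) (hi : 0 ≤ lam i) (c : ι → ℝ) :
    ∃ m : ℝ, ∫ x, ((∑ j, c j * coordProj e (fun j => lam j ≤ lam i) x j) - m) ^ 2 ∂ν ≤
      lam i * ∑ j, c j ^ 2 := by
  refine ⟨∑ j, (if lam j ≤ lam i then c j else 0) * α j, ?_⟩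
  have h : ∀ x, (∑ j, c j * coordProj e (fun j => lam j ≤ lam i) x j) -
      ∑ j, (if lam j ≤ lam i then c j else 0) * α j =
      ∑ j, (if lam j ≤ lam i then c j else 0) * (inner ℝ (e j) x - α j) := by
    intro x
    rw [← sum_sub_distrib]
    refine sum_congr rfl fun j _ => ?_
    rw [coordProj_apply]
    split_ifs <;> ring
  simp only [h]
  rw [integral_lin_sq hR h2, mul_sum]
  refine sum_le_sum fun j _ => ?_
  split_ifs with hj
  · rw [mul_comm]; exact mul_le_mul_of_nonneg_right hj (sq_nonneg _)
  · simp only [ne_eq, OfNat.ofNat_ne_zero, not_false_eq_true, zero_pow, zero_mul]; positivity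

theorem dd_coord (l j : ι) (c : ℝ) (u : ℰ ι) :
    dd (ee l) (fun u : ℰ ι => u j - c) u = if j = l then 1 else 0 := by
  have : HasFDerivAt (fun u : ℰ ι => u j - c)
      (EuclideanSpace.proj j : ℰ ι →L[ℝ] ℝ) u :=
    (EuclideanSpace.proj j : ℰ ι →L[ℝ] ℝ).hasFDerivAt.sub_const c
  unfold dd
  rw [this.fderiv]
  simp [ee]

theorem eigenvalue_le (ht : 0 < t) (hfm : Measurable f)
    (hf : StrongLC t f) (hν : ν = volume.withDensity fun x => ofReal (f x))
    (hR : ∀ᵐ x ∂ν, ‖x‖ ≤ R) (h1 : ∀ i, ∫ x, (inner ℝ (e i) x - α i) ∂ν = 0)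
    (h2 : ∀ i j, ∫ x, (inner ℝ (e i) x - α i) * (inner ℝ (e j) x - α j) ∂ν =
      if i = j then lam i else 0) (i : ι) : lam i ≤ 1 / t := by
  have hi : 0 ≤ lam i := by
    have := h2 i i
    rw [if_pos rfl] at this
    rw [← this]
    exact integral_nonneg fun x => mul_self_nonneg _
  have h := lichnerowicz_marginal (P := coordProj e fun j => lam j ≤ lam i) (q := fun u => u i - α i)
    ht hfm hf hν (norm_coordProj_le e _) hR hi (varBound_coordProj hR h2 i hi) (by fun_prop)
  simp only [coordProj_apply, le_refl, if_true, h1, dd_coord, sq] at h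
  rw [h2 i i, if_pos rfl] at h
  simp at h
  have h3 : lam i ^ 2 ≤ lam i / t := by
    rw [← Real.sq_sqrt (div_nonneg hi ht.le)]
    refine pow_le_pow_left₀ hi ?_ 2
    simpa using h
  by_contra hcon
  push Not at hcon
  have h4 : 0 < lam i := lt_trans (by positivity) hcon
  rw [div_eq_mul_one_div, sq] at h3
  exact absurd (le_of_mul_le_mul_left h3 h4) (not_le.2 hcon)

theorem third_moment_le (ht : 0 < t) (hfm : Measurable f)
    (hf : StrongLC t f) (hν : ν = volume.withDensity fun x => ofReal (f x))
    (hR : ∀ᵐ x ∂ν, ‖x‖ ≤ R) (h1 : ∀ i, ∫ x, (inner ℝ (e i) x - α i) ∂ν = 0)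
    (h2 : ∀ i j, ∫ x, (inner ℝ (e i) x - α i) * (inner ℝ (e j) x - α j) ∂ν =
      if i = j then lam i else 0) (i : ι) :
    ∑ j, ∑ k, (if lam j ≤ lam i ∧ lam k ≤ lam i then
      (∫ x, (inner ℝ (e i) x - α i) * (inner ℝ (e j) x - α j) * (inner ℝ (e k) x - α k) ∂ν) ^ 2
      else 0) ≤ 4 * lam i ^ 2 * √(lam i / t) := by
  set T : ι → ι → ℝ := fun j k =>
    ∫ x, (inner ℝ (e i) x - α i) * (inner ℝ (e j) x - α j) * (inner ℝ (e k) x - α k) ∂ν with hT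
  set B : ι → ι → ℝ := fun j k => if lam j ≤ lam i ∧ lam k ≤ lam i then T j k else 0 with hB
  have hTs : ∀ j k, T j k = T k j := by
    intro j k; simp only [hT]; congr 1; ext x; ring
  have hBs : ∀ j k, B j k = B k j := by
    intro j k; simp only [hB, hTs j k, and_comm]
  have hi : 0 ≤ lam i := by
    have := h2 i i
    rw [if_pos rfl] at this
    rw [← this]
    exact integral_nonneg fun x => mul_self_nonneg _
  set s := ∑ j, ∑ k, B j k ^ 2 with hs
  have hs' : ∑ j, ∑ k, (if lam j ≤ lam i ∧ lam k ≤ lam i then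
      (∫ x, (inner ℝ (e i) x - α i) * (inner ℝ (e j) x - α j) * (inner ℝ (e k) x - α k) ∂ν) ^ 2
      else 0) = s := by
    refine sum_congr rfl fun j _ => sum_congr rfl fun k _ => ?_
    simp only [hB]; split_ifs <;> simp [hT]
  rw [hs']
  have hs0 : 0 ≤ s := sum_nonneg fun j _ => sum_nonneg fun k _ => sq_nonneg _
  set q : ℰ ι → ℝ := fun u => ∑ j, ∑ k, B j k * ((u j - α j) * (u k - α k)) with hq
  set P := coordProj e fun j => lam j ≤ lam i with hP
  have hqP : ∀ x, q (P x) = ∑ j, ∑ k, B j k *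
      ((inner ℝ (e j) x - α j) * (inner ℝ (e k) x - α k)) := by
    intro x
    refine sum_congr rfl fun j _ => sum_congr rfl fun k _ => ?_
    rw [hP, coordProj_apply, coordProj_apply]
    simp only [hB]
    by_cases hj : lam j ≤ lam i <;> by_cases hk : lam k ≤ lam i <;> simp [hj, hk]
  have hqs : ContDiff ℝ ∞ q := by fun_prop
  have hqPc : Continuous fun x => q (P x) := hqs.continuous.comp P.continuous
  have hdq : ∀ l u, dd (ee l) q u = 2 * ∑ k, B l k * (u k - α k) := by
    intro l u
    rw [hq, dd_sum fun j _ => by fun_prop]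
    have hj : ∀ j, dd (ee l) (fun u : ℰ ι =>
        ∑ k, B j k * ((u j - α j) * (u k - α k))) u = ∑ k, B j k *
        ((if j = l then 1 else 0) * (u k - α k) + (u j - α j) * (if k = l then 1 else 0)) := by
      intro j
      rw [dd_sum fun k _ => by fun_prop]
      refine sum_congr rfl fun k _ => ?_
      rw [dd_const_mul (by fun_prop), dd_mul (by fun_prop) (by fun_prop)]
      beta_reduce
      rw [dd_coord, dd_coord]
    simp only [hj, mul_add, sum_add_distrib]
    have e1 : ∑ j, ∑ k, B j k * ((if j = l then 1 else 0) * (u k - α k)) =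
        ∑ k, B l k * (u k - α k) := by
      rw [sum_comm]
      refine sum_congr rfl fun k _ => ?_
      simp [ite_mul]
    have e2 : ∑ j, ∑ k, B j k * ((u j - α j) * (if k = l then 1 else 0)) =
        ∑ k, B l k * (u k - α k) := by
      refine sum_congr rfl fun j _ => ?_
      simp [hBs j l]
    rw [e1, e2]; ring
  have hVar := lichnerowicz_marginal (P := P) (q := q) ht hfm hf hν (norm_coordProj_le e _) hR hi
    (varBound_coordProj hR h2 i hi) hqs
  set m := ∫ x, q (P x) ∂ν with hm
  have hgrad : ∑ l, ∫ x, dd (ee l) q (P x) ^ 2 ∂ν ≤ 4 * lam i * s := by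
    rw [hs, mul_sum]
    refine sum_le_sum fun l _ => ?_
    have h3 : ∀ x, dd (ee l) q (P x) ^ 2 =
        4 * (∑ k, B l k * (inner ℝ (e k) x - α k)) ^ 2 := by
      intro x
      rw [hdq, mul_pow]
      congr 1
      · norm_num
      congr 1
      refine sum_congr rfl fun k _ => ?_
      rw [hP, coordProj_apply]
      simp only [hB]
      by_cases hk : lam k ≤ lam i <;> simp [hk]
    simp only [h3]
    rw [integral_const_mul, integral_lin_sq hR h2, mul_assoc]
    refine mul_le_mul_of_nonneg_left ?_ (by norm_num)
    rw [mul_sum]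
    refine sum_le_sum fun k _ => ?_
    by_cases hk : lam k ≤ lam i
    · rw [mul_comm]; exact mul_le_mul_of_nonneg_right hk (sq_nonneg _)
    · simp [hB, hk]
  have hcov : ∫ x, (inner ℝ (e i) x - α i) * q (P x) ∂ν = s := by
    have h3 : ∀ x, (inner ℝ (e i) x - α i) * q (P x) = ∑ j, ∑ k, B j k *
        ((inner ℝ (e i) x - α i) * (inner ℝ (e j) x - α j) * (inner ℝ (e k) x - α k)) := by
      intro x
      rw [hqP, mul_sum]
      refine sum_congr rfl fun j _ => ?_
      rw [mul_sum]
      exact sum_congr rfl fun k _ => by ring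
    simp only [h3]
    rw [integral_finsetSum _ fun i _ => (EssBdd.of_continuous hR (by fun_prop)).integrable]
    refine sum_congr rfl fun j _ => ?_
    rw [integral_finsetSum _ fun i _ => (EssBdd.of_continuous hR (by fun_prop)).integrable]
    refine sum_congr rfl fun k _ => ?_
    rw [integral_const_mul]
    change B j k * T j k = B j k ^ 2
    simp only [hB]; split_ifs <;> ring
  have hCS : s ^ 2 ≤ lam i * (∫ x, q (P x) ^ 2 ∂ν - m ^ 2) := by
    have hpos : ∀ c : ℝ, 0 ≤ lam i * (c * c) + (-2 * s) * c + (∫ x, q (P x) ^ 2 ∂ν - m ^ 2) := by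
      intro c
      have h3 : 0 ≤ ∫ x, (q (P x) - m - c * (inner ℝ (e i) x - α i)) ^ 2 ∂ν :=
        integral_nonneg fun x => sq_nonneg _
      have h4 : ∀ x, (q (P x) - m - c * (inner ℝ (e i) x - α i)) ^ 2 =
          q (P x) ^ 2 + ((-2 * m) * q (P x) + (m ^ 2 + (c ^ 2 * ((inner ℝ (e i) x - α i) *
          (inner ℝ (e i) x - α i)) + ((-2 * c) * ((inner ℝ (e i) x - α i) * q (P x)) +
          (2 * m * c) * (inner ℝ (e i) x - α i))))) := by intro x; ring
      simp only [h4] at h3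
      have hitg : ∀ {g : ℰ ι → ℝ}, Continuous g → Integrable g ν :=
        fun hg => (EssBdd.of_continuous hR hg).integrable
      rw [integral_add (hitg (by fun_prop)) (hitg (by fun_prop)),
        integral_add (hitg (by fun_prop)) (hitg (by fun_prop)),
        integral_add (hitg (by fun_prop)) (hitg (by fun_prop)),
        integral_add (hitg (by fun_prop)) (hitg (by fun_prop)),
        integral_add (hitg (by fun_prop)) (hitg (by fun_prop))] at h3
      simp only [integral_const_mul, hcov, h2 i i, h1, if_true, ← hm, integral_const,
        probReal_univ, one_smul] at h3
      nlinarith [h3]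
    have := discrim_le_zero hpos
    unfold discrim at this
    nlinarith
  have hfin : s ^ 2 ≤ (4 * lam i ^ 2 * √(lam i / t)) * s := by
    refine hCS.trans ?_
    calc _ ≤ lam i * (√(lam i / t) * (4 * lam i * s)) :=
          mul_le_mul_of_nonneg_left (hVar.trans
            (mul_le_mul_of_nonneg_left hgrad (Real.sqrt_nonneg _))) hi
      _ = _ := by ring
  rcases hs0.eq_or_lt with h0 | h0
  · rw [← h0]; positivity
  · rw [sq] at hfin; exact le_of_mul_le_mul_right hfin h0

end

section

variable {ι : Type*} [Fintype ι] {μ : Measure (ℰ ι)} [IsProbabilityMeasure μ] {R : ℝ}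

/-- The tilted measure. -/
def nuT (μ : Measure (ℰ ι)) (ξ : ℝ × ℰ ι) :
    Measure (ℰ ι) := μ.tilted fun x => sx x ξ

theorem zf_eq (ξ : ℝ × ℰ ι) : zf μ ξ = ∫ x, exp (sx x ξ) ∂μ := by
  simp [zf, lap]

theorem integral_nuT (ψ : ℰ ι → ℝ) (ξ : ℝ × ℰ ι) :
    ∫ x, ψ x ∂(nuT μ ξ) = tm μ sx ψ ξ := by
  unfold nuT
  rw [integral_tilted, ← zf_eq]
  unfold tm
  rw [show lap μ sx (fun _ => 1) ξ = zf μ ξ from rfl, div_eq_mul_inv, mul_comm]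
  unfold lap
  rw [← integral_const_mul]
  congr 1
  ext x
  rw [smul_eq_mul]
  ring

theorem isProbabilityMeasure_nuT (hR : ∀ᵐ x ∂μ, ‖x‖ ≤ R) (ξ : ℝ × ℰ ι) :
    IsProbabilityMeasure (nuT μ ξ) :=
  isProbabilityMeasure_tilted ((essBdd_sx hR).apply ξ).exp.integrable

theorem nuT_bdd (hR : ∀ᵐ x ∂μ, ‖x‖ ≤ R) (ξ : ℝ × ℰ ι) :
    ∀ᵐ x ∂(nuT μ ξ), ‖x‖ ≤ R :=
  (tilted_absolutelyContinuous μ _).ae_le hR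

/-- The density of the tilted measure. -/
def fT (μ : Measure (ℰ ι)) (f : ℰ ι → ℝ)
    (ξ : ℝ × ℰ ι) (x : ℰ ι) : ℝ :=
  f x * (exp (sx x ξ) / zf μ ξ)

theorem measurable_fT {f : ℰ ι → ℝ} (hfm : Measurable f)
    (ξ : ℝ × ℰ ι) : Measurable (fT μ f ξ) := by
  have : Continuous fun x : ℰ ι => exp (sx x ξ) / zf μ ξ := by
    have := continuous_sx (ι := ι)
    fun_prop
  exact hfm.mul this.measurable

theorem nuT_eq_withDensity {f : ℰ ι → ℝ} (hfm : Measurable f) (hf : ∀ x, 0 ≤ f x)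
    (hμ : μ = volume.withDensity fun x => ofReal (f x)) (ξ : ℝ × ℰ ι) :
    nuT μ ξ = volume.withDensity fun x => ofReal (fT μ f ξ x) := by
  have hc : Continuous fun x : ℰ ι => exp (sx x ξ) / zf μ ξ := by
    have := continuous_sx (ι := ι)
    fun_prop
  have h1 : nuT μ ξ = μ.withDensity fun x => ofReal (exp (sx x ξ) / zf μ ξ) := by
    unfold nuT Measure.tilted
    rw [← zf_eq]
  rw [h1]
  have h2 : (fun x => ofReal (fT μ f ξ x)) = (fun x => ofReal (f x)) *
      fun x => ofReal (exp (sx x ξ) / zf μ ξ) := by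
    ext x
    rw [Pi.mul_apply, ← ENNReal.ofReal_mul (hf x)]
    rfl
  rw [h2, withDensity_mul _ hfm.ennreal_ofReal hc.measurable.ennreal_ofReal, ← hμ]

theorem strongLC_fT (hR : ∀ᵐ x ∂μ, ‖x‖ ≤ R) {f : ℰ ι → ℝ} (hf : StrongLC 0 f)
    (ξ : ℝ × ℰ ι) : StrongLC ξ.1 (fT μ f ξ) := by
  have hz := zf_pos hR ξ
  have hp : ∀ x : ℰ ι, 0 ≤ exp (sx x ξ) / zf μ ξ := fun x => by positivity
  refine ⟨fun x => mul_nonneg (hf.1 x) (hp x), fun x y s hs hs1 => ?_⟩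
  have h := hf.2 x y s hs hs1
  simp only [zero_mul, zero_div, neg_zero, Real.exp_zero, mul_one] at h
  unfold fT
  rw [Real.mul_rpow (hf.1 x) (hp x), Real.mul_rpow (hf.1 y) (hp y)]
  have hexp : (exp (sx x ξ) / zf μ ξ) ^ s * (exp (sx y ξ) / zf μ ξ) ^ (1 - s) =
      exp (sx (s • x + (1 - s) • y) ξ) / zf μ ξ *
        exp (-(ξ.1 * s * (1 - s) / 2) * ‖x - y‖ ^ 2) := by
    rw [Real.div_rpow (exp_pos _).le hz.le, Real.div_rpow (exp_pos _).le hz.le,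
      ← exp_mul, ← exp_mul, div_mul_div_comm, ← exp_add, ← Real.rpow_add hz,
      add_sub_cancel, Real.rpow_one, div_mul_eq_mul_div, ← exp_add]
    congr 2
    simp only [sx_apply, inner_add_left, inner_smul_left]
    have h3 := norm_sq_convex_comb x y s
    simp only [conj_trivial]
    linear_combination (-ξ.1 / 2) * h3
  calc _ = (f x ^ s * f y ^ (1 - s)) * ((exp (sx x ξ) / zf μ ξ) ^ s *
        (exp (sx y ξ) / zf μ ξ) ^ (1 - s)) := by ring
    _ ≤ f (s • x + (1 - s) • y) * (exp (sx (s • x + (1 - s) • y) ξ) / zf μ ξ *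
        exp (-(ξ.1 * s * (1 - s) / 2) * ‖x - y‖ ^ 2)) := by
      rw [hexp]
      exact mul_le_mul_of_nonneg_right h (by positivity)
    _ = _ := by ring

end

section

section Matrices
variable {ι : Type*} [Fintype ι] [DecidableEq ι] {A : Matrix ι ι ℝ}

theorem Matrix.IsHermitian.pow_eq_conj (hA : A.IsHermitian) (m : ℕ) :
    A ^ m = (hA.eigenvectorUnitary : Matrix ι ι ℝ) *
      Matrix.diagonal (fun i => hA.eigenvalues i ^ m) *
      star (hA.eigenvectorUnitary : Matrix ι ι ℝ) := by
  have h0 : A = (hA.eigenvectorUnitary : Matrix ι ι ℝ) *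
      Matrix.diagonal hA.eigenvalues * star (hA.eigenvectorUnitary : Matrix ι ι ℝ) := by
    have := hA.spectral_theorem
    rw [Unitary.conjStarAlgAut_apply] at this
    exact this
  have hU : star (hA.eigenvectorUnitary : Matrix ι ι ℝ) * (hA.eigenvectorUnitary : Matrix ι ι ℝ) = 1 :=
    Unitary.coe_star_mul_self _
  induction m with
  | zero => simp
  | succ m ih =>
    have : ∀ U V D D' : Matrix ι ι ℝ, V * U = 1 → U * D * V * (U * D' * V) = U * (D * D') * V := by
      intro U V D D' h
      calc _ = U * D * (V * U) * D' * V := by simp only [mul_assoc]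
        _ = _ := by rw [h, mul_one, mul_assoc U]
    rw [pow_succ, ih]
    refine (congrArg (fun N => _ * N) h0).trans ?_
    rw [this _ _ _ _ hU, Matrix.diagonal_mul_diagonal]
    simp only [pow_succ]

theorem Matrix.IsHermitian.trace_pow_eq (hA : A.IsHermitian) (m : ℕ) :
    (A ^ m).trace = ∑ i, hA.eigenvalues i ^ m := by
  rw [hA.pow_eq_conj, Matrix.trace_mul_comm, ← mul_assoc, Unitary.coe_star_mul_self, one_mul,
    Matrix.trace_diagonal]

/-- The matrix `B` in an eigenbasis of `A`. -/
def Matrix.IsHermitian.conj (hA : A.IsHermitian) (B : Matrix ι ι ℝ) : Matrix ι ι ℝ :=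
  star (hA.eigenvectorUnitary : Matrix ι ι ℝ) * B * (hA.eigenvectorUnitary : Matrix ι ι ℝ)

theorem Matrix.IsHermitian.conj_apply (hA : A.IsHermitian) (B : Matrix ι ι ℝ) (i j : ι) :
    hA.conj B i j = ∑ b, ∑ a, hA.eigenvectorBasis i a * B a b * hA.eigenvectorBasis j b := by
  unfold Matrix.IsHermitian.conj
  rw [Matrix.mul_apply]
  refine sum_congr rfl fun b _ => ?_
  rw [Matrix.mul_apply, sum_mul]
  refine sum_congr rfl fun a _ => ?_
  rw [Matrix.star_apply]
  simp

theorem Matrix.IsHermitian.trace_pow_mul_pow_mul (hA : A.IsHermitian) (B : Matrix ι ι ℝ)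
    (p b : ℕ) : (A ^ p * B * A ^ b * B).trace =
      ∑ i, ∑ j, hA.eigenvalues i ^ p * hA.eigenvalues j ^ b * (hA.conj B i j * hA.conj B j i) := by
  rw [hA.pow_eq_conj p, hA.pow_eq_conj b]
  have : ∀ U V D D' : Matrix ι ι ℝ, (U * D * V * B * (U * D' * V) * B).trace =
      (D * (V * B * U) * (D' * (V * B * U))).trace := by
    intro U V D D'
    calc _ = (U * (D * V * B * U * D' * V * B)).trace := by simp only [mul_assoc]
      _ = _ := by rw [Matrix.trace_mul_comm]; simp only [mul_assoc]
  rw [this]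
  change (_ * hA.conj B * (_ * hA.conj B)).trace = _
  simp only [Matrix.trace, Matrix.diag, Matrix.mul_apply (M := _ * _), Matrix.diagonal_mul]
  exact sum_congr rfl fun i _ => sum_congr rfl fun j _ => by ring

theorem Matrix.IsHermitian.conj_self (hA : A.IsHermitian) (i j : ι) :
    hA.conj A i j = if i = j then hA.eigenvalues i else 0 := by
  have h0 := hA.pow_eq_conj 1
  rw [pow_one] at h0
  have hU : star (hA.eigenvectorUnitary : Matrix ι ι ℝ) * (hA.eigenvectorUnitary : Matrix ι ι ℝ) = 1 :=
    Unitary.coe_star_mul_self _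
  have : ∀ U V D : Matrix ι ι ℝ, V * U = 1 → V * (U * D * V) * U = D := by
    intro U V D h
    calc _ = (V * U) * D * (V * U) := by simp only [mul_assoc]
      _ = _ := by rw [h, mul_one, one_mul]
  have h1 : hA.conj A = Matrix.diagonal hA.eigenvalues := by
    unfold Matrix.IsHermitian.conj
    refine (congrArg (fun N => star (hA.eigenvectorUnitary : Matrix ι ι ℝ) * N *
      (hA.eigenvectorUnitary : Matrix ι ι ℝ)) h0).trans ?_
    rw [this _ _ _ hU]
    simp
  rw [h1, Matrix.diagonal_apply]

end Matrices

section DividedDifference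
open Polynomial

/-- The divided difference of the derivative of `q`. -/
def dquot (q : ℝ[X]) (a b : ℝ) : ℝ :=
  ∑ m ∈ q.support, q.coeff m * (m * ∑ p ∈ Finset.range (m - 1), a ^ p * b ^ (m - 2 - p))

theorem dquot_mul (q : ℝ[X]) (a b : ℝ) :
    dquot q a b * (a - b) = q.derivative.eval a - q.derivative.eval b := by
  rw [derivative_eval, derivative_eval, Polynomial.sum_def, Polynomial.sum_def,
    ← sum_sub_distrib, dquot, sum_mul]
  refine sum_congr rfl fun m _ => ?_
  have h := (Commute.all a b).geom_sum₂_mul (m - 1)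
  have h2 : ∀ p, m - 1 - 1 - p = m - 2 - p := fun p => by omega
  simp only [h2] at h
  linear_combination (q.coeff m * m) * h

theorem dquot_self (q : ℝ[X]) (a : ℝ) : dquot q a a = q.derivative.derivative.eval a := by
  have h1 : q.derivative.derivative = ∑ m ∈ q.support,
      C (q.coeff m * m * (m - 1 : ℕ)) * X ^ (m - 1 - 1) := by
    rw [derivative_apply q, Polynomial.sum_def, derivative_sum]
    refine sum_congr rfl fun m _ => ?_
    rw [derivative_C_mul_X_pow]
  rw [h1, eval_finsetSum, dquot]
  refine sum_congr rfl fun m _ => ?_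
  have : ∀ p ∈ Finset.range (m - 1), a ^ p * a ^ (m - 2 - p) = a ^ (m - 1 - 1) := by
    intro p hp
    have := Finset.mem_range.1 hp
    rw [← pow_add]; congr 1; omega
  rw [sum_congr rfl this]
  simp
  ring

theorem dquot_bounds {q : ℝ[X]} {w : ℝ → ℝ} {ε M : ℝ} (hw0 : ∀ x, 0 ≤ w x) (hw : Monotone w)
    (hq : ∀ x, 0 ≤ x → x ≤ M → |q.derivative.derivative.eval x - w x| ≤ ε) {a b : ℝ}
    (ha : 0 ≤ a) (hb : 0 ≤ b) (ha' : a ≤ M) (hb' : b ≤ M) :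
    -ε ≤ dquot q a b ∧ dquot q a b ≤ w (max a b) + ε := by
  have key : ∃ c, 0 ≤ c ∧ c ≤ max a b ∧ dquot q a b = q.derivative.derivative.eval c := by
    have hd : ∀ x, HasDerivAt (fun x => q.derivative.eval x) (q.derivative.derivative.eval x) x :=
      fun x => q.derivative.hasDerivAt x
    have hc : Continuous fun x => q.derivative.eval x := q.derivative.continuous
    rcases lt_trichotomy a b with h | h | h
    · obtain ⟨c, hc1, hc2⟩ := exists_hasDerivAt_eq_slope _ _ h hc.continuousOn fun x _ => hd x
      refine ⟨c, ha.trans hc1.1.le, hc1.2.le.trans (le_max_right _ _), ?_⟩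
      rw [hc2, eq_div_iff (sub_pos.2 h).ne']
      linear_combination -dquot_mul q a b
    · subst h
      exact ⟨a, ha, le_max_left _ _, dquot_self q a⟩
    · obtain ⟨c, hc1, hc2⟩ := exists_hasDerivAt_eq_slope _ _ h hc.continuousOn fun x _ => hd x
      refine ⟨c, hb.trans hc1.1.le, hc1.2.le.trans (le_max_left _ _), ?_⟩
      rw [hc2, eq_div_iff (sub_pos.2 h).ne']
      exact dquot_mul q a b
  obtain ⟨c, hc0, hc1, hc2⟩ := key
  have h1 := abs_le.1 (hq c hc0 (hc1.trans (max_le ha' hb')))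
  have h2 := hw hc1
  have h3 := hw0 c
  rw [hc2]
  constructor <;> linarith

end DividedDifference

end

section

open Polynomial

variable {ι : Type*} [Fintype ι] {μ : Measure (ℰ ι)}

theorem isHermitian_cA (ξ : ℝ × ℰ ι) : (cA μ ξ).IsHermitian := by
  ext i j
  rw [Matrix.conjTranspose_apply, cA_symm]
  rfl

variable [DecidableEq ι]

/-- Eigenvalues of the tilted covariance. -/
def eigA (μ : Measure (ℰ ι)) (ξ : ℝ × ℰ ι) : ι → ℝ :=
  (isHermitian_cA (μ := μ) ξ).eigenvalues

/-- Eigenbasis of the tilted covariance. -/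
def basA (μ : Measure (ℰ ι)) (ξ : ℝ × ℰ ι) :
    OrthonormalBasis ι ℝ (ℰ ι) :=
  (isHermitian_cA (μ := μ) ξ).eigenvectorBasis

/-- Coordinates of the tilted barycenter in the eigenbasis. -/
def alA (μ : Measure (ℰ ι)) (ξ : ℝ × ℰ ι) (i : ι) : ℝ :=
  ∑ k, basA μ ξ i k * ba μ k ξ

theorem inner_basA_sub (ξ : ℝ × ℰ ι) (i : ι) (x : ℰ ι) :
    inner ℝ (basA μ ξ i) x - alA μ ξ i = ∑ k, basA μ ξ i k * (x k - ba μ k ξ) := by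
  simp only [PiLp.inner_apply, alA, ← sum_sub_distrib]
  refine sum_congr rfl fun k _ => ?_
  simp
  ring

variable [IsProbabilityMeasure μ] {R : ℝ}

theorem integral_centered (hR : ∀ᵐ x ∂μ, ‖x‖ ≤ R) (ξ : ℝ × ℰ ι) (k : ι) :
    ∫ x, (x k - ba μ k ξ) ∂(nuT μ ξ) = 0 := by
  have := isProbabilityMeasure_nuT hR ξ
  rw [integral_sub (EssBdd.of_continuous (nuT_bdd hR ξ) (by fun_prop)).integrable
    (integrable_const _), integral_nuT]
  simp [ba]

theorem integral_centered_mul (hR : ∀ᵐ x ∂μ, ‖x‖ ≤ R) (ξ : ℝ × ℰ ι) (k l : ι) :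
    ∫ x, (x k - ba μ k ξ) * (x l - ba μ l ξ) ∂(nuT μ ξ) = cA μ ξ k l := by
  have := isProbabilityMeasure_nuT hR ξ
  have h : ∀ x : ℰ ι, (x k - ba μ k ξ) * (x l - ba μ l ξ) =
      x k * x l - (ba μ l ξ * (x k - ba μ k ξ) + ba μ k ξ * x l) := fun x => by ring
  simp only [h]
  have hb := nuT_bdd hR ξ
  rw [integral_sub (EssBdd.of_continuous hb (by fun_prop)).integrable
    (EssBdd.of_continuous hb (by fun_prop)).integrable,
    integral_add (EssBdd.of_continuous hb (by fun_prop)).integrable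
    (EssBdd.of_continuous hb (by fun_prop)).integrable, integral_const_mul, integral_const_mul,
    integral_centered hR, integral_nuT, integral_nuT]
  simp [cA, ba]

theorem integral_basA (hR : ∀ᵐ x ∂μ, ‖x‖ ≤ R) (ξ : ℝ × ℰ ι) (i : ι) :
    ∫ x, (inner ℝ (basA μ ξ i) x - alA μ ξ i) ∂(nuT μ ξ) = 0 := by
  have := isProbabilityMeasure_nuT hR ξ
  simp only [inner_basA_sub]
  rw [integral_finsetSum _ fun k _ =>
    (EssBdd.of_continuous (nuT_bdd hR ξ) (by fun_prop)).integrable]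
  simp only [integral_const_mul, integral_centered hR, mul_zero, Finset.sum_const_zero]

theorem integral_basA_weight (hR : ∀ᵐ x ∂μ, ‖x‖ ≤ R) (ξ : ℝ × ℰ ι)
    {h : ℰ ι → ℝ} (hh : Continuous h) (i j : ι) :
    ∫ x, (inner ℝ (basA μ ξ i) x - alA μ ξ i) * (inner ℝ (basA μ ξ j) x - alA μ ξ j) * h x
      ∂(nuT μ ξ) = (isHermitian_cA (μ := μ) ξ).conj (Matrix.of fun a b =>
        ∫ x, (x a - ba μ a ξ) * (x b - ba μ b ξ) * h x ∂(nuT μ ξ)) i j := by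
  have := isProbabilityMeasure_nuT hR ξ
  have hb := nuT_bdd hR ξ
  rw [Matrix.IsHermitian.conj_apply]
  have h1 : ∀ x : ℰ ι,
      (inner ℝ (basA μ ξ i) x - alA μ ξ i) * (inner ℝ (basA μ ξ j) x - alA μ ξ j) * h x =
      ∑ b, ∑ a, basA μ ξ i a * basA μ ξ j b * ((x a - ba μ a ξ) * (x b - ba μ b ξ) * h x) := by
    intro x
    rw [inner_basA_sub, inner_basA_sub, Finset.sum_mul_sum, sum_mul, sum_comm]
    refine sum_congr rfl fun a _ => ?_
    rw [sum_mul]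
    exact sum_congr rfl fun b _ => by ring
  simp only [h1]
  rw [integral_finsetSum _ fun k _ => (EssBdd.of_continuous hb (by fun_prop)).integrable]
  refine sum_congr rfl fun b _ => ?_
  rw [integral_finsetSum _ fun k _ => (EssBdd.of_continuous hb (by fun_prop)).integrable]
  refine sum_congr rfl fun a _ => ?_
  rw [integral_const_mul]
  simp only [Matrix.of_apply, basA]
  ring

theorem integral_basA_mul (hR : ∀ᵐ x ∂μ, ‖x‖ ≤ R) (ξ : ℝ × ℰ ι) (i j : ι) :
    ∫ x, (inner ℝ (basA μ ξ i) x - alA μ ξ i) * (inner ℝ (basA μ ξ j) x - alA μ ξ j)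
      ∂(nuT μ ξ) = if i = j then eigA μ ξ i else 0 := by
  have h := integral_basA_weight hR ξ (h := fun _ => 1) continuous_const i j
  simp only [mul_one, integral_centered_mul hR] at h
  rw [h]
  exact Matrix.IsHermitian.conj_self _ i j

/-- Third moments in the eigenbasis. -/
def tA (μ : Measure (ℰ ι)) (ξ : ℝ × ℰ ι) (i j k : ι) : ℝ :=
  ∫ x, (inner ℝ (basA μ ξ i) x - alA μ ξ i) * (inner ℝ (basA μ ξ j) x - alA μ ξ j) *
    (inner ℝ (basA μ ξ k) x - alA μ ξ k) ∂(nuT μ ξ)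

theorem conj_cT (hR : ∀ᵐ x ∂μ, ‖x‖ ≤ R) (ξ : ℝ × ℰ ι) (l i j : ι) :
    (isHermitian_cA (μ := μ) ξ).conj (cT μ l ξ) i j =
      ∫ x, (inner ℝ (basA μ ξ i) x - alA μ ξ i) * (inner ℝ (basA μ ξ j) x - alA μ ξ j) *
        (x l - ba μ l ξ) ∂(nuT μ ξ) := by
  rw [integral_basA_weight hR ξ (by fun_prop)]
  congr 1
  ext a b
  rw [cT_eq hR, Matrix.of_apply, integral_nuT]

theorem sum_conj_cT_sq (hR : ∀ᵐ x ∂μ, ‖x‖ ≤ R) (ξ : ℝ × ℰ ι) (i j : ι) :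
    ∑ l, (isHermitian_cA (μ := μ) ξ).conj (cT μ l ξ) i j *
      (isHermitian_cA (μ := μ) ξ).conj (cT μ l ξ) j i = ∑ k, tA μ ξ i j k ^ 2 := by
  have := isProbabilityMeasure_nuT hR ξ
  have hb := nuT_bdd hR ξ
  set v : ℰ ι := WithLp.toLp 2 fun l =>
    (isHermitian_cA (μ := μ) ξ).conj (cT μ l ξ) i j with hv
  have h := (basA μ ξ).sum_sq_norm_inner_right v
  have h2 : ∀ k, inner ℝ (basA μ ξ k) v = tA μ ξ i j k := by
    intro k
    unfold tA
    simp only [inner_basA_sub ξ k, mul_sum]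
    rw [integral_finsetSum _ fun k _ => (EssBdd.of_continuous hb (by fun_prop)).integrable]
    rw [PiLp.inner_apply]
    refine sum_congr rfl fun l _ => ?_
    simp only [mul_left_comm _ (basA μ ξ k l), integral_const_mul, ← conj_cT hR]
    simp [hv, mul_comm]
  simp only [h2, norm_eq_abs, sq_abs] at h
  rw [h, EuclideanSpace.norm_sq_eq]
  refine sum_congr rfl fun l _ => ?_
  have h3 : (isHermitian_cA (μ := μ) ξ).conj (cT μ l ξ) j i =
      (isHermitian_cA (μ := μ) ξ).conj (cT μ l ξ) i j := by
    rw [conj_cT hR, conj_cT hR]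
    congr 1; ext x; ring
  rw [h3]
  simp [hv, sq]

theorem eigA_nonneg (hR : ∀ᵐ x ∂μ, ‖x‖ ≤ R) (ξ : ℝ × ℰ ι) (i : ι) :
    0 ≤ eigA μ ξ i := by
  have h := integral_basA_mul hR ξ i i
  rw [if_pos rfl] at h
  rw [← h]
  exact integral_nonneg fun x => mul_self_nonneg _

theorem eigA_le_sq (hR : ∀ᵐ x ∂μ, ‖x‖ ≤ R) (ξ : ℝ × ℰ ι) (i : ι) :
    eigA μ ξ i ≤ R ^ 2 := by
  have := isProbabilityMeasure_nuT hR ξ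
  have hb := nuT_bdd hR ξ
  have h := integral_basA_mul hR ξ i i
  rw [if_pos rfl] at h
  have h0 := integral_basA hR ξ i
  have h1 : ∀ x : ℰ ι,
      (inner ℝ (basA μ ξ i) x - alA μ ξ i) * (inner ℝ (basA μ ξ i) x - alA μ ξ i) =
      (inner ℝ (basA μ ξ i) x) ^ 2 -
        (2 * alA μ ξ i * (inner ℝ (basA μ ξ i) x - alA μ ξ i) + alA μ ξ i ^ 2) :=
    fun x => by ring
  simp only [h1] at h
  rw [integral_sub (EssBdd.of_continuous hb (by fun_prop)).integrable
    (EssBdd.of_continuous hb (by fun_prop)).integrable,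
    integral_add (EssBdd.of_continuous hb (by fun_prop)).integrable
    (integrable_const _), integral_const_mul, h0] at h
  simp only [mul_zero, zero_add, integral_const, probReal_univ, smul_eq_mul, one_mul] at h
  have h2 : ∫ x, (inner ℝ (basA μ ξ i) x) ^ 2 ∂(nuT μ ξ) ≤ ∫ x, R ^ 2 ∂(nuT μ ξ) := by
    refine integral_mono_ae (EssBdd.of_continuous hb (by fun_prop)).integrable
      (integrable_const _) ?_
    filter_upwards [hb] with x hx
    have h3 := abs_real_inner_le_norm (basA μ ξ i) x
    rw [(basA μ ξ).norm_eq_one, one_mul] at h3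
    exact sq_le_sq' (by linarith [(abs_le.1 h3).1]) (by linarith [(abs_le.1 h3).2])
  simp at h2
  nlinarith [sq_nonneg (alA μ ξ i)]

theorem eigA_le_inv (hR : ∀ᵐ x ∂μ, ‖x‖ ≤ R) {f : ℰ ι → ℝ} (hfm : Measurable f)
    (hf : StrongLC 0 f) (hμ : μ = volume.withDensity fun x => ofReal (f x))
    {ξ : ℝ × ℰ ι} (hξ : 0 < ξ.1) (i : ι) : eigA μ ξ i ≤ 1 / ξ.1 :=
  have := isProbabilityMeasure_nuT hR ξ
  eigenvalue_le hξ (measurable_fT hfm ξ) (strongLC_fT hR hf ξ)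
    (nuT_eq_withDensity hfm hf.1 hμ ξ) (nuT_bdd hR ξ) (integral_basA hR ξ)
    (integral_basA_mul hR ξ) i

theorem tA_sum_le (hR : ∀ᵐ x ∂μ, ‖x‖ ≤ R) {f : ℰ ι → ℝ} (hfm : Measurable f)
    (hf : StrongLC 0 f) (hμ : μ = volume.withDensity fun x => ofReal (f x))
    {ξ : ℝ × ℰ ι} (hξ : 0 < ξ.1) (i : ι) :
    ∑ j, ∑ k, (if eigA μ ξ j ≤ eigA μ ξ i ∧ eigA μ ξ k ≤ eigA μ ξ i then tA μ ξ i j k ^ 2 else 0)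
      ≤ 4 * eigA μ ξ i ^ 2 * √(eigA μ ξ i / ξ.1) :=
  have := isProbabilityMeasure_nuT hR ξ
  third_moment_le hξ (measurable_fT hfm ξ) (strongLC_fT hR hf ξ)
    (nuT_eq_withDensity hfm hf.1 hμ ξ) (nuT_bdd hR ξ) (integral_basA hR ξ)
    (integral_basA_mul hR ξ) i

omit [DecidableEq ι] [IsProbabilityMeasure μ] in
theorem sum_max_le [DecidableEq ι] {T : ι → ι → ι → ℝ} (h12 : ∀ i j k, T i j k = T j i k)
    (h23 : ∀ i j k, T i j k = T i k j) {lam : ι → ℝ} {W : ℝ → ℝ} (hW0 : ∀ x, 0 ≤ W x)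
    (hW : Monotone W) :
    ∑ i, ∑ j, W (max (lam i) (lam j)) * ∑ k, T i j k ^ 2 ≤
      3 * ∑ i, W (lam i) *
        ∑ j, ∑ k, (if lam j ≤ lam i ∧ lam k ≤ lam i then T i j k ^ 2 else 0) := by
  set F : ι → ι → ι → ℝ := fun i j k =>
    W (lam i) * (if lam j ≤ lam i ∧ lam k ≤ lam i then T i j k ^ 2 else 0) with hF
  have hF0 : ∀ i j k, 0 ≤ F i j k := fun i j k => by
    simp only [hF]
    refine mul_nonneg (hW0 _) ?_
    split_ifs <;> positivity
  have key : ∀ i j k, W (max (lam i) (lam j)) * T i j k ^ 2 ≤ F i j k + F j i k + F k i j := by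
    intro i j k
    have ha := hF0 i j k
    have hb := hF0 j i k
    have hc := hF0 k i j
    have e1 : F i j k = W (lam i) * (if lam j ≤ lam i ∧ lam k ≤ lam i then T i j k ^ 2 else 0) :=
      rfl
    have e2 : F j i k = W (lam j) * (if lam i ≤ lam j ∧ lam k ≤ lam j then T i j k ^ 2 else 0) := by
      simp only [hF, h12 j i k]
    have e3 : F k i j = W (lam k) * (if lam i ≤ lam k ∧ lam j ≤ lam k then T i j k ^ 2 else 0) := by
      simp only [hF, h12 k i j, h23 i k j]
    have hT := sq_nonneg (T i j k)
    by_cases h1 : lam j ≤ lam i ∧ lam k ≤ lam i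
    · rw [if_pos h1] at e1
      rw [max_eq_left h1.1]
      linarith
    by_cases h2 : lam i ≤ lam j ∧ lam k ≤ lam j
    · rw [if_pos h2] at e2
      rw [max_eq_right h2.1]
      linarith
    have h3 : lam i ≤ lam k ∧ lam j ≤ lam k := by
      rcases le_total (lam i) (lam j) with h | h
      · have : lam j < lam k := lt_of_not_ge fun h' => h2 ⟨h, h'⟩
        exact ⟨h.trans this.le, this.le⟩
      · have : lam i < lam k := lt_of_not_ge fun h' => h1 ⟨h, h'⟩
        exact ⟨this.le, h.trans this.le⟩
    rw [if_pos h3] at e3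
    have := mul_le_mul_of_nonneg_right (hW (max_le h3.1 h3.2)) hT
    linarith
  have hS : ∑ i, W (lam i) * ∑ j, ∑ k, (if lam j ≤ lam i ∧ lam k ≤ lam i then T i j k ^ 2 else 0)
      = ∑ i, ∑ j, ∑ k, F i j k := by
    simp only [hF, mul_sum]
  have h2 : ∑ i, ∑ j, ∑ k, F j i k = ∑ i, ∑ j, ∑ k, F i j k := sum_comm
  have h3 : ∑ i, ∑ j, ∑ k, F k i j = ∑ i, ∑ j, ∑ k, F i j k := by
    calc _ = ∑ i, ∑ k, ∑ j, F k i j := sum_congr rfl fun i _ => sum_comm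
      _ = _ := sum_comm
  calc _ ≤ ∑ i, ∑ j, ∑ k, (F i j k + F j i k + F k i j) := by
        refine sum_le_sum fun i _ => sum_le_sum fun j _ => ?_
        rw [mul_sum]
        exact sum_le_sum fun k _ => key i j k
    _ = _ := by
        simp only [sum_add_distrib]
        rw [hS, h2, h3]
        ring

end

section

open Polynomial

variable {ι : Type*} [Fintype ι] [DecidableEq ι] {μ : Measure (ℰ ι)}

/-- The trace of a polynomial of the tilted covariance. -/
def trP (μ : Measure (ℰ ι)) (q : ℝ[X]) (ξ : ℝ × ℰ ι) : ℝ :=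
  ∑ m ∈ q.support, q.coeff m * (cA μ ξ ^ m).trace

theorem trP_eq (q : ℝ[X]) (ξ : ℝ × ℰ ι) :
    trP μ q ξ = ∑ i, q.eval (eigA μ ξ i) := by
  simp only [trP, (isHermitian_cA (μ := μ) ξ).trace_pow_eq, eval_eq_sum, Polynomial.sum_def,
    mul_sum]
  exact sum_comm

variable [IsProbabilityMeasure μ] {R : ℝ}

theorem trace_pow_mem (hR : ∀ᵐ x ∂μ, ‖x‖ ≤ R) (m : ℕ) :
    (fun ξ => (cA μ ξ ^ m).trace) ∈ tmAlg μ sx := by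
  have h : ∀ i j, (fun ξ => (cA μ ξ ^ m) i j) ∈ tmAlg μ sx := by
    induction m with
    | zero =>
      intro i j
      simp only [pow_zero]
      exact (tmAlg μ sx).algebraMap_mem ((1 : Matrix ι ι ℝ) i j)
    | succ m ih =>
      intro i j
      simp only [pow_succ, Matrix.mul_apply]
      exact tmAlg_finsetSum _ fun k _ => mul_mem (ih i k) (cA_mem hR k j)
  simp only [Matrix.trace, Matrix.diag]
  exact tmAlg_finsetSum _ fun i _ => h i i

theorem trP_mem (hR : ∀ᵐ x ∂μ, ‖x‖ ≤ R) (q : ℝ[X]) : trP μ q ∈ tmAlg μ sx :=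
  tmAlg_finsetSum _ fun m _ => mul_mem ((tmAlg μ sx).algebraMap_mem (q.coeff m))
    (trace_pow_mem hR m)

omit [DecidableEq ι] [IsProbabilityMeasure μ] in
theorem genL_sum_const_mul {α : Type*} (s : Finset α) (c : α → ℝ)
    {f : α → ℝ × ℰ ι → ℝ} (hf : ∀ a, ContDiff ℝ ∞ (f a))
    (ξ : ℝ × ℰ ι) :
    genL μ (fun ξ => ∑ a ∈ s, c a * f a ξ) ξ = ∑ a ∈ s, c a * genL μ (f a) ξ := by
  have hd : ∀ (g : α → ℝ × ℰ ι → ℝ), (∀ a, ContDiff ℝ ∞ (g a)) → ∀ v,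
      dd v (fun ξ => ∑ a ∈ s, c a * g a ξ) = fun ξ => ∑ a ∈ s, c a * dd v (g a) ξ := by
    intro g hg v
    rw [dd_sum fun a _ => contDiff_const.mul (hg a)]
    ext η
    refine sum_congr rfl fun a _ => ?_
    rw [dd_const_mul (hg a)]
  unfold genL heat
  have h1 : ∀ i : ι, dd (ve i) (dd (ve i) fun ξ => ∑ a ∈ s, c a * f a ξ) ξ =
      ∑ a ∈ s, c a * dd (ve i) (dd (ve i) (f a)) ξ := by
    intro i
    rw [hd f hf, hd _ fun a => (hf a).dd _]
  simp only [h1]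
  simp only [hd f hf, mul_sum, mul_add, sum_add_distrib]
  rw [sum_comm (s := Finset.univ), sum_comm (s := Finset.univ)]
  congr 1
  · congr 1
    exact sum_congr rfl fun a _ => sum_congr rfl fun i _ => by ring
  · exact sum_congr rfl fun a _ => sum_congr rfl fun i _ => by ring

theorem genL_trP (hR : ∀ᵐ x ∂μ, ‖x‖ ≤ R) (q : ℝ[X]) (ξ : ℝ × ℰ ι) :
    genL μ (trP μ q) ξ = -(∑ i, eigA μ ξ i ^ 2 * q.derivative.eval (eigA μ ξ i)) +
      1 / 2 * ∑ i, ∑ j, dquot q (eigA μ ξ i) (eigA μ ξ j) * ∑ k, tA μ ξ i j k ^ 2 := by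
  have h0 : genL μ (trP μ q) ξ =
      ∑ m ∈ q.support, q.coeff m * genL μ (fun ξ => (cA μ ξ ^ m).trace) ξ :=
    genL_sum_const_mul _ _ (fun m => ((cA_smooth hR).pow m).trace) ξ
  rw [h0]
  simp only [genL_trace_pow hR, (isHermitian_cA (μ := μ) ξ).trace_pow_eq,
    (isHermitian_cA (μ := μ) ξ).trace_pow_mul_pow_mul]
  have h1 : ∀ m, (∑ k, ∑ p ∈ Finset.range (m - 1), ∑ i, ∑ j,
      (isHermitian_cA (μ := μ) ξ).eigenvalues i ^ p *
      (isHermitian_cA (μ := μ) ξ).eigenvalues j ^ (m - 2 - p) *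
      ((isHermitian_cA (μ := μ) ξ).conj (cT μ k ξ) i j *
      (isHermitian_cA (μ := μ) ξ).conj (cT μ k ξ) j i)) =
      ∑ i, ∑ j, (∑ p ∈ Finset.range (m - 1), eigA μ ξ i ^ p * eigA μ ξ j ^ (m - 2 - p)) *
        ∑ k, tA μ ξ i j k ^ 2 := by
    intro m
    simp only [← sum_conj_cT_sq hR]
    calc _ = ∑ k, ∑ i, ∑ j, ∑ p ∈ Finset.range (m - 1), eigA μ ξ i ^ p * eigA μ ξ j ^ (m - 2 - p) *
          ((isHermitian_cA (μ := μ) ξ).conj (cT μ k ξ) i j *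
          (isHermitian_cA (μ := μ) ξ).conj (cT μ k ξ) j i) := by
          refine sum_congr rfl fun k _ => ?_
          rw [sum_comm]
          exact sum_congr rfl fun i _ => sum_comm
      _ = _ := by
          rw [sum_comm]
          refine sum_congr rfl fun i _ => ?_
          rw [sum_comm]
          refine sum_congr rfl fun j _ => ?_
          rw [Finset.sum_mul_sum, sum_comm]
  simp only [h1]
  simp only [mul_add, sum_add_distrib]
  congr 1
  · simp only [derivative_eval, Polynomial.sum_def, mul_sum, ← Finset.sum_neg_distrib]
    rw [sum_comm]
    refine sum_congr rfl fun i _ => sum_congr rfl fun m _ => ?_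
    change q.coeff m * (-(_ * eigA μ ξ i ^ _)) = _
    rcases m with - | m
    · simp
    · simp only [add_tsub_cancel_right]
      ring
  · have h2 : ∀ i j, dquot q (eigA μ ξ i) (eigA μ ξ j) * ∑ k, tA μ ξ i j k ^ 2 =
        ∑ m ∈ q.support, q.coeff m * (m * ((∑ p ∈ Finset.range (m - 1),
          eigA μ ξ i ^ p * eigA μ ξ j ^ (m - 2 - p)) * ∑ k, tA μ ξ i j k ^ 2)) := by
      intro i j
      rw [dquot, sum_mul]
      exact sum_congr rfl fun m _ => by ring
    simp only [h2]
    have h3 : ∀ (G : ℕ → ι → ι → ℝ), ∑ i, ∑ j, ∑ m ∈ q.support, q.coeff m * (m * G m i j) =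
        ∑ m ∈ q.support, q.coeff m * (m * ∑ i, ∑ j, G m i j) := by
      intro G
      calc _ = ∑ i, ∑ m ∈ q.support, ∑ j, q.coeff m * (m * G m i j) :=
            sum_congr rfl fun i _ => sum_comm
        _ = ∑ m ∈ q.support, ∑ i, ∑ j, q.coeff m * (m * G m i j) := sum_comm
        _ = _ := by simp only [mul_sum]
    rw [h3, mul_sum]
    exact sum_congr rfl fun m _ => by ring

theorem genL_trP_le (hR : ∀ᵐ x ∂μ, ‖x‖ ≤ R) {f : ℰ ι → ℝ} (hfm : Measurable f)
    (hf : StrongLC 0 f) (hμ : μ = volume.withDensity fun x => ofReal (f x))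
    {ξ : ℝ × ℰ ι} (hξ : 0 < ξ.1) {q : ℝ[X]} {w : ℝ → ℝ} {ε : ℝ} (hε : 0 ≤ ε)
    (hw0 : ∀ x, 0 ≤ w x) (hw : Monotone w)
    (hq : ∀ x, 0 ≤ x → x ≤ R ^ 2 → |q.derivative.derivative.eval x - w x| ≤ ε)
    (hq0 : q.derivative.eval 0 = 0) :
    genL μ (trP μ q) ξ ≤ ∑ i, (ε * eigA μ ξ i ^ 3 +
      6 * eigA μ ξ i ^ 2 * √(eigA μ ξ i / ξ.1) * (w (eigA μ ξ i) + ε)) := by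
  have hl0 := eigA_nonneg hR ξ
  have hl1 := eigA_le_sq hR ξ
  rw [genL_trP hR]
  have h1 : -(∑ i, eigA μ ξ i ^ 2 * q.derivative.eval (eigA μ ξ i)) ≤ ∑ i, ε * eigA μ ξ i ^ 3 := by
    rw [← Finset.sum_neg_distrib]
    refine sum_le_sum fun i _ => ?_
    have h := (dquot_bounds hw0 hw hq (hl0 i) le_rfl (hl1 i) (sq_nonneg R)).1
    have h' := dquot_mul q (eigA μ ξ i) 0
    rw [hq0, sub_zero, sub_zero] at h'
    rw [← h']
    have := mul_le_mul_of_nonneg_left h (pow_nonneg (hl0 i) 3)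
    nlinarith
  have hT : ∀ i j, 0 ≤ ∑ k, tA μ ξ i j k ^ 2 := fun i j => sum_nonneg fun k _ => sq_nonneg _
  have h2 : ∑ i, ∑ j, dquot q (eigA μ ξ i) (eigA μ ξ j) * ∑ k, tA μ ξ i j k ^ 2 ≤
      ∑ i, ∑ j, (fun x => w x + ε) (max (eigA μ ξ i) (eigA μ ξ j)) * ∑ k, tA μ ξ i j k ^ 2 :=
    sum_le_sum fun i _ => sum_le_sum fun j _ => mul_le_mul_of_nonneg_right
      (dquot_bounds hw0 hw hq (hl0 i) (hl0 j) (hl1 i) (hl1 j)).2 (hT i j)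
  have h3 := sum_max_le (T := tA μ ξ) (lam := eigA μ ξ) (W := fun x => w x + ε)
    (fun i j k => by unfold tA; congr 1; ext x; ring)
    (fun i j k => by unfold tA; congr 1; ext x; ring)
    (fun x => add_nonneg (hw0 x) hε) (hw.add_const ε)
  have h4 : ∑ i, (fun x => w x + ε) (eigA μ ξ i) * ∑ j, ∑ k,
      (if eigA μ ξ j ≤ eigA μ ξ i ∧ eigA μ ξ k ≤ eigA μ ξ i then tA μ ξ i j k ^ 2 else 0) ≤
      ∑ i, (w (eigA μ ξ i) + ε) * (4 * eigA μ ξ i ^ 2 * √(eigA μ ξ i / ξ.1)) :=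
    sum_le_sum fun i _ => mul_le_mul_of_nonneg_left (tA_sum_le hR hfm hf hμ hξ i)
      (add_nonneg (hw0 _) hε)
  rw [sum_add_distrib]
  have h5 : ∑ i, 6 * eigA μ ξ i ^ 2 * √(eigA μ ξ i / ξ.1) * (w (eigA μ ξ i) + ε) =
      3 / 2 * ∑ i, (w (eigA μ ξ i) + ε) * (4 * eigA μ ξ i ^ 2 * √(eigA μ ξ i / ξ.1)) := by
    rw [mul_sum]
    exact sum_congr rfl fun i _ => by ring
  rw [h5]
  linarith

end

section

open Polynomial

variable {ι : Type*} [Fintype ι] [DecidableEq ι] {μ : Measure (ℰ ι)}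

/-- The trace of a function of the tilted covariance. -/
def trF (μ : Measure (ℰ ι)) (h : ℝ → ℝ) (ξ : ℝ × ℰ ι) : ℝ :=
  ∑ i, h (eigA μ ξ i)

variable [IsProbabilityMeasure μ] {R : ℝ}

omit [IsProbabilityMeasure μ] in
theorem trF_sub_le {h k : ℝ → ℝ} {ε : ℝ} {ξ : ℝ × ℰ ι}
    (hhk : ∀ i, |h (eigA μ ξ i) - k (eigA μ ξ i)| ≤ ε) :
    |trF μ h ξ - trF μ k ξ| ≤ Fintype.card ι * ε := by
  unfold trF
  rw [← sum_sub_distrib]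
  refine (Finset.abs_sum_le_sum_abs _ _).trans ((sum_le_sum fun i _ => hhk i).trans ?_)
  simp

theorem continuous_trF (hR : ∀ᵐ x ∂μ, ‖x‖ ≤ R) {h : ℝ → ℝ} (hh : ContinuousOn h (Icc 0 (R ^ 2))) :
    Continuous (trF μ h) := by
  refine continuous_of_uniform_approx_of_continuous fun U hU => ?_
  obtain ⟨ε, hε, hU⟩ := Metric.mem_uniformity_dist.1 hU
  obtain ⟨q, hq⟩ := exists_polynomial_near_of_continuousOn 0 (R ^ 2) h hh
    (ε / (Fintype.card ι + 1)) (by positivity)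
  refine ⟨trP μ q, (tmAlg_contDiff (essBdd_sx hR) (trP_mem hR q)).continuous, fun ξ => hU ?_⟩
  have h1 : trP μ q ξ = trF μ (fun x => q.eval x) ξ := trP_eq q ξ
  rw [h1, Real.dist_eq]
  refine (trF_sub_le (ε := ε / (Fintype.card ι + 1)) fun i => ?_).trans_lt ?_
  · rw [abs_sub_comm]
    exact (hq _ ⟨eigA_nonneg hR ξ i, eigA_le_sq hR ξ i⟩).le
  · rw [mul_div_assoc', div_lt_iff₀ (by positivity)]
    nlinarith

theorem trF_bdd (hR : ∀ᵐ x ∂μ, ‖x‖ ≤ R) {h : ℝ → ℝ} (hh : ContinuousOn h (Icc 0 (R ^ 2))) :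
    ∃ C, ∀ ξ, |trF μ h ξ| ≤ C := by
  obtain ⟨C, hC⟩ := isCompact_Icc.exists_bound_of_continuousOn hh
  refine ⟨Fintype.card ι * C, fun ξ => ?_⟩
  refine (Finset.abs_sum_le_sum_abs _ _).trans ((sum_le_sum fun i _ =>
    hC _ ⟨eigA_nonneg hR ξ i, eigA_le_sq hR ξ i⟩).trans ?_)
  simp

theorem integrable_trF (hR : ∀ᵐ x ∂μ, ‖x‖ ≤ R) {h : ℝ → ℝ} (hh : ContinuousOn h (Icc 0 (R ^ 2)))
    {t : ℝ} (ht : 0 ≤ t) :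
    Integrable fun g : ℰ ι => trF μ h (t, √t • g) * zf μ (t, √t • g) * gd g := by
  obtain ⟨C, hC⟩ := trF_bdd hR hh
  exact integrable_EE hR (continuous_trF hR hh) hC ht

omit [DecidableEq ι] in
theorem EE_mono (hR : ∀ᵐ x ∂μ, ‖x‖ ≤ R) {Φ Ψ : ℝ × ℰ ι → ℝ} {t : ℝ}
    (hΦ : Integrable fun g : ℰ ι => Φ (t, √t • g) * zf μ (t, √t • g) * gd g)
    (hΨ : Integrable fun g : ℰ ι => Ψ (t, √t • g) * zf μ (t, √t • g) * gd g)
    (h : ∀ ξ, ξ.1 = t → Φ ξ ≤ Ψ ξ) : EE μ Φ t ≤ EE μ Ψ t :=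
  integral_mono hΦ hΨ fun g => mul_le_mul_of_nonneg_right
    (mul_le_mul_of_nonneg_right (h _ rfl) (zf_pos hR _).le) (gd_pos g).le

omit [DecidableEq ι] in
theorem genL_const (c : ℝ) (ξ : ℝ × ℰ ι) : genL μ (fun _ => c) ξ = 0 := by
  unfold genL heat
  simp [dd_const]

omit [DecidableEq ι] in
theorem EE_zero (Φ : ℝ × ℰ ι → ℝ) : EE μ Φ 0 = Φ 0 := by
  have h : ∀ g : ℰ ι, Φ (0, √0 • g) * zf μ (0, √0 • g) = Φ 0 := by
    intro g
    have h1 : ((0 : ℝ), √0 • g) = 0 := by simp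
    rw [h1, zf_eq]
    simp
  unfold EE
  simp only [h]
  rw [integral_const_mul, integral_gd, mul_one]

end

section

open Polynomial

variable {ι : Type*} [Fintype ι] {μ : Measure (ℰ ι)}
variable [IsProbabilityMeasure μ] {R : ℝ}

theorem tendsto_EE_zero (hR : ∀ᵐ x ∂μ, ‖x‖ ≤ R) {Φ : ℝ × ℰ ι → ℝ}
    (hΦ : Continuous Φ) {C : ℝ} (hC : ∀ ξ, |Φ ξ| ≤ C) :
    Tendsto (EE μ Φ) (𝓝[>] 0) (𝓝 (Φ 0)) := by
  rw [← EE_zero (μ := μ) Φ]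
  have hz := (contDiff_zf hR).continuous
  have hg := (contDiff_gd (κ := ι)).continuous
  refine tendsto_integral_filter_of_dominated_convergence
    (fun g => C * (exp (|R| * √1 * ‖g‖) * gd g)) ?_ ?_ ?_ ?_
  · refine Eventually.of_forall fun t => Continuous.aestronglyMeasurable ?_
    fun_prop
  · filter_upwards [self_mem_nhdsWithin, nhdsWithin_le_nhds (Iio_mem_nhds one_pos)] with t ht ht1
    refine Eventually.of_forall fun g => ?_
    rw [norm_mul, norm_eq_abs, norm_eq_abs, abs_of_pos (gd_pos g), ← mul_assoc]
    exact mul_le_mul_of_nonneg_right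
      (abs_mul_zf_le_of_le hR hC (le_of_lt ht) (le_of_lt ht1) g) (gd_pos g).le
  · exact (integrable_exp_mul_gd _).const_mul C
  · refine Eventually.of_forall fun g => Tendsto.mono_left ?_ nhdsWithin_le_nhds
    have : Continuous fun t : ℝ => Φ (t, √t • g) * zf μ (t, √t • g) * gd g := by fun_prop
    exact this.tendsto 0

theorem EE_one (hR : ∀ᵐ x ∂μ, ‖x‖ ≤ R) {t : ℝ} (ht : 0 ≤ t) : EE μ (fun _ => 1) t = 1 := by
  rcases ht.eq_or_lt with rfl | ht
  · rw [EE_zero]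
  have h1 : (fun _ => (1 : ℝ)) ∈ tmAlg μ (sx (ι := ι)) := one_mem _
  have hd : ∀ s : ℝ, 0 < s → HasDerivAt (EE μ fun _ => 1) 0 s := by
    intro s hs
    have h := hasDerivAt_EE hR h1 hs
    have e : EE μ (genL μ fun _ => 1) s = 0 := by
      unfold EE
      simp [genL_const]
    rwa [e] at h
  have hc : ∀ s : ℝ, 0 < s → EE μ (fun _ => 1) s = EE μ (fun _ => 1) t := fun s hs =>
    isOpen_Ioi.is_const_of_deriv_eq_zero isPreconnected_Ioi
      (fun x hx => (hd x hx).differentiableAt.differentiableWithinAt)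
      (fun x hx => (hd x hx).deriv) hs ht
  have hl := tendsto_EE_zero hR (Φ := fun _ => 1) continuous_const (C := 1) (by simp)
  refine tendsto_nhds_unique (tendsto_const_nhds.congr' ?_) hl
  filter_upwards [self_mem_nhdsWithin] with s hs
  exact (hc s hs).symm

theorem EE_const (hR : ∀ᵐ x ∂μ, ‖x‖ ≤ R) (c : ℝ) {t : ℝ} (ht : 0 ≤ t) :
    EE μ (fun _ => c) t = c := by
  have h := EE_one hR ht
  unfold EE at h ⊢
  have : ∀ g : ℰ ι, c * zf μ (t, √t • g) * gd g =
      c * (1 * zf μ (t, √t • g) * gd g) := fun g => by ring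
  simp only [this]
  rw [integral_const_mul, h, mul_one]

theorem decomp_ve (v : ℝ × ℰ ι) : v = v.1 • vt + ∑ i, v.2 i • ve i := by
  classical
  refine Prod.ext ?_ ?_
  · simp [vt, ve, Prod.fst_sum]
  · rw [Prod.snd_add, Prod.snd_sum]
    simp only [Prod.smul_snd, vt, ve, smul_zero, zero_add]
    have h := (EuclideanSpace.basisFun ι ℝ).sum_repr v.2
    simpa [ee] using h.symm

theorem tmAlg_lipschitz (hR : ∀ᵐ x ∂μ, ‖x‖ ≤ R) {Φ : ℝ × ℰ ι → ℝ}
    (hΦ : Φ ∈ tmAlg μ sx) : ∃ L, 0 ≤ L ∧ ∀ ξ, |Φ ξ - Φ 0| ≤ L * ‖ξ‖ := by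
  have hb := essBdd_sx hR
  have hs := tmAlg_contDiff hb hΦ
  have hbd : ∀ v : ℝ × ℰ ι, ∃ C, ∀ ξ, |dd v Φ ξ| ≤ C := fun v =>
    tmAlg_bdd hb (tmAlg_dd hb hΦ v)
  choose C hC using hbd
  have hC0 : ∀ v, 0 ≤ C v := fun v => (abs_nonneg _).trans (hC v 0)
  set L := C vt + ∑ i, C (ve i) with hL
  have hL0 : 0 ≤ L := add_nonneg (hC0 _) (sum_nonneg fun i _ => hC0 _)
  have hf : ∀ ξ, ‖fderiv ℝ Φ ξ‖ ≤ L := by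
    intro ξ
    refine ContinuousLinearMap.opNorm_le_bound _ hL0 fun v => ?_
    conv_lhs => rw [decomp_ve v]
    rw [map_add, map_sum]
    simp only [map_smul, smul_eq_mul]
    refine (norm_add_le _ _).trans ?_
    rw [hL, add_mul, sum_mul]
    refine add_le_add ?_ ((norm_sum_le _ _).trans (sum_le_sum fun i _ => ?_))
    · rw [norm_mul, mul_comm]
      exact mul_le_mul (hC vt ξ) (norm_fst_le v) (norm_nonneg _) (hC0 _)
    · rw [norm_mul, mul_comm]
      exact mul_le_mul (hC (ve i) ξ) ((PiLp.norm_apply_le v.2 i).trans (norm_snd_le v))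
        (norm_nonneg _) (hC0 _)
  refine ⟨L, hL0, fun ξ => ?_⟩
  have := convex_univ.norm_image_sub_le_of_norm_fderiv_le (𝕜 := ℝ) (f := Φ) (C := L)
    (fun x _ => (ContDiff.differentiable_infty hs) x) (fun x _ => hf x) (mem_univ 0) (mem_univ ξ)
  simpa using this

variable [DecidableEq ι]

omit [IsProbabilityMeasure μ] in
theorem eigA_eq_quadratic (ξ : ℝ × ℰ ι) (i : ι) :
    eigA μ ξ i = ∑ b, ∑ a, basA μ ξ i a * cA μ ξ a b * basA μ ξ i b := by
  have h := (isHermitian_cA (μ := μ) ξ).conj_self i i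
  rw [if_pos rfl, Matrix.IsHermitian.conj_apply] at h
  exact h.symm

theorem eigA_le_lipschitz (hR : ∀ᵐ x ∂μ, ‖x‖ ≤ R) {c : ℝ}
    (hc : ∀ v : ℰ ι, ∑ b, ∑ a, v a * cA μ 0 a b * v b ≤ c * ‖v‖ ^ 2) :
    ∃ L, 0 ≤ L ∧ ∀ ξ i, eigA μ ξ i ≤ c + L * ‖ξ‖ := by
  choose L hL0 hL using fun a b : ι => tmAlg_lipschitz hR (cA_mem hR a b)
  refine ⟨∑ b, ∑ a, L a b, sum_nonneg fun b _ => sum_nonneg fun a _ => hL0 a b,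
    fun ξ i => ?_⟩
  rw [eigA_eq_quadratic]
  have h := hc (basA μ ξ i)
  rw [(basA μ ξ).norm_eq_one, one_pow, mul_one] at h
  have h2 : ∑ b, ∑ a, basA μ ξ i a * cA μ ξ a b * basA μ ξ i b -
      ∑ b, ∑ a, basA μ ξ i a * cA μ 0 a b * basA μ ξ i b ≤ (∑ b, ∑ a, L a b) * ‖ξ‖ := by
    rw [← sum_sub_distrib, sum_mul]
    refine sum_le_sum fun b _ => ?_
    rw [← sum_sub_distrib, sum_mul]
    refine sum_le_sum fun a _ => ?_
    have hn : ∀ a, |basA μ ξ i a| ≤ 1 := fun a => by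
      have := PiLp.norm_apply_le (basA μ ξ i) a
      rwa [(basA μ ξ).norm_eq_one, norm_eq_abs] at this
    calc _ = basA μ ξ i a * (cA μ ξ a b - cA μ 0 a b) * basA μ ξ i b := by ring
      _ ≤ |basA μ ξ i a * (cA μ ξ a b - cA μ 0 a b) * basA μ ξ i b| := le_abs_self _
      _ = |basA μ ξ i a| * |cA μ ξ a b - cA μ 0 a b| * |basA μ ξ i b| := by rw [abs_mul, abs_mul]
      _ ≤ 1 * |cA μ ξ a b - cA μ 0 a b| * 1 := by
        refine mul_le_mul (mul_le_mul_of_nonneg_right (hn a) (abs_nonneg _)) (hn b)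
          (abs_nonneg _) (by positivity)
      _ ≤ _ := by rw [one_mul, mul_one]; exact hL a b ξ
  linarith

/-- Initial smallness of spectral sums vanishing to high order at the top eigenvalue. -/
theorem EE_trF_small (hR : ∀ᵐ x ∂μ, ‖x‖ ≤ R) {c : ℝ}
    (hc : ∀ v : ℰ ι, ∑ b, ∑ a, v a * cA μ 0 a b * v b ≤ c * ‖v‖ ^ 2)
    {u : ℝ → ℝ} (hu : Continuous u) (m : ℕ) (hum : ∀ x, 0 ≤ x → u x ≤ (max (x - c) 0) ^ (2 * m)) :
    ∃ D, ∀ s, 0 < s → s ≤ 1 → EE μ (trF μ u) s ≤ D * s ^ m := by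
  obtain ⟨L, hL0, hL⟩ := eigA_le_lipschitz hR hc
  set K := L ^ (2 * m) * (2 * m).factorial * exp 1 with hK
  have hK0 : 0 ≤ K := by positivity
  refine ⟨∫ g : ℰ ι, Fintype.card ι * K * (exp ((1 + |R|) * ‖g‖) * gd g),
    fun s hs hs1 => ?_⟩
  rw [← integral_mul_const]
  refine integral_mono (integrable_trF hR hu.continuousOn hs.le)
    (((integrable_exp_mul_gd _).const_mul _).mul_const _) fun g => ?_
  have hsq : s ≤ √s := by
    rw [Real.le_sqrt' hs]; nlinarith
  have hsq1 : √s ≤ 1 := Real.sqrt_le_one.2 hs1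
  have hn : ‖((s, √s • g) : ℝ × ℰ ι)‖ ≤ √s * (1 + ‖g‖) := by
    rw [Prod.norm_mk, norm_smul, norm_eq_abs, norm_eq_abs, abs_of_pos hs,
      abs_of_nonneg (Real.sqrt_nonneg s)]
    refine max_le ?_ ?_ <;> nlinarith [norm_nonneg g, Real.sqrt_nonneg s]
  have h1 : trF μ u (s, √s • g) ≤ Fintype.card ι * (K * exp ‖g‖ * s ^ m) := by
    unfold trF
    refine (Finset.sum_le_card_nsmul _ _ (K * exp ‖g‖ * s ^ m) fun i _ => ?_).trans ?_
    · refine (hum _ (eigA_nonneg hR _ _)).trans ?_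
      have h2 : max (eigA μ (s, √s • g) i - c) 0 ≤ L * (√s * (1 + ‖g‖)) := by
        refine max_le ?_ (by positivity)
        have := hL (s, √s • g) i
        have := mul_le_mul_of_nonneg_left hn hL0
        linarith
      have h3 : (1 + ‖g‖) ^ (2 * m) ≤ (2 * m).factorial * exp (1 + ‖g‖) := by
        have := Real.pow_div_factorial_le_exp (1 + ‖g‖) (by positivity) (2 * m)
        rwa [div_le_iff₀' (by positivity)] at this
      calc _ ≤ (L * (√s * (1 + ‖g‖))) ^ (2 * m) := pow_le_pow_left₀ (le_max_right _ _) h2 _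
        _ = L ^ (2 * m) * s ^ m * (1 + ‖g‖) ^ (2 * m) := by
          rw [mul_pow, mul_pow, pow_mul (√s), Real.sq_sqrt hs.le]; ring
        _ ≤ L ^ (2 * m) * s ^ m * ((2 * m).factorial * exp (1 + ‖g‖)) :=
          mul_le_mul_of_nonneg_left h3 (by positivity)
        _ = _ := by rw [hK, exp_add]; ring
    · rw [Finset.card_univ, nsmul_eq_mul]
  have hz : zf μ (s, √s • g) ≤ exp (|R| * ‖g‖) := by
    refine (zf_le hR (ξ := (s, √s • g)) hs.le).trans (Real.exp_le_exp.2 ?_)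
    simp only [norm_smul, norm_eq_abs, abs_of_nonneg (Real.sqrt_nonneg s)]
    have := le_abs_self R
    have h5 := norm_nonneg g
    have h6 := abs_nonneg R
    have h7 : √s * ‖g‖ ≤ ‖g‖ := by nlinarith
    calc R * (√s * ‖g‖) ≤ |R| * (√s * ‖g‖) := mul_le_mul_of_nonneg_right this (by positivity)
      _ ≤ _ := mul_le_mul_of_nonneg_left h7 h6
  have hz0 := zf_pos hR (s, √s • g)
  calc _ ≤ (Fintype.card ι * (K * exp ‖g‖ * s ^ m)) * zf μ (s, √s • g) * gd g :=
        mul_le_mul_of_nonneg_right (mul_le_mul_of_nonneg_right h1 hz0.le) (gd_pos g).le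
    _ ≤ (Fintype.card ι * (K * exp ‖g‖ * s ^ m)) * exp (|R| * ‖g‖) * gd g :=
        mul_le_mul_of_nonneg_right (mul_le_mul_of_nonneg_left hz (by positivity)) (gd_pos g).le
    _ = _ := by
      rw [add_mul, one_mul, exp_add]; ring

end

section

open Polynomial

theorem nonneg_of_second_deriv_nonneg {h h1 h2 : ℝ → ℝ} {a b : ℝ}
    (hd : ∀ x, HasDerivAt h (h1 x) x) (hd1 : ∀ x, HasDerivAt h1 (h2 x) x)
    (h0 : 0 ≤ h a) (h10 : 0 ≤ h1 a) (hn : ∀ x ∈ Icc a b, 0 ≤ h2 x) :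
    ∀ x ∈ Icc a b, 0 ≤ h x := by
  have m1 : MonotoneOn h1 (Icc a b) :=
    monotoneOn_of_deriv_nonneg (convex_Icc a b) (fun x _ => (hd1 x).continuousAt.continuousWithinAt)
      (fun x _ => (hd1 x).differentiableAt.differentiableWithinAt)
      fun x hx => by rw [(hd1 x).deriv]; exact hn x (interior_subset hx)
  have m0 : MonotoneOn h (Icc a b) :=
    monotoneOn_of_deriv_nonneg (convex_Icc a b) (fun x _ => (hd x).continuousAt.continuousWithinAt)
      (fun x _ => (hd x).differentiableAt.differentiableWithinAt)
      fun x hx => by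
        rw [(hd x).deriv]
        have hx' := interior_subset hx
        exact h10.trans (m1 (left_mem_Icc.2 (hx'.1.trans hx'.2)) hx' hx'.1)
  intro x hx
  exact h0.trans (m0 (left_mem_Icc.2 (hx.1.trans hx.2)) hx hx.1)

/-- The second derivative of the growth function. -/
def gw (c : ℝ) (p : ℕ) (x : ℝ) : ℝ := min ((max (x - c) 0) ^ p) 1

/-- The first derivative of the growth function. -/
def gu1 (c : ℝ) (p : ℕ) (x : ℝ) : ℝ := ∫ s in (0 : ℝ)..x, gw c p s

/-- The growth function. -/
def gu (c : ℝ) (p : ℕ) (x : ℝ) : ℝ := ∫ s in (0 : ℝ)..x, gu1 c p s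

variable {c : ℝ} {p : ℕ}

theorem continuous_gw : Continuous (gw c p) := by unfold gw; fun_prop

theorem gw_nonneg (x : ℝ) : 0 ≤ gw c p x := le_min (pow_nonneg (le_max_right _ _) _) zero_le_one

theorem gw_monotone : Monotone (gw c p) := fun x y h =>
  min_le_min (pow_le_pow_left₀ (le_max_right _ _) (max_le_max (by linarith) le_rfl) _) le_rfl

theorem hasDerivAt_gu1 (x : ℝ) : HasDerivAt (gu1 c p) (gw c p x) x :=
  continuous_gw.integral_hasStrictDerivAt 0 x |>.hasDerivAt

theorem continuous_gu1 : Continuous (gu1 c p) :=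
  continuous_iff_continuousAt.2 fun x => (hasDerivAt_gu1 x).continuousAt

theorem hasDerivAt_gu (x : ℝ) : HasDerivAt (gu c p) (gu1 c p x) x :=
  continuous_gu1.integral_hasStrictDerivAt 0 x |>.hasDerivAt

theorem continuous_gu : Continuous (gu c p) :=
  continuous_iff_continuousAt.2 fun x => (hasDerivAt_gu x).continuousAt

theorem gu_zero : gu c p 0 = 0 := by simp [gu]

theorem gu1_zero : gu1 c p 0 = 0 := by simp [gu1]

theorem gu1_nonneg {x : ℝ} (hx : 0 ≤ x) : 0 ≤ gu1 c p x :=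
  intervalIntegral.integral_nonneg hx fun s _ => gw_nonneg s

theorem gu_nonneg {x : ℝ} (hx : 0 ≤ x) : 0 ≤ gu c p x :=
  intervalIntegral.integral_nonneg hx fun s hs => gu1_nonneg hs.1

theorem hasDerivAt_max_pow (m : ℕ) (c x : ℝ) :
    HasDerivAt (fun x => (max (x - c) 0) ^ (m + 2)) ((m + 2) * (max (x - c) 0) ^ (m + 1)) x := by
  rcases lt_trichotomy x c with h | h | h
  · have e : (fun x => (max (x - c) 0) ^ (m + 2)) =ᶠ[𝓝 x] fun _ => 0 := by
      filter_upwards [Iio_mem_nhds h] with y hy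
      rw [max_eq_right (sub_nonpos.2 (le_of_lt hy))]; simp
    rw [max_eq_right (by linarith)]
    simpa using (hasDerivAt_const x (0 : ℝ)).congr_of_eventuallyEq e
  · subst h
    rw [sub_self, max_self, zero_pow (by omega), mul_zero, hasDerivAt_iff_isLittleO]
    simp only [sub_self, max_self, smul_zero, sub_zero]
    rw [zero_pow (by omega)]
    simp only [sub_zero]
    have h1 : (fun y : ℝ => (max (y - x) 0) ^ (m + 2)) =O[𝓝 x] fun y => (y - x) ^ (m + 2) := by
      refine Asymptotics.IsBigO.of_bound 1 (Eventually.of_forall fun y => ?_)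
      rw [norm_pow, norm_pow, one_mul]
      refine pow_le_pow_left₀ (norm_nonneg _) ?_ _
      rw [norm_eq_abs, abs_of_nonneg (le_max_right _ _), norm_eq_abs]
      exact max_le (le_abs_self _) (abs_nonneg _)
    refine h1.trans_isLittleO ?_
    have h2 : Tendsto (fun y : ℝ => y - x) (𝓝 x) (𝓝 0) := by
      have : Continuous fun y : ℝ => y - x := by fun_prop
      simpa using this.tendsto x
    exact (Asymptotics.isLittleO_pow_id (n := m + 2) (by omega)).comp_tendsto h2
  · have e : (fun x => (max (x - c) 0) ^ (m + 2)) =ᶠ[𝓝 x] fun x => (x - c) ^ (m + 2) := by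
      filter_upwards [Ioi_mem_nhds h] with y hy
      rw [max_eq_left (sub_nonneg.2 (le_of_lt hy))]
    rw [max_eq_left (by linarith)]
    have := ((hasDerivAt_id x).sub_const c).pow (m + 2)
    have e2 : ((m + 2 : ℕ) : ℝ) * (id x - c) ^ (m + 2 - 1) * 1 = (m + 2) * (x - c) ^ (m + 1) := by
      simp
    rw [e2] at this
    exact HasDerivAt.congr_of_eventuallyEq this e

theorem gu_le (hc : 0 ≤ c) (hp : 1 ≤ p) {x : ℝ} (hx : 0 ≤ x) : gu c p x ≤ (max (x - c) 0) ^ (p + 2) := by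
  obtain ⟨m, rfl⟩ := Nat.exists_eq_add_of_le' hp
  have h1 : ∀ x, HasDerivAt (fun x => (max (x - c) 0) ^ (m + 1 + 2) - gu c (m + 1) x)
      (((m + 1 : ℕ) + 2) * (max (x - c) 0) ^ (m + 1 + 1) - gu1 c (m + 1) x) x := fun x =>
    (hasDerivAt_max_pow (m + 1) c x).sub (hasDerivAt_gu x)
  have h2 : ∀ x, HasDerivAt (fun x => ((m + 1 : ℕ) + 2) * (max (x - c) 0) ^ (m + 1 + 1) -
      gu1 c (m + 1) x) (((m + 1 : ℕ) + 2) * ((m + 2) * (max (x - c) 0) ^ (m + 1)) -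
      gw c (m + 1) x) x := fun x =>
    ((hasDerivAt_max_pow m c x).const_mul _).sub (hasDerivAt_gu1 x)
  have h := nonneg_of_second_deriv_nonneg (a := 0) (b := x) h1 h2
    (by rw [gu_zero, max_eq_right (by linarith)]; simp)
    (by rw [gu1_zero, max_eq_right (by linarith)]; simp) (fun y hy => by
      have h3 : gw c (m + 1) y ≤ (max (y - c) 0) ^ (m + 1) := min_le_left _ _
      have h4 : 0 ≤ (max (y - c) 0) ^ (m + 1) := pow_nonneg (le_max_right _ _) _
      have h5 : (1 : ℝ) ≤ ((m + 1 : ℕ) + 2) * (m + 2) := by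
        push_cast
        nlinarith [(Nat.cast_nonneg m : (0 : ℝ) ≤ m)]
      nlinarith) x ⟨hx, le_rfl⟩
  linarith

theorem le_gu (hc : 0 ≤ c) (hp : 1 ≤ p) {x : ℝ} (hx : c ≤ x) (hx1 : x ≤ c + 1) :
    (x - c) ^ (p + 2) ≤ ((p + 1) * (p + 2)) * gu c p x := by
  obtain ⟨m, rfl⟩ := Nat.exists_eq_add_of_le' hp
  have hq : (0 : ℝ) < ((m + 1 : ℕ) + 1) * ((m + 1 : ℕ) + 2) := by positivity
  have h1 : ∀ x, HasDerivAt (fun x => (((m + 1 : ℕ) : ℝ) + 1) * ((m + 1 : ℕ) + 2) * gu c (m + 1) x -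
      (max (x - c) 0) ^ (m + 1 + 2)) ((((m + 1 : ℕ) : ℝ) + 1) * ((m + 1 : ℕ) + 2) * gu1 c (m + 1) x -
      ((m + 1 : ℕ) + 2) * (max (x - c) 0) ^ (m + 1 + 1)) x := fun x =>
    ((hasDerivAt_gu x).const_mul _).sub (hasDerivAt_max_pow (m + 1) c x)
  have h2 : ∀ x, HasDerivAt (fun x => (((m + 1 : ℕ) : ℝ) + 1) * ((m + 1 : ℕ) + 2) * gu1 c (m + 1) x -
      ((m + 1 : ℕ) + 2) * (max (x - c) 0) ^ (m + 1 + 1)) ((((m + 1 : ℕ) : ℝ) + 1) * ((m + 1 : ℕ) + 2)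
      * gw c (m + 1) x - ((m + 1 : ℕ) + 2) * ((m + 2) * (max (x - c) 0) ^ (m + 1))) x := fun x =>
    ((hasDerivAt_gu1 x).const_mul _).sub ((hasDerivAt_max_pow m c x).const_mul _)
  have h := nonneg_of_second_deriv_nonneg (a := c) (b := c + 1) h1 h2
    (by rw [sub_self, max_self]; simp only [ne_eq, Nat.add_eq_zero_iff, OfNat.ofNat_ne_zero,
          and_false, not_false_eq_true, zero_pow, sub_zero]
        exact mul_nonneg hq.le (gu_nonneg hc))
    (by rw [sub_self, max_self]; simp only [ne_eq, Nat.add_eq_zero_iff, one_ne_zero,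
          and_false, not_false_eq_true, zero_pow, sub_zero, mul_zero]
        exact mul_nonneg hq.le (gu1_nonneg hc)) (fun y hy => by
      have h3 : gw c (m + 1) y = (max (y - c) 0) ^ (m + 1) := by
        refine min_eq_left (pow_le_one₀ (le_max_right _ _) (max_le ?_ zero_le_one))
        linarith [hy.2]
      rw [h3]
      push_cast
      apply le_of_eq
      ring) x ⟨hx, hx1⟩
  rw [max_eq_left (by linarith)] at h
  linarith

theorem le_gu_of_large (hc : 0 ≤ c) {x : ℝ} (hx : c + 1 ≤ x) :
    (x - c - 1) ^ 2 / 2 + gu c p (c + 1) ≤ gu c p x := by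
  have h1 : ∀ x, HasDerivAt (fun x => gu c p x - gu c p (c + 1) - (x - c - 1) ^ 2 / 2)
      (gu1 c p x - (x - c - 1)) x := fun x => by
    have h := ((((hasDerivAt_id x).sub_const c).sub_const 1).pow 2).div_const 2
    have := ((hasDerivAt_gu (c := c) (p := p) x).sub_const (gu c p (c + 1))).sub h
    have e : gu1 c p x - ((2 : ℕ) : ℝ) * (id x - c - 1) ^ (2 - 1) * 1 / 2 =
      gu1 c p x - (x - c - 1) := by simp
    rw [e] at this
    exact this
  have h2 : ∀ x, HasDerivAt (fun x => gu1 c p x - (x - c - 1)) (gw c p x - 1) x := fun x =>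
    (hasDerivAt_gu1 x).sub (((hasDerivAt_id x).sub_const c).sub_const 1)
  have h := nonneg_of_second_deriv_nonneg (a := c + 1) (b := x) h1 h2
    (by simp) (by simpa using gu1_nonneg (by linarith)) (fun y hy => by
      have : gw c p y = 1 := by
        refine min_eq_right (one_le_pow₀ ?_)
        rw [max_eq_left] <;> linarith [hy.1]
      rw [this, sub_self]) x ⟨hx, le_rfl⟩
  linarith

end

section

open Polynomial

theorem growth_large_aux {x c t B C0 U U1 : ℝ} (hB : 75 ≤ B) (hC0p : 0 < C0) (hc1 : 1 ≤ c)
    (hc2 : c ≤ 2) (ht : 0 < t) (hxt : x ≤ 1 / t) (h2 : c + 1 < x) (hr0 : 648 * C0 * √t ≤ B)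
    (hu : (x - c - 1) ^ 2 / 2 + U1 ≤ U) (hu1 : 1 ≤ C0 * U1) (hu10 : 0 ≤ U1) :
    6 * x ^ 2 * √(x / t) ≤ B / t * U := by
  have hsq : √(x / t) = √x / √t := Real.sqrt_div (by linarith) t
  have hrp : 0 < √t := Real.sqrt_pos.2 ht
  have hrt : t = √t ^ 2 := (Real.sq_sqrt ht.le).symm
  rcases le_or_gt x 6 with h3 | h3
  · have hsx : √x ≤ 3 := by rw [Real.sqrt_le_left (by norm_num)]; linarith
    have hx3 : x ^ 2 ≤ 36 := by nlinarith
    have h4 := mul_le_mul hx3 hsx (Real.sqrt_nonneg _) (by norm_num)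
    have h0 : U1 ≤ U := by nlinarith [sq_nonneg (x - c - 1)]
    have h5 : 1 ≤ C0 * U := hu1.trans (mul_le_mul_of_nonneg_left h0 hC0p.le)
    have h5' : B * 1 ≤ B * (C0 * U) := mul_le_mul_of_nonneg_left h5 (by linarith)
    rw [hsq]
    generalize √t = r at *
    subst hrt
    rw [← mul_div_assoc, div_mul_eq_mul_div, div_le_div_iff₀ hrp (by positivity)]
    have h6 : C0 * (648 * r) ≤ C0 * (B * U) := by linarith
    have h7 := le_of_mul_le_mul_left h6 hC0p
    have h8 : 6 * x ^ 2 * √x ≤ 648 := by linarith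
    calc 6 * x ^ 2 * √x * r ^ 2 ≤ 648 * r ^ 2 := mul_le_mul_of_nonneg_right h8 (by positivity)
      _ = (648 * r) * r := by ring
      _ ≤ _ := mul_le_mul_of_nonneg_right h7 hrp.le
  · have h4 : √(x / t) ≤ 1 / t := by
      rw [Real.sqrt_le_left (by positivity), sq, ← mul_one_div]
      exact mul_le_mul_of_nonneg_right hxt (by positivity)
    have h5 : x ^ 2 / 8 ≤ U := by nlinarith
    have hU : 0 ≤ U := le_trans (by positivity) h5
    calc 6 * x ^ 2 * √(x / t) ≤ 6 * x ^ 2 * (1 / t) := mul_le_mul_of_nonneg_left h4 (by positivity)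
      _ = 1 / t * (6 * x ^ 2) := by ring
      _ ≤ 1 / t * (B * U) := by
        refine mul_le_mul_of_nonneg_left ?_ (by positivity)
        have : 75 * U ≤ B * U := mul_le_mul_of_nonneg_right hB hU
        linarith
      _ = _ := by ring

theorem gu_growth_ineq {B : ℕ} (hB : 75 ≤ B) : ∃ K t0 : ℝ, 0 ≤ K ∧ 0 < t0 ∧ t0 ≤ 1 ∧
    ∀ c, 1 ≤ c → c ≤ 2 → ∀ t, 0 < t → t ≤ t0 → ∀ x, 0 ≤ x → x ≤ 1 / t →
      6 * x ^ 2 * √(x / t) * gw c (4 * B) x ≤ B / t * gu c (4 * B) x + K * (t ^ B / √t) := by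
  have hBr : (75 : ℝ) ≤ B := by exact_mod_cast hB
  have hp1 : 1 ≤ 4 * B := by omega
  set p := 4 * B with hp
  set C0 : ℝ := (p + 1) * (p + 2) with hC0
  have hC0p : 0 < C0 := by positivity
  set C : ℝ := 108 * C0 / B with hC
  have hCp : 0 ≤ C := by positivity
  refine ⟨108 * C ^ (2 * B), min 1 ((B / (648 * C0)) ^ 2), by positivity,
    lt_min one_pos (by positivity), min_le_left _ _, ?_⟩
  intro c hc1 hc2 t ht ht0 x hx hxt
  have hc0 : 0 ≤ c := by linarith
  set r := √t with hr
  have hrp : 0 < r := Real.sqrt_pos.2 ht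
  have hrt : t = r ^ 2 := (Real.sq_sqrt ht.le).symm
  have hr0 : 648 * C0 * r ≤ B := by
    have h := Real.sqrt_le_sqrt (ht0.trans (min_le_right _ _))
    rw [Real.sqrt_sq (by positivity), le_div_iff₀ (by positivity)] at h
    rw [← hr] at h
    linarith
  have hsq : √(x / t) = √x / r := Real.sqrt_div hx t
  have hu0 := gu_nonneg (c := c) (p := p) hx
  rcases le_or_gt x c with h1 | h1
  · have : gw c p x = 0 := by
      unfold gw
      rw [max_eq_right (by linarith), zero_pow (by omega)]
      simp
    rw [this, mul_zero]
    positivity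
  rcases le_or_gt x (c + 1) with h2 | h2
  · set y := x - c with hy
    have hy0 : 0 < y := sub_pos.2 h1
    have hy1 : y ≤ 1 := by linarith
    have hw : gw c p x = y ^ p := by
      unfold gw
      rw [max_eq_left hy0.le, min_eq_left (pow_le_one₀ hy0.le hy1)]
    have hsx : √x ≤ 2 := by rw [Real.sqrt_le_left (by norm_num)]; linarith
    have hx3 : x ^ 2 ≤ 9 := by nlinarith
    have hL : 6 * x ^ 2 * √(x / t) * gw c p x ≤ 108 * y ^ p / r := by
      rw [hsq, hw, ← mul_div_assoc, div_mul_eq_mul_div]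
      refine div_le_div_of_nonneg_right (mul_le_mul_of_nonneg_right ?_ (by positivity)) hrp.le
      have := mul_le_mul hx3 hsx (Real.sqrt_nonneg _) (by norm_num)
      linarith
    have hu := le_gu (p := p) hc0 hp1 h1.le h2
    rw [← hy, ← hC0] at hu
    rcases le_or_gt (108 * C0 * r) (B * y ^ 2) with h3 | h3
    · refine hL.trans ?_
      have : 108 * y ^ p / r ≤ B / t * gu c p x := by
        rw [hrt, div_mul_eq_mul_div, div_le_div_iff₀ hrp (by positivity)]
        have h4 := mul_le_mul_of_nonneg_right h3 (pow_nonneg hy0.le p)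
        have h5 : (B : ℝ) * y ^ 2 * y ^ p ≤ B * (C0 * gu c p x) := by
          rw [mul_assoc, ← pow_add, add_comm 2 p]
          exact mul_le_mul_of_nonneg_left hu (by linarith)
        have h6 : C0 * (108 * r * y ^ p) ≤ C0 * (B * gu c p x) := by linarith
        have h7 := le_of_mul_le_mul_left h6 hC0p
        nlinarith
      have : 0 ≤ 108 * C ^ (2 * B) * (t ^ B / r) := by positivity
      linarith
    · have h4 : y ^ 2 ≤ C * r := by
        rw [hC, div_mul_eq_mul_div, le_div_iff₀ (by linarith)]
        linarith
      have h5 : y ^ p ≤ C ^ (2 * B) * t ^ B := by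
        calc y ^ p = (y ^ 2) ^ (2 * B) := by rw [← pow_mul]; congr 1; omega
          _ ≤ (C * r) ^ (2 * B) := pow_le_pow_left₀ (by positivity) h4 _
          _ = _ := by rw [mul_pow, pow_mul r, ← hrt]
      refine hL.trans ?_
      have h6 : 108 * y ^ p / r ≤ 108 * C ^ (2 * B) * (t ^ B / r) := by
        rw [← mul_div_assoc]
        refine div_le_div_of_nonneg_right ?_ hrp.le
        linarith
      have : 0 ≤ B / t * gu c p x := by positivity
      linarith
  · have hw : gw c p x ≤ 1 := min_le_right _ _
    have hu := le_gu_of_large (p := p) hc0 h2.le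
    have hu1 := le_gu (p := p) hc0 hp1 (x := c + 1) (by linarith) le_rfl
    rw [add_sub_cancel_left, one_pow, ← hC0] at hu1
    have hK : 0 ≤ 108 * C ^ (2 * B) * (t ^ B / r) := by positivity
    have hL : 6 * x ^ 2 * √(x / t) * gw c p x ≤ 6 * x ^ 2 * √(x / t) :=
      mul_le_of_le_one_right (by positivity) hw
    have h := growth_large_aux hBr hC0p hc1 hc2 ht hxt h2 hr0 hu hu1 (gu_nonneg (by linarith))
    exact (hL.trans h).trans (le_add_of_nonneg_right hK)

theorem exists_antiderivative (P : ℝ[X]) : ∃ q : ℝ[X], q.derivative = P ∧ q.eval 0 = 0 := by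
  induction P using Polynomial.induction_on' with
  | add p q hp hq =>
    obtain ⟨a, ha, ha0⟩ := hp
    obtain ⟨b, hb, hb0⟩ := hq
    exact ⟨a + b, by rw [derivative_add, ha, hb], by rw [eval_add, ha0, hb0, add_zero]⟩
  | monomial n a =>
    refine ⟨monomial (n + 1) (a / (n + 1)), ?_, by simp [eval_monomial]⟩
    rw [derivative_monomial]
    simp only [Nat.cast_add, Nat.cast_one, add_tsub_cancel_right]
    congr 1
    field_simp

theorem exists_poly_second_deriv {w u u1 : ℝ → ℝ} (hw : Continuous w)
    (hu : ∀ x, HasDerivAt u (u1 x) x) (hu1 : ∀ x, HasDerivAt u1 (w x) x) (hu0 : u 0 = 0)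
    (hu10 : u1 0 = 0) (M : ℝ) {ε : ℝ} (hε : 0 < ε) :
    ∃ q : ℝ[X], q.derivative.eval 0 = 0 ∧
      (∀ x, 0 ≤ x → x ≤ M → |q.derivative.derivative.eval x - w x| ≤ ε) ∧
      ∀ x, 0 ≤ x → x ≤ M → |q.eval x - u x| ≤ ε * M ^ 2 := by
  obtain ⟨P, hP⟩ := exists_polynomial_near_of_continuousOn 0 M w hw.continuousOn ε hε
  obtain ⟨Q, hQ, hQ0⟩ := exists_antiderivative P
  obtain ⟨q, hq, hq0⟩ := exists_antiderivative Q
  have hP' : ∀ x, 0 ≤ x → x ≤ M → |P.eval x - w x| ≤ ε := fun x h1 h2 => (hP x ⟨h1, h2⟩).le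
  refine ⟨q, by rw [hq, hQ0], by rw [hq, hQ]; exact hP', fun x hx hxM => ?_⟩
  have dq : ∀ x, HasDerivAt (fun x => q.eval x) (Q.eval x) x := fun x => by
    have := q.hasDerivAt x; rwa [hq] at this
  have dQ : ∀ x, HasDerivAt (fun x => Q.eval x) (P.eval x) x := fun x => by
    have := Q.hasDerivAt x; rwa [hQ] at this
  have ds : ∀ x, HasDerivAt (fun x : ℝ => ε * x ^ 2) (ε * (2 * x)) x := fun x => by
    simpa using ((hasDerivAt_pow 2 x).const_mul ε)
  have ds1 : ∀ x, HasDerivAt (fun x : ℝ => ε * (2 * x)) (ε * 2) x := fun x => by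
    simpa using (((hasDerivAt_id x).const_mul 2).const_mul ε)
  have h1 := nonneg_of_second_deriv_nonneg (a := 0) (b := M)
    (fun x => (ds x).sub ((dq x).sub (hu x))) (fun x => (ds1 x).sub ((dQ x).sub (hu1 x)))
    (by simp [hq0, hu0]) (by simp [hQ0, hu10])
    (fun y hy => by have := abs_le.1 (hP' y hy.1 hy.2); linarith [this.2]) x ⟨hx, hxM⟩
  have h2 := nonneg_of_second_deriv_nonneg (a := 0) (b := M)
    (fun x => (ds x).add ((dq x).sub (hu x))) (fun x => (ds1 x).add ((dQ x).sub (hu1 x)))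
    (by simp [hq0, hu0]) (by simp [hQ0, hu10])
    (fun y hy => by have := abs_le.1 (hP' y hy.1 hy.2); linarith [this.1]) x ⟨hx, hxM⟩
  simp only [Pi.sub_apply, Pi.add_apply] at h1 h2
  have h3 : ε * x ^ 2 ≤ ε * M ^ 2 := mul_le_mul_of_nonneg_left (pow_le_pow_left₀ hx hxM 2) hε.le
  rw [abs_le]
  constructor <;> linarith

variable {ι : Type*} [Fintype ι] [DecidableEq ι] {μ : Measure (ℰ ι)}
variable [IsProbabilityMeasure μ] {R : ℝ}

omit [DecidableEq ι] in
theorem EE_add_const (hR : ∀ᵐ x ∂μ, ‖x‖ ≤ R) {Φ : ℝ × ℰ ι → ℝ} {t : ℝ} (ht : 0 ≤ t)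
    (hΦ : Integrable fun g : ℰ ι => Φ (t, √t • g) * zf μ (t, √t • g) * gd g)
    (a c : ℝ) : EE μ (fun ξ => a * Φ ξ + c) t = a * EE μ Φ t + c ∧
      Integrable fun g : ℰ ι =>
        (a * Φ (t, √t • g) + c) * zf μ (t, √t • g) * gd g := by
  have h1 := integrable_EE hR (Φ := fun _ => c) continuous_const (C := |c|) (fun _ => le_rfl) ht
  have h2 := hΦ.const_mul a
  have e : (fun g : ℰ ι => (a * Φ (t, √t • g) + c) * zf μ (t, √t • g) * gd g) =
      fun g => a * (Φ (t, √t • g) * zf μ (t, √t • g) * gd g) + c * zf μ (t, √t • g) * gd g := by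
    ext g; ring
  constructor
  · have hcst := EE_const hR c ht
    unfold EE at hcst ⊢
    beta_reduce at hcst ⊢
    rw [e, integral_add h2 h1, integral_const_mul, hcst]
  · rw [e]; exact h2.add h1

theorem EE_trP_deriv_le (hR : ∀ᵐ x ∂μ, ‖x‖ ≤ R) {f : ℰ ι → ℝ} (hfm : Measurable f)
    (hf : StrongLC 0 f) (hμ : μ = volume.withDensity fun x => ofReal (f x))
    {c ε K s t : ℝ} {p B : ℕ} {q : ℝ[X]} (hε : 0 < ε) (hs : 0 < s) (hst : s ≤ t)
    (hq0 : q.derivative.eval 0 = 0)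
    (hq2 : ∀ x, 0 ≤ x → x ≤ R ^ 2 → |q.derivative.derivative.eval x - gw c p x| ≤ ε)
    (hq : ∀ x, 0 ≤ x → x ≤ R ^ 2 → |q.eval x - gu c p x| ≤ ε * (R ^ 2) ^ 2)
    (hg : ∀ x, 0 ≤ x → x ≤ 1 / t →
      6 * x ^ 2 * √(x / t) * gw c p x ≤ B / t * gu c p x + K * (t ^ B / √t)) :
    EE μ (genL μ (trP μ q)) t ≤ B / t * EE μ (trP μ q) t + Fintype.card ι * (K * (t ^ B / √t) +
      ε * (B / s * (R ^ 2) ^ 2 + (R ^ 2) ^ 3 + 6 * (R ^ 2) ^ 2 * √(R ^ 2 / s))) := by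
  have ht : 0 < t := hs.trans_le hst
  have hb := essBdd_sx hR
  have hm := trP_mem hR q
  have hm2 := genL_mem hR hm
  obtain ⟨C1, hC1⟩ := tmAlg_bdd hb hm
  obtain ⟨C2, hC2⟩ := tmAlg_bdd hb hm2
  have i1 := integrable_EE hR (tmAlg_contDiff hb hm).continuous hC1 ht.le
  have i2 := integrable_EE hR (tmAlg_contDiff hb hm2).continuous hC2 ht.le
  obtain ⟨e3, i3⟩ := EE_add_const hR ht.le i1 (B / t) (Fintype.card ι * (K * (t ^ B / √t) +
      ε * (B / s * (R ^ 2) ^ 2 + (R ^ 2) ^ 3 + 6 * (R ^ 2) ^ 2 * √(R ^ 2 / s))))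
  rw [← e3]
  refine EE_mono hR i2 i3 fun ξ hξ => ?_
  refine (genL_trP_le hR hfm hf hμ (hξ ▸ ht) hε.le gw_nonneg gw_monotone hq2 hq0).trans ?_
  have e4 : trP μ q ξ = ∑ i, q.eval (eigA μ ξ i) := trP_eq q ξ
  rw [e4, mul_sum]
  have e5 : ∀ D : ℝ, (Fintype.card ι : ℝ) * D = ∑ _i : ι, D := fun D => by simp
  rw [e5, ← sum_add_distrib]
  refine sum_le_sum fun i _ => ?_
  have hx := eigA_nonneg hR ξ i
  have hxM := eigA_le_sq hR ξ i
  have hxt := eigA_le_inv hR hfm hf hμ (hξ ▸ ht : 0 < ξ.1) i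
  rw [hξ] at hxt ⊢
  generalize eigA μ ξ i = x at hx hxM hxt
  have hM0 : 0 ≤ R ^ 2 := sq_nonneg R
  have h1 := hg x hx hxt
  have h2 := (abs_le.1 (hq x hx hxM)).1
  have h3 : B / t * gu c p x ≤ B / t * q.eval x + B / s * (ε * (R ^ 2) ^ 2) := by
    have h4 : B / t * gu c p x ≤ B / t * (q.eval x + ε * (R ^ 2) ^ 2) :=
      mul_le_mul_of_nonneg_left (by linarith) (by positivity)
    have h5 : (B : ℝ) / t * (ε * (R ^ 2) ^ 2) ≤ B / s * (ε * (R ^ 2) ^ 2) :=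
      mul_le_mul_of_nonneg_right (div_le_div_of_nonneg_left (by positivity) hs hst) (by positivity)
    linarith
  have h4 : ε * x ^ 3 ≤ ε * (R ^ 2) ^ 3 :=
    mul_le_mul_of_nonneg_left (pow_le_pow_left₀ hx hxM 3) hε.le
  have h5 : √(x / t) ≤ √(R ^ 2 / s) :=
    Real.sqrt_le_sqrt (div_le_div₀ hM0 hxM hs hst)
  have h6 : x ^ 2 * √(x / t) ≤ (R ^ 2) ^ 2 * √(R ^ 2 / s) :=
    mul_le_mul (pow_le_pow_left₀ hx hxM 2) h5 (Real.sqrt_nonneg _) (by positivity)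
  have h7 := mul_le_mul_of_nonneg_left h6 hε.le
  linarith

end

section

open Polynomial

theorem le_of_forall_mul_small {a b c δ : ℝ} (hδ : 0 < δ)
    (h : ∀ ε, 0 < ε → ε ≤ δ → a ≤ b + ε * c) : a ≤ b := by
  have h1 : Tendsto (fun ε : ℝ => b + ε * c) (𝓝[>] 0) (𝓝 b) := by
    have : Continuous fun ε : ℝ => b + ε * c := by fun_prop
    have h2 := (this.tendsto 0).mono_left (nhdsWithin_le_nhds (s := Ioi 0))
    simpa using h2
  refine ge_of_tendsto h1 ?_
  filter_upwards [Ioc_mem_nhdsGT hδ] with ε hε using h ε hε.1 hε.2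

theorem le_of_deriv_le_growth {Y Y' : ℝ → ℝ} {B : ℕ} {n K D s T : ℝ}
    (hn : 0 ≤ n) (hD : 0 ≤ D) (hs : 0 < s) (hsT : s ≤ T) (hT : T ≤ 1)
    (hY : ∀ t, 0 < t → HasDerivAt Y (Y' t) t)
    (hY' : ∀ t, s ≤ t → t ≤ T → Y' t ≤ B / t * Y t + n * (K * (t ^ B / √t) + D)) (hK : 0 ≤ K) :
    Y T ≤ T ^ B * (Y s / s ^ B + n * D / s ^ B + 2 * n * K * √T) := by
  set φ : ℝ → ℝ := fun t => Y t / t ^ B - n * D / s ^ B * t - 2 * n * K * √t with hφ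
  have hd : ∀ t, 0 < t → HasDerivAt φ
      ((Y' t * t ^ B - Y t * (B * t ^ (B - 1))) / (t ^ B) ^ 2 - n * D / s ^ B - n * K / √t) t := by
    intro t ht
    have h1 := (hY t ht).div (hasDerivAt_pow B t) (pow_pos ht B).ne'
    have h2 := (hasDerivAt_id t).const_mul (n * D / s ^ B)
    have h3 := (Real.hasDerivAt_sqrt ht.ne').const_mul (2 * n * K)
    have e : (Y' t * t ^ B - Y t * (B * t ^ (B - 1))) / (t ^ B) ^ 2 - n * D / s ^ B - n * K / √t =
      (Y' t * t ^ B - Y t * (B * t ^ (B - 1))) / (t ^ B) ^ 2 - n * D / s ^ B * 1 -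
        2 * n * K * (1 / (2 * √t)) := by
      have := (Real.sqrt_pos.2 ht).ne'
      field_simp
    rw [e]
    exact (h1.sub h2).sub h3
  have hanti : AntitoneOn φ (Icc s T) := by
    refine antitoneOn_of_deriv_nonpos (convex_Icc s T)
      (fun t ht => (hd t (hs.trans_le ht.1)).continuousAt.continuousWithinAt)
      (fun t ht => ?_) fun t ht => ?_
    · rw [interior_Icc] at ht
      exact (hd t (hs.trans ht.1)).differentiableAt.differentiableWithinAt
    · rw [interior_Icc] at ht
      have ht0 : 0 < t := hs.trans ht.1
      rw [(hd t ht0).deriv]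
      have hp := pow_pos ht0 B
      have hr := Real.sqrt_pos.2 ht0
      have h1 := hY' t ht.1.le ht.2.le
      have hB : Y t * (B * t ^ (B - 1)) = B / t * Y t * t ^ B := by
        rcases B with _ | b
        · simp
        · rw [Nat.add_sub_cancel, pow_succ]; field_simp
      have h2 : (Y' t * t ^ B - Y t * (B * t ^ (B - 1))) / (t ^ B) ^ 2 =
          (Y' t - B / t * Y t) / t ^ B := by
        rw [hB, ← sub_mul, sq, mul_div_mul_right _ _ hp.ne']
      have h3 : (Y' t - B / t * Y t) / t ^ B ≤ n * (K * (t ^ B / √t) + D) / t ^ B :=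
        div_le_div_of_nonneg_right (by linarith) hp.le
      have h4 : n * (K * (t ^ B / √t) + D) / t ^ B = n * K / √t + n * D / t ^ B := by
        field_simp
      have h5 : n * D / t ^ B ≤ n * D / s ^ B :=
        div_le_div_of_nonneg_left (by positivity) (pow_pos hs B)
          (pow_le_pow_left₀ hs.le ht.1.le B)
      rw [h2]
      linarith
  have h := hanti (left_mem_Icc.2 hsT) (right_mem_Icc.2 hsT) hsT
  simp only [hφ] at h
  have hT0 : 0 < T := hs.trans_le hsT
  have h1 : Y T / T ^ B ≤ Y s / s ^ B + n * D / s ^ B + 2 * n * K * √T := by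
    have a1 : 0 ≤ 2 * n * K * √s := by positivity
    have a2 : 0 ≤ n * D / s ^ B * s := by positivity
    have a3 : n * D / s ^ B * T ≤ n * D / s ^ B :=
      mul_le_of_le_one_right (by positivity) hT
    linarith
  rw [div_le_iff₀ (pow_pos hT0 B)] at h1
  linarith

variable {ι : Type*} [Fintype ι] [DecidableEq ι] {μ : Measure (ℰ ι)}
variable [IsProbabilityMeasure μ] {R : ℝ}

theorem EE_trP_sub_le (hR : ∀ᵐ x ∂μ, ‖x‖ ≤ R) {q : ℝ[X]} {u : ℝ → ℝ} (hu : Continuous u) {ε t : ℝ}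
    (ht : 0 ≤ t) (hq : ∀ x, 0 ≤ x → x ≤ R ^ 2 → |q.eval x - u x| ≤ ε) :
    EE μ (trP μ q) t ≤ EE μ (trF μ u) t + Fintype.card ι * ε ∧
      EE μ (trF μ u) t ≤ EE μ (trP μ q) t + Fintype.card ι * ε := by
  have hb := essBdd_sx hR
  have hm := trP_mem hR q
  obtain ⟨C1, hC1⟩ := tmAlg_bdd hb hm
  have i1 := integrable_EE hR (tmAlg_contDiff hb hm).continuous hC1 ht
  have i2 := integrable_trF hR (h := u) hu.continuousOn ht
  have key : ∀ ξ, |trP μ q ξ - trF μ u ξ| ≤ Fintype.card ι * ε := fun ξ => by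
    rw [trP_eq]
    exact trF_sub_le (h := fun x => q.eval x) fun i =>
      hq _ (eigA_nonneg hR ξ i) (eigA_le_sq hR ξ i)
  obtain ⟨e1, j1⟩ := EE_add_const hR ht i1 1 (Fintype.card ι * ε)
  obtain ⟨e2, j2⟩ := EE_add_const hR ht i2 1 (Fintype.card ι * ε)
  constructor
  · rw [← one_mul (EE μ (trF μ u) t), ← e2]
    refine EE_mono hR i1 j2 fun ξ _ => ?_
    have := abs_le.1 (key ξ); linarith [this.2]
  · rw [← one_mul (EE μ (trP μ q) t), ← e1]
    refine EE_mono hR i2 j1 fun ξ _ => ?_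
    have := abs_le.1 (key ξ); linarith [this.1]

/-- High powers of the part of the tilted covariance above level `c` stay small in mean. -/
theorem EE_trF_gu_le {B : ℕ} (hB : 75 ≤ B) : ∃ K t0 : ℝ, 0 ≤ K ∧ 0 < t0 ∧ t0 ≤ 1 ∧
    ∀ {ι : Type*} [Fintype ι] [DecidableEq ι] {μ : Measure (ℰ ι)}
      [IsProbabilityMeasure μ] {R : ℝ} (_ : ∀ᵐ x ∂μ, ‖x‖ ≤ R) {f : ℰ ι → ℝ}
      (_ : Measurable f) (_ : StrongLC 0 f)
      (_ : μ = volume.withDensity fun x => ofReal (f x)) {c : ℝ}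
      (_ : ∀ v : ℰ ι, ∑ b, ∑ a, v a * cA μ 0 a b * v b ≤ c * ‖v‖ ^ 2)
      (_ : 1 ≤ c) (_ : c ≤ 2) (t : ℝ) (_ : 0 < t) (_ : t ≤ t0),
      EE μ (trF μ (gu c (4 * B))) t ≤ 2 * Fintype.card ι * K * √t * t ^ B := by
  obtain ⟨K, t0, hK, ht0, ht01, hg⟩ := gu_growth_ineq hB
  refine ⟨K, t0, hK, ht0, ht01, ?_⟩
  intro ι _ _ μ _ R hR f hfm hf hμ c hc hc1 hc2 T hT hTt0
  set n : ℝ := ((Fintype.card ι : ℕ) : ℝ) with hn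
  have hn0 : 0 ≤ n := Nat.cast_nonneg _
  have hM0 : 0 ≤ R ^ 2 := sq_nonneg R
  set U := EE μ (trF μ (gu c (4 * B))) with hU
  have step : ∀ s, 0 < s → s ≤ T → U T ≤ T ^ B * (U s / s ^ B + 2 * n * K * √T) := by
    intro s hs hsT
    set D : ℝ := B / s * (R ^ 2) ^ 2 + (R ^ 2) ^ 3 + 6 * (R ^ 2) ^ 2 * √(R ^ 2 / s) with hD
    have hD0 : 0 ≤ D := by positivity
    refine le_of_forall_mul_small (δ := 1) (c := n * (R ^ 2) ^ 2 +
      T ^ B * (n * (R ^ 2) ^ 2 / s ^ B + n * D / s ^ B)) one_pos fun ε hε _ => ?_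
    obtain ⟨q, hq0, hq2, hq⟩ := exists_poly_second_deriv (continuous_gw (c := c) (p := 4 * B))
      hasDerivAt_gu hasDerivAt_gu1 gu_zero gu1_zero (R ^ 2) hε
    have hs1 := (EE_trP_sub_le hR continuous_gu hs.le hq).1
    have hT1 := (EE_trP_sub_le hR continuous_gu hT.le hq).2
    have h := le_of_deriv_le_growth (Y := EE μ (trP μ q)) (n := n) (K := K) (D := ε * D) hn0
      (by positivity) hs hsT (hTt0.trans ht01) (fun t ht => hasDerivAt_EE hR (trP_mem hR q) ht)
      (fun t hst htT => EE_trP_deriv_le hR hfm hf hμ hε hs hst hq0 hq2 hq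
        (hg c hc1 hc2 t (hs.trans_le hst) (htT.trans hTt0))) hK
    have h3 : EE μ (trP μ q) s / s ^ B ≤ (U s + n * (ε * (R ^ 2) ^ 2)) / s ^ B :=
      div_le_div_of_nonneg_right hs1 (pow_pos hs B).le
    have h4 : T ^ B * (EE μ (trP μ q) s / s ^ B + n * (ε * D) / s ^ B + 2 * n * K * √T) ≤
        T ^ B * ((U s + n * (ε * (R ^ 2) ^ 2)) / s ^ B + n * (ε * D) / s ^ B + 2 * n * K * √T) :=
      mul_le_mul_of_nonneg_left (by linarith) (pow_pos hT B).le
    have e : T ^ B * ((U s + n * (ε * (R ^ 2) ^ 2)) / s ^ B + n * (ε * D) / s ^ B +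
        2 * n * K * √T) + n * (ε * (R ^ 2) ^ 2) =
        T ^ B * (U s / s ^ B + 2 * n * K * √T) + ε * (n * (R ^ 2) ^ 2 +
      T ^ B * (n * (R ^ 2) ^ 2 / s ^ B + n * D / s ^ B)) := by
      ring
    rw [← e]
    change U T ≤ EE μ (trP μ q) T + n * (ε * (R ^ 2) ^ 2) at hT1
    linarith
  obtain ⟨D, hD⟩ := EE_trF_small hR hc (continuous_gu (c := c) (p := 4 * B)) (2 * B + 1)
    fun x hx => by
      have := gu_le (c := c) (p := 4 * B) (x := x) (by linarith) (by omega) hx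
      rwa [show 2 * (2 * B + 1) = 4 * B + 2 by ring]
  have : U T ≤ T ^ B * (2 * n * K * √T) := by
    refine le_of_forall_mul_small (δ := T) (c := T ^ B * |D|) hT fun s hs hsT => ?_
    refine (step s hs hsT).trans ?_
    have hs1 : s ≤ 1 := hsT.trans (hTt0.trans ht01)
    have h1 := hD s hs hs1
    have h2 : U s / s ^ B ≤ s * |D| := by
      rw [div_le_iff₀ (pow_pos hs B)]
      refine h1.trans ?_
      calc D * s ^ (2 * B + 1) ≤ |D| * s ^ (B + 1) :=
            mul_le_mul (le_abs_self D) (pow_le_pow_of_le_one hs.le hs1 (by omega))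
              (by positivity) (abs_nonneg _)
        _ = _ := by ring
    have h3 := mul_le_mul_of_nonneg_left h2 (pow_pos hT B).le
    linarith
  linarith

end

section

open Polynomial

theorem sq_le_gu {c x : ℝ} {p : ℕ} (hc1 : 1 ≤ c) (hc2 : c ≤ 2) (hx : 0 ≤ x) :
    x ^ 2 ≤ 18 + 4 * gu c p x := by
  have h0 := gu_nonneg (c := c) (p := p) hx
  rcases le_or_gt x (c + 1) with h | h
  · nlinarith
  · have h1 := le_gu_of_large (p := p) (c := c) (by linarith) h.le
    have h2 := gu_nonneg (c := c) (p := p) (x := c + 1) (by linarith)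
    nlinarith [sq_nonneg (x - c - 1 - 3)]

theorem exists_posPart_le_gu {η : ℝ} (p : ℕ) (hp : 1 ≤ p) (hη : 0 < η) : ∃ D, 0 ≤ D ∧
    ∀ c x, 1 ≤ c → 0 ≤ x → max (x - c) 0 ≤ η + D * gu c p x := by
  set C0 : ℝ := (p + 1) * (p + 2) with hC0
  have hC0p : 0 < C0 := by positivity
  refine ⟨C0 / η ^ (p + 2) + 1 + 2 * C0, by positivity, fun c x hc hx => ?_⟩
  have hu := gu_nonneg (c := c) (p := p) hx
  have hE : 0 ≤ C0 / η ^ (p + 2) := by positivity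
  rw [add_mul, add_mul]
  have p1 := mul_nonneg hE hu
  have p2 := mul_nonneg hC0p.le hu
  refine max_le ?_ (by linarith)
  rcases le_or_gt x (c + η) with h | h
  · linarith
  rcases le_or_gt x (c + 1) with h1 | h1
  · have h2 := le_gu (p := p) (c := c) (by linarith) hp (by linarith) h1
    rw [← hC0] at h2
    have h3 : η ^ (p + 2) ≤ (x - c) ^ (p + 2) := pow_le_pow_left₀ hη.le (by linarith) _
    have h4 : 1 ≤ C0 / η ^ (p + 2) * gu c p x := by
      rw [div_mul_eq_mul_div, one_le_div (by positivity)]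
      linarith
    linarith
  · have h2 := le_gu_of_large (p := p) (c := c) (by linarith) h1.le
    have h3 := le_gu (p := p) (c := c) (x := c + 1) (by linarith) hp (by linarith) le_rfl
    rw [add_sub_cancel_left, one_pow, ← hC0] at h3
    generalize gu c p x = U at *
    generalize gu c p (c + 1) = U1 at *
    have h4 : U1 ≤ U := by nlinarith [sq_nonneg (x - c - 1)]
    have h5 : C0 * U1 ≤ C0 * U := mul_le_mul_of_nonneg_left h4 hC0p.le
    have h6 : 0 ≤ U1 := by
      by_contra h7
      nlinarith
    nlinarith [sq_nonneg (x - c - 1 - 1)]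

variable {ι : Type*} [Fintype ι] [DecidableEq ι] {μ : Measure (ℰ ι)}
variable [IsProbabilityMeasure μ] {R : ℝ}

theorem EE_trF_le_add (hR : ∀ᵐ x ∂μ, ‖x‖ ≤ R) {h h1 h2 : ℝ → ℝ} (hh : Continuous h)
    (hh1 : Continuous h1) (hh2 : Continuous h2) {a b c t : ℝ} (ht : 0 ≤ t)
    (hle : ∀ x, 0 ≤ x → h x ≤ a * h1 x + b * h2 x + c) :
    EE μ (trF μ h) t ≤ a * EE μ (trF μ h1) t + b * EE μ (trF μ h2) t + Fintype.card ι * c := by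
  have i0 := integrable_trF hR hh.continuousOn ht
  have i1 := integrable_trF hR hh1.continuousOn ht
  have i2 := integrable_trF hR hh2.continuousOn ht
  obtain ⟨e3, i3⟩ := EE_add_const hR ht i2 b (Fintype.card ι * c)
  have e : (fun g : ℰ ι => (a * trF μ h1 (t, √t • g) +
      (b * trF μ h2 (t, √t • g) + Fintype.card ι * c)) * zf μ (t, √t • g) * gd g) =
      fun g => a * (trF μ h1 (t, √t • g) * zf μ (t, √t • g) * gd g) +
        (b * trF μ h2 (t, √t • g) + Fintype.card ι * c) * zf μ (t, √t • g) * gd g := by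
    ext g; ring
  have i4 := i1.const_mul a
  have e5 : EE μ (fun ξ => a * trF μ h1 ξ + (b * trF μ h2 ξ + Fintype.card ι * c)) t =
      a * EE μ (trF μ h1) t + (b * EE μ (trF μ h2) t + Fintype.card ι * c) := by
    rw [← e3]
    unfold EE
    beta_reduce
    rw [e, integral_add i4 i3, integral_const_mul]
  rw [add_assoc, ← e5]
  refine EE_mono hR i0 (by rw [e]; exact i4.add i3) fun ξ _ => ?_
  unfold trF
  have e6 : ∀ D : ℝ, (Fintype.card ι : ℝ) * D = ∑ _i : ι, D := fun D => by simp
  rw [e6, mul_sum, mul_sum, ← sum_add_distrib, ← sum_add_distrib]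
  refine sum_le_sum fun i _ => ?_
  have := hle _ (eigA_nonneg hR ξ i)
  linarith

omit [IsProbabilityMeasure μ] in
theorem trF_pow (m : ℕ) : trF μ (fun x => x ^ m) = fun ξ => (cA μ ξ ^ m).trace := by
  ext ξ
  exact ((isHermitian_cA (μ := μ) ξ).trace_pow_eq m).symm

theorem hasDerivAt_EE_trace (hR : ∀ᵐ x ∂μ, ‖x‖ ≤ R) {t : ℝ} (ht : 0 < t) :
    HasDerivAt (EE μ (trF μ fun x => x ^ 1)) (-EE μ (trF μ fun x => x ^ 2) t) t := by
  have h := hasDerivAt_EE hR (trace_pow_mem hR 1) ht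
  rw [← trF_pow] at h
  have e : genL μ (trF μ fun x => x ^ 1) = fun ξ => -1 * trF μ (fun x => x ^ 2) ξ + 0 := by
    ext ξ
    rw [trF_pow, trF_pow, genL_trace_pow hR]
    simp
  rw [e, (EE_add_const hR ht.le (integrable_trF hR (by fun_prop) ht.le) (-1) 0).1] at h
  simpa using h

theorem EE_trace_ge (hR : ∀ᵐ x ∂μ, ‖x‖ ≤ R) {C t0 : ℝ} (ht0 : 0 < t0)
    (hC : ∀ t, 0 < t → t ≤ t0 → EE μ (trF μ fun x => x ^ 2) t ≤ C) {t : ℝ} (ht : 0 < t)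
    (htt : t ≤ t0) : (cA μ 0).trace - C * t ≤ EE μ (trF μ fun x => x ^ 1) t := by
  set Y := EE μ (trF μ fun x => x ^ 1) with hY
  have hd : ∀ s, 0 < s → HasDerivAt (fun s => Y s + C * s)
      (-EE μ (trF μ fun x => x ^ 2) s + C) s := fun s hs => by
    have h1 := (hasDerivAt_EE_trace hR hs).add ((hasDerivAt_id s).const_mul C)
    rw [mul_one] at h1
    exact h1
  have hmono : MonotoneOn (fun s => Y s + C * s) (Ioc 0 t0) := by
    refine monotoneOn_of_deriv_nonneg (convex_Ioc 0 t0)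
      (fun s hs => (hd s hs.1).continuousAt.continuousWithinAt)
      (fun s hs => ?_) fun s hs => ?_
    · exact (hd s (interior_subset hs).1).differentiableAt.differentiableWithinAt
    · rw [(hd s (interior_subset hs).1).deriv]
      have := hC s (interior_subset hs).1 (interior_subset hs).2
      linarith
  have hcont : ContinuousOn (fun x : ℝ => x ^ 1) (Icc 0 (R ^ 2)) := by fun_prop
  obtain ⟨D, hD⟩ := trF_bdd (μ := μ) hR hcont
  have hl := tendsto_EE_zero hR (continuous_trF hR hcont) hD
  have hl2 : Tendsto (fun s => Y s + C * s) (𝓝[>] 0)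
      (𝓝 (trF μ (fun x => x ^ 1) 0 + C * 0)) := by
    refine hl.add ?_
    have : Continuous fun s : ℝ => C * s := by fun_prop
    exact (this.tendsto 0).mono_left nhdsWithin_le_nhds
  have h := le_of_tendsto hl2 (b := Y t + C * t) (by
    filter_upwards [Ioc_mem_nhdsGT ht] with s hs
    exact hmono ⟨hs.1, hs.2.trans htt⟩ ⟨ht, htt⟩ hs.2)
  rw [trF_pow, mul_zero, add_zero] at h
  simp only [pow_one] at h
  linarith

/-- At a universal time, the tilted covariance matrix has few small eigenvalues in mean. -/
theorem exists_good_time : ∃ t : ℝ, 0 < t ∧ t ≤ 1 ∧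
    ∀ {ι : Type*} [Fintype ι] [DecidableEq ι] {μ : Measure (ℰ ι)}
      [IsProbabilityMeasure μ] {R : ℝ} (_ : ∀ᵐ x ∂μ, ‖x‖ ≤ R) {f : ℰ ι → ℝ}
      (_ : Measurable f) (_ : StrongLC 0 f)
      (_ : μ = volume.withDensity fun x => ofReal (f x))
      (_ : ∀ v : ℰ ι, ∑ b, ∑ a, v a * cA μ 0 a b * v b ≤ 101 / 100 * ‖v‖ ^ 2)
      (_ : 99 / 100 * (Fintype.card ι : ℝ) ≤ (cA μ 0).trace),
      EE μ (trF μ fun x => 2 * max (101 / 100 - x) 0) t ≤ Fintype.card ι / 8 := by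
  obtain ⟨K, t0, hK, ht0, ht01, hg⟩ := EE_trF_gu_le (B := 75) le_rfl
  obtain ⟨D, hD0, hD⟩ := exists_posPart_le_gu (η := 1 / 100) (4 * 75) (by norm_num) (by norm_num)
  set M : ℝ := 18 + 8 * K + 2 * K * D with hM
  have hM0 : 0 < M := by positivity
  refine ⟨min t0 (1 / (100 * M)), lt_min ht0 (by positivity), (min_le_left _ _).trans ht01, ?_⟩
  intro ι _ _ μ _ R hR f hfm hf hμ hc htr
  set n : ℝ := ((Fintype.card ι : ℕ) : ℝ) with hn
  have hn0 : 0 ≤ n := Nat.cast_nonneg _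
  have hu : Continuous (gu (101 / 100) (4 * 75)) := continuous_gu
  have hgu : ∀ s, 0 < s → s ≤ t0 → EE μ (trF μ (gu (101 / 100) (4 * 75))) s ≤ 2 * n * K * s := by
    intro s hs hst
    refine (hg hR hfm hf hμ hc (by norm_num) (by norm_num) s hs hst).trans ?_
    rw [mul_assoc (2 * n * K)]
    refine mul_le_mul_of_nonneg_left ?_ (by positivity)
    have hs1 : s ≤ 1 := hst.trans ht01
    calc √s * s ^ 75 ≤ 1 * s ^ 1 := mul_le_mul (Real.sqrt_le_one.2 hs1)
          (pow_le_pow_of_le_one hs.le hs1 (by norm_num)) (by positivity) zero_le_one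
      _ = s := by ring
  have hsq : ∀ s, 0 < s → s ≤ t0 → EE μ (trF μ fun x => x ^ 2) s ≤ n * (18 + 8 * K) := by
    intro s hs hst
    have h1 := EE_trF_le_add hR (h := fun x => x ^ 2) (a := 4) (b := 0) (c := 18) (by fun_prop)
      hu hu hs.le fun x hx => by
        have := sq_le_gu (c := 101 / 100) (p := 4 * 75) (by norm_num) (by norm_num) hx
        linarith
    have h2 := hgu s hs hst
    have h3 : 2 * n * K * s ≤ 2 * n * K :=
      mul_le_of_le_one_right (by positivity) (hst.trans ht01)
    change _ ≤ _ + n * 18 at h1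
    linarith
  set t := min t0 (1 / (100 * M)) with ht
  have htp : 0 < t := lt_min ht0 (by positivity)
  have htt : t ≤ t0 := min_le_left _ _
  have htM : M * t ≤ 1 / 100 := by
    have := mul_le_mul_of_nonneg_left (min_le_right t0 (1 / (100 * M))) hM0.le
    refine this.trans (le_of_eq ?_)
    field_simp
  have h1 := EE_trace_ge hR ht0 hsq htp htt
  have h2 := hgu t htp htt
  have h3 := EE_trF_le_add hR (h := fun x => 2 * max (101 / 100 - x) 0) (h1 := fun x => x ^ 1)
    (h2 := gu (101 / 100) (4 * 75)) (a := -2) (b := 2 * D) (c := 2 * (101 / 100 + 1 / 100))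
    (by fun_prop) (by fun_prop) hu htp.le fun x hx => by
      have h4 := hD (101 / 100) x (by norm_num) hx
      have h5 : max (101 / 100 - x) 0 = 101 / 100 - x + max (x - 101 / 100) 0 := by
        rcases le_total x (101 / 100) with h | h
        · rw [max_eq_left (by linarith), max_eq_right (by linarith)]; ring
        · rw [max_eq_right (by linarith), max_eq_left (by linarith)]; ring
      rw [h5]
      linarith
  change _ ≤ _ + n * _ at h3
  have h4 := mul_le_mul_of_nonneg_left h2 hD0
  have h5 : n * (M * t) ≤ n * (1 / 100) := mul_le_mul_of_nonneg_left htM hn0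
  have h6 : 0 ≤ n * K * D * t := by positivity
  rw [hM] at h5
  nlinarith

end

section

variable {ι : Type*} [Fintype ι]

/-- A convex body carrying a density `exp G`, with `G` concave and continuous on the body. -/
structure LCBody (K : Set (ℰ ι)) (G : ℰ ι → ℝ) : Prop where
  compact : IsCompact K
  concave : ConcaveOn ℝ K G
  cont : ContinuousOn G K

/-- The density `exp G` on `K`, extended by zero. -/
def bodyDensity (K : Set (ℰ ι)) (G : ℰ ι → ℝ) :
    ℰ ι → ℝ := K.indicator fun x => exp (G x)

namespace LCBody

variable {K : Set (ℰ ι)} {G : ℰ ι → ℝ}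

theorem measurableSet (h : LCBody K G) : MeasurableSet K := h.compact.isClosed.measurableSet

theorem nonneg (x : ℰ ι) : 0 ≤ bodyDensity K G x :=
  indicator_nonneg (fun _ _ => (exp_pos _).le) x

theorem measurable (h : LCBody K G) : Measurable (bodyDensity K G) := by
  have h1 : ContinuousOn (fun x => exp (G x)) K := h.cont.rexp
  classical
  have h2 := h1.measurable_piecewise (g := fun _ => 0) continuousOn_const h.measurableSet
  have e : bodyDensity K G = K.piecewise (fun x => exp (G x)) fun _ => 0 := by
    ext x
    simp [bodyDensity, indicator, piecewise]
  rw [e]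
  exact h2

theorem integrable (h : LCBody K G) : Integrable (bodyDensity K G) := by
  have h1 : ContinuousOn (fun x => exp (G x)) K := h.cont.rexp
  exact (h1.integrableOn_compact h.compact).integrable_indicator h.measurableSet

variable {ν : Measure (ℰ ι)}

theorem ae_mem (h : LCBody K G)
    (hν : ν = volume.withDensity fun x => ofReal (bodyDensity K G x)) : ∀ᵐ x ∂ν, x ∈ K := by
  have e : {a | ¬a ∈ K} = Kᶜ := rfl
  rw [ae_iff, e, hν, withDensity_apply _ h.measurableSet.compl,
    setLIntegral_congr_fun (g := fun _ => 0) h.measurableSet.compl (fun x hx => by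
      simp only [bodyDensity, indicator_of_notMem hx, ENNReal.ofReal_zero])]
  simp

theorem ae_le (h : LCBody K G)
    (hν : ν = volume.withDensity fun x => ofReal (bodyDensity K G x)) :
    ∃ R, ∀ᵐ x ∂ν, ‖x‖ ≤ R := by
  obtain ⟨R, hR⟩ := h.compact.isBounded.exists_norm_le
  exact ⟨R, (h.ae_mem hν).mono fun x hx => hR x hx⟩

theorem integral_eq (h : LCBody K G)
    (hν : ν = volume.withDensity fun x => ofReal (bodyDensity K G x))
    (u : ℰ ι → ℝ) : ∫ x, u x ∂ν = ∫ x, bodyDensity K G x * u x := by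
  rw [hν, integral_withDensity_eq_integral_toReal_smul h.measurable.ennreal_ofReal
    (ae_of_all _ fun _ => ENNReal.ofReal_lt_top)]
  refine integral_congr_ae (ae_of_all _ fun x => ?_)
  simp only [ENNReal.toReal_ofReal (nonneg x), smul_eq_mul]

variable [IsProbabilityMeasure ν]

theorem integral_one (h : LCBody K G)
    (hν : ν = volume.withDensity fun x => ofReal (bodyDensity K G x)) :
    ∫ x, bodyDensity K G x = 1 := by
  have := h.integral_eq hν fun _ => 1
  simpa using this.symm

theorem integrable_of_continuousOn (h : LCBody K G)
    (hν : ν = volume.withDensity fun x => ofReal (bodyDensity K G x))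
    {F : Type*} [NormedAddCommGroup F] {u : ℰ ι → F} (hu : ContinuousOn u K) :
    Integrable u ν := by
  have hr : ν.restrict K = ν := Measure.restrict_eq_self_of_ae_mem (h.ae_mem hν)
  have : IntegrableOn u K ν := hu.integrableOn_compact h.compact
  rwa [IntegrableOn, hr] at this

/-- At its barycenter, a log-concave density is at least `4 ^ (-n)` times its maximum. -/
theorem barycenter (h : LCBody K G)
    (hν : ν = volume.withDensity fun x => ofReal (bodyDensity K G x)) :
    (∫ x, x ∂ν) ∈ K ∧ ∀ x0 ∈ K, G x0 - 2 * Fintype.card ι * log 2 ≤ G (∫ x, x ∂ν) := by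
  have hid := h.integrable_of_continuousOn hν (u := fun x => x) continuousOn_id
  have hG := h.integrable_of_continuousOn hν h.cont
  have hK := h.ae_mem hν
  refine ⟨h.concave.1.integral_mem h.compact.isClosed hK hid, fun x0 hx0 => ?_⟩
  have hJ := h.concave.le_map_integral h.cont h.compact.isClosed hK hid hG
  refine le_trans ?_ hJ
  set m := ∫ x, G x ∂ν with hm
  have hc1 : ContinuousOn (fun x => exp ((G x0 - G x) / 2)) K :=
    ((continuousOn_const.sub h.cont).div_const 2).rexp
  have hi1 := h.integrable_of_continuousOn hν hc1
  have hc2 : ContinuousOn (fun x => (G x0 - G x) / 2) K :=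
    (continuousOn_const.sub h.cont).div_const 2
  have hi2 := h.integrable_of_continuousOn hν hc2
  have hexp := convexOn_exp.map_integral_le (μ := ν) (f := fun x => (G x0 - G x) / 2)
    Real.continuous_exp.continuousOn isClosed_univ (ae_of_all _ fun _ => mem_univ _) hi2 hi1
  have e1 : ∫ x, (G x0 - G x) / 2 ∂ν = (G x0 - m) / 2 := by
    rw [integral_div, integral_sub (integrable_const _) hG]
    simp [hm]
  rw [e1] at hexp
  have e2 : ∫ x, exp ((G x0 - G x) / 2) ∂ν ≤
      ∫ x, bodyDensity K G ((1 / 2 : ℝ) • (x + x0)) := by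
    rw [h.integral_eq hν]
    have i1 : Integrable fun x => bodyDensity K G ((1 / 2 : ℝ) • (x + x0)) :=
      (h.integrable.comp_smul (by norm_num)).comp_add_right x0
    refine integral_mono_of_nonneg (ae_of_all _ fun x => mul_nonneg (nonneg x)
      (exp_pos _).le) i1 (ae_of_all _ fun x => ?_)
    beta_reduce
    by_cases hx : x ∈ K
    · have hmid : (1 / 2 : ℝ) • (x + x0) ∈ K := by
        rw [smul_add]
        exact h.concave.1 hx hx0 (by norm_num) (by norm_num) (by norm_num)
      have hcv := h.concave.2 hx hx0 (by norm_num : (0 : ℝ) ≤ 1 / 2) (by norm_num)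
        (by norm_num : (1 / 2 : ℝ) + 1 / 2 = 1)
      have e4 : (1 / 2 : ℝ) • x + (1 / 2 : ℝ) • x0 = (1 / 2 : ℝ) • (x + x0) := (smul_add _ _ _).symm
      rw [e4] at hcv
      simp only [smul_eq_mul] at hcv
      simp only [bodyDensity, indicator_of_mem hx, indicator_of_mem hmid, ← exp_add]
      exact Real.exp_le_exp.2 (by linarith)
    · rw [show bodyDensity K G x = 0 from indicator_of_notMem hx _, zero_mul]
      exact nonneg _
  have e3 : ∫ x, bodyDensity K G ((1 / 2 : ℝ) • (x + x0)) = 2 ^ Fintype.card ι := by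
    rw [integral_add_right_eq_self (fun x => bodyDensity K G ((1 / 2 : ℝ) • x)) x0,
      Measure.integral_comp_smul, h.integral_one hν, finrank_euclideanSpace]
    simp
  rw [e3] at e2
  have h4 := Real.log_le_log (exp_pos _) (hexp.trans e2)
  rw [Real.log_exp, Real.log_pow] at h4
  linarith

end LCBody

end

section

variable {ι : Type*} [Fintype ι] {K : Set (ℰ ι)} {G : ℰ ι → ℝ}
variable {μ : Measure (ℰ ι)} {R : ℝ}

namespace LCBody

theorem strongLC (h : LCBody K G) : StrongLC 0 (bodyDensity K G) := by
  refine ⟨nonneg, fun x y s hs hs1 => ?_⟩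
  simp only [zero_mul, zero_div, neg_zero, Real.exp_zero, mul_one]
  by_cases hx : x ∈ K
  swap
  · rw [show bodyDensity K G x = 0 from indicator_of_notMem hx _, Real.zero_rpow hs.ne', zero_mul]
    exact nonneg _
  by_cases hy : y ∈ K
  swap
  · rw [show bodyDensity K G y = 0 from indicator_of_notMem hy _,
      Real.zero_rpow (by linarith), mul_zero]
    exact nonneg _
  have hm : s • x + (1 - s) • y ∈ K := h.concave.1 hx hy hs.le (by linarith) (by ring)
  have hc := h.concave.2 hx hy hs.le (by linarith : 0 ≤ 1 - s) (by ring)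
  simp only [smul_eq_mul] at hc
  simp only [bodyDensity, indicator_of_mem hx, indicator_of_mem hy, indicator_of_mem hm,
    ← exp_mul, ← exp_add]
  exact Real.exp_le_exp.2 (by linarith)

theorem tilt (h : LCBody K G) (μ : Measure (ℰ ι)) {ξ : ℝ × ℰ ι}
    (hξ : 0 ≤ ξ.1) : LCBody K fun x => G x + (sx x ξ - log (zf μ ξ)) := by
  refine ⟨h.compact, h.concave.add ?_, h.cont.add ?_⟩
  · refine ⟨h.concave.1, fun x _ y _ a b ha hb hab => ?_⟩
    have e := norm_sq_convex_comb x y a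
    have hb' : b = 1 - a := by linarith
    subst hb'
    simp only [sx_apply, smul_eq_mul, inner_add_left, inner_smul_left]
    have h1 : 0 ≤ a * (1 - a) * ‖x - y‖ ^ 2 * ξ.1 := by positivity
    simp only [conj_trivial]
    nlinarith
  · have hc : Continuous fun x : ℰ ι => sx x ξ - log (zf μ ξ) := by
      simp only [sx_apply]
      fun_prop
    exact hc.continuousOn

variable [IsProbabilityMeasure μ]

theorem nuT_eq (h : LCBody K G) (hR : ∀ᵐ x ∂μ, ‖x‖ ≤ R)
    (hμ : μ = volume.withDensity fun x => ofReal (bodyDensity K G x))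
    (ξ : ℝ × ℰ ι) :
    nuT μ ξ = volume.withDensity fun x => ofReal
      (bodyDensity K (fun x => G x + (sx x ξ - log (zf μ ξ))) x) := by
  rw [nuT_eq_withDensity h.measurable nonneg hμ ξ]
  congr 1
  ext x
  congr 1
  unfold fT bodyDensity
  by_cases hx : x ∈ K
  · rw [indicator_of_mem hx, indicator_of_mem hx, exp_add, Real.exp_sub,
      exp_log (zf_pos hR ξ)]
  · rw [indicator_of_notMem hx, indicator_of_notMem hx, zero_mul]

end LCBody

/-- Tilted barycenter. -/
def baE (μ : Measure (ℰ ι)) (ξ : ℝ × ℰ ι) : ℰ ι :=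
  WithLp.toLp 2 fun i => ba μ i ξ

variable [IsProbabilityMeasure μ]

theorem integral_id_nuT (hR : ∀ᵐ x ∂μ, ‖x‖ ≤ R) (ξ : ℝ × ℰ ι) :
    ∫ x, x ∂(nuT μ ξ) = baE μ ξ := by
  have := isProbabilityMeasure_nuT hR ξ
  ext i
  have hi : Integrable (fun x : ℰ ι => x) (nuT μ ξ) :=
    Integrable.of_bound aestronglyMeasurable_id R (nuT_bdd hR ξ)
  have h := (EuclideanSpace.proj (𝕜 := ℝ) i).integral_comp_comm hi
  have h2 := integral_nuT (μ := μ) (fun x => x i) ξ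
  simp only [PiLp.proj_apply] at h
  rw [← h, h2]
  rfl

theorem LCBody.log_density_baE (h : LCBody K G) (hR : ∀ᵐ x ∂μ, ‖x‖ ≤ R)
    (hμ : μ = volume.withDensity fun x => ofReal (bodyDensity K G x)) {t : ℝ} (ht : 0 < t)
    (g : ℰ ι) : baE μ (t, √t • g) ∈ K ∧ ∀ x0 ∈ K,
      G x0 + √t * inner ℝ x0 g - t * ‖x0‖ ^ 2 / 2 - ‖g‖ ^ 2 / 2 - 2 * Fintype.card ι * log 2 ≤
        G (baE μ (t, √t • g)) := by
  have := isProbabilityMeasure_nuT hR (t, √t • g)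
  obtain ⟨h1, h2⟩ := (h.tilt μ (ξ := (t, √t • g)) ht.le).barycenter (h.nuT_eq hR hμ _)
  rw [integral_id_nuT hR] at h1 h2
  refine ⟨h1, fun x0 hx0 => ?_⟩
  have h3 := h2 x0 hx0
  simp only [sx_apply, inner_smul_right] at h3
  generalize baE μ (t, √t • g) = a at *
  have h4 := sq_nonneg ‖√t • a - g‖
  have h5 : ‖√t • a - g‖ ^ 2 = t * ‖a‖ ^ 2 - 2 * (√t * inner ℝ a g) + ‖g‖ ^ 2 := by
    rw [norm_sub_sq_real, norm_smul, mul_pow, norm_eq_abs, sq_abs, Real.sq_sqrt ht.le,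
      inner_smul_left]
    simp
  linarith

variable [DecidableEq ι]

theorem inner_basA_sub_eq (ξ : ℝ × ℰ ι) (i : ι) (x : ℰ ι) :
    inner ℝ (basA μ ξ i) x - alA μ ξ i = inner ℝ (basA μ ξ i) (x - baE μ ξ) := by
  rw [inner_basA_sub]
  simp only [PiLp.inner_apply, baE]
  refine sum_congr rfl fun k _ => ?_
  simp [mul_comm]

theorem eigA_pos (hR : ∀ᵐ x ∂μ, ‖x‖ ≤ R) (hμ : μ ≪ volume) (ξ : ℝ × ℰ ι) (i : ι) :
    0 < eigA μ ξ i := by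
  have := isProbabilityMeasure_nuT hR ξ
  refine (eigA_nonneg hR ξ i).lt_of_ne fun h0 => ?_
  have h := integral_basA_mul hR ξ i i
  rw [if_pos rfl, ← h0] at h
  simp only [← sq] at h
  have hi : Integrable (fun x : ℰ ι =>
      (inner ℝ (basA μ ξ i) x - alA μ ξ i) ^ 2) (nuT μ ξ) :=
    (EssBdd.of_continuous (nuT_bdd hR ξ) (by fun_prop)).integrable
  have h1 := (integral_eq_zero_iff_of_nonneg (fun x => sq_nonneg _) hi).1 h
  have hac : nuT μ ξ ≪ volume := (tilted_absolutelyContinuous μ _).trans hμ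
  set H : AffineSubspace ℝ (ℰ ι) :=
    AffineSubspace.mk' (baE μ ξ) (LinearMap.ker (innerₛₗ ℝ (basA μ ξ i))) with hH
  have hmem : ∀ x, x ∈ H ↔ inner ℝ (basA μ ξ i) (x - baE μ ξ) = 0 := by
    intro x
    rw [hH, AffineSubspace.mem_mk', LinearMap.mem_ker]
    rfl
  have hne : H ≠ ⊤ := by
    intro htop
    have h2 : basA μ ξ i + baE μ ξ ∈ H := by rw [htop]; trivial
    rw [hmem, add_sub_cancel_right, real_inner_self_eq_norm_sq] at h2
    simp at h2
  have h2 := hac (Measure.addHaar_affineSubspace volume H hne)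
  have h3 : ∀ᵐ x ∂(nuT μ ξ), x ∈ (H : Set (ℰ ι)) := by
    filter_upwards [h1] with x hx
    change x ∈ H
    rw [hmem, ← inner_basA_sub_eq]
    exact pow_eq_zero_iff two_ne_zero |>.1 hx
  have h4 : (nuT μ ξ) (H : Set (ℰ ι)) = 1 := by
    have h5 : (H : Set (ℰ ι)) ∈ ae (nuT μ ξ) := h3
    rw [measure_congr (eventuallyEq_univ.2 h5), measure_univ]
  rw [h2] at h4
  exact zero_ne_one h4

theorem hasFDerivAt_baE (hR : ∀ᵐ x ∂μ, ‖x‖ ≤ R) (t : ℝ) (g : ℰ ι) :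
    HasFDerivAt (fun g : ℰ ι => baE μ (t, √t • g))
      (Matrix.toEuclideanCLM (𝕜 := ℝ) (√t • cA μ (t, √t • g))) g := by
  rw [← hasFDerivWithinAt_univ, hasFDerivWithinAt_euclidean]
  intro i
  rw [hasFDerivWithinAt_univ]
  have h1 : HasFDerivAt (fun g : ℰ ι => (t, √t • g))
      ((0 : ℰ ι →L[ℝ] ℝ).prod (√t • ContinuousLinearMap.id ℝ _)) g :=
    (hasFDerivAt_const t g).prodMk ((hasFDerivAt_id g).const_smul √t)
  have h2 := ((contDiff_ba (μ := μ) hR i).differentiable_infty (t, √t • g)).hasFDerivAt.comp g h1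
  have e : (EuclideanSpace.proj (𝕜 := ℝ) i).comp
      (Matrix.toEuclideanCLM (𝕜 := ℝ) (√t • cA μ (t, √t • g))) =
      (fderiv ℝ (ba μ i) (t, √t • g)).comp
        ((0 : ℰ ι →L[ℝ] ℝ).prod (√t • ContinuousLinearMap.id ℝ _)) := by
    ext v
    simp only [ContinuousLinearMap.comp_apply, PiLp.proj_apply,
      Matrix.ofLp_toEuclideanCLM, ContinuousLinearMap.prod_apply, ContinuousLinearMap.zero_apply,
      ContinuousLinearMap.smul_apply, ContinuousLinearMap.id_apply]
    rw [decomp_ve ((0 : ℝ), √t • v)]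
    change _ = dd _ (ba μ i) _
    rw [zero_smul, zero_add, dd_sum_dir]
    simp only [Matrix.mulVec, dotProduct, dd_ba hR, Matrix.smul_apply, PiLp.smul_apply, smul_eq_mul]
    exact sum_congr rfl fun k _ => by ring
  rw [e]
  exact h2

end

section

variable {ι : Type*} [Fintype ι] [DecidableEq ι] {K : Set (ℰ ι)}
  {G : ℰ ι → ℝ} {μ : Measure (ℰ ι)} [IsProbabilityMeasure μ] {R : ℝ}

theorem posDef_cA (hR : ∀ᵐ x ∂μ, ‖x‖ ≤ R) (hμ : μ ≪ volume) (ξ : ℝ × ℰ ι) :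
    (cA μ ξ).PosDef :=
  (isHermitian_cA ξ).posDef_iff_eigenvalues_pos.2 fun i => eigA_pos hR hμ ξ i

theorem injective_baE (hR : ∀ᵐ x ∂μ, ‖x‖ ≤ R) (hμ : μ ≪ volume) {t : ℝ} (ht : 0 < t) :
    Function.Injective fun g : ℰ ι => baE μ (t, √t • g) := by
  intro g g' h
  by_contra hne
  set v := g' - g with hv
  have hv0 : v ≠ 0 := sub_ne_zero.2 (Ne.symm hne)
  have hl : ∀ s : ℝ, HasDerivAt (fun s : ℝ => inner ℝ v (baE μ (t, √t • (g + s • v))))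
      (inner ℝ v (Matrix.toEuclideanCLM (𝕜 := ℝ) (√t • cA μ (t, √t • (g + s • v))) v)) s := by
    intro s
    have h1 : HasDerivAt (fun s : ℝ => g + s • v) v s := by
      simpa using ((hasDerivAt_id s).smul_const v).const_add g
    have h2 := (hasFDerivAt_baE hR t (g + s • v)).comp_hasDerivAt s h1
    exact ((innerSL ℝ v).hasFDerivAt.comp_hasDerivAt s h2 :)
  have hpos : ∀ s : ℝ, 0 < inner ℝ v
      (Matrix.toEuclideanCLM (𝕜 := ℝ) (√t • cA μ (t, √t • (g + s • v))) v) := by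
    intro s
    have h1 := ((posDef_cA hR hμ (t, √t • (g + s • v))).smul (Real.sqrt_pos.2 ht)).dotProduct_mulVec_pos
      (x := v.ofLp) (by simpa using hv0)
    rw [EuclideanSpace.inner_eq_star_dotProduct, Matrix.ofLp_toEuclideanCLM, dotProduct_comm]
    exact h1
  have hm : StrictMono fun s : ℝ => inner ℝ v (baE μ (t, √t • (g + s • v))) :=
    strictMono_of_deriv_pos fun s => by rw [(hl s).deriv]; exact hpos s
  have h3 := hm (zero_lt_one (α := ℝ))
  simp only [zero_smul, add_zero, one_smul, hv, add_sub_cancel] at h3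
  simp only at h
  rw [h] at h3
  exact lt_irrefl _ h3

theorem lintegral_baE_le (hR : ∀ᵐ x ∂μ, ‖x‖ ≤ R) {f : ℰ ι → ℝ}
    (hμ : μ = volume.withDensity fun x => ofReal (f x)) {t : ℝ} (ht : 0 < t) :
    ∫⁻ g : ℰ ι, ofReal (√t ^ Fintype.card ι * ∏ i, eigA μ (t, √t • g) i) *
      ofReal (f (baE μ (t, √t • g))) ≤ 1 := by
  have hac : μ ≪ volume := hμ ▸ withDensity_absolutelyContinuous _ _
  have h := lintegral_image_eq_lintegral_abs_det_fderiv_mul volume MeasurableSet.univ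
    (fun g _ => (hasFDerivAt_baE (μ := μ) hR t g).hasFDerivWithinAt)
    (injective_baE hR hac ht).injOn fun x => ofReal (f x)
  have h1 : ∫⁻ x, ofReal (f x) = 1 := by
    have := measure_univ (μ := μ)
    rwa [hμ, withDensity_apply _ MeasurableSet.univ, setLIntegral_univ] at this
  have hdet : ∀ g : ℰ ι,
      |(Matrix.toEuclideanCLM (𝕜 := ℝ) (√t • cA μ (t, √t • g))).det| =
        √t ^ Fintype.card ι * ∏ i, eigA μ (t, √t • g) i := by
    intro g
    rw [ContinuousLinearMap.det, Matrix.coe_toEuclideanCLM_eq_toEuclideanLin]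
    rw [Matrix.toEuclideanLin, LinearMap.det_toLpLin, Matrix.det_smul,
      (isHermitian_cA _).det_eq_prod_eigenvalues]
    rw [abs_of_nonneg]
    · rfl
    · exact mul_nonneg (by positivity) (Finset.prod_nonneg fun i _ => eigA_nonneg hR _ i)
  simp only [hdet, setLIntegral_univ] at h
  rw [← h, ← h1]
  exact setLIntegral_le_lintegral _ _

end

section

variable {ι : Type*} [Fintype ι] {μ : Measure (ℰ ι)} [IsProbabilityMeasure μ] {R : ℝ}

theorem integral_norm_sq_mul_gd :
    ∫ z : ℰ ι, ‖z‖ ^ 2 * gd z = Fintype.card ι := by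
  have hb : ∀ (i : ι) (z : ℰ ι), |z i| ≤ 1 * exp (1 * ‖z‖) := fun i z => by
    rw [one_mul, one_mul, ← norm_eq_abs]
    exact (PiLp.norm_apply_le z i).trans (le_exp_norm z)
  have hs : ∀ i : ι, ContDiff ℝ ∞ fun z : ℰ ι => z i := fun i => by fun_prop
  have hd : ∀ (i : ι) (z : ℰ ι), dd (ee i) (fun z : ℰ ι => z i) z = 1 := by
    intro i z
    have h : HasFDerivAt (fun z : ℰ ι => z i)
        (EuclideanSpace.proj i : ℰ ι →L[ℝ] ℝ) z :=
      (EuclideanSpace.proj i : ℰ ι →L[ℝ] ℝ).hasFDerivAt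
    unfold dd
    rw [h.fderiv, PiLp.proj_apply]
    rw [← inner_ee, real_inner_self_eq_norm_sq]
    simp [ee]
  have h1 : ∀ i : ι, ∫ z : ℰ ι, z i * z i * gd z = 1 := by
    intro i
    have h := gauss_ibp (hs i) (hb i) (ee i) (fun z => by
      rw [hd, abs_one, one_mul, one_mul]; exact Real.one_le_exp (norm_nonneg z))
    simp only [hd, inner_ee, one_mul] at h
    rw [h, integral_gd]
  have hi : ∀ i : ι, Integrable fun z : ℰ ι => z i * z i * gd z := by
    intro i
    refine integrable_mul_gd (C := 1) (k := 2) (by fun_prop) fun z => ?_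
    rw [abs_mul, one_mul, two_mul, exp_add]
    have := hb i z
    rw [one_mul, one_mul] at this
    exact mul_le_mul this this (abs_nonneg _) (exp_pos _).le
  have e : (fun z : ℰ ι => ‖z‖ ^ 2 * gd z) = fun z => ∑ i, z i * z i * gd z := by
    ext z
    rw [EuclideanSpace.real_norm_sq_eq, sum_mul]
    exact sum_congr rfl fun i _ => by ring
  rw [e, integral_finsetSum _ fun i _ => hi i]
  simp [h1]

theorem exp_sx_mul_gd {t : ℝ} (ht : 0 ≤ t) (x g : ℰ ι) :
    exp (sx x (t, √t • g)) * gd g = gd (g - √t • x) := by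
  have e : ‖g - √t • x‖ ^ 2 = ‖g‖ ^ 2 - 2 * (√t * inner ℝ x g) + t * ‖x‖ ^ 2 := by
    rw [norm_sub_sq_real, norm_smul, mul_pow, norm_eq_abs, sq_abs, Real.sq_sqrt ht,
      inner_smul_right, real_inner_comm]
  unfold gd
  rw [sx_apply, e]
  simp only [inner_smul_right]
  rw [mul_left_comm, ← exp_add]
  congr 2
  ring

theorem lintegral_norm_sub_sq_mul_zf_le (hR : ∀ᵐ x ∂μ, ‖x‖ ≤ R) {t : ℝ} (ht : 0 ≤ t)
    (c : ℰ ι) :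
    ∫⁻ g : ℰ ι, ofReal (‖g - c‖ ^ 2 * zf μ (t, √t • g) * gd g) ≤
      ofReal (2 * Fintype.card ι + 2 * ∫ x, ‖√t • x - c‖ ^ 2 ∂μ) := by
  have h1 : ∀ g : ℰ ι, ofReal (‖g - c‖ ^ 2 * zf μ (t, √t • g) * gd g) =
      ∫⁻ x, ofReal (‖g - c‖ ^ 2 * gd (g - √t • x)) ∂μ := by
    intro g
    have hi : Integrable (fun x => exp (sx x (t, √t • g))) μ :=
      ((essBdd_sx hR).apply _).exp.integrable
    rw [zf_eq, mul_right_comm, ← integral_const_mul]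
    rw [ofReal_integral_eq_lintegral_ofReal (hi.const_mul _)
      (ae_of_all _ fun x => mul_nonneg (mul_nonneg (sq_nonneg _) (gd_pos g).le) (exp_pos _).le)]
    refine lintegral_congr fun x => ?_
    rw [← exp_sx_mul_gd ht x g]
    ring_nf
  simp only [h1]
  have hgc := (contDiff_gd (κ := ι)).continuous
  have hcont : Continuous fun p : ℰ ι × ℰ ι =>
      ‖p.1 - c‖ ^ 2 * gd (p.1 - √t • p.2) := by fun_prop
  rw [lintegral_lintegral_swap hcont.measurable.ennreal_ofReal.aemeasurable]
  have h2 : ∀ x : ℰ ι,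
      ∫⁻ g, ofReal (‖g - c‖ ^ 2 * gd (g - √t • x)) ≤
        ofReal (2 * Fintype.card ι + 2 * ‖√t • x - c‖ ^ 2) := by
    intro x
    have hi : Integrable fun z : ℰ ι =>
        2 * (‖z‖ ^ 2 * gd z) + 2 * ‖√t • x - c‖ ^ 2 * gd z :=
      (integrable_norm_sq_mul_gd.const_mul 2).add (integrable_gd.const_mul _)
    have e : ∫ z : ℰ ι, (2 * (‖z‖ ^ 2 * gd z) + 2 * ‖√t • x - c‖ ^ 2 * gd z) =
        2 * Fintype.card ι + 2 * ‖√t • x - c‖ ^ 2 := by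
      rw [integral_add (integrable_norm_sq_mul_gd.const_mul 2) (integrable_gd.const_mul _),
        integral_const_mul, integral_const_mul, integral_norm_sq_mul_gd, integral_gd, mul_one]
    rw [← e, ofReal_integral_eq_lintegral_ofReal hi (ae_of_all _ fun z => by
      have := gd_pos z
      show 0 ≤ 2 * (‖z‖ ^ 2 * gd z) + 2 * ‖√t • x - c‖ ^ 2 * gd z
      positivity), ← lintegral_sub_right_eq_self
        (fun z => ofReal (2 * (‖z‖ ^ 2 * gd z) + 2 * ‖√t • x - c‖ ^ 2 * gd z)) (√t • x)]
    refine lintegral_mono fun g => ENNReal.ofReal_le_ofReal ?_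
    have h3 : ‖g - c‖ ^ 2 ≤ 2 * ‖g - √t • x‖ ^ 2 + 2 * ‖√t • x - c‖ ^ 2 := by
      have := norm_sub_le_norm_sub_add_norm_sub g (√t • x) c
      nlinarith [norm_nonneg (g - c), sq_nonneg (‖g - √t • x‖ - ‖√t • x - c‖)]
    nlinarith [gd_pos (g - √t • x)]
  refine (lintegral_mono h2).trans ?_
  have hi : Integrable (fun x => ‖√t • x - c‖ ^ 2) μ :=
    (EssBdd.of_continuous hR (by fun_prop)).integrable
  have hi2 : Integrable (fun x => 2 * (Fintype.card ι : ℝ) + 2 * ‖√t • x - c‖ ^ 2) μ :=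
    (integrable_const _).add (hi.const_mul 2)
  rw [← ofReal_integral_eq_lintegral_ofReal hi2 (ae_of_all _ fun x => by
    show 0 ≤ 2 * (Fintype.card ι : ℝ) + 2 * ‖√t • x - c‖ ^ 2
    positivity)]
  refine ENNReal.ofReal_le_ofReal (le_of_eq ?_)
  rw [integral_add (integrable_const _) (hi.const_mul 2), integral_const, integral_const_mul]
  simp

theorem integrable_norm_sub_sq_mul_zf (hR : ∀ᵐ x ∂μ, ‖x‖ ≤ R) {t : ℝ} (ht : 0 ≤ t)
    (c : ℰ ι) :
    Integrable (fun g : ℰ ι => ‖g - c‖ ^ 2 * zf μ (t, √t • g) * gd g) ∧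
    ∫ g : ℰ ι, ‖g - c‖ ^ 2 * zf μ (t, √t • g) * gd g ≤
      2 * Fintype.card ι + 2 * ∫ x, ‖√t • x - c‖ ^ 2 ∂μ := by
  have h := lintegral_norm_sub_sq_mul_zf_le hR ht c
  have h0 : ∀ g : ℰ ι, 0 ≤ ‖g - c‖ ^ 2 * zf μ (t, √t • g) * gd g := fun g =>
    mul_nonneg (mul_nonneg (sq_nonneg _) (zf_pos hR _).le) (gd_pos g).le
  have hm : AEStronglyMeasurable
      (fun g : ℰ ι => ‖g - c‖ ^ 2 * zf μ (t, √t • g) * gd g) volume := by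
    have hgc := (contDiff_gd (κ := ι)).continuous
    have hz := (contDiff_zf hR).continuous
    exact Continuous.aestronglyMeasurable (by fun_prop)
  refine ⟨(lintegral_ofReal_ne_top_iff_integrable hm (ae_of_all _ h0)).1
    (h.trans_lt ENNReal.ofReal_lt_top).ne, ?_⟩
  rw [integral_eq_lintegral_of_nonneg_ae (ae_of_all _ h0) hm]
  refine ENNReal.toReal_le_of_le_ofReal ?_ h
  have : 0 ≤ ∫ x, ‖√t • x - c‖ ^ 2 ∂μ := integral_nonneg fun x => sq_nonneg _
  positivity

end

section

theorem integral_prod_gauss {κ : Type*} [Fintype κ] {lam a : κ → ℝ} (hl : ∀ i, 0 < lam i) :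
    Integrable (fun y : ℰ κ => ∏ i, exp (-(2 * lam i)⁻¹ * (y i - a i) ^ 2)) ∧
    ∫ y : ℰ κ, ∏ i, exp (-(2 * lam i)⁻¹ * (y i - a i) ^ 2) =
      ∏ i, √(2 * Real.pi * lam i) := by
  have h1 : ∀ i, Integrable fun s : ℝ => exp (-(2 * lam i)⁻¹ * (s - a i) ^ 2) := fun i =>
    (integrable_exp_neg_mul_sq (b := (2 * lam i)⁻¹)
      (inv_pos.2 (mul_pos two_pos (hl i)))).comp_sub_right (a i)
  have hp := PiLp.volume_preserving_ofLp κ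
  have he : MeasurableEmbedding (WithLp.ofLp (p := 2) (V := κ → ℝ)) :=
    (MeasurableEquiv.toLp 2 (κ → ℝ)).symm.measurableEmbedding
  have h2 : Integrable fun y : κ → ℝ => ∏ i, exp (-(2 * lam i)⁻¹ * (y i - a i) ^ 2) :=
    Integrable.fintype_prod h1
  refine ⟨(hp.integrable_comp_emb he).2 h2, ?_⟩
  rw [hp.integral_comp he fun y : κ → ℝ => ∏ i, exp (-(2 * lam i)⁻¹ * (y i - a i) ^ 2),
    integral_fintype_prod_volume_eq_prod
      fun i s => exp (-(2 * lam i)⁻¹ * (s - a i) ^ 2)]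
  refine Finset.prod_congr rfl fun i _ => ?_
  rw [integral_sub_right_eq_self (fun s => exp (-(2 * lam i)⁻¹ * s ^ 2)), integral_gaussian]
  congr 1
  rw [div_inv_eq_mul]
  ring

variable {ι : Type*} [Fintype ι]

/-- Densities of the orthogonal marginals are bounded exponentially in their dimension. -/
def MarginalBound (μ : Measure (ℰ ι)) (Λ : ℝ) : Prop :=
  ∀ (S : Finset ι) (b : OrthonormalBasis ι ℝ (ℰ ι)),
    μ.map (fun x => (WithLp.toLp 2 fun i : S => inner ℝ (b i) x : ℰ S)) ≤
      ofReal (exp (Λ * S.card)) • volume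

variable [DecidableEq ι] {μ : Measure (ℰ ι)} [IsProbabilityMeasure μ] {R Λ : ℝ}

theorem sum_log_eigA_ge_of_finset (hR : ∀ᵐ x ∂μ, ‖x‖ ≤ R) (hμ : μ ≪ volume)
    (hΛ : MarginalBound μ Λ) {t : ℝ} (ht : 0 < t) (g : ℰ ι) (S : Finset ι) :
    -‖g‖ ^ 2 + 2 * log (zf μ (t, √t • g)) - S.card * (1 + log (2 * Real.pi) + 2 * Λ) ≤
      ∑ i ∈ S, log (eigA μ (t, √t • g) i) := by
  set ξ : ℝ × ℰ ι := (t, √t • g) with hξ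
  have := isProbabilityMeasure_nuT hR ξ
  have hpos := eigA_pos hR hμ ξ
  set w : ℰ S → ℝ := fun y =>
    ∏ i : S, exp (-(2 * eigA μ ξ i)⁻¹ * (y i - alA μ ξ i) ^ 2) with hw
  obtain ⟨hwi, hwI⟩ := integral_prod_gauss (κ := S) (lam := fun i => eigA μ ξ i)
    (a := fun i => alA μ ξ i) fun i => hpos i
  have hwc : Continuous w := by fun_prop
  have hw0 : ∀ y, 0 ≤ w y := fun y => Finset.prod_nonneg fun i _ => (exp_pos _).le
  have hw1 : ∀ y, w y = exp (∑ i : S, -(2 * eigA μ ξ i)⁻¹ * (y i - alA μ ξ i) ^ 2) := fun y =>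
    (Real.exp_sum _ _).symm
  set Y : ℰ ι → ℰ S := fun x =>
    WithLp.toLp 2 fun i : S => inner ℝ (basA μ ξ i) x with hY
  have hYc : Continuous Y := by fun_prop
  have hlow : exp (-(S.card : ℝ) / 2) ≤ ∫ x, w (Y x) ∂(nuT μ ξ) := by
    have hq : ∀ i : S, Integrable (fun x => (inner ℝ (basA μ ξ i) x - alA μ ξ i) *
        (inner ℝ (basA μ ξ i) x - alA μ ξ i)) (nuT μ ξ) := fun i =>
      (EssBdd.of_continuous (nuT_bdd hR ξ) (by fun_prop)).integrable
    have hsi : Integrable (fun x => ∑ i : S, -(2 * eigA μ ξ i)⁻¹ *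
        ((inner ℝ (basA μ ξ i) x - alA μ ξ i) * (inner ℝ (basA μ ξ i) x - alA μ ξ i)))
        (nuT μ ξ) := integrable_finsetSum _ fun i _ => (hq i).const_mul _
    have hs : ∫ x, (∑ i : S, -(2 * eigA μ ξ i)⁻¹ * ((inner ℝ (basA μ ξ i) x - alA μ ξ i) *
        (inner ℝ (basA μ ξ i) x - alA μ ξ i))) ∂(nuT μ ξ) = -(S.card : ℝ) / 2 := by
      rw [integral_finsetSum _ fun i _ => (hq i).const_mul _]
      have : ∀ i : S, ∫ x, -(2 * eigA μ ξ i)⁻¹ * ((inner ℝ (basA μ ξ i) x - alA μ ξ i) *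
          (inner ℝ (basA μ ξ i) x - alA μ ξ i)) ∂(nuT μ ξ) = -1 / 2 := by
        intro i
        have := (hpos i).ne'
        rw [integral_const_mul, integral_basA_mul hR, if_pos rfl]
        field_simp
      simp only [this]
      simp
      ring
    have hJ := convexOn_exp.map_integral_le (μ := nuT μ ξ) (f := fun x =>
        ∑ i : S, -(2 * eigA μ ξ i)⁻¹ * ((inner ℝ (basA μ ξ i) x - alA μ ξ i) *
        (inner ℝ (basA μ ξ i) x - alA μ ξ i))) Real.continuous_exp.continuousOn isClosed_univ
        (ae_of_all _ fun _ => mem_univ _) hsi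
        ((EssBdd.of_continuous (nuT_bdd hR ξ) (by fun_prop)).integrable)
    rw [hs] at hJ
    refine hJ.trans (le_of_eq (integral_congr_ae (ae_of_all _ fun x => ?_)))
    simp only [hw1, hY, sq]
  have hz := zf_pos hR ξ
  have hsx : ∀ x : ℰ ι, sx x ξ ≤ ‖g‖ ^ 2 / 2 := by
    intro x
    rw [sx_apply]
    have h5 := sq_nonneg ‖√t • x - g‖
    have h6 : ‖√t • x - g‖ ^ 2 = t * ‖x‖ ^ 2 - 2 * (√t * inner ℝ x g) + ‖g‖ ^ 2 := by
      rw [norm_sub_sq_real, norm_smul, mul_pow, norm_eq_abs, sq_abs, Real.sq_sqrt ht.le,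
        inner_smul_left]
      simp
    simp only [hξ, inner_smul_right]
    linarith
  have hwY : ∀ φ : ℰ ι → ℝ, Continuous φ → Integrable φ μ := fun φ hφ =>
    (EssBdd.of_continuous hR hφ).integrable
  have hup : ∫ x, w (Y x) ∂(nuT μ ξ) ≤ exp (‖g‖ ^ 2 / 2) / zf μ ξ *
      (exp (Λ * S.card) * ∏ i : S, √(2 * Real.pi * eigA μ ξ i)) := by
    rw [integral_nuT]
    have h1 : lap μ sx (fun x => w (Y x)) ξ ≤ exp (‖g‖ ^ 2 / 2) * ∫ x, w (Y x) ∂μ := by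
      unfold lap
      rw [← integral_const_mul]
      refine integral_mono (((EssBdd.of_continuous hR (hwc.comp hYc)).mul
        ((essBdd_sx hR).apply ξ).exp).integrable) ((hwY _ (hwc.comp hYc)).const_mul _) fun x => ?_
      have := Real.exp_le_exp.2 (hsx x)
      have := hw0 (Y x)
      simp only
      nlinarith
    have h2 : ∫ x, w (Y x) ∂μ ≤ exp (Λ * S.card) * ∏ i : S, √(2 * Real.pi * eigA μ ξ i) := by
      rw [← integral_map hYc.aemeasurable hwc.aestronglyMeasurable, ← hwI]
      refine (integral_mono_measure (hΛ S (basA μ ξ)) (ae_of_all _ hw0)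
        (hwi.smul_measure ENNReal.ofReal_ne_top)).trans (le_of_eq ?_)
      rw [integral_smul_measure, ENNReal.toReal_ofReal (exp_pos _).le, smul_eq_mul]
    have h3 : tm μ sx (fun x => w (Y x)) ξ = lap μ sx (fun x => w (Y x)) ξ / zf μ ξ := rfl
    rw [h3, div_mul_eq_mul_div]
    refine div_le_div_of_nonneg_right (h1.trans ?_) hz.le
    exact mul_le_mul_of_nonneg_left h2 (exp_pos _).le
  have h := Real.log_le_log (exp_pos _) (hlow.trans hup)
  have hsq : ∀ i : S, √(2 * Real.pi * eigA μ ξ i) ≠ 0 := fun i =>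
    (Real.sqrt_pos.2 (mul_pos (by positivity) (hpos i))).ne'
  have hpr : ∏ i : S, √(2 * Real.pi * eigA μ ξ i) ≠ 0 := Finset.prod_ne_zero_iff.2 fun i _ => hsq i
  rw [Real.log_exp, Real.log_mul (by positivity) (mul_ne_zero (Real.exp_ne_zero _) hpr),
    Real.log_mul (Real.exp_ne_zero _) hpr, Real.log_div (Real.exp_ne_zero _) hz.ne', Real.log_exp,
    Real.log_exp, Real.log_prod fun i _ => hsq i] at h
  have e : ∑ i : S, log √(2 * Real.pi * eigA μ ξ i) =
      S.card * (log (2 * Real.pi) / 2) + (∑ i ∈ S, log (eigA μ ξ i)) / 2 := by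
    rw [← Finset.sum_coe_sort S, Finset.sum_div]
    have : (S.card : ℝ) * (log (2 * Real.pi) / 2) = ∑ _i : S, log (2 * Real.pi) / 2 := by
      simp
    rw [this, ← sum_add_distrib]
    refine sum_congr rfl fun i _ => ?_
    rw [Real.log_sqrt (mul_pos (by positivity) (hpos i)).le,
      Real.log_mul (by positivity) (hpos i).ne']
    ring
  rw [e] at h
  linarith

theorem sum_log_eigA_ge (hR : ∀ᵐ x ∂μ, ‖x‖ ≤ R) (hμ : μ ≪ volume)
    (hΛ : MarginalBound μ Λ) (hΛ0 : 0 ≤ Λ) {t : ℝ} (ht : 0 < t) (g : ℰ ι) :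
    -‖g‖ ^ 2 + 2 * log (zf μ (t, √t • g)) - Fintype.card ι * log 2 -
      trF μ (fun x => 2 * max (101 / 100 - x) 0) (t, √t • g) *
        (1 + log (2 * Real.pi) + 2 * Λ) ≤
      ∑ i, log (eigA μ (t, √t • g) i) := by
  set ξ : ℝ × ℰ ι := (t, √t • g) with hξ
  set S : Finset ι := Finset.univ.filter fun i => eigA μ ξ i < 1 / 2 with hS
  have h := sum_log_eigA_ge_of_finset hR hμ hΛ ht g S
  rw [← hξ] at h
  have hc : (0 : ℝ) ≤ 1 + log (2 * Real.pi) + 2 * Λ := by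
    have : 0 ≤ log (2 * Real.pi) := Real.log_nonneg (by linarith [Real.pi_gt_three])
    linarith
  have h1 : (S.card : ℝ) ≤ trF μ (fun x => 2 * max (101 / 100 - x) 0) ξ := by
    have : (S.card : ℝ) = ∑ i ∈ S, (1 : ℝ) := by simp
    rw [this]
    unfold trF
    refine (sum_le_sum fun i hi => ?_).trans (Finset.sum_le_sum_of_subset_of_nonneg
      (Finset.subset_univ S) fun i _ _ => by positivity)
    have := (Finset.mem_filter.1 hi).2
    have := le_max_left (101 / 100 - eigA μ ξ i) 0
    linarith
  have h2 : -(Fintype.card ι * log 2) ≤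
      ∑ i ∈ Finset.univ.filter (fun i => ¬ eigA μ ξ i < 1 / 2), log (eigA μ ξ i) := by
    have hl2 : 0 ≤ log 2 := Real.log_nonneg one_le_two
    calc -(Fintype.card ι * log 2) = ∑ _i : ι, -log 2 := by simp
      _ ≤ ∑ i ∈ Finset.univ.filter (fun i => ¬ eigA μ ξ i < 1 / 2), -log 2 :=
          by
          simp only [Finset.sum_neg_distrib, neg_le_neg_iff]
          exact Finset.sum_le_sum_of_subset_of_nonneg (Finset.filter_subset _ _) fun _ _ _ => hl2
      _ ≤ _ := sum_le_sum fun i hi => by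
          have := not_lt.1 (Finset.mem_filter.1 hi).2
          rw [← Real.log_inv]
          exact Real.log_le_log (by norm_num) (by linarith)
  rw [← Finset.sum_filter_add_sum_filter_not Finset.univ fun i => eigA μ ξ i < 1 / 2]
  have h3 := mul_le_mul_of_nonneg_right h1 hc
  linarith

end

section

variable {ι : Type*} [Fintype ι] [DecidableEq ι] {μ : Measure (ℰ ι)}
  [IsProbabilityMeasure μ] {R Λ : ℝ} {K : Set (ℰ ι)} {G : ℰ ι → ℝ}

omit [DecidableEq ι] in
theorem log_gd (g : ℰ ι) :
    log (gd g) = -(Fintype.card ι / 2 * log (2 * Real.pi)) - ‖g‖ ^ 2 / 2 := by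
  unfold gd
  rw [Real.log_mul (by positivity) (Real.exp_ne_zero _), Real.log_inv, Real.log_exp,
    Real.log_rpow (by positivity)]
  ring

omit [DecidableEq ι] [IsProbabilityMeasure μ] in
theorem integral_inner_const' (hid : Integrable (fun x : ℰ ι => x) μ)
    (c : ℰ ι) : ∫ x, inner ℝ x c ∂μ = inner ℝ (∫ x, x ∂μ) c := by
  simp only [real_inner_comm c]
  exact integral_inner hid c

omit [DecidableEq ι] in
theorem log_zf_ge (hR : ∀ᵐ x ∂μ, ‖x‖ ≤ R) {t : ℝ} (g : ℰ ι) :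
    √t * inner ℝ (∫ x, x ∂μ) g - t / 2 * ∫ x, ‖x‖ ^ 2 ∂μ ≤ log (zf μ (t, √t • g)) := by
  have hid : Integrable (fun x : ℰ ι => x) μ :=
    Integrable.of_bound aestronglyMeasurable_id R hR
  have hsq : Integrable (fun x : ℰ ι => ‖x‖ ^ 2) μ :=
    (EssBdd.of_continuous hR (by fun_prop)).integrable
  have hJ := convexOn_exp.map_integral_le (μ := μ) (f := fun x => sx x (t, √t • g))
    Real.continuous_exp.continuousOn isClosed_univ (ae_of_all _ fun _ => mem_univ _)
    ((essBdd_sx hR).apply _).integrable ((essBdd_sx hR).apply _).exp.integrable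
  have h := Real.log_le_log (exp_pos _) hJ
  rw [Real.log_exp] at h
  refine le_trans (le_of_eq ?_) (h.trans (le_of_eq ?_))
  · simp only [sx_apply, inner_smul_right]
    rw [integral_sub ((hid.inner_const g).const_mul _) ((hsq.div_const 2).mul_const t),
      integral_const_mul, integral_mul_const, integral_div, integral_inner_const' hid]
    ring
  · rw [zf_eq]

theorem integral_le_of_lintegral_ofReal_le {α : Type*} [MeasurableSpace α] {ν : Measure α}
    {u : α → ℝ} (hu : Integrable u ν) {c : ℝ} (hc : 0 ≤ c)
    (h : ∫⁻ x, ofReal (u x) ∂ν ≤ ofReal c) : ∫ x, u x ∂ν ≤ c := by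
  rw [integral_eq_lintegral_pos_part_sub_lintegral_neg_part hu]
  have := ENNReal.toReal_le_of_le_ofReal hc h
  have := ENNReal.toReal_nonneg (a := ∫⁻ x, ofReal (-u x) ∂ν)
  linarith

theorem LCBody.exp_mul_zf_mul_gd_le (h : LCBody K G) (hR : ∀ᵐ x ∂μ, ‖x‖ ≤ R)
    (hμ : μ = volume.withDensity fun x => ofReal (bodyDensity K G x))
    (hΛ : MarginalBound μ Λ) (hΛ0 : 0 ≤ Λ) {t : ℝ} (ht : 0 < t) (g : ℰ ι) :
    exp (Fintype.card ι * (log √t - 3 * log 2) + G (∫ x, x ∂μ) -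
        t / 2 * (∫ x, ‖x‖ ^ 2 ∂μ) - ‖g - √t • (∫ x, x ∂μ)‖ ^ 2 -
        trF μ (fun x => 2 * max (101 / 100 - x) 0) (t, √t • g) *
          (1 + log (2 * Real.pi) + 2 * Λ)) * zf μ (t, √t • g) * gd g ≤
      (√t ^ Fintype.card ι * ∏ i, eigA μ (t, √t • g) i) *
        bodyDensity K G (baE μ (t, √t • g)) := by
  have hac : μ ≪ volume := hμ ▸ withDensity_absolutelyContinuous _ _
  have hpos := eigA_pos hR hac (t, √t • g)
  obtain ⟨ha, hG⟩ := h.log_density_baE hR hμ ht g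
  obtain ⟨hb, -⟩ := h.barycenter hμ
  have h1 := hG _ hb
  have h2 := sum_log_eigA_ge hR hac hΛ hΛ0 ht g
  have h3 := log_zf_ge (μ := μ) hR (t := t) g
  have h4 := log_gd g
  have hz := zf_pos hR (t, √t • g)
  have hst := Real.sqrt_pos.2 ht
  rw [bodyDensity, indicator_of_mem ha]
  generalize baE μ (t, √t • g) = a at *
  set b := ∫ x, x ∂μ with hbd
  have e : ‖g - √t • b‖ ^ 2 = ‖g‖ ^ 2 - 2 * (√t * inner ℝ b g) + t * ‖b‖ ^ 2 := by
    rw [norm_sub_sq_real, norm_smul, mul_pow, norm_eq_abs, sq_abs, Real.sq_sqrt ht.le,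
      inner_smul_right, real_inner_comm]
  rw [← exp_log hz, ← exp_log (gd_pos g), ← exp_add, ← exp_add]
  have e2 : √t ^ Fintype.card ι * ∏ i, eigA μ (t, √t • g) i =
      exp (Fintype.card ι * log √t + ∑ i, log (eigA μ (t, √t • g) i)) := by
    rw [exp_add, Real.exp_sum, ← Real.log_pow, exp_log (by positivity)]
    congr 1
    exact Finset.prod_congr rfl fun i _ => (exp_log (hpos i)).symm
  rw [e2, ← exp_add]
  refine Real.exp_le_exp.2 ?_
  have hl : 0 ≤ (Fintype.card ι : ℝ) / 2 * log (2 * Real.pi) :=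
    mul_nonneg (by positivity) (Real.log_nonneg (by linarith [Real.pi_gt_three]))
  have h5 : 0 ≤ t * ‖b‖ ^ 2 := by positivity
  linarith

theorem LCBody.exists_density_bound : ∃ C : ℝ, 0 ≤ C ∧
    ∀ {ι : Type*} [Fintype ι] [DecidableEq ι] {μ : Measure (ℰ ι)}
      [IsProbabilityMeasure μ] {K : Set (ℰ ι)} {G : ℰ ι → ℝ} {Λ : ℝ}
      (_ : LCBody K G)
      (_ : μ = volume.withDensity fun x => ofReal (bodyDensity K G x))
      (_ : ∀ v : ℰ ι, ∑ b, ∑ a, v a * cA μ 0 a b * v b ≤ 101 / 100 * ‖v‖ ^ 2)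
      (_ : 99 / 100 * (Fintype.card ι : ℝ) ≤ (cA μ 0).trace)
      (_ : ∫ x, ‖x‖ ^ 2 ∂μ ≤ 2 * Fintype.card ι)
      (_ : MarginalBound μ Λ) (_ : 0 ≤ Λ),
      ∀ x ∈ K, G x ≤ Fintype.card ι * (C + Λ / 4) := by
  obtain ⟨t, ht, ht1, hgood⟩ := exists_good_time
  have hlt : log √t ≤ 0 := Real.log_nonpos (Real.sqrt_nonneg t) (Real.sqrt_le_one.2 ht1)
  have hl2 : 0 < log 2 := Real.log_pos one_lt_two
  have hlp : 0 ≤ log (2 * Real.pi) := Real.log_nonneg (by linarith [Real.pi_gt_three])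
  refine ⟨7 + 5 * log 2 - log √t + (1 + log (2 * Real.pi)) / 8, by linarith, ?_⟩
  intro ι _ _ μ _ K G Λ h hμ hc htr h2 hΛ hΛ0 x hx
  obtain ⟨R, hR⟩ := h.ae_le hμ
  have hT := hgood hR h.measurable h.strongLC hμ hc htr
  obtain ⟨-, hbar⟩ := h.barycenter hμ
  have hx1 := hbar x hx
  set b := ∫ x, x ∂μ with hb
  set M : ℝ := 1 + log (2 * Real.pi) + 2 * Λ with hM
  have hM0 : 0 ≤ M := by linarith
  set T : ℝ × ℰ ι → ℝ := trF μ fun x => 2 * max (101 / 100 - x) 0 with hTd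
  set c : ℝ := Fintype.card ι * (log √t - 3 * log 2) + G b -
    t / 2 * (∫ x, ‖x‖ ^ 2 ∂μ) with hcd
  have i1 : Integrable fun g : ℰ ι => 1 * zf μ (t, √t • g) * gd g :=
    integrable_EE (Φ := fun _ => 1) hR continuous_const (C := 1) (by simp) ht.le
  have i2 : Integrable fun g : ℰ ι => T (t, √t • g) * zf μ (t, √t • g) * gd g :=
    integrable_trF hR (by fun_prop) ht.le
  obtain ⟨i3, h3⟩ := integrable_norm_sub_sq_mul_zf (μ := μ) hR ht.le (√t • b)
  have e1 : ∫ g : ℰ ι, 1 * zf μ (t, √t • g) * gd g = 1 := EE_one hR ht.le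
  have e2 : ∫ g : ℰ ι, T (t, √t • g) * zf μ (t, √t • g) * gd g ≤
    Fintype.card ι / 8 := hT
  have hI : Integrable fun g : ℰ ι =>
      (1 + c) * (1 * zf μ (t, √t • g) * gd g) -
        (‖g - √t • b‖ ^ 2 * zf μ (t, √t • g) * gd g) -
        M * (T (t, √t • g) * zf μ (t, √t • g) * gd g) :=
    ((i1.const_mul _).sub i3).sub (i2.const_mul _)
  have hle : ∫ g : ℰ ι, ((1 + c) * (1 * zf μ (t, √t • g) * gd g) -
        (‖g - √t • b‖ ^ 2 * zf μ (t, √t • g) * gd g) -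
        M * (T (t, √t • g) * zf μ (t, √t • g) * gd g)) ≤ 1 := by
    refine integral_le_of_lintegral_ofReal_le hI zero_le_one ?_
    rw [ENNReal.ofReal_one]
    refine (lintegral_mono fun g => ?_).trans (lintegral_baE_le hR hμ ht)
    rw [← ENNReal.ofReal_mul (mul_nonneg (by positivity)
      (Finset.prod_nonneg fun i _ => eigA_nonneg hR _ i))]
    refine ENNReal.ofReal_le_ofReal (le_trans ?_ (h.exp_mul_zf_mul_gd_le hR hμ hΛ hΛ0 ht g))
    rw [← hb, ← hcd, ← hM, ← hTd]
    have h5 := Real.add_one_le_exp (c - ‖g - √t • b‖ ^ 2 - T (t, √t • g) * M)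
    have h6 : 0 ≤ zf μ (t, √t • g) * gd g := mul_nonneg (zf_pos hR _).le (gd_pos g).le
    have h7 := mul_le_mul_of_nonneg_right h5 h6
    rw [← mul_assoc, ← mul_assoc] at h7
    refine le_trans (le_of_eq ?_) h7
    ring
  have i12 : Integrable fun g : ℰ ι => (1 + c) * (1 * zf μ (t, √t • g) * gd g) -
      (‖g - √t • b‖ ^ 2 * zf μ (t, √t • g) * gd g) := (i1.const_mul _).sub i3
  rw [integral_sub i12 (i2.const_mul _), integral_sub (i1.const_mul _) i3,
    integral_const_mul, integral_const_mul, e1] at hle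
  have hid : Integrable (fun x : ℰ ι => x) μ :=
    Integrable.of_bound aestronglyMeasurable_id R hR
  have hsq : Integrable (fun x : ℰ ι => ‖x‖ ^ 2) μ :=
    (EssBdd.of_continuous hR (by fun_prop)).integrable
  have h4 : ∫ x, ‖√t • x - √t • b‖ ^ 2 ∂μ ≤ 2 * Fintype.card ι := by
    have e : ∀ x : ℰ ι, ‖√t • x - √t • b‖ ^ 2 =
        t * (‖x‖ ^ 2 - 2 * inner ℝ x b + ‖b‖ ^ 2) := fun x => by
      rw [← smul_sub, norm_smul, mul_pow, norm_eq_abs, sq_abs, Real.sq_sqrt ht.le,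
        norm_sub_sq_real]
    simp only [e]
    have i4 : Integrable (fun x => ‖x‖ ^ 2 - 2 * inner ℝ x b) μ :=
      hsq.sub ((hid.inner_const b).const_mul 2)
    rw [integral_const_mul, integral_add i4 (integrable_const _),
      integral_sub hsq ((hid.inner_const b).const_mul 2), integral_const_mul,
      integral_inner_const' hid, ← hb, real_inner_self_eq_norm_sq]
    simp only [integral_const, probReal_univ, one_smul]
    have : 0 ≤ ∫ x, ‖x - b‖ ^ 2 ∂μ := integral_nonneg fun x => sq_nonneg _
    have : 0 ≤ ∫ x, ‖x‖ ^ 2 ∂μ := integral_nonneg fun x => sq_nonneg _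
    have := sq_nonneg ‖b‖
    nlinarith
  have h0 : 0 ≤ ∫ x, ‖x‖ ^ 2 ∂μ := integral_nonneg fun x => sq_nonneg _
  have h8 : t / 2 * (∫ x, ‖x‖ ^ 2 ∂μ) ≤ Fintype.card ι := by nlinarith
  have h9 := mul_le_mul_of_nonneg_left e2 hM0
  have h10 : G b ≤ Fintype.card ι * (7 + 3 * log 2 - log √t + M / 8) := by
    linarith
  rw [hM] at h10
  linarith

end

section

variable {ι : Type*} [Fintype ι] [DecidableEq ι]

/-- The measurable equivalence splitting coordinates in an orthonormal basis. -/
def splitEquiv (b : OrthonormalBasis ι ℝ (ℰ ι)) (S : Finset ι) :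
    ℰ ι ≃ᵐ (S → ℝ) × ({i // i ∉ S} → ℝ) :=
  b.measurableEquiv.trans ((MeasurableEquiv.toLp 2 (ι → ℝ)).symm.trans
    (MeasurableEquiv.piEquivPiSubtypeProd (fun _ => ℝ) fun i => i ∈ S))

variable {b : OrthonormalBasis ι ℝ (ℰ ι)} {S : Finset ι}

theorem measurePreserving_splitEquiv : MeasurePreserving (splitEquiv b S) := by
  convert! (volume_preserving_piEquivPiSubtypeProd (fun _ => ℝ) fun i => i ∈ S).comp
    ((PiLp.volume_preserving_ofLp ι).comp b.measurePreserving_measurableEquiv)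

theorem splitEquiv_fst (x : ℰ ι) (i : S) :
    (splitEquiv b S x).1 i = inner ℝ (b i) x :=
  b.repr_apply_apply x i

theorem splitEquiv_symm_apply (p : (S → ℝ) × ({i // i ∉ S} → ℝ)) :
    (splitEquiv b S).symm p = ∑ i, (if h : i ∈ S then p.1 ⟨i, h⟩ else p.2 ⟨i, h⟩) • b i := by
  refine Eq.trans ?_ (b.sum_repr_symm
    (WithLp.toLp 2 fun i => if h : i ∈ S then p.1 ⟨i, h⟩ else p.2 ⟨i, h⟩)).symm
  rfl

theorem splitEquiv_symm_comb (p q : (S → ℝ) × ({i // i ∉ S} → ℝ)) (s r : ℝ) :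
    (splitEquiv b S).symm (s • p + r • q) =
      s • (splitEquiv b S).symm p + r • (splitEquiv b S).symm q := by
  simp only [splitEquiv_symm_apply, Finset.smul_sum, ← sum_add_distrib, smul_smul,
    ← add_smul]
  refine sum_congr rfl fun i _ => ?_
  congr 1
  split_ifs <;> rfl

theorem abs_snd_splitEquiv_le (x : ℰ ι) (j : {i // i ∉ S}) :
    |(splitEquiv b S x).2 j| ≤ ‖x‖ := by
  have : (splitEquiv b S x).2 j = inner ℝ (b j) x := b.repr_apply_apply x j
  rw [this]
  refine (abs_real_inner_le_norm _ _).trans ?_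
  rw [b.orthonormal.1, one_mul]

/-- Marginals of bounded, boundedly supported log-concave densities have log-concave densities. -/
theorem exists_marginal_density {F : ℰ ι → ℝ} (hFm : Measurable F)
    (hF : StrongLC 0 F) {M R : ℝ} (hM : ∀ x, F x ≤ M) (hR : ∀ x, F x ≠ 0 → ‖x‖ ≤ R)
    (b : OrthonormalBasis ι ℝ (ℰ ι)) (S : Finset ι) :
    ∃ g : ℰ S → ℝ, StrongLC 0 g ∧
      (volume.withDensity fun x => ofReal (F x)).map
        (fun x => (WithLp.toLp 2 fun i : S => inner ℝ (b i) x : ℰ S)) =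
      volume.withDensity fun y => ofReal (g y) := by
  set e := splitEquiv b S with he
  have hm : Measurable fun p => ofReal (F (e.symm p)) :=
    (hFm.comp e.symm.measurable).ennreal_ofReal
  set k : (S → ℝ) → ENNReal := fun y => ∫⁻ z, ofReal (F (e.symm (y, z))) with hk
  have hfin : ∀ y, k y ≠ ⊤ := by
    intro y
    have h1 : ∀ z, ofReal (F (e.symm (y, z))) ≤
        (Icc (fun _ => -R) fun _ => R).indicator (fun _ => ofReal M) z := by
      intro z
      by_cases hz : F (e.symm (y, z)) = 0
      · simp [hz]
      · rw [indicator_of_mem]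
        · exact ENNReal.ofReal_le_ofReal (hM _)
        · have h2 : ∀ j, |z j| ≤ R := fun j => by
            have := abs_snd_splitEquiv_le (b := b) (S := S) (e.symm (y, z)) j
            rw [← he, e.apply_symm_apply] at this
            exact this.trans (hR _ hz)
          exact ⟨fun j => (abs_le.1 (h2 j)).1, fun j => (abs_le.1 (h2 j)).2⟩
    refine ne_top_of_le_ne_top ?_ (lintegral_mono h1)
    rw [lintegral_indicator measurableSet_Icc, setLIntegral_const]
    exact ENNReal.mul_ne_top ENNReal.ofReal_ne_top isCompact_Icc.measure_lt_top.ne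
  refine ⟨fun w => (k w.ofLp).toReal, ⟨fun w => ENNReal.toReal_nonneg, fun v w s hs0 hs1 => ?_⟩, ?_⟩
  · have hPL : PrekopaLeindler (volume : Measure ({i // i ∉ S} → ℝ)) :=
      (prekopaLeindler_euclidean {i // i ∉ S}).of_measurePreserving
        (e := (WithLp.linearEquiv 2 ℝ ({i // i ∉ S} → ℝ)).toLinearMap)
        (PiLp.volume_preserving_ofLp _)
    have h := hPL s hs0 hs1 (fun z => ofReal (F (e.symm (v.ofLp, z))))
      (fun z => ofReal (F (e.symm (w.ofLp, z))))
      (fun z => ofReal (F (e.symm ((s • v + (1 - s) • w).ofLp, z))))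
      (hm.comp measurable_prodMk_left) (hm.comp measurable_prodMk_left)
      (hm.comp measurable_prodMk_left) fun z z' => by
        have h1 := hF.2 (e.symm (v.ofLp, z)) (e.symm (w.ofLp, z')) s hs0 hs1
        rw [← splitEquiv_symm_comb] at h1
        rw [ENNReal.ofReal_rpow_of_nonneg (hF.1 _) hs0.le,
          ENNReal.ofReal_rpow_of_nonneg (hF.1 _) (by linarith), ← ENNReal.ofReal_mul (by
            exact Real.rpow_nonneg (hF.1 _) _)]
        refine ENNReal.ofReal_le_ofReal (h1.trans (le_of_eq ?_))
        simp
        rfl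
    have h2 := ENNReal.toReal_mono (hfin _) h
    rw [ENNReal.toReal_mul, ← ENNReal.toReal_rpow, ← ENNReal.toReal_rpow] at h2
    simpa using h2
  · have hT : Measurable fun x : ℰ ι =>
        (WithLp.toLp 2 fun i : S => inner ℝ (b i) x : ℰ S) :=
      Continuous.measurable (by fun_prop)
    have hkm : Measurable k := hm.lintegral_prod_right'
    ext A hA
    rw [Measure.map_apply hT hA, withDensity_apply _ (hT hA), withDensity_apply _ hA,
      ← lintegral_indicator (hT hA), ← lintegral_indicator hA]
    have hAm : MeasurableSet ((WithLp.toLp 2 : (S → ℝ) → ℰ S) ⁻¹' A) :=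
      (MeasurableEquiv.toLp 2 (S → ℝ)).measurable hA
    have h1 := (PiLp.volume_preserving_toLp S).lintegral_comp (f := A.indicator fun w =>
      ofReal (k w.ofLp).toReal) (((hkm.comp
        (MeasurableEquiv.toLp 2 (S → ℝ)).symm.measurable).ennreal_toReal.ennreal_ofReal).indicator hA)
    have h2 := (measurePreserving_splitEquiv (b := b) (S := S)).symm.lintegral_comp
      (hFm.ennreal_ofReal.indicator (hT hA))
    have hind : Measurable fun p => ((fun x : ℰ ι => (WithLp.toLp 2 fun i : S =>
        inner ℝ (b i) x : ℰ S)) ⁻¹' A).indicator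
        (fun x => ofReal (F x)) (e.symm p) :=
      (hFm.ennreal_ofReal.indicator (hT hA)).comp e.symm.measurable
    rw [← h1, ← h2, Measure.volume_eq_prod, lintegral_prod _ hind.aemeasurable]
    refine lintegral_congr fun y => ?_
    have h3 : ∀ z, (WithLp.toLp 2 fun i : S => inner ℝ (b i) (e.symm (y, z)) :
        ℰ S) = WithLp.toLp 2 y := fun z => by
      congr 1
      ext i
      rw [← splitEquiv_fst, ← he, e.apply_symm_apply]
    by_cases hy : WithLp.toLp 2 y ∈ A
    · rw [indicator_of_mem hy]
      simp only [ENNReal.ofReal_toReal (hfin _)]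
      refine lintegral_congr fun z => indicator_of_mem ?_ _
      rw [mem_preimage, h3]
      exact hy
    · rw [indicator_of_notMem hy]
      rw [lintegral_congr (g := fun _ => 0) fun z => indicator_of_notMem ?_ _]
      · simp
      · rw [mem_preimage, h3]
        exact hy

end

section

variable {ι : Type*} [Fintype ι] {δ R Λ : ℝ} {μ : Measure (ℰ ι)}

/-- Measures whose covariance is within `δ` of the identity. -/
structure NearIso (δ : ℝ) (μ : Measure (ℰ ι)) : Prop where
  int : Integrable (fun x => ‖x‖ ^ 2) μ
  up : ∀ v : ℰ ι, ∫ x, inner ℝ v x ^ 2 ∂μ ≤ (1 + δ) * ‖v‖ ^ 2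
  lo : ∀ v : ℰ ι,
    (1 - δ) * ‖v‖ ^ 2 + (∫ x, inner ℝ v x ∂μ) ^ 2 ≤ ∫ x, inner ℝ v x ^ 2 ∂μ

theorem NearIso.map (h : NearIso δ μ) (b : OrthonormalBasis ι ℝ (ℰ ι))
    (S : Finset ι) :
    NearIso δ (μ.map fun x =>
      (WithLp.toLp 2 fun i : S => inner ℝ (b i) x : ℰ S)) := by
  set T : ℰ ι → ℰ S :=
    fun x => WithLp.toLp 2 fun i : S => inner ℝ (b i) x with hTd
  have hTc : Continuous T := by fun_prop
  have hT := hTc.measurable.aemeasurable (μ := μ)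
  have hv : ∀ w : ℰ S, ∃ v : ℰ ι, ‖v‖ ^ 2 = ‖w‖ ^ 2 ∧
      ∀ x, inner ℝ w (T x) = inner ℝ v x := fun w => by
    refine ⟨∑ i : S, w i • b i, ?_, fun x => ?_⟩
    · have hb := b.orthonormal.comp ((↑) : S → ι) Subtype.val_injective
      rw [← real_inner_self_eq_norm_sq, EuclideanSpace.real_norm_sq_eq]
      refine (hb.inner_sum (fun i => w i) (fun i => w i) Finset.univ).trans ?_
      exact sum_congr rfl fun i _ => by simp [sq]
    · rw [sum_inner, hTd, PiLp.inner_apply]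
      refine sum_congr rfl fun i _ => ?_
      rw [real_inner_smul_left]
      simp [mul_comm]
  refine ⟨?_, fun w => ?_, fun w => ?_⟩
  · rw [integrable_map_measure (by fun_prop) hT]
    refine h.int.mono' (Continuous.aestronglyMeasurable (by fun_prop)) (ae_of_all _ fun x => ?_)
    rw [Function.comp_apply, Real.norm_of_nonneg (by positivity), EuclideanSpace.real_norm_sq_eq,
      ← b.sum_sq_inner_right x]
    exact (Finset.sum_coe_sort S fun i => inner ℝ (b i) x ^ 2).le.trans
      (Finset.sum_le_sum_of_subset_of_nonneg (Finset.subset_univ S) fun i _ _ => sq_nonneg _)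
  · obtain ⟨v, hv1, hv2⟩ := hv w
    rw [integral_map hT (by fun_prop), ← hv1]
    simp only [hv2]
    exact h.up v
  · obtain ⟨v, hv1, hv2⟩ := hv w
    rw [integral_map hT (by fun_prop), integral_map hT (by fun_prop), ← hv1]
    simp only [hv2]
    exact h.lo v

variable [IsProbabilityMeasure μ]

omit [IsProbabilityMeasure μ] in
theorem integral_inner_single (u : ℝ → ℝ) [DecidableEq ι] (i : ι) :
    ∫ x, u (inner ℝ (EuclideanSpace.single i (1 : ℝ)) x) ∂μ = ∫ x, u (x i) ∂μ := by
  simp [EuclideanSpace.inner_single_left]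

theorem cA_zero (i j : ι) : cA μ 0 i j = (∫ x, x i * x j ∂μ) - (∫ x, x i ∂μ) * ∫ x, x j ∂μ := by
  have h : nuT μ 0 = μ := by
    unfold nuT
    simp [sx_apply]
  rw [cA, Matrix.of_apply, ba, ba, ← integral_nuT, ← integral_nuT, ← integral_nuT, h]

theorem NearIso.cA_le (h : NearIso δ μ) (hR : ∀ᵐ x ∂μ, ‖x‖ ≤ R) (v : ℰ ι) :
    ∑ b, ∑ a, v a * cA μ 0 a b * v b ≤ (1 + δ) * ‖v‖ ^ 2 := by
  have e : ∫ x, inner ℝ v x ^ 2 ∂μ = ∑ b, ∑ a, v a * (∫ x, x a * x b ∂μ) * v b := by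
    have e1 : ∀ x : ℰ ι, inner ℝ v x ^ 2 =
        ∑ b, ∑ a, v a * v b * (x a * x b) := fun x => by
      rw [PiLp.inner_apply, sq, Finset.sum_mul_sum, sum_comm]
      refine sum_congr rfl fun i _ => sum_congr rfl fun j _ => ?_
      simp only [RCLike.inner_apply, conj_trivial]
      ring
    simp only [e1]
    rw [integral_finsetSum _ fun i _ => (EssBdd.of_continuous hR (by fun_prop)).integrable]
    refine sum_congr rfl fun i _ => ?_
    rw [integral_finsetSum _ fun i _ => (EssBdd.of_continuous hR (by fun_prop)).integrable]
    refine sum_congr rfl fun j _ => ?_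
    rw [integral_const_mul]
    ring
  have e2 : ∑ b, ∑ a, v a * cA μ 0 a b * v b =
      (∫ x, inner ℝ v x ^ 2 ∂μ) - (∑ a, v a * ∫ x, x a ∂μ) ^ 2 := by
    rw [e, sq, Finset.sum_mul_sum, sum_comm (s := Finset.univ) (f := fun i j =>
      (v i * ∫ x, x i ∂μ) * (v j * ∫ x, x j ∂μ)), ← sum_sub_distrib]
    refine sum_congr rfl fun i _ => ?_
    rw [← sum_sub_distrib]
    refine sum_congr rfl fun j _ => ?_
    rw [cA_zero]
    ring
  rw [e2]
  have := h.up v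
  have := sq_nonneg (∑ a, v a * ∫ x, x a ∂μ)
  linarith

variable [DecidableEq ι]

omit [IsProbabilityMeasure μ] in
theorem NearIso.coord_le (h : NearIso δ μ) (i : ι) : ∫ x, x i ^ 2 ∂μ ≤ 1 + δ := by
  have := h.up (EuclideanSpace.single i 1)
  rw [integral_inner_single fun s => s ^ 2] at this
  simpa using this

theorem NearIso.trace_ge (h : NearIso δ μ) :
    (1 - δ) * (Fintype.card ι : ℝ) ≤ (cA μ 0).trace := by
  have h1 : ∀ i : ι, 1 - δ ≤ cA μ 0 i i := fun i => by
    have := h.lo (EuclideanSpace.single i 1)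
    rw [integral_inner_single fun s => s ^ 2, integral_inner_single fun s => s] at this
    rw [cA_zero]
    simp only [← sq]
    simp at this
    linarith
  calc (1 - δ) * (Fintype.card ι : ℝ) = ∑ _i : ι, (1 - δ) := by simp; ring
    _ ≤ _ := sum_le_sum fun i _ => h1 i

theorem NearIso.norm_sq_le (h : NearIso δ μ) (hR : ∀ᵐ x ∂μ, ‖x‖ ≤ R) :
    ∫ x, ‖x‖ ^ 2 ∂μ ≤ (1 + δ) * Fintype.card ι := by
  simp only [EuclideanSpace.real_norm_sq_eq]
  rw [integral_finsetSum _ fun i _ => (EssBdd.of_continuous hR (by fun_prop)).integrable]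
  calc _ ≤ ∑ _i : ι, (1 + δ) := sum_le_sum fun i _ => h.coord_le i
    _ = _ := by simp; ring

end

section

/-- Near-isotropic log-concave densities in dimension `n` are at most `exp (Λ n)`. -/
def DensityBound (Λ : ℝ) (n : ℕ) : Prop :=
  ∀ (κ : Type) [Fintype κ] [DecidableEq κ] (ν : Measure (ℰ κ))
    [IsProbabilityMeasure ν] (f : ℰ κ → ℝ) (δ : ℝ), Fintype.card κ = n →
    StrongLC 0 f → ν = volume.withDensity (fun x => ofReal (f x)) → δ < 1 / 100 →
    NearIso δ ν → ν ≤ ofReal (exp (Λ * n)) • volume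

theorem le_volume_of_isEmpty {κ : Type*} [Fintype κ] [IsEmpty κ]
    (ν : Measure (ℰ κ)) [IsProbabilityMeasure ν] : ν ≤ volume := by
  have h1 : (volume : Measure (ℰ κ)) univ = 1 := by
    rw [← (PiLp.volume_preserving_toLp κ).measure_preimage MeasurableSet.univ.nullMeasurableSet,
      preimage_univ, volume_pi, Measure.pi_of_empty]
    simp
  refine Measure.le_iff.2 fun s _ => ?_
  rcases s.eq_empty_or_nonempty with rfl | hs
  · simp
  · rw [Subsingleton.eq_univ_of_nonempty hs, h1, measure_univ]

variable {ι : Type} [Fintype ι] [DecidableEq ι] {μ : Measure (ℰ ι)}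
  [IsProbabilityMeasure μ] {δ Λ : ℝ} {K : Set (ℰ ι)} {G : ℰ ι → ℝ}

theorem LCBody.marginalBound (h : LCBody K G)
    (hμ : μ = volume.withDensity fun x => ofReal (bodyDensity K G x))
    (hδ : δ < 1 / 100) (hI : NearIso δ μ) (hΛ0 : 0 ≤ Λ)
    (ih : ∀ m < Fintype.card ι, DensityBound Λ m)
    (hG : ∀ x ∈ K, G x ≤ Λ * Fintype.card ι) : MarginalBound μ Λ := by
  have hle : ∀ x, bodyDensity K G x ≤ exp (Λ * Fintype.card ι) := fun x => by
    unfold bodyDensity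
    by_cases hx : x ∈ K
    · rw [indicator_of_mem hx]
      exact Real.exp_le_exp.2 (hG x hx)
    · rw [indicator_of_notMem hx]
      positivity
  intro S b
  set T : ℰ ι → ℰ S :=
    fun x => WithLp.toLp 2 fun i : S => inner ℝ (b i) x with hTd
  have hT : Measurable T := Continuous.measurable (by fun_prop)
  have hp : IsProbabilityMeasure (μ.map T) := Measure.isProbabilityMeasure_map hT.aemeasurable
  rcases (Finset.card_le_univ S).lt_or_eq with hS | hS
  · obtain ⟨R, hR⟩ := h.compact.isBounded.exists_norm_le
    obtain ⟨g, hg, hgm⟩ := exists_marginal_density h.measurable h.strongLC hle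
      (R := R) (fun x hx => hR x (mem_of_indicator_ne_zero hx)) b S
    rw [← hμ] at hgm
    exact ih _ hS S (μ.map T) g δ (Fintype.card_coe S) hg hgm hδ (hI.map b S)
  · have hu : ∀ i, i ∈ S := fun i => by
      rw [(Finset.card_eq_iff_eq_univ S).1 hS]
      exact Finset.mem_univ i
    let E : ℰ ι ≃ₗᵢ[ℝ] ℰ S := b.repr.trans
      (LinearIsometryEquiv.piLpCongrLeft 2 ℝ ℝ (Equiv.subtypeUnivEquiv hu).symm)
    have hE : T = E := by
      ext x i
      exact (b.repr_apply_apply x i).symm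
    have h1 : μ ≤ ofReal (exp (Λ * Fintype.card ι)) • volume := by
      rw [hμ, ← withDensity_const]
      exact withDensity_mono (ae_of_all _ fun x => ENNReal.ofReal_le_ofReal (hle x))
    have h2 := Measure.map_mono h1 hT
    rwa [Measure.map_smul, hE, E.measurePreserving.map_eq, ← hE, ← hS] at h2

theorem LCBody.le_of_densityBound {C : ℝ} (hC0 : 0 ≤ C)
    (hC : ∀ {Λ : ℝ}, MarginalBound μ Λ → 0 ≤ Λ → ∀ x ∈ K, G x ≤ Fintype.card ι * (C + Λ / 4))
    (h : LCBody K G) (hμ : μ = volume.withDensity fun x => ofReal (bodyDensity K G x))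
    (hδ : δ < 1 / 100) (hI : NearIso δ μ)
    (ih : ∀ m < Fintype.card ι, DensityBound (4 * C / 3) m) :
    ∀ x ∈ K, G x ≤ 4 * C / 3 * Fintype.card ι := by
  have hK : K.Nonempty := by
    obtain ⟨x, hx⟩ := (h.ae_mem hμ).exists
    exact ⟨x, hx⟩
  obtain ⟨x0, hx0, hmax⟩ := h.compact.exists_isMaxOn hK h.cont
  set n : ℝ := ((Fintype.card ι : ℕ) : ℝ) with hn
  have hn0 : 0 ≤ n := by positivity
  suffices h0 : G x0 ≤ 4 * C / 3 * n from fun x hx => (hmax hx).trans h0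
  by_contra! hlt
  rcases isEmpty_or_nonempty ι with he | he
  · have e : n = 0 := by simp [hn]
    have hMB : MarginalBound μ 0 := fun S b => by
      have : IsEmpty S := ⟨fun i => he.false i⟩
      have hp : IsProbabilityMeasure (μ.map fun x =>
          (WithLp.toLp 2 fun i : S => inner ℝ (b i) x : ℰ S)) :=
        Measure.isProbabilityMeasure_map (Continuous.aemeasurable (by fun_prop))
      simpa using le_volume_of_isEmpty (μ.map fun x =>
          (WithLp.toLp 2 fun i : S => inner ℝ (b i) x : ℰ S))
    have := hC hMB le_rfl x0 hx0
    rw [e] at this hlt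
    linarith
  · have hnpos : 0 < n := by rw [hn]; exact_mod_cast Fintype.card_pos
    set L : ℝ := G x0 / n with hL
    have hLn : L * n = G x0 := div_mul_cancel₀ _ hnpos.ne'
    have hCL : 4 * C / 3 < L := by rwa [hL, lt_div_iff₀ hnpos]
    have hMB : MarginalBound μ L := by
      refine h.marginalBound hμ hδ hI (by linarith) (fun m hm => ?_) fun x hx => ?_
      · intro κ _ _ ν _ f δ' h1 h2 h3 h4 h5
        refine (ih m hm κ ν f δ' h1 h2 h3 h4 h5).trans (Measure.le_iff.2 fun s _ => ?_)
        simp only [Measure.smul_apply, smul_eq_mul]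
        gcongr
      · rw [← hn, hLn]
        exact hmax hx
    have := hC hMB (by linarith) x0 hx0
    nlinarith

end

section

variable {ι : Type*} [Fintype ι] {μ : Measure (ℰ ι)} [IsProbabilityMeasure μ]
  {δ δ' : ℝ} {K : ℕ → Set (ℰ ι)}

omit [Fintype ι] [IsProbabilityMeasure μ] in
theorem integral_cond_eq {s : Set (ℰ ι)} (u : ℰ ι → ℝ) :
    ∫ x, u x ∂(ProbabilityTheory.cond μ s) = (μ.real s)⁻¹ * ∫ x in s, u x ∂μ := by
  unfold ProbabilityTheory.cond
  rw [integral_smul_measure, ENNReal.toReal_inv]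
  rfl

theorem NearIso.eventually_cond (hI : NearIso δ μ) (hδ : δ < δ') (hδ1 : δ ≤ 1)
    (hK : AECover μ atTop K) :
    ∀ᶠ k in atTop, 0 < μ.real (K k) ∧ NearIso δ' (ProbabilityTheory.cond μ (K k)) := by
  have i2 := hI.int
  have i1 : Integrable (fun x : ℰ ι => ‖x‖) μ := by
    refine (i2.add (integrable_const 1)).mono' (by fun_prop) (ae_of_all _ fun x => ?_)
    rw [norm_norm, Pi.add_apply]
    nlinarith [sq_nonneg (‖x‖ - 1)]
  have il : ∀ v : ℰ ι, Integrable (fun x => inner ℝ v x) μ := fun v =>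
    (i1.const_mul ‖v‖).mono' (Continuous.aestronglyMeasurable (by fun_prop))
      (ae_of_all _ fun x => norm_inner_le_norm v x)
  have hs : ∀ v x : ℰ ι, inner ℝ v x ^ 2 ≤ ‖v‖ ^ 2 * ‖x‖ ^ 2 := fun v x => by
    rw [← mul_pow, ← sq_abs]
    exact pow_le_pow_left₀ (abs_nonneg _) (abs_real_inner_le_norm v x) 2
  have il2 : ∀ v : ℰ ι, Integrable (fun x => inner ℝ v x ^ 2) μ := fun v =>
    (i2.const_mul (‖v‖ ^ 2)).mono' (Continuous.aestronglyMeasurable (by fun_prop))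
      (ae_of_all _ fun x => by rw [Real.norm_of_nonneg (sq_nonneg _)]; exact hs v x)
  have hp : Tendsto (fun k => μ.real (K k)) atTop (𝓝 1) := by
    have := hK.integral_tendsto_of_countably_generated (integrable_const (1 : ℝ))
    simpa using this
  have hc : ∀ k, ∀ {u : ℰ ι → ℝ}, Integrable u μ →
      ∫ x in (K k)ᶜ, u x ∂μ = ∫ x, u x ∂μ - ∫ x in K k, u x ∂μ := fun k u hu => by
    rw [← integral_add_compl (hK.measurableSet k) hu]
    ring
  have hz : ∀ {u : ℰ ι → ℝ}, Integrable u μ →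
      Tendsto (fun k => ∫ x in (K k)ᶜ, u x ∂μ) atTop (𝓝 0) := fun {u} hu => by
    simp only [hc _ hu]
    rw [← sub_self (∫ x, u x ∂μ)]
    exact tendsto_const_nhds.sub (hK.integral_tendsto_of_countably_generated hu)
  have hlim1 : Tendsto (fun k => (1 + δ') * μ.real (K k)) atTop (𝓝 ((1 + δ') * 1)) :=
    hp.const_mul _
  have hlim2 : Tendsto (fun k => (1 - δ') * μ.real (K k) + 2 * ((μ.real (K k))⁻¹ - 1) +
      (4 * (∫ x in (K k)ᶜ, ‖x‖ ∂μ) + (∫ x in (K k)ᶜ, ‖x‖ ∂μ) ^ 2) * (μ.real (K k))⁻¹ +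
      ∫ x in (K k)ᶜ, ‖x‖ ^ 2 ∂μ) atTop
      (𝓝 ((1 - δ') * 1 + 2 * (1⁻¹ - 1) + (4 * 0 + 0 ^ 2) * 1⁻¹ + 0)) :=
    (((hp.const_mul _).add (((hp.inv₀ one_ne_zero).sub_const 1).const_mul 2)).add
      ((((hz i1).const_mul 4).add ((hz i1).pow 2)).mul (hp.inv₀ one_ne_zero))).add (hz i2)
  filter_upwards [hp.eventually (lt_mem_nhds (show (0 : ℝ) < 1 by norm_num)),
    hlim1.eventually (lt_mem_nhds (show 1 + δ < (1 + δ') * 1 by linarith)),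
    hlim2.eventually (gt_mem_nhds (show _ < 1 - δ by norm_num; linarith))] with k h0 h1 h2
  refine ⟨h0, ?_, fun v => ?_, fun v => ?_⟩
  · unfold ProbabilityTheory.cond
    refine i2.restrict.smul_measure (ENNReal.inv_ne_top.2 fun h => ?_)
    rw [measureReal_def, h] at h0
    simp at h0
  · rw [integral_cond_eq, inv_mul_le_iff₀ h0]
    have h3 := setIntegral_le_integral (s := K k) (il2 v) (ae_of_all _ fun x => sq_nonneg _)
    have h4 := mul_le_mul_of_nonneg_right h1.le (sq_nonneg ‖v‖)
    have := hI.up v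
    linarith
  · rw [integral_cond_eq, integral_cond_eq]
    have hcl := hc k (il v)
    have hcl2 := hc k (il2 v)
    have hb : |∫ x in (K k)ᶜ, inner ℝ v x ∂μ| ≤ ‖v‖ * ∫ x in (K k)ᶜ, ‖x‖ ∂μ := by
      rw [← integral_const_mul]
      exact (abs_integral_le_integral_abs).trans (integral_mono (il v).restrict.abs
        (i1.restrict.const_mul _) fun x => abs_real_inner_le_norm v x)
    have hη : ∫ x in (K k)ᶜ, inner ℝ v x ^ 2 ∂μ ≤ ‖v‖ ^ 2 * ∫ x in (K k)ᶜ, ‖x‖ ^ 2 ∂μ := by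
      rw [← integral_const_mul]
      exact integral_mono (il2 v).restrict (i2.restrict.const_mul _) fun x => hs v x
    have hlo := hI.lo v
    have hup := hI.up v
    have hA2 : (∫ x, inner ℝ v x ∂μ) ^ 2 ≤ 2 * ‖v‖ ^ 2 := by
      nlinarith [sq_nonneg ‖v‖]
    have hA : |∫ x, inner ℝ v x ∂μ| ≤ 2 * ‖v‖ :=
      abs_le_of_sq_le_sq (by nlinarith [sq_nonneg ‖v‖]) (by positivity)
    have hβ : 0 ≤ ∫ x in (K k)ᶜ, ‖x‖ ∂μ := integral_nonneg fun x => norm_nonneg x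
    have hpi : 1 ≤ (μ.real (K k))⁻¹ := (one_le_inv₀ h0).2 measureReal_le_one
    generalize ∫ x in (K k)ᶜ, ‖x‖ ∂μ = β at *
    generalize ∫ x in (K k)ᶜ, ‖x‖ ^ 2 ∂μ = η at *
    generalize ∫ x, inner ℝ v x ∂μ = A at *
    generalize ∫ x in (K k)ᶜ, inner ℝ v x ∂μ = B at *
    have hIK : ∫ x in K k, inner ℝ v x ∂μ = A - B := by linarith
    rw [hIK]
    generalize ∫ x in K k, inner ℝ v x ^ 2 ∂μ = I at *
    generalize ∫ x in (K k)ᶜ, inner ℝ v x ^ 2 ∂μ = J at *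
    generalize ∫ x, inner ℝ v x ^ 2 ∂μ = T at *
    generalize μ.real (K k) = p at *
    have hpq : p * p⁻¹ = 1 := mul_inv_cancel₀ h0.ne'
    generalize p⁻¹ = q at *
    generalize ‖v‖ = w at *
    have hw : 0 ≤ w := by linarith [abs_nonneg A]
    have hB2 : B ^ 2 ≤ w ^ 2 * β ^ 2 := by
      rw [← mul_pow, ← sq_abs]
      exact pow_le_pow_left₀ (abs_nonneg _) hb 2
    have hAB : -(A * B) ≤ 2 * w * (w * β) :=
      (neg_le_abs _).trans (by rw [abs_mul]; gcongr)
    have h3 : (A - B) ^ 2 ≤ A ^ 2 + w ^ 2 * (4 * β + β ^ 2) := by nlinarith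
    have h4 : q * (A - B) ^ 2 ≤ A ^ 2 + 2 * (q - 1) * w ^ 2 +
        q * (w ^ 2 * (4 * β + β ^ 2)) := by
      have h5 := mul_le_mul_of_nonneg_left h3 (by linarith : 0 ≤ q)
      have h6 := mul_le_mul_of_nonneg_left hA2 (by linarith : 0 ≤ q - 1)
      linarith
    have h7 := mul_le_mul_of_nonneg_right h2.le (sq_nonneg w)
    have h8 : (1 - δ') * p * w ^ 2 + q * (A - B) ^ 2 ≤ I := by linarith
    have h9 := mul_le_mul_of_nonneg_left h8 (by linarith : 0 ≤ q)
    calc (1 - δ') * w ^ 2 + (q * (A - B)) ^ 2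
        = q * ((1 - δ') * p * w ^ 2 + q * (A - B) ^ 2) := by
          linear_combination (-(1 - δ') * w ^ 2) * hpq
      _ ≤ q * I := h9

end

section

section Erosion

variable {E : Type*} [NormedAddCommGroup E] [NormedSpace ℝ E]

/-- The points of `closedBall 0 k` whose distance to the complement of `O` is at least
`1 / (k + 1)`. -/
def erosion (O : Set E) (k : ℕ) : Set E :=
  Metric.closedBall 0 k ∩ {x | ∀ z, ‖z‖ < 1 / ((k : ℝ) + 1) → x + z ∈ O}

theorem erosion_subset (O : Set E) (k : ℕ) : erosion O k ⊆ O := fun x hx => by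
  simpa using hx.2 0 (by rw [norm_zero]; positivity)

theorem isClosed_erosion (O : Set E) (k : ℕ) : IsClosed (erosion O k) := by
  refine Metric.isClosed_closedBall.inter (isClosed_of_closure_subset fun x hx z hz => ?_)
  obtain ⟨y, hy, hxy⟩ := Metric.mem_closure_iff.1 hx _ (sub_pos.2 hz)
  have := hy (x - y + z) (by
    rw [dist_eq_norm] at hxy
    linarith [norm_add_le (x - y) z])
  convert this using 1
  abel

theorem convex_erosion {O : Set E} (hO : Convex ℝ O) (k : ℕ) : Convex ℝ (erosion O k) := by
  refine (convex_closedBall _ _).inter fun x hx y hy a b ha hb hab z hz => ?_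
  have := hO (hx z hz) (hy z hz) ha hb hab
  convert this using 1
  rw [smul_add, smul_add, add_add_add_comm, ← add_smul a b z, hab, one_smul]

theorem eventually_mem_erosion {O : Set E} (hO : IsOpen O) {x : E} (hx : x ∈ O) :
    ∀ᶠ k in atTop, x ∈ erosion O k := by
  obtain ⟨r, hr, hxr⟩ := Metric.isOpen_iff.1 hO x hx
  filter_upwards [tendsto_one_div_add_atTop_nhds_zero_nat.eventually (gt_mem_nhds hr),
    tendsto_natCast_atTop_atTop.eventually (eventually_ge_atTop ‖x‖)] with k h1 h2
  refine ⟨by simpa using h2, fun z hz => hxr ?_⟩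
  simpa using hz.trans h1

end Erosion

variable {ι : Type} [Fintype ι] [DecidableEq ι] {μ : Measure (ℰ ι)}
  [IsProbabilityMeasure μ] {f : ℰ ι → ℝ}

theorem StrongLC.convex_support {E : Type*} [NormedAddCommGroup E] [NormedSpace ℝ E] {f : E → ℝ}
    (hf : StrongLC 0 f) : Convex ℝ {x | 0 < f x} := by
  refine convex_iff_forall_pos.2 fun x hx y hy a b ha hb hab => ?_
  have h := hf.2 x y a ha (by linarith)
  obtain rfl : b = 1 - a := by linarith
  simp only [zero_mul, zero_div, neg_zero, Real.exp_zero, mul_one] at h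
  exact (mul_pos (Real.rpow_pos_of_pos hx _) (Real.rpow_pos_of_pos hy _)).trans_le h

theorem StrongLC.concaveOn_log {E : Type*} [NormedAddCommGroup E] [NormedSpace ℝ E] {f : E → ℝ}
    (hf : StrongLC 0 f) : ConcaveOn ℝ {x | 0 < f x} fun x => log (f x) := by
  refine concaveOn_iff_forall_pos.2 ⟨hf.convex_support, fun x hx y hy a b ha hb hab => ?_⟩
  have h := hf.2 x y a ha (by linarith)
  obtain rfl : b = 1 - a := by linarith
  simp only [zero_mul, zero_div, neg_zero, Real.exp_zero, mul_one] at h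
  have hx' := Real.rpow_pos_of_pos hx a
  have hy' := Real.rpow_pos_of_pos hy (1 - a)
  have h1 := Real.log_le_log (mul_pos hx' hy') h
  rwa [Real.log_mul hx'.ne' hy'.ne', Real.log_rpow hx, Real.log_rpow hy] at h1

theorem StrongLC.ae_mem_interior (hf : StrongLC 0 f) :
    ∀ᵐ x, x ∉ interior {x | 0 < f x} → f x = 0 := by
  filter_upwards [measure_eq_zero_iff_ae_notMem.1 (hf.convex_support.addHaar_frontier volume)]
    with x hx hxi
  by_contra h
  exact hx ⟨subset_closure ((hf.1 x).lt_of_ne' h), hxi⟩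

theorem cond_eq_withDensity_bodyDensity (hμ : μ = volume.withDensity fun x => ofReal (f x))
    {K : Set (ℰ ι)} (hK : MeasurableSet K) (h0 : 0 < μ.real K)
    (hf : ∀ x ∈ K, 0 < f x) :
    ProbabilityTheory.cond μ K = volume.withDensity fun x => ofReal
      (bodyDensity K (fun x => log (f x) - log (μ.real K)) x) := by
  have hfin : (μ K)⁻¹ ≠ ⊤ := ENNReal.inv_ne_top.2 fun h => by
    rw [measureReal_def, h] at h0
    simp at h0
  have e : (μ K)⁻¹ = ofReal (μ.real K)⁻¹ := by
    rw [ENNReal.ofReal_inv_of_pos h0, ofReal_measureReal]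
  unfold ProbabilityTheory.cond
  rw [show μ.restrict K = (volume.withDensity fun x => ofReal (f x)).restrict K by
    rw [← hμ], restrict_withDensity hK, ← withDensity_indicator hK, ← withDensity_smul' _ _ hfin]
  congr 1
  ext x
  unfold bodyDensity
  by_cases hx : x ∈ K
  · simp only [Pi.smul_apply, indicator_of_mem hx, smul_eq_mul]
    rw [e, ← ENNReal.ofReal_mul (by positivity), Real.exp_sub, exp_log (hf x hx),
      exp_log h0, div_eq_inv_mul]
  · simp [indicator_of_notMem hx]

theorem exists_densityBound : ∃ Λ : ℝ, 0 ≤ Λ ∧ ∀ n, DensityBound Λ n := by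
  obtain ⟨C, hC0, hC⟩ := LCBody.exists_density_bound.{0}
  refine ⟨4 * C / 3, by positivity, fun n => Nat.strong_induction_on n fun n ih => ?_⟩
  intro κ _ _ μ _ f δ hn hf hμ hδ hI
  subst hn
  set O := interior {x | 0 < f x} with hO
  have hOf : ∀ x ∈ O, 0 < f x := fun x hx => by
    have h : x ∈ {x | 0 < f x} := interior_subset hx
    exact h
  have hOc : Convex ℝ O := hf.convex_support.interior
  have hlog : ConcaveOn ℝ O fun x => log (f x) := hf.concaveOn_log.subset interior_subset hOc
  have hcont : ContinuousOn (fun x => log (f x)) O := hlog.continuousOn isOpen_interior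
  have hcov : AECover μ atTop (erosion O) := by
    refine ⟨?_, fun k => (isClosed_erosion O k).measurableSet⟩
    have h1 : μ Oᶜ = 0 := by
      have hz : ∫⁻ x in Oᶜ, ofReal (f x) = ∫⁻ _ in Oᶜ, 0 := by
        refine setLIntegral_congr_fun_ae isOpen_interior.measurableSet.compl ?_
        filter_upwards [hf.ae_mem_interior] with x hx hxO
        rw [hx hxO, ENNReal.ofReal_zero]
      rw [hμ, withDensity_apply _ isOpen_interior.measurableSet.compl, hz, lintegral_zero]
    filter_upwards [measure_eq_zero_iff_ae_notMem.1 h1] with x hx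
    exact eventually_mem_erosion isOpen_interior (not_not.1 hx)
  obtain ⟨δ', hδ', hδ1⟩ := exists_between hδ
  have hbd : ∀ x ∈ O, f x ≤ exp (4 * C / 3 * Fintype.card κ) := by
    intro x hx
    obtain ⟨k, ⟨hk0, hk⟩, hxk⟩ := ((hI.eventually_cond hδ' (by linarith) hcov).and
      (eventually_mem_erosion isOpen_interior hx)).exists
    have hp : IsProbabilityMeasure (ProbabilityTheory.cond μ (erosion O k)) :=
      cond_isProbabilityMeasure fun h => by
        rw [measureReal_def, h] at hk0
        simp at hk0
    have hsub := erosion_subset O k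
    have hB : LCBody (erosion O k)
        fun x => log (f x) - log (μ.real (erosion O k)) :=
      ⟨(isCompact_closedBall 0 (k : ℝ)).of_isClosed_subset (isClosed_erosion O k) inter_subset_left,
        (hlog.subset hsub (convex_erosion hOc k)).sub
          (convexOn_const _ (convex_erosion hOc k)),
        (hcont.mono hsub).sub continuousOn_const⟩
    have he := cond_eq_withDensity_bodyDensity hμ (isClosed_erosion O k).measurableSet hk0
      fun x hx => hOf x (hsub hx)
    obtain ⟨R, hR⟩ := hB.ae_le he
    have h1 := hB.le_of_densityBound hC0 (fun {Λ} hM hΛ => hC hB he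
      (fun v => (hk.cA_le hR v).trans (by gcongr; linarith))
      ((mul_le_mul_of_nonneg_right (by linarith) (Nat.cast_nonneg _)).trans hk.trace_ge)
      ((hk.norm_sq_le hR).trans (by gcongr; linarith)) hM hΛ) he hδ1 hk ih x hxk
    have h2 : log (μ.real (erosion O k)) ≤ 0 := Real.log_nonpos hk0.le measureReal_le_one
    rw [← exp_log (hOf x hx)]
    exact Real.exp_le_exp.2 (by linarith)
  rw [hμ, ← withDensity_const]
  refine withDensity_mono ?_
  filter_upwards [hf.ae_mem_interior] with x hx
  by_cases h : x ∈ O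
  · exact ENNReal.ofReal_le_ofReal (hbd x h)
  · rw [hx h, ENNReal.ofReal_zero]
    exact zero_le

end

theorem IsLogConcaveFun.strongLC {E : Type*} [NormedAddCommGroup E] [NormedSpace ℝ E] {f : E → ℝ}
    (hf : IsLogConcaveFun f) : StrongLC 0 f :=
  ⟨hf.1, fun x y s h0 h1 => by simpa using hf.2 x y s h0.le h1.le⟩

theorem IsIsotropicMeasure.nearIso {n : ℕ} {μ : Measure (ℰ (Fin n))}
    [IsProbabilityMeasure μ] (h : IsIsotropicMeasure μ) {δ : ℝ} (hδ : 0 ≤ δ) : NearIso δ μ := by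
  have i2 : ∀ i, Integrable (fun x : ℰ (Fin n) => x i ^ 2) μ := fun i => by
    by_contra hc
    have h1 := h.2 i i
    simp only [← sq] at h1
    rw [integral_undef hc] at h1
    simp at h1
  have i11 : ∀ i j, Integrable (fun x : ℰ (Fin n) => x i * x j) μ := fun i j => by
    refine ((i2 i).add (i2 j)).mono' (Continuous.aestronglyMeasurable (by fun_prop))
      (ae_of_all _ fun x => ?_)
    rw [Pi.add_apply, norm_eq_abs]
    exact abs_le.2 ⟨by nlinarith [sq_nonneg (x i + x j)], by nlinarith [sq_nonneg (x i - x j)]⟩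
  have i1 : ∀ i, Integrable (fun x : ℰ (Fin n) => x i) μ := fun i => by
    refine ((i2 i).add (integrable_const 1)).mono' (Continuous.aestronglyMeasurable (by fun_prop))
      (ae_of_all _ fun x => ?_)
    rw [Pi.add_apply, norm_eq_abs]
    exact abs_le.2 ⟨by nlinarith [sq_nonneg (x i + 1)], by nlinarith [sq_nonneg (x i - 1)]⟩
  have e1 : ∀ v : ℰ (Fin n), ∫ x, inner ℝ v x ∂μ = 0 := fun v => by
    simp only [PiLp.inner_apply, RCLike.inner_apply, conj_trivial]
    rw [integral_finsetSum _ fun i _ => (i1 i).mul_const _]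
    simp [integral_mul_const, h.1]
  have e2 : ∀ v : ℰ (Fin n), ∫ x, inner ℝ v x ^ 2 ∂μ = ‖v‖ ^ 2 := fun v => by
    have e : ∀ x : ℰ (Fin n), inner ℝ v x ^ 2 =
        ∑ i, ∑ j, v i * v j * (x i * x j) := fun x => by
      simp only [PiLp.inner_apply, RCLike.inner_apply, conj_trivial]
      rw [sq, Finset.sum_mul_sum]
      exact sum_congr rfl fun i _ => sum_congr rfl fun j _ => by ring
    simp only [e]
    rw [integral_finsetSum _ fun i _ => integrable_finsetSum _ fun j _ => (i11 i j).const_mul _,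
      EuclideanSpace.real_norm_sq_eq]
    refine sum_congr rfl fun i _ => ?_
    rw [integral_finsetSum _ fun j _ => (i11 i j).const_mul _]
    simp [integral_const_mul, h.2, sq]
  refine ⟨?_, fun v => ?_, fun v => ?_⟩
  · simp only [EuclideanSpace.real_norm_sq_eq]
    exact integrable_finsetSum _ fun i _ => i2 i
  · rw [e2]
    nlinarith [sq_nonneg ‖v‖]
  · rw [e1, e2]
    nlinarith [sq_nonneg ‖v‖]

theorem volume_sq_dist_le {n : ℕ} {ε : ℝ} (hε : 0 < ε) (y : ℰ (Fin n)) :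
    volume {x | ‖x - y‖ ^ 2 ≤ ε * n} ≤
      ofReal (exp (n / 2) * (Real.pi / (1 / (2 * ε))) ^ ((n : ℝ) / 2)) := by
  have hb : 0 < 1 / (2 * ε) := by positivity
  have hJ := GaussianFourier.integral_rexp_neg_mul_sq_norm
    (V := ℰ (Fin n)) hb
  rw [finrank_euclideanSpace_fin] at hJ
  have hitg : Integrable fun v : ℰ (Fin n) => exp (-(1 / (2 * ε)) * ‖v‖ ^ 2) :=
    by
    by_contra hc
    rw [integral_undef hc] at hJ
    exact absurd hJ (Real.rpow_pos_of_pos (by positivity) _).ne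
  have hm : MeasurableSet {x : ℰ (Fin n) | ‖x - y‖ ^ 2 ≤ ε * n} :=
    measurableSet_le (by fun_prop) (by fun_prop)
  rw [← integral_sub_right_eq_self _ y] at hJ
  rw [← hJ, ← integral_const_mul, ofReal_integral_eq_lintegral_ofReal
    ((hitg.comp_sub_right y).const_mul _) (ae_of_all _ fun x => by positivity),
    ← lintegral_indicator_one hm]
  refine lintegral_mono fun x => indicator_apply_le' (fun hx => ?_) (fun _ => zero_le)
  rw [Pi.one_apply, ← exp_add, ENNReal.one_le_ofReal, Real.one_le_exp_iff]
  have hx' : ‖x - y‖ ^ 2 ≤ ε * n := hx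
  have : 1 / (2 * ε) * ‖x - y‖ ^ 2 ≤ 1 / (2 * ε) * (ε * n) := by gcongr
  have e : 1 / (2 * ε) * (ε * n) = n / 2 := by field_simp
  linarith

theorem exp_mul_rpow_le_rpow {Λ ε n : ℝ} (hΛ : 0 ≤ Λ) (hn : 0 ≤ n) (hε : 0 < ε)
    (hc : ε < exp (-(4 * Λ + 8))) :
    exp (Λ * n) * (exp (n / 2) * (Real.pi / (1 / (2 * ε))) ^ (n / 2)) ≤
      ε ^ (exp (-(4 * Λ + 8)) * n) := by
  set c := exp (-(4 * Λ + 8)) with hcd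
  have h2 : 7 ≤ exp 2 := by
    have := Real.exp_one_gt_d9
    rw [show (2 : ℝ) = 1 + 1 by norm_num, exp_add]
    nlinarith
  have hc4 : c ≤ 1 / 4 := by
    have h1 : c ≤ exp (-2) := Real.exp_le_exp.2 (by linarith)
    rw [Real.exp_neg] at h1
    exact h1.trans ((inv_anti₀ (by norm_num) h2).trans (by norm_num))
  have hl : log ε ≤ -(4 * Λ + 8) := (Real.log_le_iff_le_exp hε).2 hc.le
  have h3 : Real.pi / (1 / (2 * ε)) ≤ exp (2 + log ε) := by
    rw [exp_add, exp_log hε, div_div_eq_mul_div, div_one, ← mul_assoc]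
    gcongr
    linarith [Real.pi_lt_d2]
  calc _ ≤ exp (Λ * n) * (exp (n / 2) * exp (2 + log ε) ^ (n / 2)) := by
        gcongr
    _ = exp (n * (Λ + 1 / 2 + 1 + log ε / 2)) := by
        rw [← exp_mul, ← exp_add, ← exp_add]
        ring_nf
    _ ≤ exp (n * (log ε * c)) := by
        gcongr
        nlinarith
    _ = ε ^ (c * n) := by
        rw [Real.rpow_def_of_pos hε]
        ring_nf

end

/-- There exists a universal constant `c₀ > 0` such that for every `n ≥ 1`, every
isotropic log-concave random vector `X` in `ℝⁿ` (identified with its law `μ`),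
every `0 < ε < c₀` and every `y ∈ ℝⁿ`, one has
`ℙ(‖X - y‖₂² ≤ ε n) ≤ ε ^ (c₀ n)`. -/
theorem small_ball_isotropic_logconcave :
    ∃ c₀ : ℝ, 0 < c₀ ∧
      ∀ n : ℕ, 1 ≤ n →
      ∀ μ : Measure (EuclideanSpace ℝ (Fin n)), IsProbabilityMeasure μ →
        IsLogConcaveMeasure μ → IsIsotropicMeasure μ →
        ∀ ε : ℝ, 0 < ε → ε < c₀ →
        ∀ y : EuclideanSpace ℝ (Fin n),
          μ {x | ‖x - y‖ ^ 2 ≤ ε * n} ≤ ENNReal.ofReal (ε ^ (c₀ * (n : ℝ))) := by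
  obtain ⟨Λ, hΛ, hD⟩ := exists_densityBound
  refine ⟨Real.exp (-(4 * Λ + 8)), Real.exp_pos _, fun n _ μ _ hlc hiso ε hε hc y => ?_⟩
  obtain ⟨f, hf, hμ⟩ := hlc
  have h1 := hD n (Fin n) μ f (1 / 200) (Fintype.card_fin n) hf.strongLC hμ (by norm_num)
    (hiso.nearIso (by norm_num))
  refine (h1 _).trans ?_
  rw [Measure.smul_apply, smul_eq_mul]
  refine (mul_le_mul_right (volume_sq_dist_le hε y) _).trans ?_
  rw [← ENNReal.ofReal_mul (Real.exp_pos _).le]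
  exact ENNReal.ofReal_le_ofReal (exp_mul_rpow_le_rpow hΛ (Nat.cast_nonneg n) hε hc)

end
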